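/- Let d ≥ 1, p ∈ (1,2], let L = (1/2)∑_{i,j} a_{ij}(x) ∂²/∂x_i∂x_j + ∑_i b_i(x) ∂/∂x_i with a_{ij}, b_i locally Hölder continuous, a symmetric and strictly elliptic, and let α, β : ℝ^d → ℝ be locally Hölder continuous with α > 0, β bounded from above, and inf_{x∈ℝ^d} β(x)/α(x) > 0. Suppose there exists a bounded, nonnegative, not identically zero function v : ℝ^d × [0,∞) → ℝ, continuous on ℝ^d × [0,∞), twice continuously differentiable in x and once in t on ℝ^d × (0,∞), satisfying ∂v/∂t = Lv on ℝ^d × (0,∞) and v(·,0) = 0 (equivalently, the diffusion corresponding to L explodes). Then there exists a nonnegative, not identically zero function u : ℝ^d × [0,∞) → ℝ, continuous on ℝ^d × [0,∞), C² in x and C¹ in t on ℝ^d × (0,∞), satisfying ∂u/∂t = Lu + β(x)u − α(x)u^p on ℝ^d × (0,∞) and u(·,0) = 0. -/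

import Mathlib

open Set

/-- The `i`-th partial derivative of a function on `ℝ^d`. -/
noncomputable def pd {d : ℕ} (i : Fin d) (f : EuclideanSpace ℝ (Fin d) → ℝ)
    (x : EuclideanSpace ℝ (Fin d)) : ℝ :=
  fderiv ℝ f x (EuclideanSpace.single i 1)

/-- `f` is locally Hölder continuous. -/
def LocHolder {d : ℕ} (f : EuclideanSpace ℝ (Fin d) → ℝ) : Prop :=
  ∀ K : Set (EuclideanSpace ℝ (Fin d)), IsCompact K →
    ∃ κ C : ℝ, 0 < κ ∧ κ ≤ 1 ∧ 0 ≤ C ∧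
      ∀ x ∈ K, ∀ y ∈ K, |f x - f y| ≤ C * ‖x - y‖ ^ κ

open MeasureTheory ProbabilityTheory Filter Topology
open scoped RealInnerProductSpace

set_option linter.unusedSectionVars false
set_option linter.style.haveILetI false

section Gauss
variable {E : Type*} [NormedAddCommGroup E] [InnerProductSpace ℝ E] [FiniteDimensional ℝ E]
  [MeasurableSpace E] [BorelSpace E]

/-- Density of the standard Gaussian measure. -/
noncomputable def gaussD (E : Type*) [NormedAddCommGroup E] [InnerProductSpace ℝ E]
    [FiniteDimensional ℝ E] (y : E) : ℝ :=
  (2 * Real.pi) ^ (-(Module.finrank ℝ E / 2 : ℝ)) * Real.exp (-(1/2) * ‖y‖ ^ 2)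

lemma gaussD_nonneg (y : E) : 0 ≤ gaussD E y := by unfold gaussD; positivity

lemma continuous_gaussD : Continuous (gaussD E) := by unfold gaussD; fun_prop

lemma integrable_gaussD : Integrable (gaussD E) := by
  unfold gaussD
  apply Integrable.const_mul
  have h := GaussianFourier.integrable_cexp_neg_mul_sq_norm_add (V := E)
    (b := (1/2 : ℂ)) (by norm_num) 0 0
  have h2 := h.norm
  refine h2.congr (Filter.Eventually.of_forall fun y => ?_)
  simp only [Complex.norm_exp]
  congr 1
  simp [← Complex.ofReal_pow]

lemma stdGaussian_eq_withDensity :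
    stdGaussian E = volume.withDensity (fun y => ENNReal.ofReal (gaussD E y)) := by
  haveI : IsFiniteMeasure (volume.withDensity (fun y : E => ENNReal.ofReal (gaussD E y))) := by
    apply isFiniteMeasure_withDensity_ofReal integrable_gaussD.2
  apply Measure.ext_of_charFun
  ext t
  rw [charFun_stdGaussian, charFun_apply,
    integral_withDensity_eq_integral_toReal_smul (by
      exact (continuous_gaussD.measurable).ennreal_ofReal) (by simp)]
  have h := GaussianFourier.integral_cexp_neg_mul_sq_norm_add (V := E)
    (b := (1/2 : ℂ)) (by norm_num) Complex.I t
  have : (∫ x : E, (ENNReal.ofReal (gaussD E x)).toReal • Complex.exp (⟪x, t⟫ * Complex.I))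
    = ((2 * Real.pi : ℝ) : ℂ) ^ (-(Module.finrank ℝ E / 2 : ℂ)) *
      ∫ v : E, Complex.exp (-(1/2 : ℂ) * ‖v‖ ^ 2 + Complex.I * ⟪t, v⟫) := by
    rw [← integral_const_mul]
    congr 1
    ext x
    rw [ENNReal.toReal_ofReal (gaussD_nonneg x), gaussD, Complex.exp_add, Complex.real_smul]
    push_cast
    rw [Complex.ofReal_cpow (by positivity), real_inner_comm]
    push_cast
    ring_nf
  rw [this, h]
  have h2 : (Real.pi / (1/2) : ℂ) = ((2 * Real.pi : ℝ) : ℂ) := by push_cast; ring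
  rw [h2, ← mul_assoc, ← Complex.cpow_add, neg_add_cancel, Complex.cpow_zero, one_mul]
  · congr 1
    rw [Complex.I_sq]; ring
  · norm_num [Real.pi_ne_zero]

variable {V : Type*} [NormedAddCommGroup V] [NormedSpace ℝ V]

lemma integral_stdGaussian (f : E → V) :
    ∫ y, f y ∂(stdGaussian E) = ∫ y, gaussD E y • f y := by
  rw [stdGaussian_eq_withDensity, integral_withDensity_eq_integral_toReal_smul (by
      exact (continuous_gaussD.measurable).ennreal_ofReal) (by simp)]
  congr 1; ext x
  rw [ENNReal.toReal_ofReal (gaussD_nonneg x)]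

lemma integrable_pow_norm_gauss (n : ℕ) : Integrable (fun y : E => ‖y‖ ^ n) (stdGaussian E) := by
  have := (IsGaussian.memLp_id (stdGaussian E) n (by simp))
  by_cases hn : n = 0
  · subst hn; simp
  simpa using this.integrable_norm_pow hn

lemma integrable_exp_shift (x₀ : E) :
    Integrable (fun z : E => Real.exp (-(1/8) * ‖z - x₀‖ ^ 2)) := by
  have h := GaussianFourier.integrable_cexp_neg_mul_sq_norm_add (V := E)
    (b := (1/8 : ℂ)) (by norm_num) 0 0
  have h2 : Integrable (fun z : E => Real.exp (-(1/8) * ‖z‖ ^ 2)) := by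
    refine h.norm.congr (Filter.Eventually.of_forall fun y => ?_)
    simp only [Complex.norm_exp]
    congr 1
    simp [← Complex.ofReal_pow]
  exact h2.comp_sub_right x₀

lemma hasFDerivAt_gaussD (z x : E) :
    HasFDerivAt (fun x => gaussD E (z - x)) (gaussD E (z - x) • innerSL ℝ (z - x)) x := by
  unfold gaussD
  have h1 : HasFDerivAt (fun x : E => ‖z - x‖ ^ 2) (2 • (innerSL ℝ (z - x)).comp
      (-ContinuousLinearMap.id ℝ E)) x := by
    have := ((hasFDerivAt_id x).const_sub z).norm_sq
    simpa using this
  have h2 := ((h1.const_mul (-(1/2 : ℝ))).exp).const_mul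
    ((2 * Real.pi) ^ (-(Module.finrank ℝ E / 2 : ℝ)))
  convert! h2 using 1
  ext v
  simp
  ring

set_option synthInstance.maxHeartbeats 200000 in
lemma hasFDerivAt_gauss_conv [CompleteSpace V] {f : E → V} (hf : Continuous f) {A : ℝ}
    (hA : ∀ x, ‖f x‖ ≤ A) (x₀ : E) :
    HasFDerivAt (fun x => ∫ y, f (x + y) ∂(stdGaussian E))
      (∫ y, (innerSL ℝ y).smulRight (f (x₀ + y)) ∂(stdGaussian E)) x₀ := by
  have hA0 : 0 ≤ A := (norm_nonneg _).trans (hA x₀)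
  have e1 : ∀ x, ∫ y, f (x + y) ∂(stdGaussian E) = ∫ z, gaussD E (z - x) • f z := by
    intro x
    rw [integral_stdGaussian, ← integral_sub_right_eq_self _ x]
    simp
  have e2 : ∫ y, (innerSL ℝ y).smulRight (f (x₀ + y)) ∂(stdGaussian E)
      = ∫ z, (gaussD E (z - x₀) • innerSL ℝ (z - x₀)).smulRight (f z) := by
    rw [integral_stdGaussian, ← integral_sub_right_eq_self _ x₀]
    congr 1; ext z v
    simp [smul_smul]
  rw [e2]
  simp_rw [e1]
  have hgc : Continuous (gaussD E) := continuous_gaussD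
  set c : ℝ := (2 * Real.pi) ^ (-(Module.finrank ℝ E / 2 : ℝ)) with hc
  have hc0 : 0 ≤ c := by positivity
  apply hasFDerivAt_integral_of_dominated_of_fderiv_le
    (s := Metric.ball x₀ 1) (bound := fun z => (c * A * Real.exp (1/4)) * Real.exp (-(1/8) * ‖z - x₀‖ ^ 2))
    (F' := fun x z => (gaussD E (z - x) • innerSL ℝ (z - x)).smulRight (f z))
    (Metric.ball_mem_nhds _ one_pos)
  · refine Eventually.of_forall fun x => Continuous.aestronglyMeasurable ?_
    fun_prop
  · have : Integrable (fun z => gaussD E (z - x₀)) := integrable_gaussD.comp_sub_right x₀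
    refine Integrable.mono' (this.mul_const A) (Continuous.aestronglyMeasurable (by fun_prop)) ?_
    refine Eventually.of_forall fun z => ?_
    rw [norm_smul, Real.norm_of_nonneg (gaussD_nonneg _)]
    exact mul_le_mul_of_nonneg_left (hA z) (gaussD_nonneg _)
  · refine Continuous.aestronglyMeasurable ?_
    have : Continuous fun z => (ContinuousLinearMap.smulRightL ℝ E V
      (gaussD E (z - x₀) • innerSL ℝ (z - x₀))) (f z) := by fun_prop
    exact this
  · refine Eventually.of_forall fun z x hx => ?_
    rw [ContinuousLinearMap.norm_smulRight_apply, norm_smul, Real.norm_of_nonneg (gaussD_nonneg _),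
      innerSL_apply_norm]
    have hx1 : ‖x - x₀‖ ≤ 1 := by
      rw [Metric.mem_ball, dist_eq_norm] at hx; exact hx.le
    set r := ‖z - x‖ with hr
    have h1 : r ≤ Real.exp (r ^ 2 / 4) := by
      have := Real.add_one_le_exp (r ^ 2 / 4)
      nlinarith [sq_nonneg (r / 2 - 1)]
    have h2 : ‖z - x₀‖ ≤ r + 1 := by
      calc ‖z - x₀‖ = ‖(z - x) + (x - x₀)‖ := by congr 1; abel
        _ ≤ r + 1 := (norm_add_le _ _).trans (by linarith)
    have h3 : ‖z - x₀‖ ^ 2 ≤ 2 * r ^ 2 + 2 := by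
      nlinarith [norm_nonneg (z - x₀), norm_nonneg (z - x), sq_nonneg (r - 1)]
    have h4 : Real.exp (-(1/2) * r ^ 2) * r ≤ Real.exp (1/4) * Real.exp (-(1/8) * ‖z - x₀‖ ^ 2) := by
      calc Real.exp (-(1/2) * r ^ 2) * r ≤ Real.exp (-(1/2) * r ^ 2) * Real.exp (r ^ 2 / 4) := by
            gcongr
        _ = Real.exp (-(1/4) * r ^ 2) := by rw [← Real.exp_add]; congr 1; ring
        _ ≤ Real.exp (1/4 + (-(1/8) * ‖z - x₀‖ ^ 2)) := by
            apply Real.exp_le_exp.2; linarith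
        _ = _ := Real.exp_add _ _
    calc gaussD E (z - x) * r * ‖f z‖ ≤ gaussD E (z - x) * r * A :=
          mul_le_mul_of_nonneg_left (hA z) (mul_nonneg (gaussD_nonneg _) (norm_nonneg _))
      _ = c * A * (Real.exp (-(1/2) * r ^ 2) * r) := by unfold gaussD; ring
      _ ≤ c * A * (Real.exp (1/4) * Real.exp (-(1/8) * ‖z - x₀‖ ^ 2)) := by gcongr
      _ = _ := by ring
  · exact (integrable_exp_shift x₀).const_mul _
  · refine Eventually.of_forall fun z x _ => ?_
    exact (hasFDerivAt_gaussD z x).smul_const (f z)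

/-- Gaussian averaging operator. -/
noncomputable def Sop (σ : E ≃L[ℝ] E) (k : ℝ) (f : E → V) (x : E) : V :=
  ∫ y, f (x + k • σ y) ∂(stdGaussian E)

/-- Scaled gradient of the Gaussian averaging operator. -/
noncomputable def Qop (σ : E ≃L[ℝ] E) (k : ℝ) (f : E → V) (x : E) : E →L[ℝ] V :=
  ∫ y, ((innerSL ℝ y).comp (σ.symm : E →L[ℝ] E)).smulRight (f (x + k • σ y)) ∂(stdGaussian E)

set_option synthInstance.maxHeartbeats 200000 in
lemma hasFDerivAt_Sop [CompleteSpace V] (σ : E ≃L[ℝ] E) {k : ℝ} (hk : k ≠ 0)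
    {f : E → V} (hf : Continuous f) {A : ℝ} (hA : ∀ x, ‖f x‖ ≤ A) (x : E) :
    HasFDerivAt (Sop σ k f) (k⁻¹ • Qop σ k f x) x := by
  have h := hasFDerivAt_gauss_conv (f := fun z => f (k • σ z)) (by fun_prop)
    (fun z => hA _) (k⁻¹ • σ.symm x)
  have hL : HasFDerivAt (fun x : E => k⁻¹ • σ.symm x) (k⁻¹ • (σ.symm : E →L[ℝ] E)) x :=
    (k⁻¹ • (σ.symm : E →L[ℝ] E)).hasFDerivAt
  have h2 := HasFDerivAt.comp x h hL
  have e1 : ∀ x y : E, k • σ (k⁻¹ • σ.symm x + y) = x + k • σ y := by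
    intro x y
    simp [smul_smul, mul_inv_cancel₀ hk]
  have : (Sop σ k f) = (fun x => ∫ y, f (k • σ (x + y)) ∂(stdGaussian E)) ∘
      (fun x : E => k⁻¹ • σ.symm x) := by
    ext x
    simp only [Sop, Function.comp, e1]
  rw [this]
  convert! h2 using 1
  simp only [e1, Qop]
  let L : (E →L[ℝ] V) →L[ℝ] (E →L[ℝ] V) :=
    (ContinuousLinearMap.compL ℝ E E V).flip (k⁻¹ • (σ.symm : E →L[ℝ] E))
  have hL' : ∀ T, T.comp (k⁻¹ • (σ.symm : E →L[ℝ] E)) = L T := fun T => rfl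
  rw [hL', ← ContinuousLinearMap.integral_comp_comm, ← integral_smul]
  · congr 1; ext y v
    simp [L, smul_smul]
  · have : Integrable (fun y : E => A * ‖y‖ ^ 1) (stdGaussian E) :=
      (integrable_pow_norm_gauss 1).const_mul _
    refine Integrable.mono' this (Continuous.aestronglyMeasurable ?_) ?_
    · have : Continuous fun y => (ContinuousLinearMap.smulRightL ℝ E V
        (innerSL ℝ y)) (f (x + k • σ y)) := by fun_prop
      exact this
    · refine Eventually.of_forall fun y => ?_
      rw [ContinuousLinearMap.norm_smulRight_apply, innerSL_apply_norm, pow_one, mul_comm]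
      exact mul_le_mul_of_nonneg_right (hA _) (norm_nonneg _)

end Gauss

section Gauss2
variable {E : Type*} [NormedAddCommGroup E] [InnerProductSpace ℝ E] [FiniteDimensional ℝ E]
  [MeasurableSpace E] [BorelSpace E]

/-- A third moment of the standard Gaussian. -/
noncomputable def mG (E : Type*) [NormedAddCommGroup E] [InnerProductSpace ℝ E]
    [FiniteDimensional ℝ E] [MeasurableSpace E] [BorelSpace E] : ℝ :=
  ∫ y, (1 + ‖y‖) ^ 3 ∂(stdGaussian E)

lemma integrable_mG : Integrable (fun y : E => (1 + ‖y‖) ^ 3) (stdGaussian E) := by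
  have h : (fun y : E => (1 + ‖y‖) ^ 3) = fun y => 1 + 3 * ‖y‖ ^ 1 + 3 * ‖y‖ ^ 2 + ‖y‖ ^ 3 := by
    ext y; ring
  rw [h]
  exact (((integrable_const _).add ((integrable_pow_norm_gauss 1).const_mul _)).add
    ((integrable_pow_norm_gauss 2).const_mul _)).add (integrable_pow_norm_gauss 3)

lemma one_le_mG : 1 ≤ mG E := by
  have : ∫ _y : E, (1 : ℝ) ∂(stdGaussian E) ≤ mG E := by
    apply integral_mono (integrable_const _) integrable_mG
    intro y
    exact one_le_pow₀ (by linarith [norm_nonneg y])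
  simpa using this

variable {V : Type*} [NormedAddCommGroup V] [NormedSpace ℝ V]

lemma continuous_smulRight_gauss {P : Type*} [TopologicalSpace P] (σ : E ≃L[ℝ] E) {y : P → E}
    {f : P → V} (hy : Continuous y) (hf : Continuous f) : Continuous fun p =>
      ((innerSL ℝ (y p)).comp (σ.symm : E →L[ℝ] E)).smulRight (f p) := by
  have : Continuous fun p => (ContinuousLinearMap.smulRightL ℝ E V
        ((ContinuousLinearMap.compL ℝ E E ℝ).flip (σ.symm : E →L[ℝ] E) (innerSL ℝ (y p)))) (f p) := by
    fun_prop
  exact this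

lemma norm_smulRight_gauss (σ : E ≃L[ℝ] E) (y : E) (v : V) :
    ‖((innerSL ℝ y).comp (σ.symm : E →L[ℝ] E)).smulRight v‖
      ≤ ‖(σ.symm : E →L[ℝ] E)‖ * ‖y‖ * ‖v‖ := by
  rw [ContinuousLinearMap.norm_smulRight_apply]
  gcongr
  refine (ContinuousLinearMap.opNorm_comp_le _ _).trans ?_
  rw [innerSL_apply_norm, mul_comm]

instance sctE {E V : Type*} [NormedAddCommGroup E] [InnerProductSpace ℝ E] [FiniteDimensional ℝ E]
    [NormedAddCommGroup V] [NormedSpace ℝ V] :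
    SecondCountableTopologyEither E (E →L[ℝ] V) := by
  have : SecondCountableTopology E := inferInstance
  infer_instance

lemma integrable_smulRight_gauss (σ : E ≃L[ℝ] E) {f : E → V} (hf : Continuous f) {A : ℝ}
    (hA : ∀ x, ‖f x‖ ≤ A * (1 + ‖x‖)) :
    Integrable (fun y => ((innerSL ℝ y).comp (σ.symm : E →L[ℝ] E)).smulRight (f y))
      (stdGaussian E) := by
  have hA0 : 0 ≤ A := by
    have := (norm_nonneg _).trans (hA 0); simpa using this
  refine Integrable.mono' (integrable_mG.const_mul (‖(σ.symm : E →L[ℝ] E)‖ * A))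
    (continuous_smulRight_gauss σ continuous_id hf).aestronglyMeasurable ?_
  refine Eventually.of_forall fun y => (norm_smulRight_gauss σ y _).trans ?_
  have hy := norm_nonneg y
  calc ‖(σ.symm : E →L[ℝ] E)‖ * ‖y‖ * ‖f y‖ ≤ ‖(σ.symm : E →L[ℝ] E)‖ * ‖y‖ * (A * (1 + ‖y‖)) := by
        gcongr; exact hA y
    _ = ‖(σ.symm : E →L[ℝ] E)‖ * A * (‖y‖ * (1 + ‖y‖)) := by ring
    _ ≤ _ := by
        gcongr
        nlinarith [sq_nonneg (‖y‖), pow_nonneg hy 3]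

lemma norm_Qop_le_of_bound (σ : E ≃L[ℝ] E) {s : ℝ} (hs2 : ‖(σ.symm : E →L[ℝ] E)‖ ≤ s)
    (hs1 : 1 ≤ s) (k : ℝ) {f : E → V} {A : ℝ} (hA : ∀ x, ‖f x‖ ≤ A) (x : E) :
    ‖Qop σ k f x‖ ≤ s ^ 2 * mG E * A := by
  have hA0 : 0 ≤ A := (norm_nonneg _).trans (hA 0)
  unfold Qop
  refine (norm_integral_le_of_norm_le (integrable_mG.const_mul (s ^ 2 * A)) ?_).trans (le_of_eq ?_)
  · refine Eventually.of_forall fun y => (norm_smulRight_gauss σ y _).trans ?_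
    have hy := norm_nonneg y
    calc ‖(σ.symm : E →L[ℝ] E)‖ * ‖y‖ * ‖f (x + k • σ y)‖ ≤ s ^ 2 * (1 + ‖y‖) ^ 3 * A := by
          gcongr
          · nlinarith
          · nlinarith [sq_nonneg (‖y‖), pow_nonneg hy 3]
          · exact hA _
      _ = _ := by ring
  · rw [integral_const_mul, mG]; ring

lemma integral_smulRight_const (σ : E ≃L[ℝ] E) (v : V) [CompleteSpace V] :
    ∫ y, ((innerSL ℝ y).comp (σ.symm : E →L[ℝ] E)).smulRight v ∂(stdGaussian E) = 0 := by
  let L : E →L[ℝ] (E →L[ℝ] V) := ((ContinuousLinearMap.smulRightL ℝ E V).flip v).comp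
    (((ContinuousLinearMap.compL ℝ E E ℝ).flip (σ.symm : E →L[ℝ] E)).comp (innerSL ℝ))
  have : ∀ y, ((innerSL ℝ y).comp (σ.symm : E →L[ℝ] E)).smulRight v = L y := fun y => rfl
  simp_rw [this]
  have hi : Integrable (fun y : E => y) (stdGaussian E) := IsGaussian.integrable_id
  rw [L.integral_comp_comm hi, integral_id_stdGaussian, map_zero]

lemma norm_Qop_le_of_holder [CompleteSpace V] (σ : E ≃L[ℝ] E) {s : ℝ}
    (hs : ‖(σ : E →L[ℝ] E)‖ ≤ s) (hs2 : ‖(σ.symm : E →L[ℝ] E)‖ ≤ s)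
    (hs1 : 1 ≤ s) {k : ℝ} (hk : 0 ≤ k) {f : E → V} (hf : Continuous f) {A B α : ℝ}
    (hα : 0 < α) (hα1 : α ≤ 1)
    (hA : ∀ x, ‖f x‖ ≤ A) (hB0 : 0 ≤ B) (hB : ∀ x y, ‖f x - f y‖ ≤ B * ‖x - y‖ ^ α) (x : E) :
    ‖Qop σ k f x‖ ≤ s ^ 2 * mG E * B * k ^ α := by
  have hA0 : 0 ≤ A := (norm_nonneg _).trans (hA 0)
  have e : Qop σ k f x = ∫ y, ((innerSL ℝ y).comp (σ.symm : E →L[ℝ] E)).smulRight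
      (f (x + k • σ y) - f x) ∂(stdGaussian E) := by
    have hb : ∀ x : E, A ≤ A * (1 + ‖x‖) := fun x => by nlinarith [norm_nonneg x]
    rw [← sub_zero (Qop σ k f x), ← integral_smulRight_const σ (f x), Qop, ← integral_sub]
    · congr 1; ext y v; simp [smul_sub]
    · exact integrable_smulRight_gauss σ (by fun_prop) (fun y => (hA _).trans (hb y))
    · exact integrable_smulRight_gauss σ (by fun_prop) (fun y => (hA _).trans (hb y))
  rw [e]
  refine (norm_integral_le_of_norm_le (integrable_mG.const_mul (s ^ 2 * B * k ^ α)) ?_).trans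
    (le_of_eq ?_)
  · refine Eventually.of_forall fun y => (norm_smulRight_gauss σ y _).trans ?_
    have hy := norm_nonneg y
    have h1 : ‖f (x + k • σ y) - f x‖ ≤ B * (k ^ α * (s * (1 + ‖y‖))) := by
      refine (hB _ _).trans ?_
      gcongr
      have h2 : ‖x + k • σ y - x‖ ≤ k * (s * (1 + ‖y‖)) := by
        rw [add_sub_cancel_left, norm_smul, Real.norm_of_nonneg hk]
        gcongr
        calc ‖σ y‖ ≤ ‖(σ : E →L[ℝ] E)‖ * ‖y‖ := (σ : E →L[ℝ] E).le_opNorm y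
          _ ≤ s * (1 + ‖y‖) := by gcongr; linarith
      calc ‖x + k • σ y - x‖ ^ α ≤ (k * (s * (1 + ‖y‖))) ^ α := by gcongr
        _ = k ^ α * (s * (1 + ‖y‖)) ^ α := Real.mul_rpow hk (by positivity)
        _ ≤ k ^ α * (s * (1 + ‖y‖)) := by
            gcongr
            calc (s * (1 + ‖y‖)) ^ α ≤ (s * (1 + ‖y‖)) ^ (1 : ℝ) := by
                  apply Real.rpow_le_rpow_of_exponent_le _ hα1
                  nlinarith
              _ = _ := Real.rpow_one _
    calc ‖(σ.symm : E →L[ℝ] E)‖ * ‖y‖ * ‖f (x + k • σ y) - f x‖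
        ≤ s * ‖y‖ * (B * (k ^ α * (s * (1 + ‖y‖)))) := by gcongr
      _ = s ^ 2 * B * k ^ α * (‖y‖ * (1 + ‖y‖)) := by ring
      _ ≤ _ := by
        gcongr
        nlinarith [sq_nonneg (‖y‖), pow_nonneg hy 3]
  · rw [integral_const_mul, mG]; ring

lemma norm_Sop_le (σ : E ≃L[ℝ] E) (k : ℝ) {f : E → V} {A : ℝ} (hA : ∀ x, ‖f x‖ ≤ A) (x : E) :
    ‖Sop σ k f x‖ ≤ A := by
  unfold Sop
  refine (norm_integral_le_of_norm_le_const (C := A) (Eventually.of_forall fun y => hA _)).trans ?_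
  simp

lemma continuous_Sop {P : Type*} [TopologicalSpace P] [FirstCountableTopology P] (σ : E ≃L[ℝ] E)
    {f : P → E → V} (hf : Continuous (fun q : P × E => f q.1 q.2)) {A : ℝ} (hA : ∀ p x, ‖f p x‖ ≤ A)
    {k : P → ℝ} (hk : Continuous k) {x : P → E} (hx : Continuous x) :
    Continuous fun p => Sop σ (k p) (f p) (x p) := by
  unfold Sop
  apply continuous_of_dominated (bound := fun _ => A)
  · intro p
    refine Continuous.aestronglyMeasurable ?_
    exact hf.comp (continuous_const.prodMk (by fun_prop))
  · exact fun p => Eventually.of_forall fun y => hA _ _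
  · exact integrable_const _
  · refine Eventually.of_forall fun y => ?_
    exact hf.comp (continuous_id.prodMk (by fun_prop))

lemma continuous_Qop {P : Type*} [TopologicalSpace P] [FirstCountableTopology P] (σ : E ≃L[ℝ] E)
    {f : P → E → V} (hf : Continuous (fun q : P × E => f q.1 q.2)) {A : ℝ} (hA : ∀ p x, ‖f p x‖ ≤ A)
    {k : P → ℝ} (hk : Continuous k) {x : P → E} (hx : Continuous x) :
    Continuous fun p => Qop σ (k p) (f p) (x p) := by
  unfold Qop
  apply continuous_of_dominated (bound := fun y => ‖(σ.symm : E →L[ℝ] E)‖ * ‖y‖ ^ 1 * A)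
  · intro p
    refine Continuous.aestronglyMeasurable ?_
    exact continuous_smulRight_gauss σ continuous_id
      (hf.comp (continuous_const.prodMk (by fun_prop)))
  · refine fun p => Eventually.of_forall fun y => (norm_smulRight_gauss σ y _).trans ?_
    rw [pow_one]
    gcongr
    exact hA _ _
  · exact ((integrable_pow_norm_gauss 1).const_mul _).mul_const _
  · refine Eventually.of_forall fun y => ?_
    exact continuous_smulRight_gauss σ continuous_const
      (hf.comp (continuous_id.prodMk (by fun_prop)))

lemma continuous_Qop1 (σ : E ≃L[ℝ] E) (k : ℝ)
    {f : E → V} (hf : Continuous f) {A : ℝ} (hA : ∀ x, ‖f x‖ ≤ A) :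
    Continuous (Qop σ k f) :=
  continuous_Qop (P := E) (f := fun _ => f) σ (by fun_prop) (fun _ => hA)
    continuous_const continuous_id

lemma integrable_Sop (σ : E ≃L[ℝ] E) (k : ℝ)
    {f : E → V} (hf : Continuous f) {A : ℝ} (hA : ∀ x, ‖f x‖ ≤ A) (x : E) :
    Integrable (fun y => f (x + k • σ y)) (stdGaussian E) :=
  Integrable.mono' (integrable_const A) (Continuous.aestronglyMeasurable (by fun_prop))
    (Eventually.of_forall fun _ => hA _)

/-- Differentiation under the Gaussian average. -/
lemma hasFDerivAt_Sop_of_hasFDerivAt (σ : E ≃L[ℝ] E) (k : ℝ)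
    {f : E → V} {f' : E → E →L[ℝ] V} (hf : ∀ x, HasFDerivAt f (f' x) x) (hf' : Continuous f')
    {A A' : ℝ} (hA : ∀ x, ‖f x‖ ≤ A) (hA' : ∀ x, ‖f' x‖ ≤ A') (x : E) :
    HasFDerivAt (Sop σ k f) (Sop σ k f' x) x := by
  have hfc : Continuous f := continuous_iff_continuousAt.2 fun x => (hf x).continuousAt
  unfold Sop
  apply hasFDerivAt_integral_of_dominated_of_fderiv_le (s := univ) (bound := fun _ => A')
    (F' := fun x y => f' (x + k • σ y)) univ_mem
  · exact Eventually.of_forall fun x => Continuous.aestronglyMeasurable (by fun_prop)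
  · exact integrable_Sop σ k hfc hA x
  · exact Continuous.aestronglyMeasurable (by fun_prop)
  · exact Eventually.of_forall fun y x _ => hA' _
  · exact integrable_const _
  · refine Eventually.of_forall fun y x _ => ?_
    simpa [Function.comp_def] using (hf (x + k • σ y)).comp x ((hasFDerivAt_id x).add_const (k • σ y))

lemma map_prod_stdGaussian (k l n : ℝ) (h : n ^ 2 = k ^ 2 + l ^ 2) :
    ((stdGaussian E).prod (stdGaussian E)).map (fun q => k • q.1 + l • q.2)
      = (stdGaussian E).map (fun y => n • y) := by
  have : IsProbabilityMeasure (((stdGaussian E).prod (stdGaussian E)).map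
    (fun q => k • q.1 + l • q.2)) := Measure.isProbabilityMeasure_map (by fun_prop)
  have : IsProbabilityMeasure ((stdGaussian E).map (fun y => n • y)) :=
    Measure.isProbabilityMeasure_map (by fun_prop)
  apply Measure.ext_of_charFun
  ext t
  have e : (fun q : E × E => Complex.exp (⟪k • q.1 + l • q.2, t⟫ * Complex.I)) =
    fun q => Complex.exp (⟪q.1, k • t⟫ * Complex.I) * Complex.exp (⟪q.2, l • t⟫ * Complex.I) := by
    ext q
    rw [← Complex.exp_add, ← add_mul]
    simp [inner_add_left, inner_smul_left, inner_smul_right]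
  rw [charFun_apply, charFun_apply, integral_map (by fun_prop)
    (Continuous.aestronglyMeasurable (by fun_prop)), integral_map (by fun_prop)
    (Continuous.aestronglyMeasurable (by fun_prop)), e,
    integral_prod_mul (fun y : E => Complex.exp (⟪y, k • t⟫ * Complex.I))
      (fun y : E => Complex.exp (⟪y, l • t⟫ * Complex.I)),
    ← charFun_apply, ← charFun_apply, charFun_stdGaussian, charFun_stdGaussian, ← Complex.exp_add]
  have e2 : (fun y : E => Complex.exp (⟪n • y, t⟫ * Complex.I)) =
      fun y => Complex.exp (⟪y, n • t⟫ * Complex.I) := by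
    ext y; simp [inner_smul_left, inner_smul_right]
  rw [e2, ← charFun_apply, charFun_stdGaussian]
  congr 1
  simp only [norm_smul, mul_pow, Complex.ofReal_mul, ← Complex.ofReal_pow, Real.norm_eq_abs, sq_abs,
    h]
  push_cast
  ring

lemma Sop_Sop (σ : E ≃L[ℝ] E) (k l n : ℝ) (h : n ^ 2 = k ^ 2 + l ^ 2)
    {f : E → V} (hf : Continuous f) {A : ℝ} (hA : ∀ x, ‖f x‖ ≤ A) :
    Sop σ k (Sop σ l f) = Sop σ n f := by
  ext x
  unfold Sop
  have h1 : ∫ q : E × E, f (x + k • σ q.1 + l • σ q.2) ∂((stdGaussian E).prod (stdGaussian E))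
      = ∫ y, ∫ y', f (x + k • σ y + l • σ y') ∂(stdGaussian E) ∂(stdGaussian E) := by
    rw [integral_prod]
    exact Integrable.mono' (integrable_const A) (Continuous.aestronglyMeasurable (by fun_prop))
      (Eventually.of_forall fun _ => hA _)
  rw [← h1]
  have h2 : ∫ q : E × E, f (x + k • σ q.1 + l • σ q.2) ∂((stdGaussian E).prod (stdGaussian E))
    = ∫ z, f (x + σ z) ∂(((stdGaussian E).prod (stdGaussian E)).map (fun q => k • q.1 + l • q.2)) := by
    rw [integral_map (by fun_prop) (Continuous.aestronglyMeasurable (by fun_prop))]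
    simp [add_assoc]
  rw [h2, map_prod_stdGaussian k l n h, integral_map (by fun_prop)
    (Continuous.aestronglyMeasurable (by fun_prop))]
  simp
end Gauss2

lemma norm_integral_le_of_two_bounds {W : Type*} [NormedAddCommGroup W] [NormedSpace ℝ W]
    {F : ℝ → W} {P α r : ℝ} (hα : 0 < α) (hα1 : α < 1) (hr : 0 < r)
    (h1 : ∀ τ, 0 < τ → ‖F τ‖ ≤ P * τ ^ (α / 2 - 1))
    (h2 : ∀ τ, 0 < τ → ‖F τ‖ ≤ P * r * τ ^ (α / 2 - 3 / 2)) :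
    ‖∫ τ in Ioi 0, F τ‖ ≤ P * (2 / α + 2 / (1 - α)) * r ^ α := by
  have hr2 : 0 < r ^ 2 := by positivity
  set G : ℝ → ℝ := fun τ => if τ ≤ r ^ 2 then P * τ ^ (α / 2 - 1) else P * r * τ ^ (α / 2 - 3 / 2)
  have hU : Ioi (0 : ℝ) = Ioc 0 (r ^ 2) ∪ Ioi (r ^ 2) := (Ioc_union_Ioi_eq_Ioi hr2.le).symm
  have i1 : IntegrableOn G (Ioc 0 (r ^ 2)) := by
    have : IntegrableOn (fun τ : ℝ => P * τ ^ (α / 2 - 1)) (Ioc 0 (r ^ 2)) := by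
      apply Integrable.const_mul
      have := intervalIntegral.intervalIntegrable_rpow' (a := 0) (b := r ^ 2) (r := α / 2 - 1)
        (by linarith)
      rwa [intervalIntegrable_iff_integrableOn_Ioc_of_le hr2.le] at this
    refine this.congr_fun (fun τ hτ => ?_) measurableSet_Ioc
    simp only [G, if_pos hτ.2]
  have i2 : IntegrableOn G (Ioi (r ^ 2)) := by
    have : IntegrableOn (fun τ : ℝ => P * r * τ ^ (α / 2 - 3 / 2)) (Ioi (r ^ 2)) := by
      apply Integrable.const_mul
      exact integrableOn_Ioi_rpow_of_lt (by linarith) hr2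
    refine this.congr_fun (fun τ hτ => ?_) measurableSet_Ioi
    simp only [G, if_neg (not_le.2 (mem_Ioi.1 hτ))]
  have hG : IntegrableOn G (Ioi 0) := by rw [hU]; exact i1.union i2
  have hb : ‖∫ τ in Ioi 0, F τ‖ ≤ ∫ τ in Ioi 0, G τ := by
    apply norm_integral_le_of_norm_le hG
    refine (ae_restrict_iff' measurableSet_Ioi).2 (Eventually.of_forall fun τ hτ => ?_)
    by_cases h : τ ≤ r ^ 2
    · simp only [G, if_pos h]; exact h1 τ hτ
    · simp only [G, if_neg h]; exact h2 τ hτ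
  refine hb.trans (le_of_eq ?_)
  rw [hU, setIntegral_union (by
    rw [Set.disjoint_left]; intro x hx hx2; exact absurd hx.2 (not_le.2 hx2)) measurableSet_Ioi i1 i2]
  have e1 : ∫ τ in Ioc 0 (r ^ 2), G τ = P * (2 / α * r ^ α) := by
    rw [setIntegral_congr_fun (g := fun τ : ℝ => P * τ ^ (α / 2 - 1)) measurableSet_Ioc
      (fun τ hτ => by simp only [G, if_pos hτ.2]), integral_const_mul,
      ← intervalIntegral.integral_of_le hr2.le, integral_rpow (Or.inl (by linarith))]
    rw [sub_add_cancel, Real.zero_rpow (by positivity), ← Real.rpow_natCast, ← Real.rpow_mul hr.le]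
    congr 1
    rw [show ((2 : ℕ) : ℝ) * (α / 2) = α by push_cast; ring]
    field_simp; ring
  have e2 : ∫ τ in Ioi (r ^ 2), G τ = P * (2 / (1 - α) * r ^ α) := by
    rw [setIntegral_congr_fun (g := fun τ : ℝ => P * r * τ ^ (α / 2 - 3 / 2)) measurableSet_Ioi
      (fun τ hτ => by simp only [G, if_neg (not_le.2 (mem_Ioi.1 hτ))]), integral_const_mul,
      integral_Ioi_rpow_of_lt (by linarith) hr2]
    rw [← Real.rpow_natCast, ← Real.rpow_mul hr.le,
      show ((2 : ℕ) : ℝ) * (α / 2 - 3 / 2 + 1) = α - 1 by push_cast; ring, Real.rpow_sub hr,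
      Real.rpow_one]
    have : (1 - α) ≠ 0 := by linarith
    have h3 : (α / 2 - 3 / 2 + 1) = - ((1 - α) / 2) := by ring
    rw [h3]
    field_simp
  rw [e1, e2]; ring

/-- Continuous linear maps between normed spaces. -/
abbrev BL (E V : Type*) [NormedAddCommGroup E] [NormedSpace ℝ E] [NormedAddCommGroup V]
    [NormedSpace ℝ V] := E →L[ℝ] V

lemma aesm_weight {W : Type*} [NormedAddCommGroup W] [NormedSpace ℝ W] {c₁ c₂ : ℝ → ℝ}
    (h₁ : Measurable c₁) (h₂ : Measurable c₂) {f : ℝ → W} {μ : Measure ℝ}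
    (hf : AEStronglyMeasurable f μ) :
    AEStronglyMeasurable (fun τ => c₁ τ • c₂ τ • f τ) μ :=
  h₁.aestronglyMeasurable.smul (h₂.aestronglyMeasurable.smul hf)

section HeatPot
variable {E : Type*} [NormedAddCommGroup E] [InnerProductSpace ℝ E] [FiniteDimensional ℝ E]
  [MeasurableSpace E] [BorelSpace E]
variable {V : Type*} [NormedAddCommGroup V] [NormedSpace ℝ V] [CompleteSpace V]

lemma Qop_eq_Sop_Qop (σ : E ≃L[ℝ] E) {k q : ℝ} (hq : 0 < q) (hk : 0 < k) (h : k ^ 2 = 2 * q ^ 2)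
    {f : E → V} (hf : Continuous f) {A : ℝ} (hA : ∀ x, ‖f x‖ ≤ A) (x : E) :
    k⁻¹ • Qop σ k f x = q⁻¹ • Sop σ q (Qop σ q f) x := by
  have h1 := hasFDerivAt_Sop σ hk.ne' hf hA x
  have h0 : k ^ 2 = q ^ 2 + q ^ 2 := by rw [h]; ring
  rw [← Sop_Sop σ q q k h0 hf hA] at h1
  set s : ℝ := max (max ‖(σ : E →L[ℝ] E)‖ ‖(σ.symm : E →L[ℝ] E)‖) 1
  have hb : ∀ x, ‖q⁻¹ • Qop σ q f x‖ ≤ q⁻¹ * (s ^ 2 * mG E * A) := by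
    intro x
    rw [norm_smul, Real.norm_of_nonneg (by positivity)]
    gcongr
    exact norm_Qop_le_of_bound σ ((le_max_right _ _).trans (le_max_left _ _)) (le_max_right _ _)
      q hA x
  have h2 := hasFDerivAt_Sop_of_hasFDerivAt σ q (f := Sop σ q f) (f' := fun x => q⁻¹ • Qop σ q f x)
    (fun x => hasFDerivAt_Sop σ hq.ne' hf hA x) (by have := continuous_Qop1 σ q hf hA; fun_prop)
    (fun x => norm_Sop_le σ q hA x) hb x
  rw [h1.unique h2, Sop, Sop, integral_smul]

lemma hasFDerivAt_Qop (σ : E ≃L[ℝ] E) {k q : ℝ} (hq : 0 < q) (hk : 0 < k) (h : k ^ 2 = 2 * q ^ 2)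
    {f : E → V} (hf : Continuous f) {A : ℝ} (hA : ∀ x, ‖f x‖ ≤ A) (x : E) :
    HasFDerivAt (fun x => k⁻¹ • Qop σ k f x) ((q ^ 2)⁻¹ • Qop σ q (Qop σ q f) x) x := by
  have : (fun x => k⁻¹ • Qop σ k f x) = fun x => q⁻¹ • Sop σ q (Qop σ q f) x := by
    ext1 x; exact Qop_eq_Sop_Qop σ hq hk h hf hA x
  rw [this]
  have h3 := (hasFDerivAt_Sop σ hq.ne' (continuous_Qop1 σ q hf hA)
    (norm_Qop_le_of_bound σ ((le_max_right _ _).trans (le_max_left _ _)) (le_max_right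
      (max ‖(σ : E →L[ℝ] E)‖ ‖(σ.symm : E →L[ℝ] E)‖) 1) q hA) x).const_smul q⁻¹
  convert! h3 using 1
  rw [smul_smul, sq, mul_inv]

lemma norm_QQ_le (σ : E ≃L[ℝ] E) {s : ℝ}
    (hs : ‖(σ : E →L[ℝ] E)‖ ≤ s) (hs2 : ‖(σ.symm : E →L[ℝ] E)‖ ≤ s)
    (hs1 : 1 ≤ s) {q : ℝ} (hq : 0 ≤ q) {f : E → V} (hf : Continuous f) {A B α : ℝ}
    (hα : 0 < α) (hα1 : α ≤ 1)
    (hA : ∀ x, ‖f x‖ ≤ A) (hB0 : 0 ≤ B) (hB : ∀ x y, ‖f x - f y‖ ≤ B * ‖x - y‖ ^ α) (x : E) :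
    ‖Qop σ q (Qop σ q f) x‖ ≤ (s ^ 2 * mG E) ^ 2 * B * q ^ α := by
  have := norm_Qop_le_of_bound σ hs2 hs1 q
    (norm_Qop_le_of_holder σ hs hs2 hs1 hq hf hα hα1 hA hB0 hB) x
  refine this.trans (le_of_eq ?_); ring

lemma norm_QQ_sub_le (σ : E ≃L[ℝ] E) {s : ℝ}
    (hs : ‖(σ : E →L[ℝ] E)‖ ≤ s) (hs2 : ‖(σ.symm : E →L[ℝ] E)‖ ≤ s)
    (hs1 : 1 ≤ s) {q : ℝ} (hq : 0 < q) {f : E → V} (hf : Continuous f) {A B α : ℝ}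
    (hα : 0 < α) (hα1 : α ≤ 1)
    (hA : ∀ x, ‖f x‖ ≤ A) (hB0 : 0 ≤ B) (hB : ∀ x y, ‖f x - f y‖ ≤ B * ‖x - y‖ ^ α) (x x' : E) :
    ‖Qop σ q (Qop σ q f) x - Qop σ q (Qop σ q f) x'‖
      ≤ 2 * (s ^ 2 * mG E) ^ 3 * B * q ^ (α - 1) * ‖x - x'‖ := by
  set F := Qop σ q f with hF
  have hFc : Continuous F := continuous_Qop1 σ q hf hA
  have hFb : ∀ x, ‖F x‖ ≤ s ^ 2 * mG E * B * q ^ α :=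
    norm_Qop_le_of_holder σ hs hs2 hs1 hq.le hf hα hα1 hA hB0 hB
  set q' := q / Real.sqrt 2
  have hq' : 0 < q' := by positivity
  have hqq : q ^ 2 = 2 * q' ^ 2 := by
    simp only [q', div_pow, Real.sq_sqrt (show (0:ℝ) ≤ 2 by norm_num)]; ring
  have hd : ∀ x, HasFDerivAt (fun x => Qop σ q F x)
      (q • (q' ^ 2)⁻¹ • Qop σ q' (Qop σ q' F) x) x := by
    intro x
    have := (hasFDerivAt_Qop σ hq' hq hqq hFc hFb x).const_smul q
    have e : (q • fun x => q⁻¹ • Qop σ q F x) = Qop σ q F := by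
      ext1 x; simp [smul_smul, mul_inv_cancel₀ hq.ne']
    rw [e] at this
    exact this
  have hbd : ∀ x, ‖q • (q' ^ 2)⁻¹ • Qop σ q' (Qop σ q' F) x‖
      ≤ 2 * (s ^ 2 * mG E) ^ 3 * B * q ^ (α - 1) := by
    intro x
    rw [norm_smul, norm_smul, Real.norm_of_nonneg hq.le, Real.norm_of_nonneg (by positivity)]
    have h1 := norm_Qop_le_of_bound σ hs2 hs1 q' (norm_Qop_le_of_bound σ hs2 hs1 q' hFb) x
    have h2 : (q' ^ 2)⁻¹ = 2 * (q ^ 2)⁻¹ := by rw [hqq, mul_inv]; ring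
    rw [h2]
    calc q * (2 * (q ^ 2)⁻¹ * ‖Qop σ q' (Qop σ q' F) x‖)
        ≤ q * (2 * (q ^ 2)⁻¹ * (s ^ 2 * mG E * (s ^ 2 * mG E * (s ^ 2 * mG E * B * q ^ α)))) := by
          gcongr
      _ = 2 * (s ^ 2 * mG E) ^ 3 * B * (q ^ α / q) := by field_simp
      _ = _ := by rw [Real.rpow_sub_one hq.ne']
  have := Convex.norm_image_sub_le_of_norm_hasFDerivWithin_le (s := univ)
    (fun x _ => (hd x).hasFDerivWithinAt) (fun x _ => hbd x) convex_univ (mem_univ x') (mem_univ x)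
  exact this

/-- Heat potential. -/
noncomputable def potW (σ : E ≃L[ℝ] E) (h : ℝ × E → ℝ) (z : ℝ × E) : ℝ :=
  ∫ τ in Ioi (0:ℝ), Real.exp (-τ) * Sop σ (√τ) (fun x => h (z.1 - τ, x)) z.2

/-- Spatial gradient of the heat potential. -/
noncomputable def potG (σ : E ≃L[ℝ] E) (h : ℝ × E → ℝ) (z : ℝ × E) : E →L[ℝ] ℝ :=
  ∫ τ in Ioi (0:ℝ), Real.exp (-τ) • (√τ)⁻¹ • Qop σ (√τ) (fun x => h (z.1 - τ, x)) z.2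

/-- Spatial Hessian of the heat potential. -/
noncomputable def potH (σ : E ≃L[ℝ] E) (h : ℝ × E → ℝ) (z : ℝ × E) : BL E (BL E ℝ) :=
  ∫ τ in Ioi (0:ℝ), Real.exp (-τ) • (τ / 2)⁻¹ •
    Qop σ (√(τ / 2)) (Qop σ (√(τ / 2)) (fun x => h (z.1 - τ, x))) z.2

lemma integrableOn_gamma_weight {s : ℝ} (hs : 0 < s) (C : ℝ) :
    IntegrableOn (fun τ => C * (Real.exp (-τ) * τ ^ (s - 1))) (Ioi 0) :=
  (Real.GammaIntegral_convergent hs).const_mul C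

section
variable (σ : E ≃L[ℝ] E) {s : ℝ}
    (hs : ‖(σ : E →L[ℝ] E)‖ ≤ s) (hs2 : ‖(σ.symm : E →L[ℝ] E)‖ ≤ s)
    (hs1 : 1 ≤ s) {h : ℝ × E → ℝ} (hc : Continuous h) {A B α : ℝ}
    (hα : 0 < α) (hα1 : α < 1)
    (hA : ∀ z, ‖h z‖ ≤ A) (hB0 : 0 ≤ B)
    (hB : ∀ t x y, ‖h (t, x) - h (t, y)‖ ≤ B * ‖x - y‖ ^ α)
include hs hs2 hs1 hc hα hα1 hA hB0 hB

lemma potW_integrand_cont : Continuous fun p : ℝ × (ℝ × E) =>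
    Real.exp (-p.1) * Sop σ (√p.1) (fun x => h (p.2.1 - p.1, x)) p.2.2 := by
  refine Continuous.mul (by fun_prop) ?_
  exact continuous_Sop σ (f := fun (p : ℝ × (ℝ × E)) x => h (p.2.1 - p.1, x)) (by fun_prop)
    (fun p x => hA _) (by fun_prop) (by fun_prop)

lemma potQ_cont : Continuous fun p : ℝ × (ℝ × E) =>
    Qop σ (√p.1) (fun x => h (p.2.1 - p.1, x)) p.2.2 :=
  continuous_Qop σ (f := fun (p : ℝ × (ℝ × E)) x => h (p.2.1 - p.1, x)) (by fun_prop)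
    (fun p x => hA _) (by fun_prop) (by fun_prop)

lemma potQQ_cont : Continuous fun p : ℝ × (ℝ × E) =>
    Qop σ (√(p.1/2)) (Qop σ (√(p.1/2)) (fun x => h (p.2.1 - p.1, x))) p.2.2 := by
  refine continuous_Qop σ (f := fun (p : ℝ × (ℝ × E)) =>
    Qop σ (√(p.1/2)) (fun x => h (p.2.1 - p.1, x)))
    ?_ (A := s ^ 2 * mG E * A) (fun p x => norm_Qop_le_of_bound σ hs2 hs1 _ (fun _ => hA _) x)
    (by fun_prop) (by fun_prop)
  exact continuous_Qop σ (P := (ℝ × (ℝ × E)) × E) (f := fun q x => h (q.1.2.1 - q.1.1, x)) (by fun_prop)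
    (fun p x => hA _) (by fun_prop) (by fun_prop)

lemma norm_potW_integrand (z : ℝ × E) (τ : ℝ) :
    ‖Real.exp (-τ) * Sop σ (√τ) (fun x => h (z.1 - τ, x)) z.2‖ ≤ A * (Real.exp (-τ) * τ ^ ((1:ℝ) - 1)) := by
  rw [norm_mul, Real.norm_of_nonneg (Real.exp_pos _).le, sub_self, Real.rpow_zero, mul_one, mul_comm]
  gcongr
  exact norm_Sop_le σ _ (fun x => hA _) _

lemma norm_potG_integrand (z : ℝ × E) {τ : ℝ} (hτ : 0 < τ) :
    ‖Real.exp (-τ) • (√τ)⁻¹ • Qop σ (√τ) (fun x => h (z.1 - τ, x)) z.2‖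
      ≤ (s ^ 2 * mG E * A) * (Real.exp (-τ) * τ ^ ((1/2:ℝ) - 1)) := by
  rw [norm_smul, norm_smul, Real.norm_of_nonneg (Real.exp_pos _).le,
    Real.norm_of_nonneg (by positivity)]
  have : τ ^ ((1/2:ℝ) - 1) = (√τ)⁻¹ := by
    rw [Real.sqrt_eq_rpow, ← Real.rpow_neg hτ.le]; norm_num
  rw [this, mul_comm, mul_assoc]
  have h1 := norm_Qop_le_of_bound σ hs2 hs1 (√τ) (fun x => hA (z.1 - τ, x)) z.2
  calc _ = ‖Qop σ √τ (fun x => h (z.1 - τ, x)) z.2‖ * (Real.exp (-τ) * (√τ)⁻¹) := by ring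
    _ ≤ _ := by gcongr

lemma norm_potH_integrand (z : ℝ × E) {τ : ℝ} (hτ : 0 < τ) :
    ‖Real.exp (-τ) • (τ / 2)⁻¹ •
    Qop σ (√(τ / 2)) (Qop σ (√(τ / 2)) (fun x => h (z.1 - τ, x))) z.2‖
      ≤ (2 * (s ^ 2 * mG E) ^ 2 * B) * (Real.exp (-τ) * τ ^ ((α / 2) - 1)) := by
  rw [norm_smul, norm_smul, Real.norm_of_nonneg (Real.exp_pos _).le,
    Real.norm_of_nonneg (by positivity)]
  have h1 := norm_QQ_le σ hs hs2 hs1 (Real.sqrt_nonneg (τ / 2)) (f := fun x => h (z.1 - τ, x))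
    (by fun_prop) hα hα1.le (fun x => hA _) hB0 (hB _) z.2
  have h2 : √(τ / 2) ^ α ≤ τ ^ (α / 2) := by
    rw [Real.sqrt_eq_rpow, ← Real.rpow_mul (by positivity)]
    rw [show 1 / 2 * α = α / 2 by ring]
    gcongr
    linarith
  calc _ ≤ Real.exp (-τ) * ((τ / 2)⁻¹ * ((s ^ 2 * mG E) ^ 2 * B * τ ^ (α / 2))) := by
        gcongr; exact h1.trans (by gcongr)
    _ = _ := by rw [Real.rpow_sub_one hτ.ne']; field_simp

lemma hasFDerivAt_potW (t : ℝ) (x : E) :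
    HasFDerivAt (fun x => potW σ h (t, x)) (potG σ h (t, x)) x := by
  have hA0 : 0 ≤ A := (norm_nonneg _).trans (hA 0)
  have c1 := potW_integrand_cont σ hs hs2 hs1 hc hα hα1 hA hB0 hB
  have c2 := potQ_cont σ hs hs2 hs1 hc hα hα1 hA hB0 hB
  apply hasFDerivAt_integral_of_dominated_of_fderiv_le (s := univ)
    (bound := fun τ => (s ^ 2 * mG E * A) * (Real.exp (-τ) * τ ^ ((1/2:ℝ) - 1)))
    (F' := fun x τ => Real.exp (-τ) • (√τ)⁻¹ • Qop σ (√τ) (fun x => h (t - τ, x)) x) univ_mem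
  · refine Eventually.of_forall fun x => Continuous.aestronglyMeasurable ?_
    exact c1.comp (f := fun τ : ℝ => (τ, (t, x))) (by fun_prop)
  · refine Integrable.mono' (integrableOn_gamma_weight one_pos A) (Continuous.aestronglyMeasurable
      (c1.comp (f := fun τ : ℝ => (τ, (t, x))) (by fun_prop))) (Eventually.of_forall fun τ => ?_)
    exact norm_potW_integrand σ hs hs2 hs1 hc hα hα1 hA hB0 hB (t, x) τ
  · refine aesm_weight (by fun_prop) (by fun_prop) (Continuous.aestronglyMeasurable ?_)
    exact c2.comp (f := fun τ : ℝ => (τ, (t, x))) (by fun_prop)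
  · refine (ae_restrict_iff' measurableSet_Ioi).2 (Eventually.of_forall fun τ hτ x _ => ?_)
    exact norm_potG_integrand σ hs hs2 hs1 hc hα hα1 hA hB0 hB (t, x) hτ
  · exact integrableOn_gamma_weight (by norm_num) _
  · refine (ae_restrict_iff' measurableSet_Ioi).2 (Eventually.of_forall fun τ hτ x _ => ?_)
    exact (hasFDerivAt_Sop σ (Real.sqrt_pos.2 hτ).ne' (f := fun x => h (t - τ, x)) (by fun_prop)
      (fun x => hA _) x).const_mul _

lemma hasFDerivAt_potG (t : ℝ) (x : E) :
    HasFDerivAt (fun x => potG σ h (t, x)) (potH σ h (t, x)) x := by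
  have hA0 : 0 ≤ A := (norm_nonneg _).trans (hA 0)
  have c1 := potQ_cont σ hs hs2 hs1 hc hα hα1 hA hB0 hB
  have c2 := potQQ_cont σ hs hs2 hs1 hc hα hα1 hA hB0 hB
  have m1 : ∀ x, AEStronglyMeasurable (fun τ : ℝ =>
      Real.exp (-τ) • (√τ)⁻¹ • Qop σ (√τ) (fun x => h (t - τ, x)) x) (volume.restrict (Ioi 0)) := by
    intro x
    refine aesm_weight (by fun_prop) (by fun_prop) (Continuous.aestronglyMeasurable ?_)
    exact c1.comp (f := fun τ : ℝ => (τ, (t, x))) (by fun_prop)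
  apply hasFDerivAt_integral_of_dominated_of_fderiv_le (s := univ)
    (bound := fun τ => (2 * (s ^ 2 * mG E) ^ 2 * B) * (Real.exp (-τ) * τ ^ ((α / 2) - 1)))
    (F' := fun x τ => Real.exp (-τ) • (τ / 2)⁻¹ •
      Qop σ (√(τ / 2)) (Qop σ (√(τ / 2)) (fun x => h (t - τ, x))) x) univ_mem
  · exact Eventually.of_forall m1
  · refine Integrable.mono' (integrableOn_gamma_weight (s := 1/2) (by norm_num) (s ^ 2 * mG E * A))
      (m1 x) ?_
    refine (ae_restrict_iff' measurableSet_Ioi).2 (Eventually.of_forall fun τ hτ => ?_)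
    exact norm_potG_integrand σ hs hs2 hs1 hc hα hα1 hA hB0 hB (t, x) hτ
  · refine aesm_weight (by fun_prop) (by fun_prop) (Continuous.aestronglyMeasurable ?_)
    exact c2.comp (f := fun τ : ℝ => (τ, (t, x))) (by fun_prop)
  · refine (ae_restrict_iff' measurableSet_Ioi).2 (Eventually.of_forall fun τ hτ x _ => ?_)
    exact norm_potH_integrand σ hs hs2 hs1 hc hα hα1 hA hB0 hB (t, x) hτ
  · exact integrableOn_gamma_weight (by positivity) _
  · refine (ae_restrict_iff' measurableSet_Ioi).2 (Eventually.of_forall fun τ hτ x _ => ?_)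
    have hτ' : 0 < τ := hτ
    have := (hasFDerivAt_Qop σ (k := √τ) (q := √(τ / 2)) (by positivity) (by positivity)
      (by rw [Real.sq_sqrt (by positivity), Real.sq_sqrt (by positivity)]; ring)
      (f := fun x => h (t - τ, x)) (by fun_prop) (fun x => hA _) x).const_smul (Real.exp (-τ))
    rw [Real.sq_sqrt (by positivity)] at this
    exact this

lemma norm_potW_le (z : ℝ × E) : ‖potW σ h z‖ ≤ A * Real.Gamma 1 := by
  refine (norm_integral_le_of_norm_le (integrableOn_gamma_weight one_pos A)
    (Eventually.of_forall fun τ =>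
      norm_potW_integrand σ hs hs2 hs1 hc hα hα1 hA hB0 hB z τ)).trans (le_of_eq ?_)
  rw [integral_const_mul, Real.Gamma_eq_integral one_pos]

lemma continuous_potW : Continuous (potW σ h) := by
  have c1 := potW_integrand_cont σ hs hs2 hs1 hc hα hα1 hA hB0 hB
  apply continuous_of_dominated (bound := fun τ => A * (Real.exp (-τ) * τ ^ ((1:ℝ) - 1)))
  · exact fun z => Continuous.aestronglyMeasurable
      (c1.comp (f := fun τ : ℝ => (τ, z)) (by fun_prop))
  · exact fun z => (Eventually.of_forall fun τ =>
      norm_potW_integrand σ hs hs2 hs1 hc hα hα1 hA hB0 hB z τ)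
  · exact integrableOn_gamma_weight one_pos A
  · exact Eventually.of_forall fun τ => (c1.comp (f := fun z : ℝ × E => (τ, z)) (by fun_prop))

lemma potH_meas (z : ℝ × E) : AEStronglyMeasurable (fun τ : ℝ => Real.exp (-τ) • (τ / 2)⁻¹ •
    Qop σ (√(τ / 2)) (Qop σ (√(τ / 2)) (fun x => h (z.1 - τ, x))) z.2)
      (volume.restrict (Ioi 0)) := by
  have c1 := potQQ_cont σ hs hs2 hs1 hc hα hα1 hA hB0 hB
  refine aesm_weight (by fun_prop) (by fun_prop) (Continuous.aestronglyMeasurable ?_)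
  exact c1.comp (f := fun τ : ℝ => (τ, z)) (by fun_prop)

lemma continuous_potH : Continuous (potH σ h) := by
  have c1 := potQQ_cont σ hs hs2 hs1 hc hα hα1 hA hB0 hB
  apply continuous_of_dominated
    (bound := fun τ => (2 * (s ^ 2 * mG E) ^ 2 * B) * (Real.exp (-τ) * τ ^ ((α / 2) - 1)))
  · exact potH_meas σ hs hs2 hs1 hc hα hα1 hA hB0 hB
  · intro z
    refine (ae_restrict_iff' measurableSet_Ioi).2 (Eventually.of_forall fun τ hτ => ?_)
    exact norm_potH_integrand σ hs hs2 hs1 hc hα hα1 hA hB0 hB z hτ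
  · exact integrableOn_gamma_weight (by positivity) _
  · refine Eventually.of_forall fun τ => ?_
    have := (c1.comp (f := fun z : ℝ × E => (τ, z)) (by fun_prop))
    exact (this.const_smul (τ / 2)⁻¹).const_smul (Real.exp (-τ))

lemma norm_potH_sub_le (t : ℝ) (x x' : E) :
    ‖potH σ h (t, x) - potH σ h (t, x')‖
      ≤ 8 * (s ^ 2 * mG E) ^ 3 * B * (2 / α + 2 / (1 - α)) * ‖x - x'‖ ^ α := by
  rcases eq_or_ne x x' with rfl | hne
  · rw [sub_self (potH σ h (t, x)), norm_zero]
    have : 0 ≤ mG E := zero_le_one.trans one_le_mG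
    have : 0 < 1 - α := by linarith
    positivity
  have hr : 0 < ‖x - x'‖ := norm_pos_iff.2 (sub_ne_zero.2 hne)
  have hm := one_le_mG (E := E)
  have hM : 1 ≤ s ^ 2 * mG E := by nlinarith
  have int : ∀ z : ℝ × E, IntegrableOn (fun τ : ℝ => Real.exp (-τ) • (τ / 2)⁻¹ •
    Qop σ (√(τ / 2)) (Qop σ (√(τ / 2)) (fun x => h (z.1 - τ, x))) z.2) (Ioi 0) := by
    intro z
    refine Integrable.mono' (integrableOn_gamma_weight (s := α / 2) (by positivity)
      (2 * (s ^ 2 * mG E) ^ 2 * B)) (potH_meas σ hs hs2 hs1 hc hα hα1 hA hB0 hB z) ?_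
    refine (ae_restrict_iff' measurableSet_Ioi).2 (Eventually.of_forall fun τ hτ => ?_)
    exact norm_potH_integrand σ hs hs2 hs1 hc hα hα1 hA hB0 hB z hτ
  unfold potH
  rw [← integral_sub (int (t, x)) (int (t, x'))]
  apply norm_integral_le_of_two_bounds hα hα1 hr
  · intro τ hτ
    refine (norm_sub_le _ _).trans ?_
    have n1 := norm_potH_integrand σ hs hs2 hs1 hc hα hα1 hA hB0 hB (t, x) hτ
    have n2 := norm_potH_integrand σ hs hs2 hs1 hc hα hα1 hA hB0 hB (t, x') hτ
    have e1 : Real.exp (-τ) ≤ 1 := by rw [Real.exp_le_one_iff]; linarith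
    have hM3 : (s ^ 2 * mG E) ^ 2 ≤ (s ^ 2 * mG E) ^ 3 := pow_le_pow_right₀ hM (by norm_num)
    calc _ ≤ (2 * (s ^ 2 * mG E) ^ 2 * B) * (Real.exp (-τ) * τ ^ ((α / 2) - 1))
          + (2 * (s ^ 2 * mG E) ^ 2 * B) * (Real.exp (-τ) * τ ^ ((α / 2) - 1)) := add_le_add n1 n2
      _ = 4 * (s ^ 2 * mG E) ^ 2 * B * (Real.exp (-τ) * τ ^ ((α / 2) - 1)) := by ring
      _ ≤ 8 * (s ^ 2 * mG E) ^ 3 * B * (1 * τ ^ ((α / 2) - 1)) := by gcongr; norm_num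
      _ = _ := by ring
  · intro τ hτ
    rw [← smul_sub, ← smul_sub, norm_smul, norm_smul, Real.norm_of_nonneg (Real.exp_pos _).le,
      Real.norm_of_nonneg (by positivity)]
    have n1 := norm_QQ_sub_le σ hs hs2 hs1 (q := √(τ / 2)) (by positivity)
      (f := fun x => h (t - τ, x)) (by fun_prop) hα hα1.le (fun x => hA _) hB0 (hB _) x x'
    have e1 : Real.exp (-τ) ≤ 1 := by rw [Real.exp_le_one_iff]; linarith
    have e2 : √(τ / 2) ^ (α - 1) ≤ 2 * τ ^ (α / 2 - 1 / 2) := by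
      rw [Real.sqrt_eq_rpow, ← Real.rpow_mul (by positivity),
        show 1 / 2 * (α - 1) = α / 2 - 1 / 2 by ring, div_eq_mul_inv, Real.mul_rpow hτ.le (by norm_num),
        mul_comm]
      gcongr
      rw [Real.inv_rpow (by norm_num), ← Real.rpow_neg (by norm_num)]
      calc (2:ℝ) ^ (-(α / 2 - 1 / 2)) ≤ 2 ^ (1:ℝ) := by
            apply Real.rpow_le_rpow_of_exponent_le (by norm_num) (by linarith)
        _ = 2 := Real.rpow_one _
    calc _ ≤ 1 * ((τ / 2)⁻¹ * (2 * (s ^ 2 * mG E) ^ 3 * B * (2 * τ ^ (α / 2 - 1 / 2)) * ‖x - x'‖)) := by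
          gcongr
          exact n1.trans (by gcongr)
      _ = 8 * (s ^ 2 * mG E) ^ 3 * B * ‖x - x'‖ * (τ ^ (α / 2 - 1 / 2) / τ) := by field_simp; ring
      _ = _ := by rw [← Real.rpow_sub_one hτ.ne']; congr 2; ring

end
end HeatPot

section Taylor
variable {E : Type*} [NormedAddCommGroup E] [NormedSpace ℝ E]

lemma hasDerivAt_line (x v : E) (θ : ℝ) : HasDerivAt (fun θ : ℝ => x + θ • v) v θ := by
  simpa using ((hasDerivAt_id θ).smul_const v).const_add x

lemma grad_taylor {g : E → BL E ℝ} {H : E → BL E (BL E ℝ)} {x v : E} {K : ℝ}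
    (hg : ∀ θ ∈ Icc (0:ℝ) 1, HasFDerivAt g (H (x + θ • v)) (x + θ • v))
    (hH : ∀ θ ∈ Icc (0:ℝ) 1, ‖H (x + θ • v) - H x‖ ≤ K) :
    ‖g (x + v) - g x - H x v‖ ≤ K * ‖v‖ := by
  have hd : ∀ θ ∈ Icc (0:ℝ) 1, HasDerivWithinAt (fun θ : ℝ => g (x + θ • v) - θ • H x v)
      (H (x + θ • v) v - H x v) (Icc 0 1) θ := by
    intro θ hθ
    have h1 := (hg θ hθ).comp_hasDerivAt θ (hasDerivAt_line x v θ)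
    have h2 := h1.sub ((hasDerivAt_id θ).smul_const (H x v))
    simpa [Function.comp_def] using! h2.hasDerivWithinAt
  have := norm_image_sub_le_of_norm_deriv_le_segment_01' hd (C := K * ‖v‖) (fun θ hθ => by
    rw [← sub_apply]
    exact (ContinuousLinearMap.le_opNorm _ _).trans
      (mul_le_mul_of_nonneg_right (hH θ (Ico_subset_Icc_self hθ)) (norm_nonneg _)))
  convert! this using 2
  simp
  abel

lemma fun_taylor {w : E → ℝ} {g : E → BL E ℝ} {H : E → BL E (BL E ℝ)} {x v : E} {K : ℝ}
    (hw : ∀ θ ∈ Icc (0:ℝ) 1, HasFDerivAt w (g (x + θ • v)) (x + θ • v))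
    (hg : ∀ θ ∈ Icc (0:ℝ) 1, HasFDerivAt g (H (x + θ • v)) (x + θ • v))
    (hH : ∀ θ ∈ Icc (0:ℝ) 1, ‖H (x + θ • v) - H x‖ ≤ K) :
    |w (x + v) - w x - g x v - (1/2) * H x v v| ≤ K * ‖v‖ ^ 2 := by
  have hK : 0 ≤ K := (norm_nonneg _).trans (hH 0 (by simp))
  have hd : ∀ θ ∈ Icc (0:ℝ) 1, HasDerivWithinAt
      (fun θ : ℝ => w (x + θ • v) - θ * g x v - (1/2) * θ ^ 2 * H x v v)
      ((g (x + θ • v) - g x - H x (θ • v)) v) (Icc 0 1) θ := by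
    intro θ hθ
    have h1 := (hw θ hθ).comp_hasDerivAt θ (hasDerivAt_line x v θ)
    have h2 := (h1.sub ((hasDerivAt_id θ).mul_const (g x v))).sub
      ((((hasDerivAt_id θ).pow 2).const_mul (1/2)).mul_const (H x v v))
    refine (h2.congr_deriv ?_).hasDerivWithinAt
    simp
  have := norm_image_sub_le_of_norm_deriv_le_segment_01' hd (C := K * ‖v‖ ^ 2) (fun θ hθ => by
    refine (ContinuousLinearMap.le_opNorm _ _).trans ?_
    have h3 := grad_taylor (g := g) (H := H) (x := x) (v := θ • v) (K := K)
      (fun η hη => by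
        rw [smul_smul]
        exact hg _ ⟨mul_nonneg hη.1 hθ.1, mul_le_one₀ hη.2 hθ.1 hθ.2.le⟩)
      (fun η hη => by
        rw [smul_smul]
        exact hH _ ⟨mul_nonneg hη.1 hθ.1, mul_le_one₀ hη.2 hθ.1 hθ.2.le⟩)
    have h4 : ‖θ • v‖ ≤ ‖v‖ := by
      rw [norm_smul, Real.norm_of_nonneg hθ.1]
      exact mul_le_of_le_one_left (norm_nonneg _) hθ.2.le
    calc _ ≤ (K * ‖θ • v‖) * ‖v‖ := by gcongr
      _ ≤ (K * ‖v‖) * ‖v‖ := by gcongr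
      _ = _ := by ring)
  rw [Real.norm_eq_abs] at this
  convert! this using 2
  simp
  ring
end Taylor

lemma hasDerivAt_of_right {f f' : ℝ → ℝ} (hf : Continuous f) (hf' : Continuous f')
    (h : ∀ t, HasDerivWithinAt f (f' t) (Ici t) t) (t : ℝ) : HasDerivAt f (f' t) t := by
  set P : ℝ → ℝ := fun s => ∫ τ in (t - 1)..s, f' τ
  have hP : ∀ s, HasDerivAt P (f' s) s := fun s =>
    intervalIntegral.integral_hasDerivAt_right (hf'.intervalIntegrable _ _)
      hf'.stronglyMeasurable.stronglyMeasurableAtFilter hf'.continuousAt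
  have hPc : Continuous P := continuous_iff_continuousAt.2 fun s => (hP s).continuousAt
  have hc := constant_of_has_deriv_right_zero (f := fun s => f s - P s) (a := t - 1) (b := t + 1)
    (hf.sub hPc).continuousOn (fun x _ => by
      have := (h x).sub (hP x).hasDerivWithinAt
      rw [sub_self] at this
      exact this)
  have he : f =ᶠ[𝓝 t] fun s => P s + (f (t - 1) - P (t - 1)) := by
    filter_upwards [Icc_mem_nhds (show t - 1 < t by linarith) (show t < t + 1 by linarith)] with s hs
    have := hc s hs
    linarith
  exact ((hP t).add_const _).congr_of_eventuallyEq he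

section HeatTime
variable {E : Type*} [NormedAddCommGroup E] [InnerProductSpace ℝ E] [FiniteDimensional ℝ E]
  [MeasurableSpace E] [BorelSpace E]

lemma integral_bilin_gauss {ι : Type*} [Fintype ι] (b : OrthonormalBasis ι ℝ E) (σ : E ≃L[ℝ] E)
    (H : BL E (BL E ℝ)) :
    ∫ y, H (σ y) (σ y) ∂(stdGaussian E) = ∑ i, H (σ (b i)) (σ (b i)) := by
  have e : ∀ y, H (σ y) (σ y) = ∑ i, ∑ j, (⟪b i, y⟫ * ⟪b j, y⟫) * H (σ (b i)) (σ (b j)) := by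
    intro y
    conv_lhs => rw [← b.sum_repr' y]
    simp only [map_sum, map_smul, sum_apply, smul_apply,
      smul_eq_mul, Finset.mul_sum]
    rw [Finset.sum_comm]
    refine Finset.sum_congr rfl fun i _ => Finset.sum_congr rfl fun j _ => ?_
    ring
  have hI : ∀ i j, Integrable (fun y : E => ⟪b i, y⟫ * ⟪b j, y⟫) (stdGaussian E) := by
    intro i j
    refine Integrable.mono' (integrable_pow_norm_gauss 2)
      (Continuous.aestronglyMeasurable (by fun_prop)) (Eventually.of_forall fun y => ?_)
    rw [norm_mul, sq]
    have h1 : ∀ i, ‖⟪b i, y⟫‖ ≤ ‖y‖ := fun i => by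
      have := norm_inner_le_norm (𝕜 := ℝ) (b i) y
      simpa using this
    exact mul_le_mul (h1 i) (h1 j) (norm_nonneg _) (norm_nonneg _)
  have hm : ∀ i j, ∫ y, ⟪b i, y⟫ * ⟪b j, y⟫ ∂(stdGaussian E) = ⟪b i, b j⟫ := by
    intro i j
    have h1 := covarianceBilin_apply (μ := stdGaussian E) IsGaussian.memLp_two_id (b i) (b j)
    rw [covarianceBilin_stdGaussian] at h1
    simpa using! h1.symm
  rw [integral_congr_ae (Eventually.of_forall e)]
  rw [integral_finsetSum _ fun i _ => integrable_finsetSum _ fun j _ => (hI i j).mul_const _]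
  refine Finset.sum_congr rfl fun i _ => ?_
  rw [integral_finsetSum _ fun j _ => (hI i j).mul_const _]
  simp_rw [integral_mul_const, hm]
  rw [Finset.sum_eq_single i]
  · simp
  · intro j _ hj
    rw [b.inner_eq_zero (Ne.symm hj), zero_mul]
  · simp

section
variable (σ : E ≃L[ℝ] E) {s : ℝ}
    (hs : ‖(σ : E →L[ℝ] E)‖ ≤ s) (hs2 : ‖(σ.symm : E →L[ℝ] E)‖ ≤ s)
    (hs1 : 1 ≤ s) {h : ℝ × E → ℝ} (hc : Continuous h) {A B α : ℝ}
    (hα : 0 < α) (hα1 : α < 1)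
    (hA : ∀ z, ‖h z‖ ≤ A) (hB0 : 0 ≤ B)
    (hB : ∀ t x y, ‖h (t, x) - h (t, y)‖ ≤ B * ‖x - y‖ ^ α)
include hs hs2 hs1 hc hα hα1 hA hB0 hB

lemma potW_semigroup (t : ℝ) (x : E) {δ : ℝ} (hδ : 0 < δ) :
    potW σ h (t + δ, x) = (∫ τ in Ioc 0 δ, Real.exp (-τ) * Sop σ (√τ) (fun x => h (t + δ - τ, x)) x)
      + Real.exp (-δ) * Sop σ (√δ) (fun x => potW σ h (t, x)) x := by
  have hA0 : 0 ≤ A := (norm_nonneg _).trans (hA 0)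
  have c1 := potW_integrand_cont σ hs hs2 hs1 hc hα hα1 hA hB0 hB
  have hi : ∀ z : ℝ × E, IntegrableOn (fun τ : ℝ =>
      Real.exp (-τ) * Sop σ (√τ) (fun x => h (z.1 - τ, x)) z.2) (Ioi 0) := fun z =>
    Integrable.mono' (integrableOn_gamma_weight one_pos A) (Continuous.aestronglyMeasurable
      (c1.comp (f := fun τ : ℝ => (τ, z)) (by fun_prop))) (Eventually.of_forall fun τ =>
      norm_potW_integrand σ hs hs2 hs1 hc hα hα1 hA hB0 hB z τ)
  have h1 : potW σ h (t + δ, x)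
      = (∫ τ in Ioc 0 δ, Real.exp (-τ) * Sop σ (√τ) (fun x => h (t + δ - τ, x)) x)
      + ∫ τ in Ioi δ, Real.exp (-τ) * Sop σ (√τ) (fun x => h (t + δ - τ, x)) x := by
    have hU : Ioi (0 : ℝ) = Ioc 0 δ ∪ Ioi δ := (Ioc_union_Ioi_eq_Ioi hδ.le).symm
    have h2 := hi (t + δ, x)
    rw [hU] at h2
    unfold potW
    rw [hU]
    exact setIntegral_union (Ioc_disjoint_Ioi_same) measurableSet_Ioi
      h2.left_of_union h2.right_of_union
  rw [h1]
  congr 1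
  have h2 : Sop σ (√δ) (fun x => potW σ h (t, x)) x =
      ∫ τ in Ioi (0:ℝ), Real.exp (-τ) * Sop σ (√(τ + δ)) (fun x => h (t - τ, x)) x := by
    have e : ∀ τ ∈ Ioi (0:ℝ), Real.exp (-τ) * Sop σ (√(τ + δ)) (fun x => h (t - τ, x)) x =
        ∫ y, Real.exp (-τ) * Sop σ (√τ) (fun x => h (t - τ, x)) (x + √δ • σ y) ∂(stdGaussian E) := by
      intro τ hτ
      have hτ' : 0 < τ := hτ
      rw [integral_const_mul, ← Sop_Sop σ (√δ) (√τ) (√(τ + δ)) (by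
        rw [Real.sq_sqrt hδ.le, Real.sq_sqrt hτ'.le, Real.sq_sqrt (by positivity)]; ring)
        (f := fun x => h (t - τ, x)) (by fun_prop) (fun x => hA _)]
      rfl
    rw [setIntegral_congr_fun measurableSet_Ioi e]
    unfold Sop potW
    rw [integral_integral_swap]
    · rfl
    · have b1 : Integrable (fun q : E × ℝ => (1:ℝ) * (A * (Real.exp (-q.2) * q.2 ^ ((1:ℝ) - 1))))
          ((stdGaussian E).prod (volume.restrict (Ioi 0))) :=
        (integrable_const (1:ℝ)).mul_prod (integrableOn_gamma_weight one_pos A)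
      refine b1.mono' (Continuous.aestronglyMeasurable ?_) (Eventually.of_forall fun q => ?_)
      · exact c1.comp (f := fun q : E × ℝ => (q.2, (t, x + √δ • σ q.1))) (by fun_prop)
      · rw [one_mul]
        exact norm_potW_integrand σ hs hs2 hs1 hc hα hα1 hA hB0 hB (t, x + √δ • σ q.1) q.2
  rw [h2, ← integral_const_mul, ← integral_indicator measurableSet_Ioi,
    ← integral_add_right_eq_self _ δ, ← integral_indicator measurableSet_Ioi]
  congr 1
  ext τ
  by_cases hτ : 0 < τ
  · rw [indicator_of_mem (show τ + δ ∈ Ioi δ by simpa using hτ), indicator_of_mem (by exact hτ),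
      neg_add, Real.exp_add]
    rw [show t + δ - (τ + δ) = t - τ by ring]
    ring
  · rw [indicator_of_notMem (show τ + δ ∉ Ioi δ by simpa using hτ), indicator_of_notMem (by exact hτ)]

lemma Sop_potW_expand {ι : Type*} [Fintype ι] (b : OrthonormalBasis ι ℝ E) :
    ∃ C : ℝ, 0 ≤ C ∧ ∀ (t : ℝ) (x : E) (δ : ℝ), 0 ≤ δ →
    |Sop σ (√δ) (fun x => potW σ h (t, x)) x - potW σ h (t, x)
      - δ * ((1/2) * ∑ i, potH σ h (t, x) (σ (b i)) (σ (b i)))| ≤ C * δ ^ (1 + α / 2) := by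
  set K := 8 * (s ^ 2 * mG E) ^ 3 * B * (2 / α + 2 / (1 - α)) with hK
  have hα1' : 0 < 1 - α := by linarith
  have hm0 : 0 ≤ mG E := zero_le_one.trans one_le_mG
  have hK0 : 0 ≤ K := by positivity
  refine ⟨K * s ^ 3 * mG E, by positivity, fun t x δ hδ => ?_⟩
  set w := fun x => potW σ h (t, x)
  set g := fun x => potG σ h (t, x)
  set H := fun x => potH σ h (t, x)
  have hw : ∀ x, HasFDerivAt w (g x) x :=
    fun x => hasFDerivAt_potW σ hs hs2 hs1 hc hα hα1 hA hB0 hB t x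
  have hg : ∀ x, HasFDerivAt g (H x) x :=
    fun x => hasFDerivAt_potG σ hs hs2 hs1 hc hα hα1 hA hB0 hB t x
  have hwc : Continuous w := continuous_iff_continuousAt.2 fun x => (hw x).continuousAt
  have T : ∀ v, |w (x + v) - w x - g x v - (1/2) * H x v v| ≤ K * ‖v‖ ^ α * ‖v‖ ^ 2 := by
    intro v
    apply fun_taylor (fun θ _ => hw _) (fun θ _ => hg _)
    intro θ hθ
    refine (norm_potH_sub_le σ hs hs2 hs1 hc hα hα1 hA hB0 hB t _ _).trans ?_
    rw [← hK]
    gcongr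
    rw [add_sub_cancel_left, norm_smul, Real.norm_of_nonneg hθ.1]
    exact mul_le_of_le_one_left (norm_nonneg _) hθ.2
  have i1 : Integrable (fun y => w (x + √δ • σ y)) (stdGaussian E) :=
    integrable_Sop σ (√δ) hwc (fun z => norm_potW_le σ hs hs2 hs1 hc hα hα1 hA hB0 hB (t, z)) x
  have i2 : Integrable (fun y => g x (√δ • σ y)) (stdGaussian E) := by
    have : Integrable (fun y : E => y) (stdGaussian E) := IsGaussian.integrable_id
    exact ((g x).comp (√δ • (σ : E →L[ℝ] E))).integrable_comp this
  have z2 : ∫ y, g x (√δ • σ y) ∂(stdGaussian E) = 0 := by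
    have : Integrable (fun y : E => y) (stdGaussian E) := IsGaussian.integrable_id
    have := ((g x).comp (√δ • (σ : E →L[ℝ] E))).integral_comp_comm this
    rw [integral_id_stdGaussian, map_zero] at this
    exact this
  have i3 : Integrable (fun y => H x (σ y) (σ y)) (stdGaussian E) := by
    refine Integrable.mono' ((integrable_pow_norm_gauss 2).const_mul (‖H x‖ * s ^ 2))
      (Continuous.aestronglyMeasurable (by fun_prop)) (Eventually.of_forall fun y => ?_)
    have h1 : ‖σ y‖ ≤ s * ‖y‖ := ((σ : E →L[ℝ] E).le_opNorm y).trans (by gcongr)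
    calc ‖H x (σ y) (σ y)‖ ≤ ‖H x‖ * ‖σ y‖ * ‖σ y‖ := (H x).le_opNorm₂ _ _
      _ ≤ ‖H x‖ * (s * ‖y‖) * (s * ‖y‖) := by gcongr
      _ = _ := by ring
  have key : Sop σ (√δ) w x - w x - δ * ((1/2) * ∑ i, H x (σ (b i)) (σ (b i)))
      = ∫ y, (w (x + √δ • σ y) - w x - g x (√δ • σ y) - (δ * (1/2)) * H x (σ y) (σ y))
        ∂(stdGaussian E) := by
    have i12 : Integrable (fun y => w (x + √δ • σ y) - w x) (stdGaussian E) :=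
      i1.sub (integrable_const _)
    have i123 : Integrable (fun y => w (x + √δ • σ y) - w x - g x (√δ • σ y)) (stdGaussian E) :=
      i12.sub i2
    rw [integral_sub i123 (i3.const_mul _),
      integral_sub i12 i2, integral_sub i1 (integrable_const _),
      z2, integral_const_mul, integral_bilin_gauss b σ (H x)]
    simp [Sop]
    ring
  rw [key, ← Real.norm_eq_abs]
  refine (norm_integral_le_of_norm_le (integrable_mG.const_mul (K * s ^ 3 * δ ^ (1 + α / 2)))
    (Eventually.of_forall fun y => ?_)).trans (le_of_eq ?_)
  · have h1 : (δ * (1/2)) * H x (σ y) (σ y) = (1/2) * H x (√δ • σ y) (√δ • σ y) := by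
      simp only [map_smul, smul_apply, smul_eq_mul]
      rw [← mul_assoc (√δ), Real.mul_self_sqrt hδ]; ring
    rw [h1, Real.norm_eq_abs]
    refine (T _).trans ?_
    have hy := norm_nonneg y
    have h2 : ‖√δ • σ y‖ ≤ √δ * (s * (1 + ‖y‖)) := by
      rw [norm_smul, Real.norm_of_nonneg (Real.sqrt_nonneg _)]
      gcongr
      calc ‖σ y‖ ≤ ‖(σ : E →L[ℝ] E)‖ * ‖y‖ := (σ : E →L[ℝ] E).le_opNorm y
        _ ≤ s * (1 + ‖y‖) := by gcongr; linarith
    have h3 : (s * (1 + ‖y‖)) ^ α ≤ s * (1 + ‖y‖) := by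
      calc (s * (1 + ‖y‖)) ^ α ≤ (s * (1 + ‖y‖)) ^ (1:ℝ) :=
            Real.rpow_le_rpow_of_exponent_le (by nlinarith) hα1.le
        _ = _ := Real.rpow_one _
    calc K * ‖√δ • σ y‖ ^ α * ‖√δ • σ y‖ ^ 2
        ≤ K * (√δ * (s * (1 + ‖y‖))) ^ α * (√δ * (s * (1 + ‖y‖))) ^ 2 := by gcongr
      _ = K * (√δ ^ α * (s * (1 + ‖y‖)) ^ α) * (√δ ^ 2 * (s * (1 + ‖y‖)) ^ 2) := by
          rw [Real.mul_rpow (by positivity) (by positivity), mul_pow]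
      _ ≤ K * (√δ ^ α * (s * (1 + ‖y‖))) * (√δ ^ 2 * (s * (1 + ‖y‖)) ^ 2) := by gcongr
      _ = K * s ^ 3 * (√δ ^ 2 * √δ ^ α) * (1 + ‖y‖) ^ 3 := by ring
      _ = _ := by
        congr 2
        rw [Real.sq_sqrt hδ, Real.sqrt_eq_rpow, ← Real.rpow_mul hδ,
          Real.rpow_add_of_nonneg hδ (by norm_num) (by positivity), Real.rpow_one]
        congr 2; ring
  · rw [integral_const_mul, mG]; ring

lemma hasDerivAt_potW {ι : Type*} [Fintype ι] (b : OrthonormalBasis ι ℝ E) (t : ℝ) (x : E) :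
    HasDerivAt (fun t => potW σ h (t, x))
      ((1/2) * ∑ i, potH σ h (t, x) (σ (b i)) (σ (b i)) - potW σ h (t, x) + h (t, x)) t := by
  have hcw := continuous_potW σ hs hs2 hs1 hc hα hα1 hA hB0 hB
  have hcH := continuous_potH σ hs hs2 hs1 hc hα hα1 hA hB0 hB
  have c1 := potW_integrand_cont σ hs hs2 hs1 hc hα hα1 hA hB0 hB
  apply hasDerivAt_of_right (f := fun t => potW σ h (t, x))
    (f' := fun t => (1/2) * ∑ i, potH σ h (t, x) (σ (b i)) (σ (b i)) - potW σ h (t, x) + h (t, x))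
  · fun_prop
  · refine ((continuous_const.mul (continuous_finsetSum _ fun i _ => ?_)).sub (by fun_prop)).add
      (by fun_prop)
    have : Continuous fun t : ℝ => potH σ h (t, x) := by fun_prop
    exact (this.clm_apply continuous_const).clm_apply continuous_const
  intro t
  obtain ⟨C, hC0, hC⟩ := Sop_potW_expand σ hs hs2 hs1 hc hα hα1 hA hB0 hB b
  set L := (1/2) * ∑ i, potH σ h (t, x) (σ (b i)) (σ (b i)) with hL
  set W := potW σ h (t, x) with hW
  rw [hasDerivWithinAt_iff_isLittleO, Asymptotics.isLittleO_iff]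
  intro ε hε
  have hΦ : Continuous fun q : ℝ × ℝ =>
      Real.exp (-q.2) * Sop σ (√q.2) (fun x => h (t + q.1 - q.2, x)) x :=
    c1.comp (f := fun q : ℝ × ℝ => (q.2, (t + q.1, x))) (by fun_prop)
  have hΦ0 : Real.exp (-(0:ℝ)) * Sop σ (√(0:ℝ)) (fun x => h (t + 0 - 0, x)) x = h (t, x) := by
    simp [Sop]
  obtain ⟨η, hη, hΦη⟩ := Metric.continuousAt_iff.1 (hΦ.continuousAt (x := (0, 0))) (ε / 2)
    (by positivity)
  have htend : Tendsto (fun δ : ℝ => C * δ ^ (α / 2) + δ * |L| + δ * |W|) (𝓝 0) (𝓝 0) := by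
    have h1 : ContinuousAt (fun δ : ℝ => C * δ ^ (α / 2) + δ * |L| + δ * |W|) 0 := by
      have : ContinuousAt (fun δ : ℝ => δ ^ (α / 2)) 0 :=
        Real.continuousAt_rpow_const _ _ (Or.inr (by positivity))
      fun_prop
    have h2 := h1.tendsto
    simpa [Real.zero_rpow (show α / 2 ≠ 0 by positivity)] using h2
  obtain ⟨η', hη', hsm⟩ := Metric.eventually_nhds_iff.1
    (htend.eventually (gt_mem_nhds (half_pos hε)))
  have hmem : Ico t (t + min (min η η') 1) ∈ 𝓝[Ici t] t :=
    Ico_mem_nhdsGE (by have : 0 < min (min η η') 1 := by positivity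
                       linarith)
  filter_upwards [hmem] with t' ht'
  rcases eq_or_lt_of_le ht'.1 with heq | hlt
  · rw [← heq]; simp
  set δ := t' - t with hδdef
  have hδ : 0 < δ := by rw [hδdef]; linarith
  have hδlt : δ < min (min η η') 1 := by rw [hδdef]; linarith [ht'.2]
  have hδη : δ < η := hδlt.trans_le ((min_le_left _ _).trans (min_le_left _ _))
  have hδη' : δ < η' := hδlt.trans_le ((min_le_left _ _).trans (min_le_right _ _))
  have hδ1 : δ < 1 := hδlt.trans_le (min_le_right _ _)
  have htt : t' = t + δ := by rw [hδdef]; ring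
  rw [htt, potW_semigroup σ hs hs2 hs1 hc hα hα1 hA hB0 hB t x hδ]
  set I := ∫ τ in Ioc 0 δ, Real.exp (-τ) * Sop σ (√τ) (fun x => h (t + δ - τ, x)) x with hI
  set S := Sop σ (√δ) (fun x => potW σ h (t, x)) x with hS
  have b1 : |I - δ * h (t, x)| ≤ ε / 2 * δ := by
    have e1 : δ * h (t, x) = ∫ _τ in Ioc 0 δ, h (t, x) := by
      simp [hδ.le]
    rw [e1, hI, ← integral_sub]
    · have := norm_setIntegral_le_of_norm_le_const (μ := volume) (s := Ioc 0 δ)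
        (f := fun τ => Real.exp (-τ) * Sop σ (√τ) (fun x => h (t + δ - τ, x)) x - h (t, x))
        (C := ε / 2) (by simp) (fun τ hτ => by
          have h3 := hΦη (x := (δ, τ)) (by
            rw [Prod.dist_eq]
            simp only [Real.dist_eq, sub_zero]
            rw [abs_of_pos hδ, abs_of_pos hτ.1]
            exact max_lt hδη (hτ.2.trans_lt hδη))
          rw [dist_eq_norm] at h3
          simp only [hΦ0] at h3
          exact h3.le)
      simpa [hδ.le] using! this
    · exact (Continuous.integrableOn_Icc (by
        exact hΦ.comp (f := fun τ : ℝ => (δ, τ)) (by fun_prop))).mono_set Ioc_subset_Icc_self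
    · simp
  have b2 : |S - W - δ * L| ≤ C * δ ^ (1 + α / 2) := hC t x δ hδ.le
  have b2' : C * δ ^ (1 + α / 2) = (C * δ ^ (α / 2)) * δ := by
    rw [Real.rpow_add hδ, Real.rpow_one]; ring
  have x1 : Real.exp (-δ) ≤ 1 := by rw [Real.exp_le_one_iff]; linarith
  have x2 : 0 < Real.exp (-δ) := Real.exp_pos _
  have x3 : 1 - δ ≤ Real.exp (-δ) := by linarith [Real.add_one_le_exp (-δ)]
  have x4 : Real.exp (-δ) ≤ 1 - δ + δ ^ 2 := by
    have := Real.abs_exp_sub_one_sub_id_le (x := -δ) (by rw [abs_neg, abs_of_pos hδ]; exact hδ1.le)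
    have := (abs_le.1 this).2
    nlinarith
  have hsm' := hsm (y := δ) (by rw [Real.dist_eq, sub_zero, abs_of_pos hδ]; exact hδη')
  have e2 : I + Real.exp (-δ) * S - W - δ • (L - W + h (t, x))
      = (I - δ * h (t, x)) + Real.exp (-δ) * (S - W - δ * L) + (Real.exp (-δ) - 1) * (δ * L)
        + (Real.exp (-δ) - 1 + δ) * W := by
    rw [smul_eq_mul]; ring
  change ‖I + Real.exp (-δ) * S - W - δ • (L - W + h (t, x))‖ ≤ ε * ‖δ‖
  rw [e2, Real.norm_eq_abs, Real.norm_of_nonneg hδ.le]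
  have a1 : |Real.exp (-δ) * (S - W - δ * L)| ≤ (C * δ ^ (α / 2)) * δ := by
    rw [abs_mul, abs_of_pos x2, ← b2']
    exact (mul_le_of_le_one_left (abs_nonneg _) x1).trans b2
  have a2 : |(Real.exp (-δ) - 1) * (δ * L)| ≤ δ * |L| * δ := by
    rw [abs_mul, abs_mul, abs_of_pos hδ]
    have : |Real.exp (-δ) - 1| ≤ δ := by rw [abs_le]; constructor <;> linarith
    calc _ ≤ δ * (δ * |L|) := by gcongr
      _ = _ := by ring
  have a3 : |(Real.exp (-δ) - 1 + δ) * W| ≤ δ * |W| * δ := by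
    rw [abs_mul]
    have : |Real.exp (-δ) - 1 + δ| ≤ δ ^ 2 := by rw [abs_le]; constructor <;> nlinarith
    calc _ ≤ δ ^ 2 * |W| := by gcongr
      _ = _ := by ring
  calc _ ≤ |I - δ * h (t, x)| + |Real.exp (-δ) * (S - W - δ * L)| + |(Real.exp (-δ) - 1) * (δ * L)|
        + |(Real.exp (-δ) - 1 + δ) * W| := by
        refine (abs_add_le _ _).trans ?_
        gcongr
        refine (abs_add_le _ _).trans ?_
        gcongr
        exact abs_add_le _ _
    _ ≤ ε / 2 * δ + (C * δ ^ (α / 2)) * δ + δ * |L| * δ + δ * |W| * δ := by gcongr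
    _ = ε / 2 * δ + (C * δ ^ (α / 2) + δ * |L| + δ * |W|) * δ := by ring
    _ ≤ ε / 2 * δ + ε / 2 * δ := by gcongr
    _ = ε * δ := by ring

end
end HeatTime

section Holder

/-- `f` is bounded by `A` on `S` and has modulus `B * ϱ` there. -/
structure Hol {Z V : Type*} [NormedAddCommGroup V] (ϱ : Z → Z → ℝ) (A B : ℝ) (S : Set Z)
    (f : Z → V) : Prop where
  bd : ∀ z ∈ S, ‖f z‖ ≤ A
  ho : ∀ z ∈ S, ∀ z' ∈ S, ‖f z - f z'‖ ≤ B * ϱ z z'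

namespace Hol
variable {Z U V W : Type*} [NormedAddCommGroup U] [NormedAddCommGroup V] [NormedAddCommGroup W]
  {ϱ : Z → Z → ℝ} {A B A' B' : ℝ} {S S' : Set Z}

lemma mono {f : Z → V} (hf : Hol ϱ A B S f) (hϱ : ∀ z z', 0 ≤ ϱ z z') (hA : A ≤ A')
    (hB : B ≤ B') : Hol ϱ A' B' S f :=
  ⟨fun z hz => (hf.bd z hz).trans hA, fun z hz z' hz' => (hf.ho z hz z' hz').trans
    (mul_le_mul_of_nonneg_right hB (hϱ _ _))⟩

lemma subset {f : Z → V} (hf : Hol ϱ A B S f) (h : S' ⊆ S) : Hol ϱ A B S' f :=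
  ⟨fun z hz => hf.bd z (h hz), fun z hz z' hz' => hf.ho z (h hz) z' (h hz')⟩

lemma congr {f g : Z → V} (hf : Hol ϱ A B S f) (h : ∀ z ∈ S, f z = g z) : Hol ϱ A B S g :=
  ⟨fun z hz => by rw [← h z hz]; exact hf.bd z hz, fun z hz z' hz' => by
    rw [← h z hz, ← h z' hz']; exact hf.ho z hz z' hz'⟩

lemma add {f g : Z → V} (hf : Hol ϱ A B S f) (hg : Hol ϱ A' B' S g) :
    Hol ϱ (A + A') (B + B') S (fun z => f z + g z) :=
  ⟨fun z hz => (norm_add_le _ _).trans (add_le_add (hf.bd z hz) (hg.bd z hz)),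
    fun z hz z' hz' => by
      rw [add_sub_add_comm, add_mul]
      exact (norm_add_le _ _).trans (add_le_add (hf.ho z hz z' hz') (hg.ho z hz z' hz'))⟩

lemma neg {f : Z → V} (hf : Hol ϱ A B S f) : Hol ϱ A B S (fun z => -f z) :=
  ⟨fun z hz => by rw [norm_neg]; exact hf.bd z hz, fun z hz z' hz' => by
    rw [neg_sub_neg, norm_sub_rev]; exact hf.ho z hz z' hz'⟩

lemma sub {f g : Z → V} (hf : Hol ϱ A B S f) (hg : Hol ϱ A' B' S g) :
    Hol ϱ (A + A') (B + B') S (fun z => f z - g z) := by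
  simpa only [sub_eq_add_neg] using hf.add hg.neg

lemma const (c : V) : Hol ϱ ‖c‖ 0 S (fun _ => c) :=
  ⟨fun _ _ => le_rfl, fun z _ z' _ => by simp⟩

lemma bilin {T : U → V → W} {C : ℝ} (h1 : ∀ u u' v, T u v - T u' v = T (u - u') v)
    (h2 : ∀ u v v', T u v - T u v' = T u (v - v')) (hT : ∀ u v, ‖T u v‖ ≤ C * ‖u‖ * ‖v‖)
    (hC : 0 ≤ C) {f : Z → U} {g : Z → V} (hf : Hol ϱ A B S f) (hg : Hol ϱ A' B' S g) :
    Hol ϱ (C * A * A') (C * (A * B' + B * A')) S (fun z => T (f z) (g z)) := by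
  constructor
  · intro z hz
    have a1 := hf.bd z hz
    have a2 := hg.bd z hz
    have a3 := (norm_nonneg _).trans a1
    exact (hT _ _).trans (by gcongr)
  · intro z hz z' hz'
    have a1 := hf.bd z hz
    have a2 := hg.bd z' hz'
    have a3 := (norm_nonneg _).trans a1
    have a4 := hf.ho z hz z' hz'
    have a5 := hg.ho z hz z' hz'
    have a6 := (norm_nonneg _).trans a4
    calc ‖T (f z) (g z) - T (f z') (g z')‖
        = ‖T (f z) (g z - g z') + T (f z - f z') (g z')‖ := by
          rw [← h1, ← h2]; congr 1; abel
      _ ≤ C * ‖f z‖ * ‖g z - g z'‖ + C * ‖f z - f z'‖ * ‖g z'‖ :=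
          (norm_add_le _ _).trans (add_le_add (hT _ _) (hT _ _))
      _ ≤ C * A * (B' * ϱ z z') + C * (B * ϱ z z') * A' := by gcongr
      _ = _ := by ring

lemma bilin_cut {T : U → V → W} {C : ℝ} (h1 : ∀ u u' v, T u v - T u' v = T (u - u') v)
    (h2 : ∀ u v v', T u v - T u v' = T u (v - v')) (hT : ∀ u v, ‖T u v‖ ≤ C * ‖u‖ * ‖v‖)
    (hC : 0 ≤ C) {f : Z → U} {g : Z → V} (hϱ : ∀ z z', 0 ≤ ϱ z z')
    (hf : Hol ϱ A B univ f) (hf0 : ∀ z ∉ S, f z = 0)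
    (hg : Hol ϱ A' B' S g) (hA : 0 ≤ A) (hB : 0 ≤ B) (hA' : 0 ≤ A') (hB' : 0 ≤ B') :
    Hol ϱ (C * A * A') (C * (A * B' + B * A')) univ (fun z => T (f z) (g z)) := by
  have hS := bilin h1 h2 hT hC (hf.subset (subset_univ S)) hg
  have hz0 : ∀ v, T 0 v = 0 := fun v => by simpa using (h1 0 0 v).symm
  have key : ∀ z ∈ S, ∀ z' ∉ S, ‖T (f z) (g z)‖ ≤ (C * (A * B' + B * A')) * ϱ z z' ∧
      ‖T (f z) (g z)‖ ≤ (C * (A * B' + B * A')) * ϱ z' z := by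
    intro z hz z' hz'
    have a2 := hg.bd z hz
    have a3 := hϱ z z'
    have a3' := hϱ z' z
    constructor
    · have a4 := hf.ho z (mem_univ _) z' (mem_univ _)
      rw [hf0 z' hz', sub_zero] at a4
      calc _ ≤ C * ‖f z‖ * ‖g z‖ := hT _ _
        _ ≤ C * (B * ϱ z z') * A' := by gcongr
        _ ≤ C * (A * B' * ϱ z z') + C * (B * ϱ z z') * A' := le_add_of_nonneg_left (by positivity)
        _ = _ := by ring
    · have a4 := hf.ho z' (mem_univ _) z (mem_univ _)
      rw [hf0 z' hz', zero_sub, norm_neg] at a4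
      calc _ ≤ C * ‖f z‖ * ‖g z‖ := hT _ _
        _ ≤ C * (B * ϱ z' z) * A' := by gcongr
        _ ≤ C * (A * B' * ϱ z' z) + C * (B * ϱ z' z) * A' := le_add_of_nonneg_left (by positivity)
        _ = _ := by ring
  constructor
  · intro z _
    by_cases hz : z ∈ S
    · exact hS.bd z hz
    · rw [hf0 z hz, hz0, norm_zero]; positivity
  · intro z _ z' _
    by_cases hz : z ∈ S <;> by_cases hz' : z' ∈ S
    · exact hS.ho z hz z' hz'
    · rw [hf0 z' hz', hz0, sub_zero]
      exact (key z hz z' hz').1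
    · rw [hf0 z hz, hz0, zero_sub, norm_neg]
      exact (key z' hz' z hz).2
    · rw [hf0 z hz, hf0 z' hz', hz0, hz0, sub_zero, norm_zero]
      have := hϱ z z'
      positivity

end Hol

/-- Parabolic-type Hölder modulus on `ℝ × E`. -/
noncomputable def rho {E : Type*} [NormedAddCommGroup E] (α : ℝ) (z z' : ℝ × E) : ℝ :=
  ‖z.2 - z'.2‖ ^ α + |z.1 - z'.1| ^ (α / 3)

/-- Spatial Hölder modulus. -/
noncomputable def sho {E : Type*} [NormedAddCommGroup E] (α : ℝ) (x y : E) : ℝ := ‖x - y‖ ^ α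

variable {E V : Type*} [NormedAddCommGroup E] [NormedAddCommGroup V]

lemma rho_nonneg (α : ℝ) (z z' : ℝ × E) : 0 ≤ rho α z z' := by unfold rho; positivity
lemma sho_nonneg (α : ℝ) (z z' : E) : 0 ≤ sho α z z' := by unfold sho; positivity

lemma rho_space {α : ℝ} (hα : 0 < α) (t : ℝ) (x y : E) : rho α (t, x) (t, y) = sho α x y := by
  have : α / 3 ≠ 0 := by positivity
  simp [rho, sho, Real.zero_rpow this]

/-- `Hol` for the modulus `rho`, with a single constant. -/
abbrev XH (α A : ℝ) (S : Set (ℝ × E)) (f : ℝ × E → V) : Prop := Hol (rho α) A A S f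

lemma Hol.slice {α A B : ℝ} (hα : 0 < α) {S : Set (ℝ × E)} {f : ℝ × E → V}
    (hf : Hol (rho α) A B S f) (t : ℝ) : Hol (sho α) A B {x | (t, x) ∈ S} (fun x => f (t, x)) :=
  ⟨fun x hx => hf.bd _ hx, fun x hx y hy => by
    have := hf.ho _ hx _ hy
    rwa [rho_space hα] at this⟩

lemma tendsto_rho {α : ℝ} (hα : 0 < α) (z : ℝ × E) :
    Tendsto (fun z' => rho α z' z) (𝓝 z) (𝓝 0) := by
  have h1 : Continuous fun z' : ℝ × E => rho α z' z := by
    unfold rho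
    refine Continuous.add ?_ ?_
    · exact Continuous.rpow_const (by fun_prop) fun _ => Or.inr hα.le
    · exact Continuous.rpow_const (by fun_prop) fun _ => Or.inr (by positivity)
  have h2 := h1.tendsto z
  have : α / 3 ≠ 0 := by positivity
  simpa [rho, Real.zero_rpow hα.ne', Real.zero_rpow this] using h2

lemma Hol.continuousOn {α A B : ℝ} (hα : 0 < α) {S : Set (ℝ × E)} {f : ℝ × E → V}
    (hf : Hol (rho α) A B S f) : ContinuousOn f S := by
  intro z hz
  rw [ContinuousWithinAt, tendsto_iff_norm_sub_tendsto_zero]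
  refine squeeze_zero' (Eventually.of_forall fun _ => norm_nonneg _)
    (eventually_nhdsWithin_of_forall fun z' hz' => hf.ho z' hz' z hz) ?_
  have := ((tendsto_rho hα z).const_mul B).mono_left (nhdsWithin_le_nhds (s := S))
  simpa using this

lemma Hol.continuous {α A B : ℝ} (hα : 0 < α) {f : ℝ × E → V}
    (hf : Hol (rho α) A B univ f) : Continuous f :=
  continuousOn_univ.1 (hf.continuousOn hα)

/-- If `f` varies by at most `B * dist` then it is Hölder on sets of diameter at most one, and
globally if in addition it is bounded. -/
lemma le_rho_of_lip {α D : ℝ} (hα : 0 < α) (hα1 : α < 1) {z z' : ℝ × E} {c : ℝ} (hD : 0 ≤ D)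
    (h1 : c ≤ D * dist z z') (h2 : c ≤ D) : c ≤ D * rho α z z' := by
  rcases le_total 1 (dist z z') with h | h
  · refine h2.trans ?_
    have : 1 ≤ rho α z z' := by
      rw [Prod.dist_eq] at h
      rcases le_max_iff.1 h with h | h
      · rw [Real.dist_eq] at h
        have := Real.one_le_rpow h (show 0 ≤ α / 3 by positivity)
        unfold rho
        have : 0 ≤ ‖z.2 - z'.2‖ ^ α := by positivity
        linarith
      · rw [dist_eq_norm] at h
        have := Real.one_le_rpow h hα.le
        unfold rho
        have : 0 ≤ |z.1 - z'.1| ^ (α / 3) := by positivity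
        linarith
    nlinarith
  · refine h1.trans (mul_le_mul_of_nonneg_left ?_ hD)
    rw [Prod.dist_eq] at h ⊢
    have ha : ∀ {r β : ℝ}, 0 ≤ r → r ≤ 1 → 0 < β → β ≤ 1 → r ≤ r ^ β := by
      intro r β h0 h1 hb hb1
      rcases h0.eq_or_lt with h0 | h0
      · rw [← h0]; exact Real.rpow_nonneg le_rfl _
      · calc r = r ^ (1:ℝ) := (Real.rpow_one r).symm
          _ ≤ r ^ β := Real.rpow_le_rpow_of_exponent_ge h0 h1 hb1
    have b1 := ha (abs_nonneg (z.1 - z'.1)) ((Real.dist_eq _ _ ▸ le_max_left _ _ :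
      |z.1 - z'.1| ≤ max (dist z.1 z'.1) (dist z.2 z'.2)).trans h) (show 0 < α / 3 by positivity)
      (by linarith)
    have b2 := ha (norm_nonneg (z.2 - z'.2)) ((dist_eq_norm z.2 z'.2 ▸ le_max_right _ _ :
      ‖z.2 - z'.2‖ ≤ max (dist z.1 z'.1) (dist z.2 z'.2)).trans h) hα hα1.le
    unfold rho
    refine max_le ?_ ?_
    · rw [Real.dist_eq]
      have : 0 ≤ ‖z.2 - z'.2‖ ^ α := by positivity
      linarith
    · rw [dist_eq_norm]
      have : 0 ≤ |z.1 - z'.1| ^ (α / 3) := by positivity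
      linarith

end Holder

section RegDef
variable {E : Type*} [NormedAddCommGroup E] [InnerProductSpace ℝ E]

/-- `w` has spatial gradient `g`, spatial Hessian `H`, time derivative `p` on `S`, all of them
bounded and Hölder with constant `A`. -/
structure Reg (α A : ℝ) (S : Set (ℝ × E)) (w : ℝ × E → ℝ) (g : ℝ × E → BL E ℝ)
    (H : ℝ × E → BL E (BL E ℝ)) (p : ℝ × E → ℝ) : Prop where
  dw : ∀ z ∈ S, HasFDerivAt (fun x => w (z.1, x)) (g z) z.2
  dg : ∀ z ∈ S, HasFDerivAt (fun x => g (z.1, x)) (H z) z.2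
  dt : ∀ z ∈ S, HasDerivAt (fun t => w (t, z.2)) (p z) z.1
  xw : XH α A S w
  xg : XH α A S g
  xH : XH α A S H
  xp : XH α A S p

namespace Reg
variable {α A A' : ℝ} {S S' : Set (ℝ × E)} {w w' : ℝ × E → ℝ} {g g' : ℝ × E → BL E ℝ}
    {H H' : ℝ × E → BL E (BL E ℝ)} {p p' : ℝ × E → ℝ}

lemma mono (h : Reg α A S w g H p) (hA : A ≤ A') : Reg α A' S w g H p :=
  ⟨h.dw, h.dg, h.dt, h.xw.mono (rho_nonneg α) hA hA, h.xg.mono (rho_nonneg α) hA hA,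
    h.xH.mono (rho_nonneg α) hA hA, h.xp.mono (rho_nonneg α) hA hA⟩

lemma subset (h : Reg α A S w g H p) (hS : S' ⊆ S) : Reg α A S' w g H p :=
  ⟨fun z hz => h.dw z (hS hz), fun z hz => h.dg z (hS hz), fun z hz => h.dt z (hS hz),
    h.xw.subset hS, h.xg.subset hS, h.xH.subset hS, h.xp.subset hS⟩

lemma add (h : Reg α A S w g H p) (h' : Reg α A' S w' g' H' p') :
    Reg α (A + A') S (fun z => w z + w' z) (fun z => g z + g' z) (fun z => H z + H' z)
      (fun z => p z + p' z) :=
  ⟨fun z hz => (h.dw z hz).add (h'.dw z hz), fun z hz => (h.dg z hz).add (h'.dg z hz),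
    fun z hz => (h.dt z hz).add (h'.dt z hz), h.xw.add h'.xw, h.xg.add h'.xg, h.xH.add h'.xH,
    h.xp.add h'.xp⟩

end Reg
end RegDef

section Coeff
variable {d : ℕ}

/-- `d`-dimensional Euclidean space. -/
abbrev Es (d : ℕ) := EuclideanSpace ℝ (Fin d)

/-- The standard basis vectors. -/
noncomputable abbrev eb (i : Fin d) : Es d := EuclideanSpace.single i 1

/-- Second-order part of the operator with coefficient matrix `m`. -/
noncomputable def trc (m : Fin d → Fin d → ℝ) (H : BL (Es d) (BL (Es d) ℝ)) : ℝ :=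
  (1 / 2) * ∑ i, ∑ j, m i j * H (eb i) (eb j)

/-- First-order part of the operator with drift `b`. -/
noncomputable def drf (b : Fin d → ℝ) (g : BL (Es d) ℝ) : ℝ := ∑ i, b i * g (eb i)

lemma norm_eb (i : Fin d) : ‖(eb i : Es d)‖ = 1 := by simp

lemma norm_trc_le (m : Fin d → Fin d → ℝ) (H : BL (Es d) (BL (Es d) ℝ)) :
    ‖trc m H‖ ≤ (d : ℝ) ^ 2 * ‖m‖ * ‖H‖ := by
  have h1 : ∀ i j, ‖m i j * H (eb i) (eb j)‖ ≤ ‖m‖ * ‖H‖ := fun i j => by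
    rw [norm_mul]
    have a1 : ‖m i j‖ ≤ ‖m‖ := (norm_le_pi_norm (m i) j).trans (norm_le_pi_norm m i)
    have a2 := H.le_opNorm₂ (eb i) (eb j)
    rw [norm_eb, norm_eb, mul_one, mul_one] at a2
    gcongr
  unfold trc
  rw [norm_mul]
  have h2 : ‖∑ i, ∑ j, m i j * H (eb i) (eb j)‖ ≤ (d : ℝ) ^ 2 * ‖m‖ * ‖H‖ := by
    refine (norm_sum_le_of_le _ fun i _ => norm_sum_le_of_le _ fun j _ => h1 i j).trans ?_
    simp only [Finset.sum_const, Finset.card_univ, Fintype.card_fin, nsmul_eq_mul]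
    apply le_of_eq; ring
  have : ‖(1/2 : ℝ)‖ ≤ 1 := by norm_num
  calc _ ≤ 1 * ((d : ℝ) ^ 2 * ‖m‖ * ‖H‖) := by gcongr
    _ = _ := by ring

lemma norm_drf_le (b : Fin d → ℝ) (g : BL (Es d) ℝ) : ‖drf b g‖ ≤ (d : ℝ) * ‖b‖ * ‖g‖ := by
  have h1 : ∀ i, ‖b i * g (eb i)‖ ≤ ‖b‖ * ‖g‖ := fun i => by
    rw [norm_mul]
    have a2 := g.le_opNorm (eb i)
    rw [norm_eb, mul_one] at a2
    have := norm_le_pi_norm b i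
    gcongr
  refine (norm_sum_le_of_le _ fun i _ => h1 i).trans ?_
  simp only [Finset.sum_const, Finset.card_univ, Fintype.card_fin, nsmul_eq_mul]
  apply le_of_eq; ring

lemma trc_sub_left (m m' : Fin d → Fin d → ℝ) (H : BL (Es d) (BL (Es d) ℝ)) :
    trc m H - trc m' H = trc (m - m') H := by
  simp only [trc, ← mul_sub, ← Finset.sum_sub_distrib, Pi.sub_apply, sub_mul]

lemma trc_sub_right (m : Fin d → Fin d → ℝ) (H H' : BL (Es d) (BL (Es d) ℝ)) :
    trc m H - trc m H' = trc m (H - H') := by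
  simp only [trc, ← mul_sub, ← Finset.sum_sub_distrib, sub_apply]

lemma trc_add_right (m : Fin d → Fin d → ℝ) (H H' : BL (Es d) (BL (Es d) ℝ)) :
    trc m (H + H') = trc m H + trc m H' := by
  simp only [trc, ← mul_add, ← Finset.sum_add_distrib, add_apply]

lemma trc_neg_right (m : Fin d → Fin d → ℝ) (H : BL (Es d) (BL (Es d) ℝ)) :
    trc m (-H) = -trc m H := by
  simp [trc, neg_apply]

lemma trc_smul_right (m : Fin d → Fin d → ℝ) (c : ℝ) (H : BL (Es d) (BL (Es d) ℝ)) :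
    trc m (c • H) = c * trc m H := by
  simp only [trc, smul_apply, smul_eq_mul, Finset.mul_sum]
  refine Finset.sum_congr rfl fun i _ => Finset.sum_congr rfl fun j _ => by ring

lemma drf_sub_left (b b' : Fin d → ℝ) (g : BL (Es d) ℝ) : drf b g - drf b' g = drf (b - b') g := by
  simp only [drf, ← Finset.sum_sub_distrib, Pi.sub_apply, sub_mul]

lemma drf_sub_right (b : Fin d → ℝ) (g g' : BL (Es d) ℝ) :
    drf b g - drf b g' = drf b (g - g') := by
  simp only [drf, ← mul_sub, ← Finset.sum_sub_distrib, sub_apply]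

lemma drf_add_right (b : Fin d → ℝ) (g g' : BL (Es d) ℝ) :
    drf b (g + g') = drf b g + drf b g' := by
  simp only [drf, ← mul_add, ← Finset.sum_add_distrib, add_apply]

lemma drf_neg_right (b : Fin d → ℝ) (g : BL (Es d) ℝ) : drf b (-g) = -drf b g := by
  simp [drf, neg_apply]

lemma drf_smul_right (b : Fin d → ℝ) (c : ℝ) (g : BL (Es d) ℝ) : drf b (c • g) = c * drf b g := by
  simp only [drf, smul_apply, smul_eq_mul, Finset.mul_sum]
  refine Finset.sum_congr rfl fun i _ => by ring

end Coeff

section Factor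
variable {d : ℕ}

/-- The operator which is diagonal in the orthonormal basis `u`, with entries `r`. -/
noncomputable def diagOp (u : OrthonormalBasis (Fin d) ℝ (Es d)) (r : Fin d → ℝ) :
    Es d →L[ℝ] Es d :=
  ∑ k, (r k • innerSL ℝ (u k)).smulRight (u k)

lemma diagOp_apply (u : OrthonormalBasis (Fin d) ℝ (Es d)) (r : Fin d → ℝ) (y : Es d) :
    diagOp u r y = ∑ k, (r k * ⟪u k, y⟫) • u k := by
  simp [diagOp, sum_apply, smul_apply]

lemma diagOp_basis (u : OrthonormalBasis (Fin d) ℝ (Es d)) (r : Fin d → ℝ) (k : Fin d) :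
    diagOp u r (u k) = r k • u k := by
  rw [diagOp_apply, Finset.sum_eq_single k]
  · simp
  · intro j _ hj
    rw [u.inner_eq_zero hj]; simp
  · simp

lemma diagOp_diagOp (u : OrthonormalBasis (Fin d) ℝ (Es d)) {r r' : Fin d → ℝ}
    (h : ∀ k, r k * r' k = 1) (y : Es d) : diagOp u r (diagOp u r' y) = y := by
  rw [diagOp_apply u r' y, map_sum]
  conv_rhs => rw [← u.sum_repr' y]
  refine Finset.sum_congr rfl fun k _ => ?_
  rw [map_smul, diagOp_basis, smul_smul]
  congr 1
  linear_combination ⟪u k, y⟫ * h k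

lemma norm_diagOp_le (u : OrthonormalBasis (Fin d) ℝ (Es d)) {r : Fin d → ℝ} {c : ℝ}
    (hc : 0 ≤ c) (h : ∀ k, |r k| ≤ c) : ‖diagOp u r‖ ≤ d * c := by
  refine ContinuousLinearMap.opNorm_le_bound _ (by positivity) fun y => ?_
  rw [diagOp_apply]
  have : ∀ k, ‖(r k * ⟪u k, y⟫) • u k‖ ≤ c * ‖y‖ := fun k => by
    rw [norm_smul, norm_mul, u.norm_eq_one, mul_one]
    have h2 := norm_inner_le_norm (𝕜 := ℝ) (u k) y
    rw [u.norm_eq_one, one_mul] at h2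
    have := h k
    rw [← Real.norm_eq_abs] at this
    gcongr
  refine (norm_sum_le_of_le _ fun k _ => this k).trans ?_
  simp [mul_assoc]

lemma sum_eb (x : Es d) : ∑ i, x i • (eb i : Es d) = x := by
  have := (EuclideanSpace.basisFun (Fin d) ℝ).sum_repr x
  simpa using this

lemma bilin_expand (H : BL (Es d) (BL (Es d) ℝ)) (x y : Es d) :
    H x y = ∑ i, ∑ j, (x i * y j) * H (eb i) (eb j) := by
  conv_lhs => rw [← sum_eb x, ← sum_eb y]
  simp only [map_sum, map_smul, sum_apply, smul_apply, smul_eq_mul, Finset.mul_sum]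
  rw [Finset.sum_comm]
  refine Finset.sum_congr rfl fun i _ => Finset.sum_congr rfl fun j _ => ?_
  ring

/-- Uniform ellipticity with symmetry. -/
structure Ell (θ : ℝ) (m : Fin d → Fin d → ℝ) : Prop where
  symm : ∀ i j, m i j = m j i
  ell : ∀ ν : Es d, θ * ‖ν‖ ^ 2 ≤ ∑ i, ∑ j, m i j * ν i * ν j

lemma exists_factor {θ Λ : ℝ} (hθ : 0 < θ) (hΛ : 0 ≤ Λ) :
    ∃ s : ℝ, 1 ≤ s ∧ ∀ m : Fin d → Fin d → ℝ, Ell θ m → ‖m‖ ≤ Λ →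
      ∃ (σ : Es d ≃L[ℝ] Es d) (u : OrthonormalBasis (Fin d) ℝ (Es d)),
        ‖(σ : Es d →L[ℝ] Es d)‖ ≤ s ∧ ‖(σ.symm : Es d →L[ℝ] Es d)‖ ≤ s ∧
        ∀ H : BL (Es d) (BL (Es d) ℝ), (1 / 2) * ∑ k, H (σ (u k)) (σ (u k)) = trc m H := by
  refine ⟨1 + d * √(d ^ 2 * Λ) + d * (√θ)⁻¹, ?_, ?_⟩
  · have : 0 ≤ d * √(d ^ 2 * Λ) + d * (√θ)⁻¹ := by positivity
    linarith
  intro m hm hmΛ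
  have hH : (Matrix.of m).IsHermitian := by
    ext i j; simp [hm.symm j i]
  set u := hH.eigenvectorBasis
  set l := hH.eigenvalues
  have hev : ∀ k i, ∑ j, m i j * u k j = l k * u k i := by
    intro k i
    have := congrFun (hH.mulVec_eigenvectorBasis k) i
    simpa [Matrix.mulVec, dotProduct] using this
  have hnorm : ∀ k, ∑ i, u k i * u k i = 1 := by
    intro k
    have := u.inner_eq_one k
    simp only [PiLp.inner_apply, RCLike.inner_apply, conj_trivial] at this
    exact this
  have hform : ∀ k, ∑ i, ∑ j, m i j * u k i * u k j = l k := by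
    intro k
    calc _ = ∑ i, u k i * ∑ j, m i j * u k j := by
          refine Finset.sum_congr rfl fun i _ => ?_
          rw [Finset.mul_sum]
          exact Finset.sum_congr rfl fun j _ => by ring
      _ = ∑ i, l k * (u k i * u k i) := Finset.sum_congr rfl fun i _ => by rw [hev]; ring
      _ = _ := by rw [← Finset.mul_sum, hnorm, mul_one]
  have hl1 : ∀ k, θ ≤ l k := fun k => by
    have := hm.ell (u k)
    rwa [u.norm_eq_one, one_pow, mul_one, hform] at this
  have hl2 : ∀ k, l k ≤ d ^ 2 * Λ := fun k => by
    rw [← hform k]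
    have h1 : ∀ i j, m i j * u k i * u k j ≤ Λ := fun i j => by
      have a1 : |m i j| ≤ Λ := ((norm_le_pi_norm (m i) j).trans (norm_le_pi_norm m i)).trans hmΛ
      have a2 : ∀ i, |u k i| ≤ 1 := fun i => by
        have := PiLp.norm_apply_le (u k) i
        rwa [u.norm_eq_one] at this
      calc _ ≤ |m i j * u k i * u k j| := le_abs_self _
        _ = |m i j| * |u k i| * |u k j| := by rw [abs_mul, abs_mul]
        _ ≤ Λ * 1 * 1 := by gcongr <;> apply a2
        _ = Λ := by ring
    refine (Finset.sum_le_sum fun i _ => Finset.sum_le_sum fun j _ => h1 i j).trans ?_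
    simp only [Finset.sum_const, Finset.card_univ, Fintype.card_fin, nsmul_eq_mul]
    apply le_of_eq; ring
  have hl0 : ∀ k, 0 < l k := fun k => hθ.trans_le (hl1 k)
  have hinv : ∀ k, √(l k) * (√(l k))⁻¹ = 1 := fun k =>
    mul_inv_cancel₀ (Real.sqrt_pos.2 (hl0 k)).ne'
  refine ⟨ContinuousLinearEquiv.equivOfInverse (diagOp u fun k => √(l k))
    (diagOp u fun k => (√(l k))⁻¹)
    (diagOp_diagOp u fun k => by rw [mul_comm]; exact hinv k)
    (diagOp_diagOp u fun k => hinv k), u, ?_, ?_, ?_⟩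
  · have := norm_diagOp_le u (r := fun k => √(l k)) (c := √(d ^ 2 * Λ)) (by positivity)
      (fun k => by rw [abs_of_nonneg (Real.sqrt_nonneg _)]; exact Real.sqrt_le_sqrt (hl2 k))
    refine (show _ ≤ _ from this).trans ?_
    have : 0 ≤ d * (√θ)⁻¹ := by positivity
    linarith
  · have := norm_diagOp_le u (r := fun k => (√(l k))⁻¹) (c := (√θ)⁻¹) (by positivity)
      (fun k => by
        rw [abs_of_nonneg (by positivity)]
        exact inv_anti₀ (Real.sqrt_pos.2 hθ) (Real.sqrt_le_sqrt (hl1 k)))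
    refine (show _ ≤ _ from this).trans ?_
    have : 0 ≤ d * √(d ^ 2 * Λ) := by positivity
    linarith
  · intro H
    have hδ : ∀ l j : Fin d, ∑ k, u k l * u k j = if l = j then 1 else 0 := by
      intro l j
      have := u.sum_inner_mul_inner (eb l) (eb j)
      simpa [EuclideanSpace.inner_single_left, EuclideanSpace.inner_single_right,
        Pi.single_apply, eq_comm] using this
    unfold trc
    congr 1
    have h1 : ∀ k, H ((diagOp u fun k => √(l k)) (u k)) ((diagOp u fun k => √(l k)) (u k))
        = ∑ i, ∑ j, (l k * u k i) * u k j * H (eb i) (eb j) := fun k => by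
      rw [diagOp_basis, map_smul, map_smul, smul_apply, smul_smul, smul_eq_mul,
        Real.mul_self_sqrt (hl0 k).le, bilin_expand, Finset.mul_sum]
      refine Finset.sum_congr rfl fun i _ => ?_
      rw [Finset.mul_sum]
      exact Finset.sum_congr rfl fun j _ => by ring
    refine (Finset.sum_congr rfl fun k _ => h1 k).trans ?_
    rw [Finset.sum_comm]
    refine Finset.sum_congr rfl fun i _ => ?_
    rw [Finset.sum_comm]
    refine Finset.sum_congr rfl fun j _ => ?_
    rw [← Finset.sum_mul]
    congr 1
    simp_rw [← hev, Finset.sum_mul]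
    rw [Finset.sum_comm]
    have : ∀ x, ∑ k, m i x * u k x * u k j = m i x * if x = j then 1 else 0 := fun x => by
      rw [← hδ, Finset.mul_sum]
      exact Finset.sum_congr rfl fun k _ => by ring
    simp_rw [this]
    simp

end Factor

section MaxPrinciple

lemma second_deriv_nonpos_of_localMax {φ ψ : ℝ → ℝ} {c x : ℝ} (hmax : IsLocalMax φ x)
    (h1 : ∀ᶠ s in 𝓝 x, HasDerivAt φ (ψ s) s) (h2 : HasDerivAt ψ c x) : ψ x = 0 ∧ c ≤ 0 := by
  have h0 : ψ x = 0 := hmax.hasDerivAt_eq_zero h1.self_of_nhds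
  refine ⟨h0, ?_⟩
  by_contra! hc
  have hd : deriv φ =ᶠ[𝓝 x] ψ := h1.mono fun s hs => hs.deriv
  have hdd : deriv (deriv φ) x = c := by rw [hd.deriv_eq, h2.deriv]
  have hmin : IsLocalMin φ x := isLocalMin_of_deriv_deriv_pos (by rw [hdd]; exact hc)
    (by rw [hd.self_of_nhds, h0]) h1.self_of_nhds.continuousAt
  have hcst : φ =ᶠ[𝓝 x] fun _ => φ x := by
    filter_upwards [hmin, hmax] with s a b using le_antisymm b a
  have : deriv (deriv φ) x = 0 := by
    rw [hcst.deriv.deriv_eq]; simp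
  linarith

lemma deriv_nonneg_of_left_max {q : ℝ → ℝ} {c t : ℝ} (hq : HasDerivAt q c t)
    (h : ∀ᶠ s in 𝓝[≤] t, q s ≤ q t) : 0 ≤ c := by
  have h1 := hq.hasDerivWithinAt (s := Iio t)
  rw [hasDerivWithinAt_iff_tendsto_slope' (by simp)] at h1
  refine ge_of_tendsto h1 ?_
  filter_upwards [h.filter_mono (nhdsWithin_mono _ Iio_subset_Iic_self), self_mem_nhdsWithin]
    with s hs hs'
  rw [slope_def_field]
  exact div_nonneg_of_nonpos (by linarith) (by linarith [show s < t from hs'])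

variable {d : ℕ}

lemma trc_le_of_form_le {m : Fin d → Fin d → ℝ} (hm : (Matrix.of m).PosSemidef)
    {H : BL (Es d) (BL (Es d) ℝ)} {ε Λ : ℝ} (hε : 0 ≤ ε) (hΛ : ‖m‖ ≤ Λ)
    (hH : ∀ v, H v v ≤ 2 * ε * ‖v‖ ^ 2) : trc m H ≤ ε * (d * Λ) := by
  obtain ⟨N, v, hv⟩ := Matrix.posSemidef_iff_eq_sum_vecMulVec.1 hm
  have hmv : ∀ i j, m i j = ∑ k, v k i * v k j := fun i j => by
    have := congrFun (congrFun hv i) j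
    simpa [Matrix.sum_apply, Matrix.vecMulVec_apply] using this
  have h1 : ∑ i, ∑ j, m i j * H (eb i) (eb j)
      = ∑ k, H (WithLp.toLp 2 (v k)) (WithLp.toLp 2 (v k)) := by
    have hx : ∀ k, H (WithLp.toLp 2 (v k)) (WithLp.toLp 2 (v k))
        = ∑ i, ∑ j, (v k i * v k j) * H (eb i) (eb j) := fun k => bilin_expand H _ _
    simp_rw [hx, hmv, Finset.sum_mul]
    symm
    rw [Finset.sum_comm]
    refine Finset.sum_congr rfl fun i _ => ?_
    rw [Finset.sum_comm]
  have h2 : ∑ k, H (WithLp.toLp 2 (v k)) (WithLp.toLp 2 (v k)) ≤ 2 * ε * ∑ i, m i i := by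
    have : ∑ i, m i i = ∑ k, ‖(WithLp.toLp 2 (v k) : Es d)‖ ^ 2 := by
      simp_rw [EuclideanSpace.norm_sq_eq, hmv]
      rw [Finset.sum_comm]
      refine Finset.sum_congr rfl fun i _ => Finset.sum_congr rfl fun k _ => ?_
      simp [sq]
    rw [this, Finset.mul_sum]
    exact Finset.sum_le_sum fun k _ => hH _
  have h3 : ∑ i, m i i ≤ d * Λ := by
    have : ∀ i, m i i ≤ Λ := fun i => (le_abs_self _).trans
      (((norm_le_pi_norm (m i) i).trans (norm_le_pi_norm m i)).trans hΛ)
    refine (Finset.sum_le_sum fun i _ => this i).trans ?_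
    simp
  unfold trc
  rw [h1]
  nlinarith

/-- The data needed to apply the maximum principle at `z`: near `z` the domain `D` contains the
spatial slice and the past, and `e` is a classical subsolution of `e_t ≤ L e - e` at `z`. -/
def SubAt (Λ : ℝ) (D : Set (ℝ × Es d)) (e : ℝ × Es d → ℝ) (z : ℝ × Es d) : Prop :=
  (∀ᶠ y in 𝓝 z.2, (z.1, y) ∈ D) ∧ (∀ᶠ s in 𝓝[≤] z.1, (s, z.2) ∈ D) ∧
  ∃ (p : ℝ) (G : Es d → BL (Es d) ℝ) (H : BL (Es d) (BL (Es d) ℝ)) (m : Fin d → Fin d → ℝ)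
    (b : Fin d → ℝ), HasDerivAt (fun s => e (s, z.2)) p z.1 ∧
    (∀ᶠ y in 𝓝 z.2, HasFDerivAt (fun x => e (z.1, x)) (G y) y) ∧ HasFDerivAt G H z.2 ∧
    (Matrix.of m).PosSemidef ∧ ‖m‖ ≤ Λ ∧ ‖b‖ ≤ Λ ∧ p ≤ trc m H + drf b (G z.2) - e z

lemma hessian_at_penalized_max {f : Es d → ℝ} {G : Es d → BL (Es d) ℝ}
    {H : BL (Es d) (BL (Es d) ℝ)} {x : Es d} {c δ : ℝ}
    (hG : ∀ᶠ y in 𝓝 x, HasFDerivAt f (G y) y) (hH : HasFDerivAt G H x)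
    (hmax : ∀ᶠ y in 𝓝 x, f y - (c + δ * ‖y‖ ^ 2) ≤ f x - (c + δ * ‖x‖ ^ 2)) (v : Es d) :
    G x v = 2 * δ * ⟪x, v⟫ ∧ H v v ≤ 2 * δ * ‖v‖ ^ 2 := by
  have hl : ∀ s : ℝ, HasDerivAt (fun s : ℝ => x + s • v) v s := fun s => hasDerivAt_line x v s
  have hlc : Tendsto (fun s : ℝ => x + s • v) (𝓝 0) (𝓝 x) := by
    have := (hl 0).continuousAt.tendsto
    simpa using this
  have hn : ∀ s : ℝ, HasDerivAt (fun s : ℝ => ‖x + s • v‖ ^ 2) (2 * (⟪x, v⟫ + s * ‖v‖ ^ 2)) s := by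
    intro s
    have := (hl s).norm_sq
    refine this.congr_deriv ?_
    rw [inner_add_left, inner_smul_left, real_inner_self_eq_norm_sq]
    simp
  have h1 : ∀ᶠ s in 𝓝 (0:ℝ), HasDerivAt (fun s : ℝ => f (x + s • v) - (c + δ * ‖x + s • v‖ ^ 2))
      (G (x + s • v) v - δ * (2 * (⟪x, v⟫ + s * ‖v‖ ^ 2))) s := by
    filter_upwards [hlc.eventually hG] with s hs
    have a1 : HasDerivAt (fun s : ℝ => f (x + s • v)) (G (x + s • v) v) s :=
      hs.comp_hasDerivAt s (hl s)
    have a2 : HasDerivAt (fun s : ℝ => c + δ * ‖x + s • v‖ ^ 2)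
        (δ * (2 * (⟪x, v⟫ + s * ‖v‖ ^ 2))) s := ((hn s).const_mul δ).const_add c
    exact a1.sub a2
  have h2 : HasDerivAt (fun s : ℝ => G (x + s • v) v - δ * (2 * (⟪x, v⟫ + s * ‖v‖ ^ 2)))
      (H v v - δ * (2 * ‖v‖ ^ 2)) 0 := by
    have hH' : HasFDerivAt G H (x + (0:ℝ) • v) := by simpa using hH
    have a0 : HasFDerivAt (fun y => G y v) (H.flip v) (x + (0:ℝ) • v) := by
      have := (ContinuousLinearMap.apply ℝ ℝ v).hasFDerivAt.comp (x + (0:ℝ) • v) hH'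
      exact this
    have a1 : HasDerivAt (fun s : ℝ => G (x + s • v) v) (H v v) 0 := by
      have := a0.comp_hasDerivAt (f := fun s : ℝ => x + s • v) (0:ℝ) (hl 0)
      exact this
    have a2 : HasDerivAt (fun s : ℝ => δ * (2 * (⟪x, v⟫ + s * ‖v‖ ^ 2)))
        (δ * (2 * ‖v‖ ^ 2)) 0 := by
      have := ((((hasDerivAt_id (0:ℝ)).mul_const (‖v‖ ^ 2)).const_add ⟪x, v⟫).const_mul
        (2:ℝ)).const_mul δ
      refine this.congr_deriv (by ring)
    exact a1.sub a2
  have h3 : IsLocalMax (fun s : ℝ => f (x + s • v) - (c + δ * ‖x + s • v‖ ^ 2)) 0 := by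
    filter_upwards [hlc.eventually hmax] with s hs
    simpa using hs
  obtain ⟨b1, b2⟩ := second_deriv_nonpos_of_localMax h3 h1 h2
  simp only [zero_smul, add_zero, zero_mul] at b1
  constructor <;> linarith

set_option maxHeartbeats 800000 in
lemma max_principle {D : Set (ℝ × Es d)} (hD : IsClosed D) {e : ℝ × Es d → ℝ}
    (he : ContinuousOn e D) {K Λ : ℝ} (hK : ∀ z ∈ D, e z ≤ K)
    (hm : ∀ z ∈ D, 0 < e z → SubAt Λ D e z) : ∀ z ∈ D, e z ≤ 0 := by
  intro z1 hz1
  by_contra! hpos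
  have hKpos : 0 < K := hpos.trans_le (hK z1 hz1)
  set μ := e z1 / 2 with hμ
  have hμ0 : 0 < μ := by positivity
  have hΛ : 0 ≤ Λ := by
    obtain ⟨_, _, p, G, H, m, b, _, _, _, _, h1, _⟩ := hm z1 hz1 hpos
    exact (norm_nonneg _).trans h1
  set C := d * Λ + d * Λ * (1 + K) + (1 + K) with hC
  have hCpos : 0 < C := by positivity
  set q1 := z1.1 ^ 2 + ‖z1.2‖ ^ 2 with hq1
  have hq10 : 0 ≤ q1 := by positivity
  obtain ⟨δ, hδ0, hδ1, hδC, hδq⟩ : ∃ δ : ℝ, 0 < δ ∧ δ ≤ 1 ∧ δ * C < μ ∧ δ * q1 ≤ μ := by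
    refine ⟨min 1 (μ / (2 * C + q1 + 1)), by positivity, min_le_left _ _, ?_, ?_⟩
    · have h1 : min 1 (μ / (2 * C + q1 + 1)) ≤ μ / (2 * C + q1 + 1) := min_le_right _ _
      rw [le_div_iff₀ (by positivity)] at h1
      have : 0 < min 1 (μ / (2 * C + q1 + 1)) := by positivity
      nlinarith
    · have h1 : min 1 (μ / (2 * C + q1 + 1)) ≤ μ / (2 * C + q1 + 1) := min_le_right _ _
      rw [le_div_iff₀ (by positivity)] at h1
      have : 0 < min 1 (μ / (2 * C + q1 + 1)) := by positivity
      nlinarith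
  set F : ℝ × Es d → ℝ := fun z => e z - δ ^ 2 * (z.1 ^ 2 + ‖z.2‖ ^ 2) with hF
  have hF1 : μ ≤ F z1 := by
    have : δ ^ 2 * q1 ≤ μ := by nlinarith
    simp only [hF, ← hq1]
    linarith
  set r := ‖z1‖ + (K + 1) / δ with hr
  have hr1 : ‖z1‖ ≤ r := by
    have : 0 < (K + 1) / δ := by positivity
    linarith
  have hcomp : IsCompact (D ∩ Metric.closedBall 0 r) :=
    (isCompact_closedBall _ _).inter_left hD
  obtain ⟨z, hz, hzmax⟩ := hcomp.exists_isMaxOn ⟨z1, hz1, by simpa using hr1⟩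
    (f := F) ((he.mono inter_subset_left).sub (by fun_prop))
  have hzF : μ ≤ F z := hF1.trans (hzmax ⟨hz1, by simpa using hr1⟩)
  have hmax : ∀ y ∈ D, F y ≤ F z := by
    intro y hy
    by_cases hyr : ‖y‖ ≤ r
    · exact hzmax ⟨hy, by simpa using hyr⟩
    · have h1 : F y ≤ 0 := by
        have h2 : r ^ 2 ≤ y.1 ^ 2 + ‖y.2‖ ^ 2 := by
          push Not at hyr
          have h3 : ‖y‖ ^ 2 ≤ y.1 ^ 2 + ‖y.2‖ ^ 2 := by
            rw [Prod.norm_def]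
            rcases max_cases ‖y.1‖ ‖y.2‖ with ⟨h, _⟩ | ⟨h, _⟩ <;> rw [h]
            · rw [Real.norm_eq_abs, sq_abs]; nlinarith [sq_nonneg ‖y.2‖]
            · nlinarith [sq_nonneg y.1]
          have : 0 ≤ r := (norm_nonneg _).trans hr1
          nlinarith
        have h4 : K ≤ δ ^ 2 * r ^ 2 := by
          have h5 : K + 1 ≤ δ * r := by
            have : δ * ((K + 1) / δ) = K + 1 := by field_simp
            rw [hr, mul_add, this]
            have := mul_nonneg hδ0.le (norm_nonneg z1)
            linarith
          nlinarith
        have h5 := hK y hy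
        simp only [hF]
        nlinarith [sq_nonneg δ]
      linarith
  have hq : δ ^ 2 * (z.1 ^ 2 + ‖z.2‖ ^ 2) ≤ K := by
    have := hK z hz.1
    simp only [hF] at hzF
    linarith
  have hez : μ ≤ e z := by
    have : 0 ≤ δ ^ 2 * (z.1 ^ 2 + ‖z.2‖ ^ 2) := by positivity
    simp only [hF] at hzF
    linarith
  obtain ⟨hD1, hD2, p, G, H, m, b, hp, hG, hH, hmP, hmΛ, hbΛ, hle⟩ := hm z hz.1 (hμ0.trans_le hez)
  have ht : -(2 * δ ^ 2 * |z.1|) ≤ p := by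
    have h1 : HasDerivAt (fun s => e (s, z.2) - δ ^ 2 * (s ^ 2 + ‖z.2‖ ^ 2))
        (p - δ ^ 2 * (2 * z.1)) z.1 := by
      have := hp.sub ((((hasDerivAt_id z.1).pow 2).add_const (‖z.2‖ ^ 2)).const_mul (δ ^ 2))
      refine this.congr_deriv ?_
      simp
    have h2 := deriv_nonneg_of_left_max h1 (by
      filter_upwards [hD2] with s hs using hmax _ hs)
    have h3 := neg_abs_le z.1
    nlinarith [sq_nonneg δ]
  have hx := hessian_at_penalized_max (f := fun x => e (z.1, x)) (c := δ ^ 2 * z.1 ^ 2)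
    (δ := δ ^ 2) hG hH (by
      filter_upwards [hD1] with y hy
      have := hmax _ hy
      simp only [hF] at this
      linarith)
  have htr := trc_le_of_form_le hmP (sq_nonneg δ) hmΛ fun v => (hx v).2
  have hdr : drf b (G z.2) ≤ d * Λ * (2 * δ ^ 2 * ‖z.2‖) := by
    refine (le_abs_self _).trans ((norm_drf_le b (G z.2)).trans ?_)
    have : ‖G z.2‖ ≤ 2 * δ ^ 2 * ‖z.2‖ := by
      refine ContinuousLinearMap.opNorm_le_bound _ (by positivity) fun v => ?_
      rw [(hx v).1, norm_mul, Real.norm_of_nonneg (by positivity : 0 ≤ 2 * δ ^ 2),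
        mul_assoc (2 * δ ^ 2)]
      have h0 : (0:ℝ) ≤ 2 * δ ^ 2 := by positivity
      exact mul_le_mul_of_nonneg_left (abs_real_inner_le_norm z.2 v) h0
    gcongr
  have ham : ∀ y : ℝ, 0 ≤ y → δ ^ 2 * y ^ 2 ≤ K → 2 * δ ^ 2 * y ≤ δ * (1 + K) := by
    intro y hy hyK
    have h1 : 2 * (δ * y) ≤ 1 + K := by nlinarith only [sq_nonneg (δ * y - 1), hyK]
    calc 2 * δ ^ 2 * y = δ * (2 * (δ * y)) := by ring
      _ ≤ _ := mul_le_mul_of_nonneg_left h1 hδ0.le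
  have ha1 := ham |z.1| (abs_nonneg _) (by rw [sq_abs]; nlinarith [sq_nonneg (δ * ‖z.2‖)])
  have ha2 := ham ‖z.2‖ (norm_nonneg _) (by nlinarith [sq_nonneg (δ * z.1)])
  have hdΛ : 0 ≤ d * Λ := by positivity
  have h9 : μ ≤ δ * C := by
    have c1 : d * Λ * (2 * δ ^ 2 * ‖z.2‖) ≤ d * Λ * (δ * (1 + K)) := by gcongr
    have c2 : δ ^ 2 * (d * Λ) ≤ δ * (d * Λ) := by
      apply mul_le_mul_of_nonneg_right _ hdΛ
      nlinarith
    have c3 : δ ^ 2 * (d * Λ) + d * Λ * (2 * δ ^ 2 * ‖z.2‖) + δ * (1 + K) ≤ δ * C := by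
      rw [hC]
      linarith only [c1, c2]
    linarith only [c3, hle, htr, hdr, ht, hez, ha1]
  linarith only [h9, hδC]

end MaxPrinciple

section Interpolation
variable {E : Type*} [NormedAddCommGroup E] [InnerProductSpace ℝ E]

/-- Pointwise interpolation: bounds on `w` and on the oscillation of its Hessian on a ball control
gradient and Hessian at the centre. -/
lemma interp_ball {w : E → ℝ} {g : E → BL E ℝ} {H : E → BL E (BL E ℝ)} {x : E} {h A K : ℝ}
    (hh : 0 < h) (hw : ∀ y ∈ Metric.closedBall x h, HasFDerivAt w (g y) y)
    (hg : ∀ y ∈ Metric.closedBall x h, HasFDerivAt g (H y) y)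
    (hA : ∀ y ∈ Metric.closedBall x h, |w y| ≤ A)
    (hH : ∀ y ∈ Metric.closedBall x h, ‖H y - H x‖ ≤ K) :
    ‖g x‖ ≤ A / h + K * h ∧ ‖H x‖ ≤ 4 * A / h ^ 2 + 2 * K := by
  have hA0 : 0 ≤ A := (abs_nonneg _).trans (hA x (Metric.mem_closedBall_self hh.le))
  have hK0 : 0 ≤ K := (norm_nonneg _).trans (hH x (Metric.mem_closedBall_self hh.le))
  have hmem : ∀ v : E, ‖v‖ ≤ h → ∀ θ ∈ Icc (0:ℝ) 1, x + θ • v ∈ Metric.closedBall x h := by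
    intro v hv θ hθ
    rw [mem_closedBall_iff_norm, add_sub_cancel_left, norm_smul, Real.norm_of_nonneg hθ.1]
    exact (mul_le_of_le_one_left (norm_nonneg _) hθ.2).trans hv
  have T : ∀ v : E, ‖v‖ ≤ h → |w (x + v) - w x - g x v - (1/2) * H x v v| ≤ K * ‖v‖ ^ 2 :=
    fun v hv => fun_taylor (fun θ hθ => hw _ (hmem v hv θ hθ)) (fun θ hθ => hg _ (hmem v hv θ hθ))
      (fun θ hθ => hH _ (hmem v hv θ hθ))
  have hB : ∀ v : E, ‖v‖ ≤ h → |w (x + v)| ≤ A := fun v hv => by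
    have := hA _ (hmem v hv 1 (by simp))
    rwa [one_smul] at this
  have hx := hB 0 (by simpa using hh.le)
  rw [add_zero] at hx
  have P : ∀ v : E, ‖v‖ ≤ h → |g x v| ≤ A + K * ‖v‖ ^ 2 ∧ |H x v v| ≤ 4 * A + 2 * K * ‖v‖ ^ 2 := by
    intro v hv
    have t1 := abs_le.1 (T v hv)
    have t2 := T (-v) (by rwa [norm_neg])
    simp only [map_neg, neg_apply, norm_neg, neg_neg] at t2
    have t2 := abs_le.1 t2
    have b1 := abs_le.1 (hB v hv)
    have b2 := abs_le.1 (hB (-v) (by rwa [norm_neg]))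
    have b3 := abs_le.1 hx
    constructor <;> rw [abs_le] <;> constructor <;> linarith [t1.1, t1.2, t2.1, t2.2]
  have hscale : ∀ v : E, v ≠ 0 → ∃ c : ℝ, 0 < c ∧ ‖c • v‖ = h ∧ c * ‖v‖ = h := by
    intro v hv
    have hv' : 0 < ‖v‖ := norm_pos_iff.2 hv
    refine ⟨h / ‖v‖, by positivity, ?_, by field_simp⟩
    rw [norm_smul, Real.norm_of_nonneg (by positivity)]; field_simp
  constructor
  · refine ContinuousLinearMap.opNorm_le_bound _ (by positivity) fun v => ?_
    rcases eq_or_ne v 0 with rfl | hv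
    · simp
    obtain ⟨c, hc, hcv, hcv'⟩ := hscale v hv
    have := (P (c • v) hcv.le).1
    rw [hcv, map_smul, smul_eq_mul, abs_mul, abs_of_pos hc] at this
    rw [Real.norm_eq_abs]
    have h1 : ‖v‖ = h / c := by field_simp; linarith
    rw [h1]
    calc |g x v| = (c * |g x v|) / c := by field_simp
      _ ≤ (A + K * h ^ 2) / c := by gcongr
      _ = _ := by field_simp
  · set Q := 4 * A / h ^ 2 + 2 * K with hQ
    have hQ0 : 0 ≤ Q := by positivity
    have hquad : ∀ v, |H x v v| ≤ Q * ‖v‖ ^ 2 := by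
      intro v
      rcases eq_or_ne v 0 with rfl | hv
      · simp
      obtain ⟨c, hc, hcv, hcv'⟩ := hscale v hv
      have := (P (c • v) hcv.le).2
      simp only [hcv, map_smul, smul_apply, smul_eq_mul, abs_mul, abs_of_pos hc] at this
      have h1 : ‖v‖ = h / c := by field_simp; linarith
      rw [h1, hQ]
      calc |H x v v| = (c * (c * |H x v v|)) / c ^ 2 := by field_simp
        _ ≤ (4 * A + 2 * K * h ^ 2) / c ^ 2 := by gcongr
        _ = _ := by field_simp
    have hsym : ∀ u v, H x u v = H x v u := fun u v =>
      second_derivative_symmetric_of_eventually (𝕜 := ℝ) (f := w) (f' := g) (f'' := H x) (x := x)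
        (by filter_upwards [Metric.closedBall_mem_nhds x hh] with y hy using hw y hy)
        (hg x (Metric.mem_closedBall_self hh.le)) u v
    have hone : ∀ u v : E, ‖u‖ = 1 → ‖v‖ = 1 → |H x u v| ≤ Q := by
      intro u v hu hv
      have e1 : H x u v = (1/4) * (H x (u + v) (u + v) - H x (u - v) (u - v)) := by
        simp only [map_add, map_sub, add_apply, sub_apply]
        rw [hsym v u]; ring
      have p1 := parallelogram_law_with_norm ℝ u v
      rw [hu, hv] at p1
      have q1 := abs_le.1 (hquad (u + v))
      have q2 := abs_le.1 (hquad (u - v))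
      rw [e1, abs_le]
      constructor <;> nlinarith
    refine ContinuousLinearMap.opNorm_le_bound _ hQ0 fun u => ?_
    refine ContinuousLinearMap.opNorm_le_bound _ (by positivity) fun v => ?_
    rcases eq_or_ne u 0 with rfl | hu
    · simp
    rcases eq_or_ne v 0 with rfl | hv
    · simp
    have hu' : ‖u‖ ≠ 0 := norm_ne_zero_iff.2 hu
    have hv' : ‖v‖ ≠ 0 := norm_ne_zero_iff.2 hv
    have := hone (‖u‖⁻¹ • u) (‖v‖⁻¹ • v) (by rw [norm_smul, norm_inv, norm_norm]; field_simp)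
      (by rw [norm_smul, norm_inv, norm_norm]; field_simp)
    simp only [map_smul, smul_apply, smul_eq_mul, abs_mul, abs_inv, abs_norm] at this
    rw [Real.norm_eq_abs]
    calc |H x u v| = (‖u‖ * ‖v‖) * (‖v‖⁻¹ * (‖u‖⁻¹ * |H x u v|)) := by field_simp
      _ ≤ (‖u‖ * ‖v‖) * Q := by
          gcongr
      _ = _ := by ring

end Interpolation

section RegAlgebra
variable {E : Type*} [NormedAddCommGroup E] [InnerProductSpace ℝ E]
variable {Z : Type*} {ϱ : Z → Z → ℝ} {A A' B B' : ℝ} {S : Set Z}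

lemma Hol.mul {f g : Z → ℝ} (hf : Hol ϱ A B S f) (hg : Hol ϱ A' B' S g) :
    Hol ϱ (A * A') (A * B' + B * A') S (fun z => f z * g z) := by
  simpa using Hol.bilin (T := fun u v : ℝ => u * v) (C := 1) (fun u u' v => by ring)
    (fun u v v' => by ring) (fun u v => by simp) zero_le_one hf hg

lemma Hol.smul {V : Type*} [NormedAddCommGroup V] [NormedSpace ℝ V] {f : Z → ℝ} {g : Z → V}
    (hf : Hol ϱ A B S f) (hg : Hol ϱ A' B' S g) :
    Hol ϱ (A * A') (A * B' + B * A') S (fun z => f z • g z) := by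
  simpa using Hol.bilin (T := fun (u : ℝ) (v : V) => u • v) (C := 1)
    (fun u u' v => (sub_smul _ _ _).symm)
    (fun u v v' => (smul_sub _ _ _).symm) (fun u v => by simp [norm_smul]) zero_le_one hf hg

/-- The rank-one bilinear form `(x, y) ↦ u x * v y`. -/
noncomputable def tens (u v : BL E ℝ) : BL E (BL E ℝ) := ContinuousLinearMap.smulRight u v

lemma norm_tens (u v : BL E ℝ) : ‖tens u v‖ = ‖u‖ * ‖v‖ := ContinuousLinearMap.norm_smulRight_apply u v

lemma tens_sub_left (u u' v : BL E ℝ) : tens u v - tens u' v = tens (u - u') v := by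
  ext x y; simp [tens, sub_mul]

lemma tens_sub_right (u v v' : BL E ℝ) : tens u v - tens u v' = tens u (v - v') := by
  ext x y; simp [tens, mul_sub]

lemma Hol.tens {f g : Z → BL E ℝ} (hf : Hol ϱ A B S f) (hg : Hol ϱ A' B' S g) :
    Hol ϱ (A * A') (A * B' + B * A') S (fun z => tens (f z) (g z)) := by
  simpa using Hol.bilin (T := fun u v : BL E ℝ => _root_.tens u v) (C := 1)
    (fun u u' v => tens_sub_left u u' v)
    (fun u v v' => tens_sub_right u v v') (fun u v => by rw [norm_tens, one_mul]) zero_le_one hf hg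

lemma Reg.mul {α A A' : ℝ} {S : Set (ℝ × E)} {w w' : ℝ × E → ℝ} {g g' : ℝ × E → BL E ℝ}
    {H H' : ℝ × E → BL E (BL E ℝ)} {p p' : ℝ × E → ℝ} (hA : 0 ≤ A) (hA' : 0 ≤ A')
    (h : Reg α A S w g H p) (h' : Reg α A' S w' g' H' p') :
    Reg α (8 * A * A') S (fun z => w z * w' z) (fun z => w z • g' z + w' z • g z)
      (fun z => (w z • H' z + tens (g z) (g' z)) + (w' z • H z + tens (g' z) (g z)))
      (fun z => p z * w' z + w z * p' z) := by
  have hn : 0 ≤ A * A' := mul_nonneg hA hA'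
  refine ⟨fun z hz => (h.dw z hz).mul (h'.dw z hz), fun z hz => ?_,
    fun z hz => (h.dt z hz).mul (h'.dt z hz), ?_, ?_, ?_, ?_⟩
  · exact ((h.dw z hz).smul (h'.dg z hz)).add ((h'.dw z hz).smul (h.dg z hz))
  · exact (h.xw.mul h'.xw).mono (rho_nonneg α) (by nlinarith) (by nlinarith)
  · exact ((h.xw.smul h'.xg).add (h'.xw.smul h.xg)).mono (rho_nonneg α) (by nlinarith)
      (by nlinarith)
  · exact (((h.xw.smul h'.xH).add (h.xg.tens h'.xg)).add
      ((h'.xw.smul h.xH).add (h'.xg.tens h.xg))).mono (rho_nonneg α) (by nlinarith) (by nlinarith)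
  · exact ((h.xp.mul h'.xw).add (h.xw.mul h'.xp)).mono (rho_nonneg α) (by nlinarith) (by nlinarith)

end RegAlgebra

section Smooth
variable {E : Type*} [NormedAddCommGroup E] [InnerProductSpace ℝ E] [FiniteDimensional ℝ E]

lemma xh_of_contDiff {V : Type*} [NormedAddCommGroup V] [NormedSpace ℝ V] {α : ℝ} (hα : 0 < α)
    (hα1 : α < 1) {f : ℝ × E → V} (hf : ContDiff ℝ 1 f) (hc : HasCompactSupport f) :
    ∃ A, ∀ A' ≥ A, XH α A' univ f := by
  obtain ⟨C, hC⟩ := hf.lipschitzWith_of_hasCompactSupport hc (by simp)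
  obtain ⟨M, hM⟩ := hf.continuous.bounded_above_of_compact_support hc
  have hM0 : 0 ≤ M := (norm_nonneg _).trans (hM 0)
  refine ⟨C + 2 * M, fun A' hA' => ?_⟩
  have hC0 : (0:ℝ) ≤ C := C.2
  refine ⟨fun z _ => (hM z).trans (by linarith), fun z _ z' _ => ?_⟩
  refine le_rho_of_lip hα hα1 (by linarith) ?_ ?_
  · rw [← dist_eq_norm]
    refine (hC.dist_le_mul z z').trans ?_
    gcongr
    linarith
  · refine (norm_sub_le _ _).trans ?_
    linarith [hM z, hM z']

lemma spatial_fderiv {V : Type*} [NormedAddCommGroup V] [NormedSpace ℝ V] {f : ℝ × E → V}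
    {n : ℕ∞} (hf : ContDiff ℝ (n + 1) f) (hc : HasCompactSupport f) :
    ContDiff ℝ n (fun z => (fderiv ℝ f z).comp (ContinuousLinearMap.inr ℝ ℝ E)) ∧
    HasCompactSupport (fun z => (fderiv ℝ f z).comp (ContinuousLinearMap.inr ℝ ℝ E)) ∧
    ∀ z, HasFDerivAt (fun x => f (z.1, x)) ((fderiv ℝ f z).comp (ContinuousLinearMap.inr ℝ ℝ E))
      z.2 := by
  refine ⟨(hf.fderiv_right le_rfl).clm_comp contDiff_const, (hc.fderiv ℝ).mono fun z hz => ?_,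
    fun z => ?_⟩
  · rw [Function.mem_support] at hz ⊢
    exact fun h => hz (by simp only [h, ContinuousLinearMap.zero_comp])
  · exact ((hf.differentiable (by simp)) z).hasFDerivAt.comp z.2
      (hasFDerivAt_prodMk_right z.1 z.2)

lemma exists_reg_of_contDiff {α : ℝ} (hα : 0 < α) (hα1 : α < 1) {b : ℝ × E → ℝ}
    (hb : ContDiff ℝ 3 b) (hc : HasCompactSupport b) :
    ∃ A g H p, 0 ≤ A ∧ Reg α A univ b g H p ∧ ∀ U : Set (ℝ × E), IsOpen U → ∀ c : ℝ,
      (∀ z ∈ U, b z = c) → ∀ z ∈ U, g z = 0 ∧ H z = 0 ∧ p z = 0 := by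
  set J : BL E (ℝ × E) := ContinuousLinearMap.inr ℝ ℝ E with hJ
  set g : ℝ × E → BL E ℝ := fun z => (fderiv ℝ b z).comp J with hg
  set H : ℝ × E → BL E (BL E ℝ) := fun z => (fderiv ℝ g z).comp J with hH
  set p : ℝ × E → ℝ := fun z => fderiv ℝ b z (1, 0) with hp
  have hb' : ContDiff ℝ 2 (fderiv ℝ b) := hb.fderiv_right (by norm_num)
  obtain ⟨hgc, sg, dgx⟩ := spatial_fderiv (n := 2) (hb.of_le (by norm_num)) hc
  obtain ⟨hHc, sH, dHx⟩ := spatial_fderiv (n := 1) (hgc.of_le (by norm_num)) sg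
  have hpc : ContDiff ℝ 1 p := (hb'.of_le (by norm_num)).clm_apply contDiff_const
  have sp : HasCompactSupport p := (hc.fderiv ℝ).mono fun z hz => by
    rw [Function.mem_support] at hz ⊢
    exact fun h => hz (by simp only [hp, h, zero_apply])
  obtain ⟨A1, h1⟩ := xh_of_contDiff hα hα1 (hb.of_le (by norm_num)) hc
  obtain ⟨A2, h2⟩ := xh_of_contDiff hα hα1 (hgc.of_le (by norm_num)) sg
  obtain ⟨A3, h3⟩ := xh_of_contDiff hα hα1 hHc sH
  obtain ⟨A4, h4⟩ := xh_of_contDiff hα hα1 hpc sp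
  set A := max 0 (max (max A1 A2) (max A3 A4))
  refine ⟨A, g, H, p, le_max_left _ _, ⟨fun z _ => ?_, fun z _ => ?_, fun z _ => ?_, h1 _ ?_,
    h2 _ ?_, h3 _ ?_, h4 _ ?_⟩, ?_⟩
  · exact dgx z
  · exact dHx z
  · have h5 : HasDerivAt (fun t : ℝ => ((t, z.2) : ℝ × E)) (1, 0) z.1 :=
      (hasDerivAt_id z.1).prodMk (hasDerivAt_const _ _)
    exact ((hb.differentiable (by norm_num)) z).hasFDerivAt.comp_hasDerivAt z.1 h5
  · exact (le_max_left _ _).trans ((le_max_left _ _).trans (le_max_right _ _))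
  · exact (le_max_right _ _).trans ((le_max_left _ _).trans (le_max_right _ _))
  · exact (le_max_left _ _).trans ((le_max_right _ _).trans (le_max_right _ _))
  · exact (le_max_right _ _).trans ((le_max_right _ _).trans (le_max_right _ _))
  · intro U hU c hbc
    have d0 : ∀ z ∈ U, fderiv ℝ b z = 0 := fun z hz => by
      have : b =ᶠ[𝓝 z] fun _ => c := by
        filter_upwards [hU.mem_nhds hz] with y hy using hbc y hy
      rw [this.fderiv_eq]; simp
    have d1 : ∀ z ∈ U, g z = 0 := fun z hz => by simp [hg, d0 z hz]
    refine fun z hz => ⟨d1 z hz, ?_, by simp [hp, d0 z hz]⟩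
    have : g =ᶠ[𝓝 z] fun _ => 0 := by
      filter_upwards [hU.mem_nhds hz] with y hy using d1 y hy
    simp [hH, this.fderiv_eq]

lemma rho_scale {α : ℝ} (hα : 0 < α) (hα1 : α < 1) {s : ℝ} (hs : 0 < s) (hs1 : s ≤ 1)
    (y z z' : ℝ × E) : rho α (s⁻¹ • (z - y)) (s⁻¹ • (z' - y)) ≤ s⁻¹ * rho α z z' := by
  have h1 : 1 ≤ s⁻¹ := (one_le_inv₀ hs).2 hs1
  have h0 : 0 ≤ s⁻¹ := by positivity
  have hpow : ∀ {β r : ℝ}, 0 < β → β ≤ 1 → 0 ≤ r → (s⁻¹ * r) ^ β ≤ s⁻¹ * r ^ β := by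
    intro β r hb hb1 hr
    rw [Real.mul_rpow h0 hr]
    gcongr
    calc s⁻¹ ^ β ≤ s⁻¹ ^ (1:ℝ) := Real.rpow_le_rpow_of_exponent_le h1 hb1
      _ = _ := Real.rpow_one _
  have e1 : (s⁻¹ • (z - y)).2 - (s⁻¹ • (z' - y)).2 = s⁻¹ • (z.2 - z'.2) := by
    simp [← smul_sub]
  have e2 : (s⁻¹ • (z - y)).1 - (s⁻¹ • (z' - y)).1 = s⁻¹ * (z.1 - z'.1) := by
    simp [← mul_sub]
  unfold rho
  rw [e1, e2, norm_smul, abs_mul, Real.norm_of_nonneg h0, abs_of_nonneg h0, mul_add]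
  exact add_le_add (hpow hα hα1.le (norm_nonneg _)) (hpow (by positivity) (by linarith)
    (abs_nonneg _))

lemma Hol.scale {V : Type*} [NormedAddCommGroup V] {α A : ℝ} (hα : 0 < α) (hα1 : α < 1) {s : ℝ}
    (hs : 0 < s) (hs1 : s ≤ 1) (hA : 0 ≤ A) (y : ℝ × E) {f : ℝ × E → V} (hf : XH α A univ f) :
    Hol (rho α) A (A * s⁻¹) univ (fun z => f (s⁻¹ • (z - y))) :=
  ⟨fun z _ => hf.bd _ (mem_univ _), fun z _ z' _ => (hf.ho _ (mem_univ _) _ (mem_univ _)).trans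
    (by rw [mul_assoc]; exact mul_le_mul_of_nonneg_left (rho_scale hα hα1 hs hs1 y z z') hA)⟩

lemma exists_bump (E : Type*) [NormedAddCommGroup E] [InnerProductSpace ℝ E]
    [FiniteDimensional ℝ E] {α : ℝ} (hα : 0 < α) (hα1 : α < 1) :
    ∃ K, 0 ≤ K ∧ ∀ (y : ℝ × E) (s : ℝ), 0 < s → s ≤ 1 → ∃ χ g H p,
      Reg α (K * (s⁻¹) ^ 3) univ χ g H p ∧ (∀ z, |χ z| ≤ 1) ∧
      (∀ z ∈ Metric.ball y (2 * s), χ z = 1 ∧ g z = 0 ∧ H z = 0) ∧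
      (∀ z ∉ Metric.ball y (3 * s), χ z = 0 ∧ g z = 0 ∧ H z = 0 ∧ p z = 0) := by
  let B : ContDiffBump (0 : ℝ × E) := ⟨2, 5 / 2, by norm_num, by norm_num⟩
  obtain ⟨A, g, H, p, hA, hR, hU⟩ := exists_reg_of_contDiff hα hα1 (b := B) B.contDiff
    B.hasCompactSupport
  refine ⟨A, hA, fun y s hs hs1 => ?_⟩
  have h1 : 1 ≤ s⁻¹ := (one_le_inv₀ hs).2 hs1
  have h0 : 0 ≤ s⁻¹ := by positivity
  have h2 : A ≤ A * s⁻¹ := le_mul_of_one_le_right hA h1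
  have h3 : A * s⁻¹ ≤ A * s⁻¹ ^ 3 := by
    gcongr; exact le_self_pow₀ h1 (by norm_num)
  have h4 : A * s⁻¹ ^ 2 ≤ A * s⁻¹ ^ 3 := by
    gcongr; norm_num
  have hx : ∀ z : ℝ × E, HasFDerivAt (fun x : E => s⁻¹ • (x - y.2))
      (s⁻¹ • ContinuousLinearMap.id ℝ E) z.2 := fun z =>
    ((hasFDerivAt_id z.2).sub_const y.2).const_smul s⁻¹
  have hin : ∀ z : ℝ × E, ∀ r, z ∈ Metric.ball y (r * s) ↔ ‖s⁻¹ • (z - y)‖ < r := by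
    intro z r
    rw [norm_smul, Real.norm_of_nonneg h0, mem_ball_iff_norm, inv_mul_lt_iff₀ hs, mul_comm]
  refine ⟨fun z => B (s⁻¹ • (z - y)), fun z => s⁻¹ • g (s⁻¹ • (z - y)),
    fun z => s⁻¹ • s⁻¹ • H (s⁻¹ • (z - y)), fun z => s⁻¹ * p (s⁻¹ • (z - y)),
    ⟨fun z _ => ?_, fun z _ => ?_, fun z _ => ?_, ?_, ?_, ?_, ?_⟩, fun z => ?_, fun z hz => ?_,
    fun z hz => ?_⟩
  · have := (hR.dw (s⁻¹ • (z - y)) (mem_univ _)).comp z.2 (hx z)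
    refine this.congr_fderiv ?_
    ext v; simp
  · have := ((hR.dg (s⁻¹ • (z - y)) (mem_univ _)).comp z.2 (hx z)).const_smul s⁻¹
    refine this.congr_fderiv ?_
    ext v; simp
  · have hd : HasDerivAt (fun t : ℝ => s⁻¹ * (t - y.1)) s⁻¹ z.1 := by
      simpa using ((hasDerivAt_id z.1).sub_const y.1).const_mul s⁻¹
    have := (hR.dt (s⁻¹ • (z - y)) (mem_univ _)).comp z.1 hd
    refine this.congr_deriv ?_
    rw [mul_comm]
  · exact (hR.xw.scale hα hα1 hs hs1 hA y).mono (rho_nonneg α) (h2.trans h3) h3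
  · have := (Hol.const (ϱ := rho α) (S := (univ : Set (ℝ × E))) (s⁻¹)).smul
      (hR.xg.scale hα hα1 hs hs1 hA y)
    refine this.mono (rho_nonneg α) ?_ ?_ <;> rw [Real.norm_of_nonneg h0] <;> nlinarith
  · have := (Hol.const (ϱ := rho α) (S := (univ : Set (ℝ × E))) (s⁻¹)).smul
      ((Hol.const (ϱ := rho α) (S := (univ : Set (ℝ × E))) (s⁻¹)).smul
      (hR.xH.scale hα hα1 hs hs1 hA y))
    refine this.mono (rho_nonneg α) ?_ ?_ <;> rw [Real.norm_of_nonneg h0] <;> nlinarith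
  · have := (Hol.const (ϱ := rho α) (S := (univ : Set (ℝ × E))) (s⁻¹)).mul
      (hR.xp.scale hα hα1 hs hs1 hA y)
    refine this.mono (rho_nonneg α) ?_ ?_ <;> rw [Real.norm_of_nonneg h0] <;> nlinarith
  · rw [abs_of_nonneg B.nonneg]; exact B.le_one
  · have hz' := (hin z 2).1 hz
    have hone : ∀ y ∈ Metric.ball (0 : ℝ × E) 2, B y = 1 := fun y hy =>
      B.one_of_mem_closedBall (Metric.ball_subset_closedBall hy)
    have hm : s⁻¹ • (z - y) ∈ Metric.ball (0 : ℝ × E) 2 := by simpa using hz'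
    have := hU _ Metric.isOpen_ball 1 hone _ hm
    exact ⟨hone _ hm, by simp only [this.1, smul_zero], by simp only [this.2.1, smul_zero]⟩
  · have hz' : 3 ≤ ‖s⁻¹ • (z - y)‖ := not_lt.1 fun h => hz ((hin z 3).2 h)
    have hzero : ∀ y ∈ (Metric.closedBall (0 : ℝ × E) (5/2))ᶜ, B y = 0 := fun y hy =>
      B.zero_of_le_dist (by simp at hy; simpa using hy.le)
    have hm : s⁻¹ • (z - y) ∈ (Metric.closedBall (0 : ℝ × E) (5/2))ᶜ := by
      rw [mem_compl_iff, mem_closedBall_zero_iff, not_le]; linarith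
    have := hU _ Metric.isClosed_closedBall.isOpen_compl 0 hzero _ hm
    exact ⟨hzero _ hm, by simp only [this.1, smul_zero], by simp only [this.2.1, smul_zero],
      by simp only [this.2.2, mul_zero]⟩

end Smooth

section ConstCoeff
variable {d : ℕ}

lemma Ell.posSemidef {θ : ℝ} (hθ : 0 ≤ θ) {m : Fin d → Fin d → ℝ} (h : Ell θ m) :
    (Matrix.of m).PosSemidef := by
  refine Matrix.PosSemidef.of_dotProduct_mulVec_nonneg ?_ fun v => ?_
  · ext i j; simp [h.symm j i]
  · have := h.ell (WithLp.toLp 2 v)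
    have h2 : 0 ≤ θ * ‖(WithLp.toLp 2 v : Es d)‖ ^ 2 := by positivity
    refine (h2.trans this).trans (le_of_eq ?_)
    simp only [dotProduct, Matrix.mulVec, Matrix.of_apply, Finset.mul_sum, star_trivial]
    refine Finset.sum_congr rfl fun i _ => Finset.sum_congr rfl fun j _ => by ring

lemma mp_univ {e : ℝ × Es d → ℝ} {G : ℝ × Es d → BL (Es d) ℝ}
    {H : ℝ × Es d → BL (Es d) (BL (Es d) ℝ)} {p : ℝ × Es d → ℝ}
    {m : ℝ × Es d → Fin d → Fin d → ℝ} {b : ℝ × Es d → Fin d → ℝ} {Λ K : ℝ}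
    (he : Continuous e) (hK : ∀ z, e z ≤ K)
    (hw : ∀ z, HasFDerivAt (fun x => e (z.1, x)) (G z) z.2)
    (hg : ∀ z, HasFDerivAt (fun x => G (z.1, x)) (H z) z.2)
    (ht : ∀ z, HasDerivAt (fun t => e (t, z.2)) (p z) z.1)
    (hm : ∀ z, (Matrix.of (m z)).PosSemidef) (hmΛ : ∀ z, ‖m z‖ ≤ Λ) (hbΛ : ∀ z, ‖b z‖ ≤ Λ)
    (hp : ∀ z, 0 < e z → p z ≤ trc (m z) (H z) + drf (b z) (G z) - e z) (z : ℝ × Es d) :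
    e z ≤ 0 := by
  refine max_principle (D := univ) isClosed_univ he.continuousOn (Λ := Λ) (fun z _ => hK z)
    (fun z _ hz => ⟨by simp, by simp, p z, fun y => G (z.1, y), H z, m z, b z, ht z,
      Eventually.of_forall fun y => hw (z.1, y), hg z, hm z, hmΛ z, hbΛ z, hp z hz⟩) z (mem_univ _)

lemma const_coeff_holder {θ Λ α : ℝ} (hθ : 0 < θ) (hΛ : 0 ≤ Λ) (hα : 0 < α) (hα1 : α < 1) :
    ∃ N, 0 ≤ N ∧ ∀ m : Fin d → Fin d → ℝ, Ell θ m → ‖m‖ ≤ Λ → ∀ {W : ℝ × Es d → ℝ}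
      {G : ℝ × Es d → BL (Es d) ℝ} {H : ℝ × Es d → BL (Es d) (BL (Es d) ℝ)}
      {P : ℝ × Es d → ℝ} {A : ℝ}, Reg α A univ W G H P → ∀ {B : ℝ}, 0 ≤ B →
      (∀ t x y, ‖(P (t, x) - trc m (H (t, x)) + W (t, x)) -
        (P (t, y) - trc m (H (t, y)) + W (t, y))‖ ≤ B * ‖x - y‖ ^ α) →
      ∀ t x x', ‖H (t, x) - H (t, x')‖ ≤ N * B * ‖x - x'‖ ^ α := by
  obtain ⟨s, hs1, hfac⟩ := exists_factor (d := d) hθ hΛ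
  refine ⟨8 * (s ^ 2 * mG (Es d)) ^ 3 * (2 / α + 2 / (1 - α)), ?_, ?_⟩
  · have : 0 < 1 - α := by linarith
    have : 0 ≤ mG (Es d) := integral_nonneg fun x => by positivity
    positivity
  intro m hm hmΛ W G H P A hR B hB hh t x x'
  obtain ⟨σ, u, hs, hs2, hσ⟩ := hfac m hm hmΛ
  set h : ℝ × Es d → ℝ := fun z => P z - trc m (H z) + W z with hdef
  have hWc := hR.xw.continuous hα
  have hc : Continuous h := by
    have h1 : Continuous fun z => trc m (H z) := by
      have := hR.xH.continuous hα
      unfold trc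
      fun_prop
    exact ((hR.xp.continuous hα).sub h1).add hWc
  have hA : ∀ z, ‖h z‖ ≤ A + d ^ 2 * Λ * A + A := fun z => by
    have a1 := hR.xp.bd z (mem_univ _)
    have a2 := hR.xH.bd z (mem_univ _)
    have a3 := hR.xw.bd z (mem_univ _)
    have a4 := norm_trc_le m (H z)
    have a5 : (d : ℝ) ^ 2 * ‖m‖ * ‖H z‖ ≤ d ^ 2 * Λ * A := by gcongr
    calc ‖h z‖ ≤ ‖P z‖ + ‖trc m (H z)‖ + ‖W z‖ :=
          (norm_add_le _ _).trans (add_le_add_left (norm_sub_le _ _) _)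
      _ ≤ _ := by linarith
  have hB' : ∀ t x y, ‖h (t, x) - h (t, y)‖ ≤ B * ‖x - y‖ ^ α := hh
  have q1 := fun t x => hasFDerivAt_potW σ hs hs2 hs1 hc hα hα1 hA hB hB' t x
  have q2 := fun t x => hasFDerivAt_potG σ hs hs2 hs1 hc hα hα1 hA hB hB' t x
  have q3 := fun t x => hasDerivAt_potW σ hs hs2 hs1 hc hα hα1 hA hB hB' u t x
  have q4 := continuous_potW σ hs hs2 hs1 hc hα hα1 hA hB hB'
  have q5 := norm_potW_le σ hs hs2 hs1 hc hα hα1 hA hB hB'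
  set K := A + (A + d ^ 2 * Λ * A + A) * Real.Gamma 1
  have hmp := hm.posSemidef hθ.le
  have u1 : ∀ z, W z - potW σ h z ≤ 0 := by
    refine mp_univ (K := K) (Λ := Λ) (G := fun z => G z - potG σ h z)
      (H := fun z => H z - potH σ h z)
      (p := fun z => P z - (trc m (potH σ h z) - potW σ h z + h z)) (m := fun _ => m)
      (b := fun _ => 0) (hWc.sub q4) (fun z => ?_)
      (fun z => (hR.dw z (mem_univ _)).sub (q1 z.1 z.2))
      (fun z => (hR.dg z (mem_univ _)).sub (q2 z.1 z.2)) (fun z => ?_) (fun _ => hmp)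
      (fun _ => hmΛ) (fun _ => by simpa using hΛ) (fun z _ => ?_)
    · have := (abs_le.1 (hR.xw.bd z (mem_univ _))).2
      have := (abs_le.1 (q5 z)).1
      linarith
    · have := q3 z.1 z.2
      rw [hσ] at this
      exact (hR.dt z (mem_univ _)).sub this
    · rw [← trc_sub_right]; simp only [drf, hdef]; simp; linarith
  have u2 : ∀ z, potW σ h z - W z ≤ 0 := by
    refine mp_univ (K := K) (Λ := Λ) (G := fun z => potG σ h z - G z)
      (H := fun z => potH σ h z - H z)
      (p := fun z => (trc m (potH σ h z) - potW σ h z + h z) - P z) (m := fun _ => m)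
      (b := fun _ => 0) (q4.sub hWc) (fun z => ?_)
      (fun z => (q1 z.1 z.2).sub (hR.dw z (mem_univ _)))
      (fun z => (q2 z.1 z.2).sub (hR.dg z (mem_univ _))) (fun z => ?_) (fun _ => hmp)
      (fun _ => hmΛ) (fun _ => by simpa using hΛ) (fun z _ => ?_)
    · have := (abs_le.1 (hR.xw.bd z (mem_univ _))).1
      have := (abs_le.1 (q5 z)).2
      linarith
    · have := q3 z.1 z.2
      rw [hσ] at this
      exact this.sub (hR.dt z (mem_univ _))
    · rw [← trc_sub_right]; simp only [drf, hdef]; simp; linarith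
  have eW : W = potW σ h := funext fun z => by linarith [u1 z, u2 z]
  have eG : G = potG σ h := funext fun z => by
    have h1 := hR.dw z (mem_univ _)
    rw [eW] at h1
    exact h1.unique (q1 z.1 z.2)
  have eH : ∀ z, H z = potH σ h z := fun z => by
    have h1 := hR.dg z (mem_univ _)
    rw [eG] at h1
    exact h1.unique (q2 z.1 z.2)
  rw [eH, eH]
  have := norm_potH_sub_le σ hs hs2 hs1 hc hα hα1 hA hB hB' t x x'
  calc _ ≤ _ := this
    _ = _ := by ring

end ConstCoeff

section Cut
variable {d : ℕ}

set_option maxHeartbeats 1000000 in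
/-- Localized Schauder step: the spatial Hölder seminorm of the Hessian at `y` is controlled by
a small multiple of the same seminorm nearby and lower order quantities. -/
lemma cut_step {θ Λ α : ℝ} (hθ : 0 < θ) (hΛ : 0 ≤ Λ) (hα : 0 < α) (hα1 : α < 1) :
    ∃ N, 0 ≤ N ∧ ∀ {a : Es d → Fin d → Fin d → ℝ} {b : Es d → Fin d → ℝ} {w : ℝ × Es d → ℝ}
      {g : ℝ × Es d → BL (Es d) ℝ} {H : ℝ × Es d → BL (Es d) (BL (Es d) ℝ)}
      {p f : ℝ × Es d → ℝ} {A : ℝ}, 0 ≤ A → Reg α A univ w g H p →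
      ∀ {y : ℝ × Es d} {s ε M Q : ℝ}, 0 < s → s ≤ 1 → 0 ≤ ε → ε ≤ 1 → 0 ≤ M → 0 ≤ Q →
      Ell θ (a y.2) → ‖a y.2‖ ≤ Λ →
      (∀ x ∈ Metric.ball y.2 (3 * s), ‖a x - a y.2‖ ≤ ε) →
      (∀ x ∈ Metric.ball y.2 (3 * s), ∀ x' ∈ Metric.ball y.2 (3 * s),
        ‖a x - a x'‖ ≤ Λ * ‖x - x'‖ ^ α) →
      Hol (sho α) Λ Λ (Metric.ball y.2 (3 * s)) b →
      (∀ z ∈ Metric.ball y (3 * s), p z = trc (a z.2) (H z) + drf (b z.2) (g z) + f z) →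
      (∀ t, Hol (sho α) M M {x | (t, x) ∈ Metric.ball y (3 * s)} (fun x => w (t, x))) →
      (∀ t, Hol (sho α) M M {x | (t, x) ∈ Metric.ball y (3 * s)} (fun x => g (t, x))) →
      (∀ t, Hol (sho α) M Q {x | (t, x) ∈ Metric.ball y (3 * s)} (fun x => H (t, x))) →
      (∀ t, Hol (sho α) M M {x | (t, x) ∈ Metric.ball y (3 * s)} (fun x => f (t, x))) →
      ∀ x', ‖y.2 - x'‖ < 2 * s →
      ‖H y - H (y.1, x')‖ ≤ N * (ε * Q + s⁻¹ ^ 3 * M) * ‖y.2 - x'‖ ^ α := by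
  obtain ⟨N, hN, hcc⟩ := const_coeff_holder (d := d) hθ hΛ hα hα1
  obtain ⟨K, hK, hbump⟩ := exists_bump (Es d) hα hα1
  set k1 : ℝ := d ^ 2 * Λ + 2 * d * Λ + 2 with hk1
  set k2 : ℝ := d ^ 2 + d * Λ + 4 + 6 * d ^ 2 * Λ with hk2
  refine ⟨N * (d ^ 2 + k1 + K * k2), by positivity, ?_⟩
  intro a b w g H p f A hA hR y s ε M Q hs hs1 hε hε1 hM hQ hEll hay haε haH hbH heq hw hg hH hf
    x' hx'
  obtain ⟨χ, gχ, Hχ, pχ, hχ, hχ1, hχone, hχzero⟩ := hbump y s hs hs1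
  have hσ0 : 0 ≤ s⁻¹ := by positivity
  have hσ1 : 1 ≤ s⁻¹ ^ 3 := one_le_pow₀ ((one_le_inv₀ hs).2 hs1)
  set X := K * s⁻¹ ^ 3 with hX
  have hX0 : 0 ≤ X := by positivity
  have hreg := Reg.mul hX0 hA hχ hR
  set m := a y.2 with hm
  have hd : (0:ℝ) ≤ d := by positivity
  -- the right-hand side of the frozen equation
  have key : ∀ t, Hol (sho α)
      (1 * 1 * (d ^ 2 * ε * M + d * Λ * M + M) + 1 * X * M + d ^ 2 * Λ * X * M
        + 2 * d ^ 2 * Λ * X * M + 1 * 1 * M)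
      (1 * (1 * (d ^ 2 * (ε * Q + Λ * M) + d * (Λ * M + Λ * M) + M)
          + X * (d ^ 2 * ε * M + d * Λ * M + M))
        + 1 * (X * M + X * M) + d ^ 2 * Λ * (X * M + X * M)
        + 2 * d ^ 2 * Λ * (X * M + X * M) + 1 * (1 * M + X * M)) univ
      (fun x => χ (t, x) * (p (t, x) - trc m (H (t, x))) + pχ (t, x) * w (t, x)
        - w (t, x) * trc m (Hχ (t, x))
        - trc m (tens (gχ (t, x)) (g (t, x)) + tens (g (t, x)) (gχ (t, x)))
        + χ (t, x) * w (t, x)) := by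
    intro t
    set S : Set (Es d) := {x | (t, x) ∈ Metric.ball y (3 * s)} with hS
    have hSb : S ⊆ Metric.ball y.2 (3 * s) := fun x hx => by
      rw [hS, mem_ofPred_eq, ← Prod.mk.eta (p := y), ← ball_prod_same] at hx
      exact hx.2
    have z1 : ∀ x ∉ S, χ (t, x) = 0 ∧ gχ (t, x) = 0 ∧ Hχ (t, x) = 0 ∧ pχ (t, x) = 0 :=
      fun x hx => hχzero _ hx
    have sχ : Hol (sho α) 1 X univ (fun x => χ (t, x)) :=
      ⟨fun x _ => hχ1 _, fun x _ x' _ => (hχ.xw.slice hα t).ho x (mem_univ _) x' (mem_univ _)⟩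
    have sp : Hol (sho α) X X univ (fun x => pχ (t, x)) := hχ.xp.slice hα t
    have sg : Hol (sho α) X X univ (fun x => gχ (t, x)) := hχ.xg.slice hα t
    have sH : Hol (sho α) X X univ (fun x => Hχ (t, x)) := hχ.xH.slice hα t
    have ha : Hol (sho α) ε Λ S (fun x => a x - m) :=
      ⟨fun x hx => haε x (hSb hx), fun x hx x' hx' => by
        simpa [sho] using haH x (hSb hx) x' (hSb hx')⟩
    have T1 := ((Hol.bilin (T := trc) (C := d ^ 2) (fun u u' v => trc_sub_left u u' v)
      (fun u v v' => trc_sub_right u v v') (fun u v => norm_trc_le u v) (by positivity) ha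
      (hH t)).add (Hol.bilin (T := drf) (C := d) (fun u u' v => drf_sub_left u u' v)
      (fun u v v' => drf_sub_right u v v') (fun u v => norm_drf_le u v) (by positivity)
      (hbH.subset hSb) (hg t))).add (hf t)
    have T1' : Hol (sho α) (d ^ 2 * ε * M + d * Λ * M + M)
        (d ^ 2 * (ε * Q + Λ * M) + d * (Λ * M + Λ * M) + M) S
        (fun x => p (t, x) - trc m (H (t, x))) := by
      refine T1.congr fun x hx => ?_
      rw [heq _ hx, ← trc_sub_left]
      ring
    have mulcut : ∀ {A1 B1 A2 B2 : ℝ} {u v : Es d → ℝ}, Hol (sho α) A1 B1 univ u →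
        (∀ x ∉ S, u x = 0) → Hol (sho α) A2 B2 S v → 0 ≤ A1 → 0 ≤ B1 → 0 ≤ A2 → 0 ≤ B2 →
        Hol (sho α) (1 * A1 * A2) (1 * (A1 * B2 + B1 * A2)) univ (fun x => u x * v x) := by
      intro A1 B1 A2 B2 u v hu hu0 hv n1 n2 n3 n4
      exact Hol.bilin_cut (T := fun u v : ℝ => u * v) (C := 1) (fun u u' v => by ring)
        (fun u v v' => by ring) (fun u v => by simp) zero_le_one (sho_nonneg α) hu hu0 hv
        n1 n2 n3 n4
    have U1 := mulcut sχ (fun x hx => (z1 x hx).1) T1' zero_le_one hX0 (by positivity)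
      (by positivity)
    have U2 := mulcut sp (fun x hx => (z1 x hx).2.2.2) (hw t) hX0 hX0 hM hM
    have U3 := Hol.bilin_cut (T := fun (u : BL (Es d) (BL (Es d) ℝ)) (v : ℝ) => v * trc m u)
      (C := d ^ 2 * Λ)
      (fun u u' v => by rw [← trc_sub_right]; ring) (fun u v v' => by ring)
      (fun u v => by
        rw [norm_mul, mul_comm]
        refine mul_le_mul_of_nonneg_right ((norm_trc_le m u).trans ?_) (norm_nonneg _)
        gcongr) (by positivity) (sho_nonneg α)
      sH (fun x hx => (z1 x hx).2.2.1) (hw t) hX0 hX0 hM hM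
    have U4 := Hol.bilin_cut
      (T := fun (u v : BL (Es d) ℝ) => trc m (tens u v + tens v u))
      (C := 2 * d ^ 2 * Λ)
      (fun u u' v => by
        rw [trc_sub_right, ← tens_sub_left, ← tens_sub_right, add_sub_add_comm])
      (fun u v v' => by
        rw [trc_sub_right, ← tens_sub_left, ← tens_sub_right, add_sub_add_comm])
      (fun u v => by
        refine (norm_trc_le m _).trans ?_
        have := norm_add_le (tens u v) (tens v u)
        rw [norm_tens, norm_tens] at this
        calc (d:ℝ) ^ 2 * ‖m‖ * ‖tens u v + tens v u‖
            ≤ d ^ 2 * Λ * (‖u‖ * ‖v‖ + ‖v‖ * ‖u‖) := by gcongr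
          _ = _ := by ring) (by positivity) (sho_nonneg α)
      sg (fun x hx => (z1 x hx).2.1) (hg t) hX0 hX0 hM hM
    have U5 := mulcut sχ (fun x hx => (z1 x hx).1) (hw t) zero_le_one hX0 hM hM
    exact (((U1.add U2).sub U3).sub U4).add U5
  have hB : (1 * (1 * (d ^ 2 * (ε * Q + Λ * M) + d * (Λ * M + Λ * M) + M)
          + X * (d ^ 2 * ε * M + d * Λ * M + M))
        + 1 * (X * M + X * M) + d ^ 2 * Λ * (X * M + X * M)
        + 2 * d ^ 2 * Λ * (X * M + X * M) + 1 * (1 * M + X * M))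
      ≤ (d ^ 2 + k1 + K * k2) * (ε * Q + s⁻¹ ^ 3 * M) := by
    have e1 : M ≤ s⁻¹ ^ 3 * M := le_mul_of_one_le_left hM hσ1
    have e2 : X * M = K * (s⁻¹ ^ 3 * M) := by rw [hX]; ring
    set c := s⁻¹ ^ 3 * M with hc
    have hc0 : 0 ≤ c := by positivity
    have e3 : X * (d ^ 2 * ε * M) ≤ K * c * d ^ 2 := by
      calc X * (d ^ 2 * ε * M) = (X * M) * d ^ 2 * ε := by ring
        _ ≤ (X * M) * d ^ 2 * 1 := by gcongr
        _ = _ := by rw [e2]; ring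
    have e4 : M * k1 ≤ c * k1 := by gcongr
    have e5 : 0 ≤ (k1 + K * k2) * (ε * Q) := by positivity
    have e6 : 0 ≤ d ^ 2 * c := by positivity
    calc _ = d ^ 2 * (ε * Q) + M * k1 + X * (d ^ 2 * ε * M) + (X * M) * (d * Λ + 4 + 6 * d ^ 2 * Λ) := by
          rw [hk1]; ring
      _ ≤ d ^ 2 * (ε * Q) + c * k1 + K * c * d ^ 2 + (K * c) * (d * Λ + 4 + 6 * d ^ 2 * Λ) := by
          rw [e2]; linarith
      _ = d ^ 2 * (ε * Q) + (k1 + K * k2) * c := by rw [hk2]; ring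
      _ ≤ _ := by linarith
  have hfin := hcc m hEll hay hreg (B := (d ^ 2 + k1 + K * k2) * (ε * Q + s⁻¹ ^ 3 * M))
    (by positivity) (fun t x x' => by
      have := ((key t).mono (sho_nonneg α) le_rfl hB).ho x (mem_univ _) x' (mem_univ _)
      refine le_trans (le_of_eq ?_) this
      congr 1
      simp only [trc_add_right, trc_smul_right]
      ring) y.1 y.2 x'
  have i1 : y ∈ Metric.ball y (2 * s) := Metric.mem_ball_self (by positivity)
  have i2 : (y.1, x') ∈ Metric.ball y (2 * s) := by
    rw [← Prod.mk.eta (p := y), ← ball_prod_same]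
    refine ⟨Metric.mem_ball_self (by positivity), ?_⟩
    rwa [Metric.mem_ball, dist_comm, dist_eq_norm]
  obtain ⟨c1, c2, c3⟩ := hχone _ i1
  obtain ⟨c4, c5, c6⟩ := hχone _ i2
  have ht0 : ∀ v : BL (Es d) ℝ, tens 0 v = 0 ∧ tens v 0 = 0 := fun v => by
    constructor <;> (ext; simp [tens])
  simp only [Prod.mk.eta, c1, c2, c3, c4, c5, c6, (ht0 _).1, (ht0 _).2, one_smul, smul_zero,
    add_zero] at hfin
  rwa [← mul_assoc] at hfin

end Cut

section Interior
variable {d : ℕ}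

lemma le_rpow_of_le_one {r β : ℝ} (h0 : 0 ≤ r) (h1 : r ≤ 1) (hb1 : β ≤ 1) :
    r ≤ r ^ β := by
  rcases h0.eq_or_lt with h0 | h0
  · rw [← h0]; exact Real.rpow_nonneg le_rfl _
  · calc r = r ^ (1:ℝ) := (Real.rpow_one r).symm
      _ ≤ r ^ β := Real.rpow_le_rpow_of_exponent_ge h0 h1 hb1

lemma holder_of_deriv {E V : Type*} [NormedAddCommGroup E] [NormedSpace ℝ E]
    [NormedAddCommGroup V] [NormedSpace ℝ V] {F : E → V} {F' : E → BL E V} {c : E} {r M α : ℝ}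
    (hα1 : α ≤ 1) (hr : 2 * r ≤ 1)
    (hF : ∀ x ∈ Metric.ball c r, HasFDerivAt F (F' x) x)
    (hM : ∀ x ∈ Metric.ball c r, ‖F' x‖ ≤ M) (x x' : E) (hx : x ∈ Metric.ball c r)
    (hx' : x' ∈ Metric.ball c r) : ‖F x - F x'‖ ≤ M * ‖x - x'‖ ^ α := by
  have h1 := (convex_ball c r).norm_image_sub_le_of_norm_hasFDerivWithin_le
    (fun x hx => (hF x hx).hasFDerivWithinAt) hM hx' hx
  have hM0 : 0 ≤ M := (norm_nonneg _).trans (hM x hx)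
  refine h1.trans (mul_le_mul_of_nonneg_left (le_rpow_of_le_one (norm_nonneg _) ?_ hα1) hM0)
  rw [← dist_eq_norm]
  have := dist_triangle_right x x' c
  have h3 := Metric.mem_ball.1 hx
  have h4 := Metric.mem_ball.1 hx'
  linarith

lemma mem_ball_slice {z0 : ℝ × Es d} {t : ℝ} {x x' : Es d} {r h : ℝ}
    (h1 : (t, x) ∈ Metric.ball z0 r) (h2 : dist x' x ≤ h) (hh : 0 ≤ h) :
    (t, x') ∈ Metric.ball z0 (r + h) := by
  rw [Metric.mem_ball] at *
  have : dist (t, x') (t, x) ≤ h := by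
    rw [Prod.dist_eq, dist_self]; exact max_le hh h2
  linarith [dist_triangle (t, x') (t, x) z0]

/-- Data of a globally smooth function solving a linear parabolic equation in a ball. -/
structure LocSol (α θ Λ A R : ℝ) (z0 : ℝ × Es d) (a : Es d → Fin d → Fin d → ℝ)
    (b : Es d → Fin d → ℝ) (w : ℝ × Es d → ℝ) (g : ℝ × Es d → BL (Es d) ℝ)
    (H : ℝ × Es d → BL (Es d) (BL (Es d) ℝ)) (p f : ℝ × Es d → ℝ) : Prop where
  ell : ∀ x ∈ Metric.ball z0.2 R, Ell θ (a x)
  ha : Hol (sho α) Λ Λ (Metric.ball z0.2 R) a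
  hb : Hol (sho α) Λ Λ (Metric.ball z0.2 R) b
  eq : ∀ z ∈ Metric.ball z0 R, p z = trc (a z.2) (H z) + drf (b z.2) (g z) + f z
  wA : ∀ z ∈ Metric.ball z0 R, |w z| ≤ A
  fA : ∀ z ∈ Metric.ball z0 R, |f z| ≤ A
  fh : ∀ z ∈ Metric.ball z0 R, ∀ z' ∈ Metric.ball z0 R,
    |f z - f z'| ≤ A * rho α z z' + Λ * |w z - w z'|

set_option maxHeartbeats 1000000 in
lemma interior_step {θ Λ α R : ℝ} (hθ : 0 < θ) (hΛ : 0 ≤ Λ) (hα : 0 < α) (hα1 : α < 1)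
    (hR : 0 < R) (hR1 : R ≤ 1) :
    ∃ R0 C, 0 < R0 ∧ R0 ≤ R ∧ 0 ≤ C ∧ ∀ {a : Es d → Fin d → Fin d → ℝ} {b : Es d → Fin d → ℝ}
      {w : ℝ × Es d → ℝ} {g : ℝ × Es d → BL (Es d) ℝ} {H : ℝ × Es d → BL (Es d) (BL (Es d) ℝ)}
      {p f : ℝ × Es d → ℝ} {A1 A : ℝ} {z0 : ℝ × Es d}, 0 ≤ A1 → 0 ≤ A → Reg α A1 univ w g H p →
      LocSol α θ Λ A R z0 a b w g H p f → ∀ Φ, 0 ≤ Φ →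
      (∀ ρ, 0 < ρ → ρ < R0 → ∀ t x x', (t, x) ∈ Metric.ball z0 ρ → (t, x') ∈ Metric.ball z0 ρ →
        ‖H (t, x) - H (t, x')‖ ≤ Φ * (R0 - ρ) ^ (-(3 + 6 / α)) * ‖x - x'‖ ^ α) →
      (∀ ρ, 0 < ρ → ρ < R0 → ∀ t x x', (t, x) ∈ Metric.ball z0 ρ → (t, x') ∈ Metric.ball z0 ρ →
        ‖H (t, x) - H (t, x')‖ ≤ (Φ / 2 + C * A) * (R0 - ρ) ^ (-(3 + 6 / α)) * ‖x - x'‖ ^ α) := by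
  obtain ⟨N, hN, hcut⟩ := cut_step (d := d) hθ hΛ hα hα1
  set γ := 3 + 6 / α with hγ
  have hγ0 : 0 < γ := by positivity
  set N2 := N + 2 with hN2
  have hN20 : 0 < N2 := by positivity
  have h6 : (0:ℝ) < 6 ^ (-γ) := by positivity
  set κ := min 1 (6 ^ (-γ) / (2 * N2 * (3 + 2 * Λ))) with hκ
  have hκ0 : 0 < κ := by positivity
  have hκ1 : κ ≤ 1 := min_le_left _ _
  have hκ2 : N2 * (3 + 2 * Λ) * κ ≤ 6 ^ (-γ) / 2 := by
    have : κ ≤ 6 ^ (-γ) / (2 * N2 * (3 + 2 * Λ)) := min_le_right _ _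
    rw [le_div_iff₀ (by positivity)] at this
    linarith
  set R0 := min R ((κ / (Λ + 1)) ^ (1 / α)) with hR0
  have hR00 : 0 < R0 := by positivity
  have hR0R : R0 ≤ R := min_le_left _ _
  have hosc : Λ * R0 ^ α ≤ κ := by
    have h1 : R0 ^ α ≤ κ / (Λ + 1) := by
      calc R0 ^ α ≤ ((κ / (Λ + 1)) ^ (1 / α)) ^ α :=
            Real.rpow_le_rpow hR00.le (min_le_right _ _) hα.le
        _ = κ / (Λ + 1) := by
            rw [← Real.rpow_mul (by positivity), one_div, inv_mul_cancel₀ hα.ne', Real.rpow_one]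
    calc Λ * R0 ^ α ≤ (Λ + 1) * (κ / (Λ + 1)) := by gcongr; linarith
      _ = κ := by field_simp
  refine ⟨R0, 6 ^ γ * (4 * N2 * (1 + Λ) * κ ^ (-(2 / α))), hR00, hR0R, by positivity, ?_⟩
  intro a b w g H p f A1 A z0 hA1 hA hreg hsol Φ hΦ hP ρ hρ hρR t x x' hx hx'
  set s := (R0 - ρ) / 6 with hs
  have hs0 : 0 < s := by rw [hs]; linarith
  have hRρ : R0 - ρ = 6 * s := by rw [hs]; ring
  have hs6 : 6 * s ≤ 1 := by linarith
  have hs1 : s ≤ 1 := by linarith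
  set Q := Φ * (2 * s) ^ (-γ) with hQ
  have hQ0 : 0 ≤ Q := by positivity
  set h := (κ * s ^ 3) ^ (1 / α) with hh
  have hh0 : 0 < h := by positivity
  have hks : κ * s ^ 3 ≤ s := by
    calc κ * s ^ 3 ≤ 1 * s ^ 1 :=
        mul_le_mul hκ1 (pow_le_pow_of_le_one hs0.le hs1 (by norm_num)) (by positivity) zero_le_one
      _ = s := by ring
  have h1α : 1 ≤ 1 / α := by rw [le_div_iff₀ hα]; linarith
  have hhs : h ≤ s := by
    calc h ≤ s ^ (1 / α) := Real.rpow_le_rpow (by positivity) hks (by positivity)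
      _ ≤ s ^ (1:ℝ) := Real.rpow_le_rpow_of_exponent_ge hs0 hs1 h1α
      _ = s := Real.rpow_one s
  have hhα : h ^ α = κ * s ^ 3 := by
    rw [hh, ← Real.rpow_mul (by positivity), one_div, inv_mul_cancel₀ hα.ne', Real.rpow_one]
  have hh2 : s⁻¹ ^ 3 * (h ^ 2)⁻¹ = κ ^ (-(2 / α)) * s ^ (-γ) := by
    have e1 : (h ^ 2)⁻¹ = κ ^ (-(2 / α)) * s ^ (-(6 / α)) := by
      rw [← Real.rpow_natCast h 2, ← Real.rpow_neg hh0.le, hh, ← Real.rpow_mul (by positivity),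
        Real.mul_rpow hκ0.le (by positivity), ← Real.rpow_natCast s 3, ← Real.rpow_mul hs0.le]
      congr 2
      · push_cast; ring
      · push_cast; ring
    have e2 : s⁻¹ ^ 3 = s ^ (-(3:ℝ)) := by
      rw [Real.rpow_neg hs0.le, inv_pow]
      norm_cast
    rw [e1, e2, hγ, mul_left_comm, ← Real.rpow_add hs0]
    congr 2; ring
  set M0 := 4 * A / h ^ 2 + 2 * (Q * (κ * s ^ 3)) with hM0
  have hM00 : 0 ≤ M0 := by positivity
  have hh1 : h ≤ 1 := hhs.trans hs1
  have hAh : A ≤ A / h ^ 2 := by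
    rw [le_div_iff₀ (by positivity)]
    exact mul_le_of_le_one_right hA (pow_le_one₀ hh0.le hh1)
  have hAh' : A / h ≤ A / h ^ 2 := by
    gcongr
    calc h ^ 2 ≤ h ^ 1 := pow_le_pow_of_le_one hh0.le hh1 (by norm_num)
      _ = h := pow_one h
  have hAh0 : 0 ≤ A / h ^ 2 := by positivity
  have hqk : 0 ≤ Q * (κ * s ^ 3) := by positivity
  have hAM0 : A ≤ M0 := by rw [hM0, mul_div_assoc]; linarith
  have hPQ := hP (ρ + 4 * s) (by linarith) (by linarith)
  have hR2 : R0 - (ρ + 4 * s) = 2 * s := by linarith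
  rw [hR2, ← hQ] at hPQ
  have hsub : Metric.ball z0 (ρ + 4 * s) ⊆ Metric.ball z0 R :=
    Metric.ball_subset_ball (by linarith)
  have hgH : ∀ τ ξ, (τ, ξ) ∈ Metric.ball z0 (ρ + 3 * s) →
      ‖g (τ, ξ)‖ ≤ M0 ∧ ‖H (τ, ξ)‖ ≤ M0 := by
    intro τ ξ hξ
    have hin : ∀ η ∈ Metric.closedBall ξ h, (τ, η) ∈ Metric.ball z0 (ρ + 4 * s) := fun η hη => by
      have := mem_ball_slice (h := s) hξ ((Metric.mem_closedBall.1 hη).trans hhs) hs0.le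
      have e : ρ + 3 * s + s = ρ + 4 * s := by ring
      rwa [e] at this
    obtain ⟨i1, i2⟩ := interp_ball (w := fun x => w (τ, x)) (g := fun x => g (τ, x))
      (H := fun x => H (τ, x)) (x := ξ) (A := A) (K := Q * (κ * s ^ 3)) hh0
      (fun η _ => hreg.dw (τ, η) (mem_univ _)) (fun η _ => hreg.dg (τ, η) (mem_univ _))
      (fun η hη => hsol.wA _ (hsub (hin η hη))) (fun η hη => by
        refine (hPQ τ η ξ (hin η hη) (hin ξ (Metric.mem_closedBall_self hh0.le))).trans ?_
        rw [← hhα, ← dist_eq_norm]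
        gcongr
        exact Metric.mem_closedBall.1 hη)
    constructor
    · refine i1.trans ?_
      have : Q * (κ * s ^ 3) * h ≤ Q * (κ * s ^ 3) := mul_le_of_le_one_right hqk hh1
      rw [hM0, mul_div_assoc]; linarith
    · exact i2
  set M := (1 + Λ) * M0 with hM
  have hM0M : M0 ≤ M := by rw [hM]; nlinarith
  have hM0' : 0 ≤ M := hM00.trans hM0M
  have hmain : ‖H (t, x) - H (t, x')‖ ≤ N2 * (κ * Q + s⁻¹ ^ 3 * M) * ‖x - x'‖ ^ α := by
    rcases lt_or_ge ‖x - x'‖ (2 * s) with hlt | hge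
    · have hy : Metric.ball (t, x) (3 * s) ⊆ Metric.ball z0 (ρ + 3 * s) := by
        intro z hz
        rw [Metric.mem_ball] at *
        linarith [dist_triangle z (t, x) z0]
      have hy4 : Metric.ball (t, x) (3 * s) ⊆ Metric.ball z0 (ρ + 4 * s) :=
        hy.trans (Metric.ball_subset_ball (by linarith))
      have hyR := hy4.trans hsub
      have hyx : Metric.ball x (3 * s) ⊆ Metric.ball z0.2 R := by
        intro ξ hξ
        have : (t, ξ) ∈ Metric.ball z0 R := hyR (by
          rw [← ball_prod_same]; exact ⟨Metric.mem_ball_self (by linarith), hξ⟩)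
        rw [← Prod.mk.eta (p := z0), ← ball_prod_same] at this
        exact this.2
      have hxx : x ∈ Metric.ball x (3 * s) := Metric.mem_ball_self (by linarith)
      have hslice : ∀ τ ξ, (τ, ξ) ∈ Metric.ball (t, x) (3 * s) → ξ ∈ Metric.ball x (3 * s) ∧
          ∀ η ∈ Metric.ball x (3 * s), (τ, η) ∈ Metric.ball (t, x) (3 * s) := by
        intro τ ξ hξ
        rw [← ball_prod_same] at hξ ⊢
        exact ⟨hξ.2, fun η hη => ⟨hξ.1, hη⟩⟩
      have hwS : ∀ τ, Hol (sho α) M M {ξ | (τ, ξ) ∈ Metric.ball (t, x) (3 * s)}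
          (fun ξ => w (τ, ξ)) := fun τ =>
        ⟨fun ξ hξ => ((hsol.wA _ (hyR hξ)).trans hAM0).trans hM0M, fun ξ hξ ξ' hξ' =>
          holder_of_deriv (F := fun η => w (τ, η)) (F' := fun η => g (τ, η)) (c := x) (r := 3 * s)
            hα1.le (by linarith) (fun η _ => hreg.dw (τ, η) (mem_univ _))
            (fun η hη => ((hgH _ _ (hy ((hslice τ ξ hξ).2 η hη))).1).trans hM0M) ξ ξ'
            (hslice τ ξ hξ).1 (hslice τ ξ' hξ').1⟩
      have hwS0 : ∀ τ ξ ξ', (τ, ξ) ∈ Metric.ball (t, x) (3 * s) →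
          (τ, ξ') ∈ Metric.ball (t, x) (3 * s) → |w (τ, ξ) - w (τ, ξ')| ≤ M0 * ‖ξ - ξ'‖ ^ α :=
        fun τ ξ ξ' hξ hξ' =>
          holder_of_deriv (F := fun η => w (τ, η)) (F' := fun η => g (τ, η)) (c := x) (r := 3 * s)
            hα1.le (by linarith) (fun η _ => hreg.dw (τ, η) (mem_univ _))
            (fun η hη => ((hgH _ _ (hy ((hslice τ ξ hξ).2 η hη))).1)) ξ ξ'
            (hslice τ ξ hξ).1 (hslice τ ξ' hξ').1
      have := hcut hA1 hreg (y := (t, x)) hs0 hs1 hκ0.le hκ1 hM0' hQ0 (a := a) (b := b) (f := f)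
        (hsol.ell x (hyx hxx)) (hsol.ha.bd x (hyx hxx))
        (fun ξ hξ => (hsol.ha.ho ξ (hyx hξ) x (hyx hxx)).trans (by
          refine le_trans ?_ hosc
          unfold sho
          gcongr
          rw [← dist_eq_norm]
          exact (Metric.mem_ball.1 hξ).le.trans (by linarith)))
        (fun ξ hξ ξ' hξ' => hsol.ha.ho ξ (hyx hξ) ξ' (hyx hξ'))
        (hsol.hb.subset hyx) (fun z hz => hsol.eq z (hyR hz)) hwS
        (fun τ => ⟨fun ξ hξ => ((hgH _ _ (hy hξ)).1).trans hM0M, fun ξ hξ ξ' hξ' =>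
          holder_of_deriv (F := fun η => g (τ, η)) (F' := fun η => H (τ, η)) (c := x) (r := 3 * s)
            hα1.le (by linarith) (fun η _ => hreg.dg (τ, η) (mem_univ _))
            (fun η hη => ((hgH _ _ (hy ((hslice τ ξ hξ).2 η hη))).2).trans hM0M) ξ ξ'
            (hslice τ ξ hξ).1 (hslice τ ξ' hξ').1⟩)
        (fun τ => ⟨fun ξ hξ => ((hgH _ _ (hy hξ)).2).trans hM0M, fun ξ hξ ξ' hξ' =>
          hPQ τ ξ ξ' (hy4 hξ) (hy4 hξ')⟩)
        (fun τ => ⟨fun ξ hξ => ((hsol.fA _ (hyR hξ)).trans hAM0).trans hM0M, fun ξ hξ ξ' hξ' => by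
          refine (hsol.fh _ (hyR hξ) _ (hyR hξ')).trans ?_
          rw [rho_space hα, hM]
          have h1 := mul_le_mul_of_nonneg_left (hwS0 τ ξ ξ' hξ hξ') hΛ
          have h2 : A * sho α ξ ξ' ≤ M0 * sho α ξ ξ' :=
            mul_le_mul_of_nonneg_right hAM0 (sho_nonneg _ _ _)
          unfold sho at *
          linarith⟩) x' hlt
      refine this.trans ?_
      gcongr
      linarith
    · have hb : ∀ ξ, (t, ξ) ∈ Metric.ball z0 ρ → ‖H (t, ξ)‖ ≤ M := fun ξ hξ =>
        ((hgH t ξ (Metric.ball_subset_ball (by linarith) hξ)).2).trans hM0M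
      have h1 : ‖H (t, x) - H (t, x')‖ ≤ 2 * M :=
        (norm_sub_le _ _).trans (by linarith [hb x hx, hb x' hx'])
      have h2 : 1 ≤ s⁻¹ ^ 3 * ‖x - x'‖ ^ α := by
        have h3 : s ≤ ‖x - x'‖ ^ α := by
          calc s ≤ s ^ α := le_rpow_of_le_one hs0.le hs1 hα1.le
            _ ≤ ‖x - x'‖ ^ α := Real.rpow_le_rpow hs0.le (by linarith) hα.le
        have h4 : s⁻¹ ≤ s⁻¹ ^ 3 := le_self_pow₀ ((one_le_inv₀ hs0).2 hs1) (by norm_num)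
        calc 1 = s⁻¹ * s := by field_simp
          _ ≤ _ := by gcongr
      have h5 : 0 ≤ ‖x - x'‖ ^ α := by positivity
      calc _ ≤ 2 * M * 1 := by linarith
        _ ≤ 2 * M * (s⁻¹ ^ 3 * ‖x - x'‖ ^ α) := by gcongr
        _ = 2 * (s⁻¹ ^ 3 * M) * ‖x - x'‖ ^ α := by ring
        _ ≤ _ := by
          gcongr
          · linarith
          · have : 0 ≤ κ * Q := by positivity
            linarith
  refine hmain.trans (mul_le_mul_of_nonneg_right ?_ (by positivity))
  have h7 : s⁻¹ ^ 3 * M = 4 * (1 + Λ) * κ ^ (-(2 / α)) * A * s ^ (-γ) + 2 * (1 + Λ) * κ * Q := by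
    have e : s⁻¹ ^ 3 * s ^ 3 = 1 := by rw [← mul_pow, inv_mul_cancel₀ hs0.ne', one_pow]
    calc s⁻¹ ^ 3 * M = 4 * (1 + Λ) * A * (s⁻¹ ^ 3 * (h ^ 2)⁻¹)
          + 2 * (1 + Λ) * κ * Q * (s⁻¹ ^ 3 * s ^ 3) := by rw [hM, hM0]; ring
      _ = _ := by rw [hh2, e]; ring
  have h8 : (R0 - ρ) ^ (-γ) = 6 ^ (-γ) * s ^ (-γ) := by
    rw [hRρ, Real.mul_rpow (by norm_num) hs0.le]
  have h9 : (6:ℝ) ^ γ * 6 ^ (-γ) = 1 := by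
    rw [← Real.rpow_add (by norm_num)]; simp
  have h10 : Q ≤ Φ * s ^ (-γ) := by
    rw [hQ]
    gcongr 1
    exact Real.rpow_le_rpow_of_nonpos hs0 (by linarith) (by linarith)
  calc N2 * (κ * Q + s⁻¹ ^ 3 * M) = (N2 * (3 + 2 * Λ) * κ) * Q
        + 4 * N2 * (1 + Λ) * κ ^ (-(2 / α)) * A * s ^ (-γ) := by rw [h7]; ring
    _ ≤ (6 ^ (-γ) / 2) * (Φ * s ^ (-γ)) + 4 * N2 * (1 + Λ) * κ ^ (-(2 / α)) * A * s ^ (-γ) := by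
        gcongr
    _ = (6 ^ (-γ) / 2) * (Φ * s ^ (-γ))
        + (6 ^ γ * 6 ^ (-γ)) * (4 * N2 * (1 + Λ) * κ ^ (-(2 / α)) * A * s ^ (-γ)) := by
        rw [h9, one_mul]
    _ = _ := by rw [h8]; ring

lemma interior_holder {θ Λ α R : ℝ} (hθ : 0 < θ) (hΛ : 0 ≤ Λ) (hα : 0 < α) (hα1 : α < 1)
    (hR : 0 < R) (hR1 : R ≤ 1) :
    ∃ r C, 0 < r ∧ r ≤ R ∧ 0 ≤ C ∧ ∀ {a : Es d → Fin d → Fin d → ℝ} {b : Es d → Fin d → ℝ}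
      {w : ℝ × Es d → ℝ} {g : ℝ × Es d → BL (Es d) ℝ} {H : ℝ × Es d → BL (Es d) (BL (Es d) ℝ)}
      {p f : ℝ × Es d → ℝ} {A1 A : ℝ} {z0 : ℝ × Es d}, 0 ≤ A1 → 0 ≤ A → Reg α A1 univ w g H p →
      LocSol α θ Λ A R z0 a b w g H p f → ∀ t x x', (t, x) ∈ Metric.ball z0 r →
      (t, x') ∈ Metric.ball z0 r → ‖H (t, x) - H (t, x')‖ ≤ C * A * ‖x - x'‖ ^ α := by
  obtain ⟨R0, C, hR0, hR0R, hC, hstep⟩ := interior_step (d := d) hθ hΛ hα hα1 hR hR1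
  set γ := 3 + 6 / α with hγ
  have hγ0 : 0 < γ := by positivity
  refine ⟨R0 / 2, 2 * C * (R0 / 2) ^ (-γ), by positivity, by linarith, by positivity, ?_⟩
  intro a b w g H p f A1 A z0 hA1 hA hreg hsol t x x' hx hx'
  have hn : ∀ n : ℕ, ∀ ρ, 0 < ρ → ρ < R0 → ∀ t x x', (t, x) ∈ Metric.ball z0 ρ →
      (t, x') ∈ Metric.ball z0 ρ → ‖H (t, x) - H (t, x')‖
        ≤ (2 * (C * A) + A1 * (1 / 2) ^ n) * (R0 - ρ) ^ (-γ) * ‖x - x'‖ ^ α := by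
    intro n
    induction n with
    | zero =>
      intro ρ hρ hρR t x x' hx hx'
      have h1 := hreg.xH.ho (t, x) (mem_univ _) (t, x') (mem_univ _)
      rw [rho_space hα] at h1
      refine h1.trans (mul_le_mul_of_nonneg_right ?_ (sho_nonneg _ _ _))
      have h2 : 1 ≤ (R0 - ρ) ^ (-γ) :=
        Real.one_le_rpow_of_pos_of_le_one_of_nonpos (by linarith) (by linarith) (by linarith)
      have h3 : 0 ≤ C * A := by positivity
      calc A1 = A1 * 1 := by ring
        _ ≤ (2 * (C * A) + A1 * (1 / 2) ^ 0) * (R0 - ρ) ^ (-γ) := by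
          gcongr
          simp; linarith
    | succ n ih =>
      have := hstep hA1 hA hreg hsol _ (by positivity) ih
      have e : (2 * (C * A) + A1 * (1 / 2) ^ n) / 2 + C * A
          = 2 * (C * A) + A1 * (1 / 2) ^ (n + 1) := by rw [pow_succ]; ring
      rwa [e] at this
  have hlim : Tendsto (fun n : ℕ => (2 * (C * A) + A1 * (1 / 2) ^ n) * (R0 - R0 / 2) ^ (-γ)
      * ‖x - x'‖ ^ α) atTop (𝓝 ((2 * (C * A) + A1 * 0) * (R0 - R0 / 2) ^ (-γ) * ‖x - x'‖ ^ α)) := by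
    have := tendsto_pow_atTop_nhds_zero_of_lt_one (r := (1/2 : ℝ)) (by norm_num) (by norm_num)
    exact (((this.const_mul A1).const_add _).mul_const _).mul_const _
  have := ge_of_tendsto' hlim fun n => hn n (R0 / 2) (by positivity) (by linarith) t x x' hx hx'
  refine this.trans (le_of_eq ?_)
  rw [show R0 - R0 / 2 = R0 / 2 by ring]
  ring

end Interior

section InteriorFinal
variable {d : ℕ}

lemma Hol.trc {Z : Type*} {ϱ : Z → Z → ℝ} {A B A' B' : ℝ} {S : Set Z}
    {a : Z → Fin d → Fin d → ℝ} {H : Z → BL (Es d) (BL (Es d) ℝ)} (ha : Hol ϱ A B S a)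
    (hH : Hol ϱ A' B' S H) :
    Hol ϱ ((d:ℝ) ^ 2 * A * A') ((d:ℝ) ^ 2 * (A * B' + B * A')) S (fun z => trc (a z) (H z)) :=
  Hol.bilin (T := fun m H => _root_.trc m H) (fun _ _ _ => trc_sub_left _ _ _)
    (fun _ _ _ => trc_sub_right _ _ _) (fun _ _ => norm_trc_le _ _) (by positivity) ha hH

lemma Hol.drf {Z : Type*} {ϱ : Z → Z → ℝ} {A B A' B' : ℝ} {S : Set Z}
    {b : Z → Fin d → ℝ} {g : Z → BL (Es d) ℝ} (hb : Hol ϱ A B S b) (hg : Hol ϱ A' B' S g) :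
    Hol ϱ ((d:ℝ) * A * A') ((d:ℝ) * (A * B' + B * A')) S (fun z => drf (b z) (g z)) :=
  Hol.bilin (T := fun m H => _root_.drf m H) (fun _ _ _ => drf_sub_left _ _ _)
    (fun _ _ _ => drf_sub_right _ _ _) (fun _ _ => norm_drf_le _ _) (by positivity) hb hg

lemma Hol.comp_snd {V : Type*} [NormedAddCommGroup V] {α A B : ℝ} {S : Set (Es d)}
    {f : Es d → V} (hB : 0 ≤ B) (hf : Hol (sho α) A B S f) :
    Hol (rho α) A B {z : ℝ × Es d | z.2 ∈ S} (fun z => f z.2) :=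
  ⟨fun z hz => hf.bd _ hz, fun z hz z' hz' => (hf.ho _ hz _ hz').trans
    (mul_le_mul_of_nonneg_left (by
      unfold sho rho
      have : 0 ≤ |z.1 - z'.1| ^ (α / 3) := by positivity
      linarith) hB)⟩

/-- Hölder continuity on a ball from separate bounds in space and time. -/
lemma Hol.of_space_time {V : Type*} [NormedAddCommGroup V] {α A B : ℝ} {z0 : ℝ × Es d} {r : ℝ}
    {f : ℝ × Es d → V} (h0 : ∀ z ∈ Metric.ball z0 r, ‖f z‖ ≤ A)
    (h1 : ∀ t x x', (t, x) ∈ Metric.ball z0 r → (t, x') ∈ Metric.ball z0 r →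
      ‖f (t, x) - f (t, x')‖ ≤ B * ‖x - x'‖ ^ α)
    (h2 : ∀ t t' x, (t, x) ∈ Metric.ball z0 r → (t', x) ∈ Metric.ball z0 r →
      ‖f (t, x) - f (t', x)‖ ≤ B * |t - t'| ^ (α / 3)) :
    Hol (rho α) A B (Metric.ball z0 r) f := by
  refine ⟨h0, ?_⟩
  rintro ⟨t, x⟩ hz ⟨t', x'⟩ hz'
  have hm : (t, x') ∈ Metric.ball z0 r := by
    rw [← Prod.mk.eta (p := z0), ← ball_prod_same] at hz hz' ⊢
    exact ⟨hz.1, hz'.2⟩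
  have e : f (t, x) - f (t', x') = (f (t, x) - f (t, x')) + (f (t, x') - f (t', x')) := by abel
  rw [e, rho, mul_add]
  exact (norm_add_le _ _).trans (add_le_add (h1 t x x' hz hm) (h2 t t' x' hm hz'))

set_option maxHeartbeats 1000000 in
/-- A spatial Hölder bound for the Hessian of a solution yields full regularity. -/
lemma reg_of_spatial_holder {Λ α r1 R C1 : ℝ} (hΛ : 0 ≤ Λ) (hα : 0 < α) (hα1 : α < 1)
    (hr1 : 0 < r1) (hr1R : r1 ≤ R) (hR1 : R ≤ 1) (hC1 : 0 ≤ C1) :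
    ∃ C, 0 ≤ C ∧ ∀ {θ : ℝ} {a : Es d → Fin d → Fin d → ℝ} {b : Es d → Fin d → ℝ}
      {w : ℝ × Es d → ℝ} {g : ℝ × Es d → BL (Es d) ℝ} {H : ℝ × Es d → BL (Es d) (BL (Es d) ℝ)}
      {p f : ℝ × Es d → ℝ} {A : ℝ} {z0 : ℝ × Es d}, 0 ≤ A →
      (∀ z, HasFDerivAt (fun x => w (z.1, x)) (g z) z.2) →
      (∀ z, HasFDerivAt (fun x => g (z.1, x)) (H z) z.2) →
      (∀ z, HasDerivAt (fun t => w (t, z.2)) (p z) z.1) →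
      (∀ t x x', (t, x) ∈ Metric.ball z0 r1 → (t, x') ∈ Metric.ball z0 r1 →
        ‖H (t, x) - H (t, x')‖ ≤ C1 * A * ‖x - x'‖ ^ α) →
      LocSol α θ Λ A R z0 a b w g H p f → Reg α (C * A) (Metric.ball z0 (r1 / 4)) w g H p := by
  have hr11 : r1 ≤ 1 := hr1R.trans hR1
  set B := 4 / (r1 / 4) ^ 2 + 2 * C1 with hB
  have hB0 : 0 ≤ B := by positivity
  set P := (d:ℝ) ^ 2 * Λ * B + d * Λ * B + 1 with hP
  have hP0 : 0 ≤ P := by positivity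
  set T := 4 * P / (r1 / 8) ^ 2 + 4 * C1 with hT
  have hT0 : 0 ≤ T := by positivity
  set W := B + C1 + P + T with hW
  have hW0 : 0 ≤ W := by positivity
  set X := (d:ℝ) ^ 2 * (Λ * W + Λ * W) + (d:ℝ) * (Λ * W + Λ * W) + (1 + Λ * W) with hX
  have hX0 : 0 ≤ X := by positivity
  refine ⟨W + P + X, by positivity, ?_⟩
  intro θ a b w g H p f A z0 hA dw dg dt hHs hsol
  have sub1 : ∀ {r}, r ≤ r1 → Metric.ball z0 r ⊆ Metric.ball z0 r1 := fun h =>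
    Metric.ball_subset_ball h
  have subR : Metric.ball z0 r1 ⊆ Metric.ball z0 R := Metric.ball_subset_ball hr1R
  have hα3 : α / 3 ≤ 1 := by linarith
  have hα30 : 0 < α / 3 := by positivity
  -- sup bounds on the half ball
  have hgH : ∀ z ∈ Metric.ball z0 (r1 / 2), ‖g z‖ ≤ B * A ∧ ‖H z‖ ≤ B * A := by
    rintro ⟨t, x⟩ hz
    have hh : 0 < r1 / 4 := by positivity
    have hin : ∀ η ∈ Metric.closedBall x (r1 / 4), (t, η) ∈ Metric.ball z0 r1 := fun η hη =>
      sub1 (by linarith) (mem_ball_slice hz (Metric.mem_closedBall.1 hη) hh.le)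
    obtain ⟨i1, i2⟩ := interp_ball (w := fun x => w (t, x)) (g := fun x => g (t, x))
      (H := fun x => H (t, x)) (x := x) (A := A) (K := C1 * A) hh
      (fun η _ => dw (t, η)) (fun η _ => dg (t, η))
      (fun η hη => hsol.wA _ (subR (hin η hη))) (fun η hη => by
        refine (hHs t η x (hin η hη) (hin x (Metric.mem_closedBall_self hh.le))).trans ?_
        refine mul_le_of_le_one_right (by positivity) (Real.rpow_le_one (norm_nonneg _) ?_ hα.le)
        rw [← dist_eq_norm]
        linarith [Metric.mem_closedBall.1 hη])
    have e : B * A = 4 * A / (r1 / 4) ^ 2 + 2 * (C1 * A) := by rw [hB]; ring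
    refine ⟨i1.trans ?_, i2.trans e.ge⟩
    rw [e]
    have h1 : A / (r1 / 4) ≤ 4 * A / (r1 / 4) ^ 2 := by
      rw [div_le_div_iff₀ hh (by positivity)]
      have : 0 ≤ A * (r1 / 4) := by positivity
      nlinarith
    have h2 : C1 * A * (r1 / 4) ≤ C1 * A := mul_le_of_le_one_right (by positivity) (by linarith)
    have h3 : 0 ≤ C1 * A := by positivity
    linarith
  have sub2 : Metric.ball z0 (r1 / 2) ⊆ Metric.ball z0 R := (sub1 (by linarith)).trans subR
  have snd : ∀ {z} {r : ℝ}, z ∈ Metric.ball z0 r → z.2 ∈ Metric.ball z0.2 r := by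
    intro z r hz
    rw [← Prod.mk.eta (p := z0), ← ball_prod_same] at hz
    exact hz.2
  have hp : ∀ z ∈ Metric.ball z0 (r1 / 2), ‖p z‖ ≤ P * A := by
    intro z hz
    rw [hsol.eq z (sub2 hz)]
    have ha := hsol.ha.bd _ (snd (sub2 hz))
    have hb := hsol.hb.bd _ (snd (sub2 hz))
    have h1 : ‖trc (a z.2) (H z)‖ ≤ (d:ℝ) ^ 2 * Λ * (B * A) := by
      refine (norm_trc_le _ _).trans ?_
      gcongr
      exact (hgH z hz).2
    have h2 : ‖drf (b z.2) (g z)‖ ≤ (d:ℝ) * Λ * (B * A) := by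
      refine (norm_drf_le _ _).trans ?_
      gcongr
      exact (hgH z hz).1
    have h3 : ‖f z‖ ≤ A := hsol.fA z (sub2 hz)
    calc _ ≤ ‖trc (a z.2) (H z)‖ + ‖drf (b z.2) (g z)‖ + ‖f z‖ := norm_add₃_le
      _ ≤ (d:ℝ) ^ 2 * Λ * (B * A) + (d:ℝ) * Λ * (B * A) + A := by linarith
      _ = P * A := by rw [hP]; ring
  have hwt : ∀ t t' x, (t, x) ∈ Metric.ball z0 (r1 / 2) → (t', x) ∈ Metric.ball z0 (r1 / 2) →
      |w (t, x) - w (t', x)| ≤ P * A * |t - t'| := by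
    intro t t' x h h'
    rw [← Prod.mk.eta (p := z0), ← ball_prod_same] at h h'
    refine (convex_ball z0.1 (r1 / 2)).norm_image_sub_le_of_norm_hasDerivWithin_le
      (f := fun s => w (s, x)) (f' := fun s => p (s, x))
      (fun s _ => (dt (s, x)).hasDerivWithinAt) (fun s hs => hp (s, x) ?_)
      h'.1 h.1
    rw [← Prod.mk.eta (p := z0), ← ball_prod_same]
    exact ⟨hs, h.2⟩
  have hdist : ∀ t t' x, (t, x) ∈ Metric.ball z0 (r1 / 4) → (t', x) ∈ Metric.ball z0 (r1 / 4) →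
      |t - t'| ≤ 1 := by
    intro t t' x h h'
    rw [← Prod.mk.eta (p := z0), ← ball_prod_same] at h h'
    have h1 := Metric.mem_ball.1 h.1
    have h2 := Metric.mem_ball.1 h'.1
    rw [← Real.dist_eq]
    linarith [dist_triangle_right t t' z0.1]
  have htime : ∀ t t' x, (t, x) ∈ Metric.ball z0 (r1 / 4) → (t', x) ∈ Metric.ball z0 (r1 / 4) →
      ‖g (t, x) - g (t', x)‖ ≤ T * A * |t - t'| ^ (α / 3) ∧
      ‖H (t, x) - H (t', x)‖ ≤ T * A * |t - t'| ^ (α / 3) := by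
    intro t t' x h h'
    rcases eq_or_ne t t' with rfl | hne
    · have : 0 ≤ T * A * |t - t| ^ (α / 3) := by positivity
      simpa using this
    set τ := |t - t'| with hτ
    have hτ0 : 0 < τ := abs_pos.2 (sub_ne_zero.2 hne)
    have hτ1 : τ ≤ 1 := hdist t t' x h h'
    set k := τ ^ (1 / 3 : ℝ) with hk
    have hk0 : 0 < k := by positivity
    have hk1 : k ≤ 1 := Real.rpow_le_one hτ0.le hτ1 (by norm_num)
    have hk3 : k ^ 3 = τ := by
      rw [hk, ← Real.rpow_natCast, ← Real.rpow_mul hτ0.le]; norm_num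
    have hkα : k ^ α = τ ^ (α / 3) := by
      rw [hk, ← Real.rpow_mul hτ0.le]; congr 1; ring
    have hkle : k ≤ τ ^ (α / 3) := by
      rw [← hkα]; exact le_rpow_of_le_one hk0.le hk1 hα1.le
    have hh : 0 < r1 / 8 * k := by positivity
    have hh1 : r1 / 8 * k ≤ r1 / 8 := mul_le_of_le_one_right (by positivity) hk1
    have hin : ∀ s, (s, x) ∈ Metric.ball z0 (r1 / 4) →
        ∀ η ∈ Metric.closedBall x (r1 / 8 * k), (s, η) ∈ Metric.ball z0 (r1 / 2) :=
      fun s hs η hη => Metric.ball_subset_ball (by linarith)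
        (mem_ball_slice hs ((Metric.mem_closedBall.1 hη).trans hh1) (by positivity))
    have hx0 : x ∈ Metric.closedBall x (r1 / 8 * k) := Metric.mem_closedBall_self hh.le
    have hHx : ∀ s, (s, x) ∈ Metric.ball z0 (r1 / 4) →
        ∀ η ∈ Metric.closedBall x (r1 / 8 * k), ‖H (s, η) - H (s, x)‖ ≤ C1 * A * τ ^ (α / 3) := by
      intro s hs η hη
      refine (hHs s η x (sub1 (by linarith) (hin s hs η hη))
        (sub1 (by linarith) (hin s hs x hx0))).trans ?_
      rw [← hkα, ← dist_eq_norm]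
      gcongr
      have : r1 / 8 * k ≤ k := mul_le_of_le_one_left hk0.le (by linarith)
      exact (Metric.mem_closedBall.1 hη).trans this
    obtain ⟨i1, i2⟩ := interp_ball (w := fun x => w (t, x) - w (t', x))
      (g := fun x => g (t, x) - g (t', x))
      (H := fun x => H (t, x) - H (t', x)) (x := x) (A := P * A * τ)
      (K := 2 * (C1 * A * τ ^ (α / 3))) hh
      (fun η _ => (dw (t, η)).sub (dw (t', η)))
      (fun η _ => (dg (t, η)).sub (dg (t', η)))
      (fun η hη => hwt t t' η (hin t h η hη) (hin t' h' η hη)) (fun η hη => by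
        have e : H (t, η) - H (t', η) - (H (t, x) - H (t', x))
          = (H (t, η) - H (t, x)) - (H (t', η) - H (t', x)) := by abel
        rw [e]
        refine (norm_sub_le _ _).trans ?_
        linarith [hHx t h η hη, hHx t' h' η hη])
    have h2 : 4 * (P * A * τ) / (r1 / 8 * k) ^ 2 ≤ 4 * P / (r1 / 8) ^ 2 * A * τ ^ (α / 3) := by
      calc _ = 4 * P / (r1 / 8) ^ 2 * A * k := by rw [← hk3]; field_simp
        _ ≤ _ := by gcongr
    have e : T * A * τ ^ (α / 3) = 4 * P / (r1 / 8) ^ 2 * A * τ ^ (α / 3)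
        + 2 * (2 * (C1 * A * τ ^ (α / 3))) := by rw [hT]; ring
    have h3 : 0 ≤ C1 * A * τ ^ (α / 3) := by positivity
    have hh1' : r1 / 8 * k ≤ 1 := by linarith
    refine ⟨i1.trans ?_, i2.trans (by linarith)⟩
    have h4 : P * A * τ / (r1 / 8 * k) ≤ 4 * (P * A * τ) / (r1 / 8 * k) ^ 2 := by
      rw [div_le_div_iff₀ hh (by positivity)]
      have h5 : 0 ≤ P * A * τ * (r1 / 8 * k) := by positivity
      calc P * A * τ * (r1 / 8 * k) ^ 2 = (P * A * τ * (r1 / 8 * k)) * (r1 / 8 * k) := by ring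
        _ ≤ (P * A * τ * (r1 / 8 * k)) * 1 := by gcongr
        _ ≤ _ := by linarith
    have h6 : 2 * (C1 * A * τ ^ (α / 3)) * (r1 / 8 * k) ≤ 2 * (C1 * A * τ ^ (α / 3)) :=
      mul_le_of_le_one_right (by positivity) hh1'
    linarith
  have sub4 : Metric.ball z0 (r1 / 4) ⊆ Metric.ball z0 (r1 / 2) :=
    Metric.ball_subset_ball (by linarith)
  have sub4R := sub4.trans sub2
  have hBW : B * A ≤ W * A := by gcongr; linarith
  have hTW : T * A ≤ W * A := by gcongr; linarith
  have hPW : P * A ≤ W * A := by gcongr; linarith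
  have hCW : C1 * A ≤ W * A := by gcongr; linarith
  have slice : ∀ {t x}, (t, x) ∈ Metric.ball z0 (r1 / 4) → x ∈ Metric.ball z0.2 (r1 / 4) ∧
      ∀ η ∈ Metric.ball z0.2 (r1 / 4), (t, η) ∈ Metric.ball z0 (r1 / 4) := by
    intro t x h
    rw [← Prod.mk.eta (p := z0), ← ball_prod_same] at h ⊢
    exact ⟨h.2, fun η hη => ⟨h.1, hη⟩⟩
  have xw : Hol (rho α) A (W * A) (Metric.ball z0 (r1 / 4)) w := by
    refine Hol.of_space_time (fun z hz => hsol.wA z (sub4R hz)) (fun t x x' h h' => ?_)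
      (fun t t' x h h' => ?_)
    · exact (holder_of_deriv (F := fun η => w (t, η)) (F' := fun η => g (t, η)) (c := z0.2)
        (r := r1 / 4) (M := W * A) hα1.le (by linarith)
        (fun η _ => dw (t, η))
        (fun η hη => ((hgH _ (sub4 ((slice h).2 η hη))).1).trans hBW) x x' (slice h).1 (slice h').1)
    · refine (hwt t t' x (sub4 h) (sub4 h')).trans ?_
      gcongr
      exact le_rpow_of_le_one (abs_nonneg _) (hdist t t' x h h') hα3
  have xg : Hol (rho α) (W * A) (W * A) (Metric.ball z0 (r1 / 4)) g := by
    refine Hol.of_space_time (fun z hz => ((hgH z (sub4 hz)).1).trans hBW)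
      (fun t x x' h h' => ?_) (fun t t' x h h' => ((htime t t' x h h').1).trans (by gcongr))
    exact (holder_of_deriv (F := fun η => g (t, η)) (F' := fun η => H (t, η)) (c := z0.2)
        (r := r1 / 4) (M := W * A) hα1.le (by linarith)
        (fun η _ => dg (t, η))
        (fun η hη => ((hgH _ (sub4 ((slice h).2 η hη))).2).trans hBW) x x' (slice h).1 (slice h').1)
  have xH : Hol (rho α) (W * A) (W * A) (Metric.ball z0 (r1 / 4)) H :=
    Hol.of_space_time (fun z hz => ((hgH z (sub4 hz)).2).trans hBW)
      (fun t x x' h h' => (hHs t x x' (sub1 (by linarith) h) (sub1 (by linarith) h')).trans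
        (by gcongr))
      (fun t t' x h h' => ((htime t t' x h h').2).trans (by gcongr))
  have ha : Hol (rho α) Λ Λ (Metric.ball z0 (r1 / 4)) (fun z => a z.2) :=
    (hsol.ha.comp_snd hΛ).subset fun z hz => snd (sub4R hz)
  have hb : Hol (rho α) Λ Λ (Metric.ball z0 (r1 / 4)) (fun z => b z.2) :=
    (hsol.hb.comp_snd hΛ).subset fun z hz => snd (sub4R hz)
  have hf : Hol (rho α) A ((1 + Λ * W) * A) (Metric.ball z0 (r1 / 4)) f := by
    refine ⟨fun z hz => hsol.fA z (sub4R hz), fun z hz z' hz' => ?_⟩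
    have h1 := mul_le_mul_of_nonneg_left (xw.ho z hz z' hz') hΛ
    have h2 := hsol.fh z (sub4R hz) z' (sub4R hz')
    rw [Real.norm_eq_abs] at h1 ⊢
    linarith
  have xp : Hol (rho α) (P * A) (X * A) (Metric.ball z0 (r1 / 4)) p := by
    refine ⟨fun z hz => hp z (sub4 hz), ?_⟩
    have := ((ha.trc xH).add (hb.drf xg)).add hf
    have h2 := (this.congr fun z hz => (hsol.eq z (sub4R hz)).symm).ho
    intro z hz z' hz'
    refine (h2 z hz z' hz').trans (mul_le_mul_of_nonneg_right (le_of_eq ?_) (rho_nonneg _ _ _))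
    rw [hX]; ring
  have hA' : A ≤ (W + P + X) * A := by
    have : 1 ≤ W + P + X := by
      have h1 : 0 ≤ (d:ℝ) ^ 2 * Λ * B + d * Λ * B := by positivity
      linarith
    nlinarith
  have hWA : W * A ≤ (W + P + X) * A := by gcongr; linarith
  have hPA : P * A ≤ (W + P + X) * A := by gcongr; linarith
  have hXA : X * A ≤ (W + P + X) * A := by gcongr; linarith
  exact ⟨fun z _ => dw z, fun z _ => dg z,
    fun z _ => dt z, xw.mono (rho_nonneg α) hA' hWA,
    xg.mono (rho_nonneg α) hWA hWA, xH.mono (rho_nonneg α) hWA hWA,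
    xp.mono (rho_nonneg α) hPA hXA⟩

/-- Interior Schauder estimate. -/
lemma interior_reg {θ Λ α R : ℝ} (hθ : 0 < θ) (hΛ : 0 ≤ Λ) (hα : 0 < α) (hα1 : α < 1)
    (hR : 0 < R) (hR1 : R ≤ 1) :
    ∃ r C, 0 < r ∧ r ≤ R ∧ 0 ≤ C ∧ ∀ {a : Es d → Fin d → Fin d → ℝ} {b : Es d → Fin d → ℝ}
      {w : ℝ × Es d → ℝ} {g : ℝ × Es d → BL (Es d) ℝ} {H : ℝ × Es d → BL (Es d) (BL (Es d) ℝ)}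
      {p f : ℝ × Es d → ℝ} {A1 A : ℝ} {z0 : ℝ × Es d}, 0 ≤ A1 → 0 ≤ A → Reg α A1 univ w g H p →
      LocSol α θ Λ A R z0 a b w g H p f → Reg α (C * A) (Metric.ball z0 r) w g H p := by
  obtain ⟨r1, C1, hr1, hr1R, hC1, hH⟩ := interior_holder (d := d) hθ hΛ hα hα1 hR hR1
  obtain ⟨C, hC, h⟩ := reg_of_spatial_holder (d := d) hΛ hα hα1 hr1 hr1R hR1 hC1
  refine ⟨r1 / 4, C, by positivity, by linarith, hC, ?_⟩
  intro a b w g H p f A1 A z0 hA1 hA hreg hsol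
  exact h hA (fun z => hreg.dw z (mem_univ _)) (fun z => hreg.dg z (mem_univ _))
    (fun z => hreg.dt z (mem_univ _)) (hH hA1 hA hreg hsol) hsol

end InteriorFinal

section Closure

/-- Limits of functions whose derivatives are equi-Hölder. -/
lemma hasFDerivAt_of_tendsto_holder {ι F V : Type*} [NormedAddCommGroup F] [NormedSpace ℝ F]
    [NormedAddCommGroup V] [NormedSpace ℝ V] {U : Filter ι} [U.NeBot] {f : ι → F → V}
    {f' : ι → F → BL F V} {k : F → V} {k' : BL F V} {x : F} {ε A α : ℝ} (hε : 0 < ε) (hα : 0 < α)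
    (hd : ∀ᶠ n in U, ∀ y ∈ Metric.ball x ε, HasFDerivAt (f n) (f' n y) y ∧
      ‖f' n y - f' n x‖ ≤ A * ‖y - x‖ ^ α)
    (hf : ∀ y ∈ Metric.ball x ε, Tendsto (fun n => f n y) U (𝓝 (k y)))
    (hf' : Tendsto (fun n => f' n x) U (𝓝 k')) : HasFDerivAt k k' x := by
  have hA : ∀ r, 0 ≤ r → r < ε → ∀ y, ‖y - x‖ ≤ r → A * ‖y - x‖ ^ α ≤ |A| * r ^ α := by
    intro r hr _ y hy
    gcongr
    exact le_abs_self A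
  have key : ∀ y ∈ Metric.ball x ε, ‖k y - k x - k' (y - x)‖ ≤ |A| * ‖y - x‖ ^ α * ‖y - x‖ := by
    intro y hy
    have hx := Metric.mem_ball_self (x := x) hε
    have ht : Tendsto (fun n => ‖f n y - f n x - f' n x (y - x)‖) U
        (𝓝 ‖k y - k x - k' (y - x)‖) :=
      (((hf y hy).sub (hf x hx)).sub
        (((ContinuousLinearMap.apply ℝ V (y - x)).continuous.tendsto k').comp hf')).norm
    refine le_of_tendsto ht ?_
    filter_upwards [hd] with n hn
    have hyε : ‖y - x‖ < ε := mem_ball_iff_norm.1 hy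
    have hsub : ∀ y' ∈ Metric.closedBall x ‖y - x‖, y' ∈ Metric.ball x ε := fun y' hy' =>
      Metric.mem_ball.2 ((Metric.mem_closedBall.1 hy').trans_lt hyε)
    exact (convex_closedBall x ‖y - x‖).norm_image_sub_le_of_norm_hasFDerivWithin_le'
      (fun y' hy' => (hn y' (hsub y' hy')).1.hasFDerivWithinAt)
      (fun y' hy' => ((hn y' (hsub y' hy')).2).trans
        (hA _ (norm_nonneg _) hyε y' (mem_closedBall_iff_norm.1 hy')))
      (Metric.mem_closedBall_self (norm_nonneg _)) (mem_closedBall_iff_norm.2 le_rfl)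
  refine HasFDerivAt.of_isLittleO (Asymptotics.isLittleO_iff.2 fun c hc => ?_)
  have h0 : Tendsto (fun y => |A| * ‖y - x‖ ^ α) (𝓝 x) (𝓝 0) := by
    have h1 : Continuous fun y : F => |A| * ‖y - x‖ ^ α :=
      continuous_const.mul (Continuous.rpow_const (by fun_prop) fun _ => Or.inr hα.le)
    have := h1.tendsto x
    simpa [Real.zero_rpow hα.ne'] using this
  filter_upwards [h0.eventually (gt_mem_nhds hc), Metric.ball_mem_nhds x hε] with y hy hy'
  exact (key y hy').trans (mul_le_mul_of_nonneg_right hy.le (norm_nonneg _))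

lemma exists_tendsto_of_bounded {V : Type*} [NormedAddCommGroup V] [ProperSpace V]
    {U : Ultrafilter ℕ} {f : ℕ → V} {A : ℝ} (h : ∀ᶠ n in (U : Filter ℕ), ‖f n‖ ≤ A) :
    ∃ l, Tendsto f U (𝓝 l) := by
  obtain ⟨l, _, hl⟩ := (isCompact_closedBall (0 : V) A).ultrafilter_le_nhds (U.map f) (by
    rw [le_principal_iff]
    show ∀ᶠ n in (U : Filter ℕ), f n ∈ Metric.closedBall 0 A
    simpa using h)
  exact ⟨l, hl⟩

variable {d : ℕ} {U : Ultrafilter ℕ}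

lemma Hol.of_tendsto {Z V : Type*} [NormedAddCommGroup V] {ϱ : Z → Z → ℝ} {A B : ℝ} {S : Set Z}
    {f : ℕ → Z → V} {k : Z → V} (h : ∀ᶠ n in (U : Filter ℕ), Hol ϱ A B S (f n))
    (hk : ∀ z ∈ S, Tendsto (fun n => f n z) U (𝓝 (k z))) : Hol ϱ A B S k :=
  ⟨fun z hz => le_of_tendsto (hk z hz).norm (h.mono fun _ hn => hn.bd z hz),
    fun z hz z' hz' => le_of_tendsto ((hk z hz).sub (hk z' hz')).norm
      (h.mono fun _ hn => hn.ho z hz z' hz')⟩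

/-- Compactness of bounded sets of regular functions under pointwise convergence. -/
lemma Reg.closure {α A : ℝ} (hα : 0 < α) {S : Set (ℝ × Es d)} (hS : IsOpen S)
    {w : ℕ → ℝ × Es d → ℝ} {g : ℕ → ℝ × Es d → BL (Es d) ℝ}
    {H : ℕ → ℝ × Es d → BL (Es d) (BL (Es d) ℝ)} {p : ℕ → ℝ × Es d → ℝ}
    (h : ∀ᶠ n in (U : Filter ℕ), Reg α A S (w n) (g n) (H n) (p n)) :
    ∃ w' g' H' p', Reg α A S w' g' H' p' ∧ ∀ z ∈ S, Tendsto (fun n => w n z) U (𝓝 (w' z)) ∧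
      Tendsto (fun n => g n z) U (𝓝 (g' z)) ∧ Tendsto (fun n => H n z) U (𝓝 (H' z)) ∧
      Tendsto (fun n => p n z) U (𝓝 (p' z)) := by
  haveI : ProperSpace (BL (Es d) ℝ) := FiniteDimensional.proper_real _
  haveI : ProperSpace (BL (Es d) (BL (Es d) ℝ)) := FiniteDimensional.proper_real _
  have cw : ∀ z, ∃ l, z ∈ S → Tendsto (fun n => w n z) U (𝓝 l) := fun z => by
    by_cases hz : z ∈ S
    · obtain ⟨l, hl⟩ := exists_tendsto_of_bounded (h.mono fun _ hn => hn.xw.bd z hz)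
      exact ⟨l, fun _ => hl⟩
    · exact ⟨0, fun h => absurd h hz⟩
  have cg : ∀ z, ∃ l, z ∈ S → Tendsto (fun n => g n z) U (𝓝 l) := fun z => by
    by_cases hz : z ∈ S
    · obtain ⟨l, hl⟩ := exists_tendsto_of_bounded (h.mono fun _ hn => hn.xg.bd z hz)
      exact ⟨l, fun _ => hl⟩
    · exact ⟨0, fun h => absurd h hz⟩
  have cH : ∀ z, ∃ l, z ∈ S → Tendsto (fun n => H n z) U (𝓝 l) := fun z => by
    by_cases hz : z ∈ S
    · obtain ⟨l, hl⟩ := exists_tendsto_of_bounded (h.mono fun _ hn => hn.xH.bd z hz)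
      exact ⟨l, fun _ => hl⟩
    · exact ⟨0, fun h => absurd h hz⟩
  have cp : ∀ z, ∃ l, z ∈ S → Tendsto (fun n => p n z) U (𝓝 l) := fun z => by
    by_cases hz : z ∈ S
    · obtain ⟨l, hl⟩ := exists_tendsto_of_bounded (h.mono fun _ hn => hn.xp.bd z hz)
      exact ⟨l, fun _ => hl⟩
    · exact ⟨0, fun h => absurd h hz⟩
  choose w' hw using cw
  choose g' hg using cg
  choose H' hH using cH
  choose p' hp using cp
  refine ⟨w', g', H', p', ⟨?_, ?_, ?_, Hol.of_tendsto (h.mono fun _ hn => hn.xw) hw,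
    Hol.of_tendsto (h.mono fun _ hn => hn.xg) hg, Hol.of_tendsto (h.mono fun _ hn => hn.xH) hH,
    Hol.of_tendsto (h.mono fun _ hn => hn.xp) hp⟩,
    fun z hz => ⟨hw z hz, hg z hz, hH z hz, hp z hz⟩⟩
  · rintro ⟨t, x⟩ hz
    obtain ⟨ε, hε, hb⟩ := Metric.isOpen_iff.1 hS _ hz
    have hin : ∀ y ∈ Metric.ball x ε, (t, y) ∈ S := fun y hy => hb (by
      rw [← ball_prod_same]; exact ⟨Metric.mem_ball_self hε, hy⟩)
    refine hasFDerivAt_of_tendsto_holder (U := (U : Filter ℕ)) (f := fun n y => w n (t, y))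
      (f' := fun n y => g n (t, y)) hε hα (A := A) ?_ (fun y hy => hw _ (hin y hy)) (hg _ hz)
    filter_upwards [h] with n hn y hy
    refine ⟨hn.dw _ (hin y hy), ?_⟩
    have := hn.xg.ho _ (hin y hy) _ hz
    rwa [rho_space hα] at this
  · rintro ⟨t, x⟩ hz
    obtain ⟨ε, hε, hb⟩ := Metric.isOpen_iff.1 hS _ hz
    have hin : ∀ y ∈ Metric.ball x ε, (t, y) ∈ S := fun y hy => hb (by
      rw [← ball_prod_same]; exact ⟨Metric.mem_ball_self hε, hy⟩)
    refine hasFDerivAt_of_tendsto_holder (U := (U : Filter ℕ)) (f := fun n y => g n (t, y))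
      (f' := fun n y => H n (t, y)) hε hα (A := A) ?_ (fun y hy => hg _ (hin y hy)) (hH _ hz)
    filter_upwards [h] with n hn y hy
    refine ⟨hn.dg _ (hin y hy), ?_⟩
    have := hn.xH.ho _ (hin y hy) _ hz
    rwa [rho_space hα] at this
  · rintro ⟨t, x⟩ hz
    obtain ⟨ε, hε, hb⟩ := Metric.isOpen_iff.1 hS _ hz
    have hin : ∀ s ∈ Metric.ball t ε, (s, x) ∈ S := fun s hs => hb (by
      rw [← ball_prod_same]; exact ⟨hs, Metric.mem_ball_self hε⟩)
    refine hasFDerivAt_of_tendsto_holder (U := (U : Filter ℕ)) (f := fun n s => w n (s, x))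
      (f' := fun n s => ContinuousLinearMap.toSpanSingleton ℝ (p n (s, x))) hε
      (α := α / 3) (by positivity) (A := A) ?_ (fun s hs => hw _ (hin s hs))
      (((ContinuousLinearMap.toSpanSingletonCLE (𝕜 := ℝ) (E := ℝ)).continuous.tendsto _).comp
        (hp _ hz))
    filter_upwards [h] with n hn s hs
    refine ⟨(hn.dt _ (hin s hs)).hasFDerivAt, ?_⟩
    have h1 := hn.xp.ho _ (hin s hs) _ hz
    have e : ContinuousLinearMap.toSpanSingleton ℝ (p n (s, x))
        - ContinuousLinearMap.toSpanSingleton ℝ (p n (t, x))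
        = ContinuousLinearMap.toSpanSingleton ℝ (p n (s, x) - p n (t, x)) := by ext; simp
    rw [e, ContinuousLinearMap.norm_toSpanSingleton]
    refine h1.trans (le_of_eq ?_)
    simp [rho, Real.zero_rpow hα.ne']

end Closure

section Linear
variable {d : ℕ}

lemma le_rho_of_le_dist {α r : ℝ} (hα : 0 < α) (hα1 : α < 1) (hr : 0 < r) (hr1 : r ≤ 1)
    {z z' : ℝ × Es d} (h : r ≤ dist z z') : r ≤ rho α z z' := by
  have h1 : 0 ≤ ‖z.2 - z'.2‖ ^ α := by positivity
  have h2 : 0 ≤ |z.1 - z'.1| ^ (α / 3) := by positivity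
  rw [Prod.dist_eq, le_max_iff, Real.dist_eq, dist_eq_norm] at h
  unfold rho
  rcases h with h | h
  · have := (le_rpow_of_le_one hr.le hr1 (by linarith : α / 3 ≤ 1)).trans
      (Real.rpow_le_rpow hr.le h (by positivity))
    linarith
  · have := (le_rpow_of_le_one hr.le hr1 hα1.le).trans (Real.rpow_le_rpow hr.le h hα.le)
    linarith

lemma Hol.of_balls {V : Type*} [NormedAddCommGroup V] {α A r : ℝ} (hα : 0 < α) (hα1 : α < 1)
    (hA : 0 ≤ A) (hr : 0 < r) (hr1 : r ≤ 1) {f : ℝ × Es d → V}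
    (h : ∀ z0, XH α A (Metric.ball z0 r) f) : XH α (A * (1 + 2 / r)) univ f := by
  have hb : ∀ z, ‖f z‖ ≤ A := fun z => (h z).bd z (Metric.mem_ball_self hr)
  have h2r : 0 ≤ 2 / r := by positivity
  refine ⟨fun z _ => (hb z).trans (by nlinarith), fun z _ z' _ => ?_⟩
  rcases lt_or_ge (dist z' z) r with hlt | hge
  · refine ((h z).ho z (Metric.mem_ball_self hr) z' hlt).trans ?_
    exact mul_le_mul_of_nonneg_right (by nlinarith) (rho_nonneg _ _ _)
  · rw [dist_comm] at hge
    have h1 := le_rho_of_le_dist hα hα1 hr hr1 hge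
    calc ‖f z - f z'‖ ≤ 2 * A := (norm_sub_le _ _).trans (by linarith [hb z, hb z'])
      _ = A * (2 / r) * r := by field_simp
      _ ≤ A * (1 + 2 / r) * rho α z z' := by gcongr; linarith

lemma Reg.of_balls {α A r : ℝ} (hα : 0 < α) (hα1 : α < 1) (hA : 0 ≤ A) (hr : 0 < r) (hr1 : r ≤ 1)
    {w : ℝ × Es d → ℝ} {g : ℝ × Es d → BL (Es d) ℝ} {H : ℝ × Es d → BL (Es d) (BL (Es d) ℝ)}
    {p : ℝ × Es d → ℝ} (h : ∀ z0, Reg α A (Metric.ball z0 r) w g H p) :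
    Reg α (A * (1 + 2 / r)) univ w g H p :=
  ⟨fun z _ => (h z).dw z (Metric.mem_ball_self hr), fun z _ => (h z).dg z (Metric.mem_ball_self hr),
    fun z _ => (h z).dt z (Metric.mem_ball_self hr),
    Hol.of_balls hα hα1 hA hr hr1 fun z => (h z).xw,
    Hol.of_balls hα hα1 hA hr hr1 fun z => (h z).xg,
    Hol.of_balls hα hα1 hA hr hr1 fun z => (h z).xH,
    Hol.of_balls hα hα1 hA hr hr1 fun z => (h z).xp⟩

/-- Globally bounded and Hölder continuous elliptic coefficients. -/
structure Coef (α θ Λ : ℝ) (a : Es d → Fin d → Fin d → ℝ) (b : Es d → Fin d → ℝ) : Prop where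
  ell : ∀ x, Ell θ (a x)
  ha : Hol (sho α) Λ Λ univ a
  hb : Hol (sho α) Λ Λ univ b

/-- Global Schauder estimate. -/
lemma global_reg {θ Λ α : ℝ} (hθ : 0 < θ) (hΛ : 0 ≤ Λ) (hα : 0 < α) (hα1 : α < 1) :
    ∃ N, 0 ≤ N ∧ ∀ {a : Es d → Fin d → Fin d → ℝ} {b : Es d → Fin d → ℝ}
      {w : ℝ × Es d → ℝ} {g : ℝ × Es d → BL (Es d) ℝ} {H : ℝ × Es d → BL (Es d) (BL (Es d) ℝ)}
      {p f : ℝ × Es d → ℝ} {A1 A : ℝ}, Coef α θ Λ a b → 0 ≤ A1 → 0 ≤ A → Reg α A1 univ w g H p →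
      (∀ z, p z = trc (a z.2) (H z) + drf (b z.2) (g z) + f z) → (∀ z, |w z| ≤ A) →
      (∀ z, |f z| ≤ A) → (∀ z z', |f z - f z'| ≤ A * rho α z z' + Λ * |w z - w z'|) →
      Reg α (N * A) univ w g H p := by
  obtain ⟨r, C, hr, hr1, hC, h⟩ := interior_reg (d := d) hθ hΛ hα hα1 one_pos le_rfl
  refine ⟨C * (1 + 2 / r), by positivity, ?_⟩
  intro a b w g H p f A1 A hc hA1 hA hreg heq hw hf hfh
  have := Reg.of_balls hα hα1 (by positivity : 0 ≤ C * A) hr hr1 fun z0 => h hA1 hA hreg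
    (⟨fun x _ => hc.ell x, hc.ha.subset (subset_univ _), hc.hb.subset (subset_univ _),
      fun z _ => heq z, fun z _ => hw z, fun z _ => hf z, fun z _ z' _ => hfh z z'⟩ :
      LocSol α θ Λ A 1 z0 a b w g H p f)
  exact this.mono (le_of_eq (by ring))

/-- The identity coefficient matrix. -/
def idc (d : ℕ) : Fin d → Fin d → ℝ := fun i j => if i = j then 1 else 0

lemma ell_idc : Ell 1 (idc d) := by
  refine ⟨fun i j => by simp [idc, eq_comm], fun ν => ?_⟩
  rw [EuclideanSpace.norm_sq_eq]
  simp [idc, pow_two]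

lemma norm_idc_le : ‖idc d‖ ≤ 1 := by
  refine (pi_norm_le_iff_of_nonneg zero_le_one).2 fun i =>
    (pi_norm_le_iff_of_nonneg zero_le_one).2 fun j => ?_
  unfold idc
  split_ifs <;> simp

lemma trc_idc (H : BL (Es d) (BL (Es d) ℝ)) : trc (idc d) H = (1 / 2) * ∑ i, H (eb i) (eb i) := by
  simp [trc, idc]

lemma trc_add_left (m m' : Fin d → Fin d → ℝ) (H : BL (Es d) (BL (Es d) ℝ)) :
    trc (m + m') H = trc m H + trc m' H := by
  simp only [trc, ← mul_add, ← Finset.sum_add_distrib, Pi.add_apply, add_mul]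

lemma trc_smul_left (c : ℝ) (m : Fin d → Fin d → ℝ) (H : BL (Es d) (BL (Es d) ℝ)) :
    trc (c • m) H = c * trc m H := by
  simp only [trc, Pi.smul_apply, smul_eq_mul, Finset.mul_sum]
  refine Finset.sum_congr rfl fun i _ => Finset.sum_congr rfl fun j _ => by ring

lemma drf_smul_left (c : ℝ) (b : Fin d → ℝ) (g : BL (Es d) ℝ) : drf (c • b) g = c * drf b g := by
  simp only [drf, Pi.smul_apply, smul_eq_mul, Finset.mul_sum]
  refine Finset.sum_congr rfl fun i _ => by ring

/-- Solvability of `∂w/∂t = ½Δw - w + f`. -/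
lemma heat_solve {α : ℝ} (hα : 0 < α) (hα1 : α < 1) {f : ℝ × Es d → ℝ} {A : ℝ} (hA : 0 ≤ A)
    (hf : XH α A univ f) : ∃ K w g H p, 0 ≤ K ∧ Reg α K univ w g H p ∧
      ∀ z, p z = trc (idc d) (H z) - w z + f z := by
  let σ : Es d ≃L[ℝ] Es d := ContinuousLinearEquiv.refl ℝ (Es d)
  have hs : ‖(σ : Es d →L[ℝ] Es d)‖ ≤ 1 := ContinuousLinearMap.norm_id_le
  have hs2 : ‖(σ.symm : Es d →L[ℝ] Es d)‖ ≤ 1 := ContinuousLinearMap.norm_id_le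
  have hc := hf.continuous hα
  have hA' : ∀ z, ‖f z‖ ≤ A := fun z => hf.bd z (mem_univ _)
  have hB : ∀ t x y, ‖f (t, x) - f (t, y)‖ ≤ A * ‖x - y‖ ^ α := fun t x y => by
    have := hf.ho (t, x) (mem_univ _) (t, y) (mem_univ _)
    rwa [rho_space hα] at this
  have q1 := fun t x => hasFDerivAt_potW σ hs hs2 le_rfl hc hα hα1 hA' hA hB t x
  have q2 := fun t x => hasFDerivAt_potG σ hs hs2 le_rfl hc hα hα1 hA' hA hB t x
  have q3 := fun t x => hasDerivAt_potW σ hs hs2 le_rfl hc hα hα1 hA' hA hB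
    (EuclideanSpace.basisFun (Fin d) ℝ) t x
  have q5 := norm_potW_le σ hs hs2 le_rfl hc hα hα1 hA' hA hB
  have q6 := norm_potH_sub_le σ hs hs2 le_rfl hc hα hα1 hA' hA hB
  have q4 := continuous_potW σ hs hs2 le_rfl hc hα hα1 hA' hA hB
  set C1 := 8 * ((1:ℝ) ^ 2 * mG (Es d)) ^ 3 * (2 / α + 2 / (1 - α)) with hC1
  have hC10 : 0 ≤ C1 := by
    have : 0 < 1 - α := by linarith
    have : 0 ≤ mG (Es d) := integral_nonneg fun x => by positivity
    positivity
  have hΓ : Real.Gamma 1 = 1 := Real.Gamma_one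
  rw [hΓ] at q5
  obtain ⟨C, hC, hreg⟩ := reg_of_spatial_holder (d := d) (Λ := 1) zero_le_one hα hα1
    (one_pos (α := ℝ)) le_rfl le_rfl hC10
  have hp : ∀ z, HasDerivAt (fun t => potW σ f (t, z.2))
      (trc (idc d) (potH σ f z) - potW σ f z + f z) z.1 := fun z => by
    have := q3 z.1 z.2
    rw [trc_idc]
    simpa [σ] using this
  have hall : ∀ z0, Reg α (C * (2 * A)) (Metric.ball z0 (1 / 4)) (potW σ f) (potG σ f) (potH σ f)
      (fun z => trc (idc d) (potH σ f z) - potW σ f z + f z) := fun z0 => by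
    refine hreg (θ := 1) (a := fun _ => idc d) (b := fun _ => 0) (f := fun z => f z - potW σ f z)
      (by positivity) (fun z => q1 z.1 z.2) (fun z => q2 z.1 z.2) hp ?_ ?_
    · intro t x x' _ _
      refine (q6 t x x').trans ?_
      have h0 : 0 ≤ ‖x - x'‖ ^ α := by positivity
      have h1 : 0 ≤ C1 * A * ‖x - x'‖ ^ α := by positivity
      calc _ = C1 * A * ‖x - x'‖ ^ α := by rw [hC1]; ring
        _ ≤ C1 * (2 * A) * ‖x - x'‖ ^ α := by linarith
    · refine ⟨fun _ _ => ell_idc, ⟨fun _ _ => norm_idc_le, fun _ _ _ _ => ?_⟩,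
        ⟨fun _ _ => by simp, fun _ _ _ _ => ?_⟩, fun z _ => ?_, fun z _ => ?_, fun z _ => ?_,
        fun z _ z' _ => ?_⟩
      · simpa using sho_nonneg _ _ _
      · simpa using sho_nonneg _ _ _
      · simp [drf]; ring
      · have := q5 z
        rw [Real.norm_eq_abs] at this
        linarith
      · have h1 := q5 z
        have h2 := hA' z
        refine (norm_sub_le (f z) _).trans ?_
        linarith
      · have h1 := hf.ho z (mem_univ _) z' (mem_univ _)
        have h2 : 0 ≤ A * rho α z z' := mul_nonneg hA (rho_nonneg _ _ _)
        have e : f z - potW σ f z - (f z' - potW σ f z')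
            = (f z - f z') - (potW σ f z - potW σ f z') := by ring
        rw [e]
        refine (norm_sub_le (f z - f z') _).trans ?_
        rw [Real.norm_eq_abs (potW σ f z - potW σ f z')]
        linarith
  exact ⟨_, _, _, _, _, by positivity, Reg.of_balls hα hα1 (by positivity) (by norm_num)
    (by norm_num) hall, fun z => rfl⟩

end Linear

section Continuity
variable {d : ℕ}

/-- The difference between the operator `L - lam` and the model operator `½Δ - 1`. -/
noncomputable def mop (a : Es d → Fin d → Fin d → ℝ) (b : Es d → Fin d → ℝ) (lam : ℝ)
    (w : ℝ × Es d → ℝ) (g : ℝ × Es d → BL (Es d) ℝ) (H : ℝ × Es d → BL (Es d) (BL (Es d) ℝ))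
    (z : ℝ × Es d) : ℝ :=
  trc (a z.2) (H z) - trc (idc d) (H z) + drf (b z.2) (g z) - (lam - 1) * w z

lemma Coef.xa {α θ Λ : ℝ} {a : Es d → Fin d → Fin d → ℝ} {b : Es d → Fin d → ℝ} (hΛ : 0 ≤ Λ)
    (hc : Coef α θ Λ a b) : XH α Λ univ (fun z : ℝ × Es d => a z.2) :=
  (hc.ha.comp_snd hΛ).subset fun _ _ => mem_univ _

lemma Coef.xb {α θ Λ : ℝ} {a : Es d → Fin d → Fin d → ℝ} {b : Es d → Fin d → ℝ} (hΛ : 0 ≤ Λ)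
    (hc : Coef α θ Λ a b) : XH α Λ univ (fun z : ℝ × Es d => b z.2) :=
  (hc.hb.comp_snd hΛ).subset fun _ _ => mem_univ _

lemma mop_xh {α θ Λ lam K : ℝ} {a : Es d → Fin d → Fin d → ℝ} {b : Es d → Fin d → ℝ}
    {w : ℝ × Es d → ℝ} {g : ℝ × Es d → BL (Es d) ℝ} {H : ℝ × Es d → BL (Es d) (BL (Es d) ℝ)}
    {p : ℝ × Es d → ℝ} (hΛ : 0 ≤ Λ) (hlam : 1 ≤ lam) (hlamΛ : lam ≤ Λ) (hK : 0 ≤ K)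
    (hc : Coef α θ Λ a b) (h : Reg α K univ w g H p) :
    XH α ((2 * d ^ 2 * Λ + d ^ 2 + 2 * d * Λ + Λ) * K) univ (mop a b lam w g H) := by
  have h1 : XH α (2 * d ^ 2 * Λ * K) univ (fun z => trc (a z.2) (H z)) := by
    have := (hc.xa hΛ).trc h.xH
    have h0 : 0 ≤ (d:ℝ) ^ 2 * Λ * K := by positivity
    exact this.mono (rho_nonneg α) (by linarith) (by linarith)
  have h2 : XH α (d ^ 2 * K) univ (fun z => trc (idc d) (H z)) := by
    have := (Hol.const (ϱ := rho α) (S := univ) (idc d)).trc h.xH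
    have h0 : (d:ℝ) ^ 2 * ‖idc d‖ * K ≤ (d:ℝ) ^ 2 * 1 * K := by gcongr; exact norm_idc_le
    exact this.mono (rho_nonneg α) (by linarith) (by linarith)
  have h3 : XH α (2 * d * Λ * K) univ (fun z => drf (b z.2) (g z)) := by
    have := (hc.xb hΛ).drf h.xg
    have h0 : 0 ≤ (d:ℝ) * Λ * K := by positivity
    exact this.mono (rho_nonneg α) (by linarith) (by linarith)
  have h4 : XH α (Λ * K) univ (fun z => (lam - 1) * w z) := by
    have := (Hol.const (ϱ := rho α) (S := univ) (lam - 1)).mul h.xw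
    have h0 : ‖lam - 1‖ * K ≤ Λ * K := by
      gcongr
      rw [Real.norm_eq_abs, abs_of_nonneg (by linarith)]
      linarith
    exact this.mono (rho_nonneg α) (by linarith) (by linarith)
  exact (((h1.sub h2).add h3).sub h4).mono (rho_nonneg α) (le_of_eq (by ring)) (le_of_eq (by ring))

lemma Coef.interp {α θ Λ s : ℝ} {a : Es d → Fin d → Fin d → ℝ} {b : Es d → Fin d → ℝ}
    (hΛ : 0 ≤ Λ) (hc : Coef α θ Λ a b) (hs : s ∈ Icc (0:ℝ) 1) :
    Coef α (min θ 1) (Λ + 1) (fun x => (1 - s) • idc d + s • a x) (fun x => s • b x) := by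
  have h0 := hs.1
  have h1 : 0 ≤ 1 - s := by linarith [hs.2]
  refine ⟨fun x => ⟨fun i j => ?_, fun ν => ?_⟩, ⟨fun x _ => ?_, fun x _ y _ => ?_⟩,
    ⟨fun x _ => ?_, fun x _ y _ => ?_⟩⟩
  · simp only [Pi.add_apply, Pi.smul_apply]
    rw [(hc.ell x).symm i j, ell_idc.symm i j]
  · have e : ∑ i, ∑ j, ((1 - s) • idc d + s • a x) i j * ν i * ν j
        = (1 - s) * ∑ i, ∑ j, idc d i j * ν i * ν j + s * ∑ i, ∑ j, a x i j * ν i * ν j := by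
      simp only [Finset.mul_sum, ← Finset.sum_add_distrib]
      refine Finset.sum_congr rfl fun i _ => Finset.sum_congr rfl fun j _ => ?_
      simp only [Pi.add_apply, Pi.smul_apply, smul_eq_mul]
      ring
    rw [e]
    have e1 := mul_le_mul_of_nonneg_left (ell_idc.ell ν) h1
    have e2 := mul_le_mul_of_nonneg_left ((hc.ell x).ell ν) h0
    have hn : 0 ≤ ‖ν‖ ^ 2 := by positivity
    have e3 : min θ 1 * ‖ν‖ ^ 2 ≤ θ * ‖ν‖ ^ 2 := by gcongr; exact min_le_left _ _
    have e4 : min θ 1 * ‖ν‖ ^ 2 ≤ 1 * ‖ν‖ ^ 2 := by gcongr; exact min_le_right _ _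
    nlinarith [mul_le_mul_of_nonneg_left e3 h0, mul_le_mul_of_nonneg_left e4 h1]
  · refine (norm_add_le _ _).trans ?_
    rw [norm_smul, norm_smul, Real.norm_of_nonneg h0, Real.norm_of_nonneg h1]
    have e1 := hc.ha.bd x (mem_univ _)
    have e2 := norm_idc_le (d := d)
    nlinarith [norm_nonneg (a x), norm_nonneg (idc d), hs.2]
  · have e : (1 - s) • idc d + s • a x - ((1 - s) • idc d + s • a y) = s • (a x - a y) := by
      rw [smul_sub]; abel
    rw [e, norm_smul, Real.norm_of_nonneg h0]
    have e1 := hc.ha.ho x (mem_univ _) y (mem_univ _)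
    have e2 := sho_nonneg α x y
    nlinarith [norm_nonneg (a x - a y), hs.2]
  · rw [norm_smul, Real.norm_of_nonneg h0]
    have e1 := hc.hb.bd x (mem_univ _)
    nlinarith [norm_nonneg (b x), hs.2]
  · rw [← smul_sub, norm_smul, Real.norm_of_nonneg h0]
    have e1 := hc.hb.ho x (mem_univ _) y (mem_univ _)
    have e2 := sho_nonneg α x y
    nlinarith [norm_nonneg (b x - b y), hs.2]

/-- A priori bound along the method of continuity. -/
lemma continuity_apriori {θ Λ α lam : ℝ} (hθ : 0 < θ) (hΛ : 0 ≤ Λ) (hα : 0 < α) (hα1 : α < 1)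
    (hlam : 1 ≤ lam) (hlamΛ : lam ≤ Λ) :
    ∃ N, 0 ≤ N ∧ ∀ {a : Es d → Fin d → Fin d → ℝ} {b : Es d → Fin d → ℝ}
      {w : ℝ × Es d → ℝ} {g : ℝ × Es d → BL (Es d) ℝ} {H : ℝ × Es d → BL (Es d) (BL (Es d) ℝ)}
      {p f : ℝ × Es d → ℝ} {A1 A s : ℝ}, Coef α θ Λ a b → s ∈ Icc (0:ℝ) 1 → 0 ≤ A1 → 0 ≤ A →
      Reg α A1 univ w g H p → XH α A univ f →
      (∀ z, p z = trc (idc d) (H z) - w z + s * mop a b lam w g H z + f z) →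
      Reg α (N * A) univ w g H p := by
  obtain ⟨N, hN, h⟩ := global_reg (d := d) (θ := min θ 1) (Λ := Λ + 1) (by positivity)
    (by positivity) hα hα1
  refine ⟨N * (1 + Λ), by positivity, ?_⟩
  intro a b w g H p f A1 A s hc hs hA1 hA hreg hf heq
  have hci := hc.interp hΛ hs
  have hs0 := hs.1
  have hs1 := hs.2
  set μ := 1 + s * (lam - 1) with hμ
  have hμ1 : 1 ≤ μ := by rw [hμ]; nlinarith
  have hμΛ : μ ≤ Λ := by rw [hμ]; nlinarith
  have heq' : ∀ z, p z = trc ((1 - s) • idc d + s • a z.2) (H z) + drf (s • b z.2) (g z)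
      + (f z - μ * w z) := fun z => by
    rw [heq, mop, trc_add_left, trc_smul_left, trc_smul_left, drf_smul_left, hμ]
    ring
  have hfb : ∀ z, |f z| ≤ A := fun z => hf.bd z (mem_univ _)
  have hcw := hreg.xw.continuous hα
  have hup : ∀ z, w z - A ≤ 0 := by
    refine mp_univ (K := A1) (Λ := Λ + 1) (G := g) (H := H) (p := p)
      (m := fun z => (1 - s) • idc d + s • a z.2) (b := fun z => s • b z.2)
      (hcw.sub continuous_const) (fun z => ?_) (fun z => (hreg.dw z (mem_univ _)).sub_const A)
      (fun z => hreg.dg z (mem_univ _)) (fun z => (hreg.dt z (mem_univ _)).sub_const A)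
      (fun z => (hci.ell z.2).posSemidef (by positivity)) (fun z => hci.ha.bd _ (mem_univ _))
      (fun z => hci.hb.bd _ (mem_univ _)) (fun z hz => ?_)
    · have := (abs_le.1 (hreg.xw.bd z (mem_univ _))).2
      linarith
    · rw [heq' z]
      have := (abs_le.1 (hfb z)).2
      nlinarith
  have hlo : ∀ z, -w z - A ≤ 0 := by
    refine mp_univ (K := A1) (Λ := Λ + 1) (G := fun z => -g z) (H := fun z => -H z)
      (p := fun z => -p z)
      (m := fun z => (1 - s) • idc d + s • a z.2) (b := fun z => s • b z.2)
      (hcw.neg.sub continuous_const) (fun z => ?_)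
      (fun z => (hreg.dw z (mem_univ _)).neg.sub_const A)
      (fun z => (hreg.dg z (mem_univ _)).neg) (fun z => (hreg.dt z (mem_univ _)).neg.sub_const A)
      (fun z => (hci.ell z.2).posSemidef (by positivity)) (fun z => hci.ha.bd _ (mem_univ _))
      (fun z => hci.hb.bd _ (mem_univ _)) (fun z hz => ?_)
    · have := (abs_le.1 (hreg.xw.bd z (mem_univ _))).1
      linarith
    · rw [heq' z, trc_neg_right, drf_neg_right]
      have := (abs_le.1 (hfb z)).1
      nlinarith
  have hwA : ∀ z, |w z| ≤ A := fun z => abs_le.2 ⟨by linarith [hlo z], by linarith [hup z]⟩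
  have hAΛ : A ≤ (1 + Λ) * A := by nlinarith
  have := h (f := fun z => f z - μ * w z) (A := (1 + Λ) * A) hci hA1 (by positivity) hreg heq'
    (fun z => (hwA z).trans hAΛ) (fun z => by
      refine (abs_sub _ _).trans ?_
      rw [abs_mul, abs_of_nonneg (by linarith : 0 ≤ μ)]
      have := hwA z
      have := hfb z
      nlinarith [abs_nonneg (w z)]) (fun z z' => by
      have e : f z - μ * w z - (f z' - μ * w z') = (f z - f z') - μ * (w z - w z') := by ring
      rw [e]
      refine (abs_sub _ _).trans ?_
      rw [abs_mul, abs_of_nonneg (by linarith : 0 ≤ μ)]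
      have h1 : |f z - f z'| ≤ A * rho α z z' := hf.ho z (mem_univ _) z' (mem_univ _)
      have h2 : A * rho α z z' ≤ (1 + Λ) * A * rho α z z' :=
        mul_le_mul_of_nonneg_right hAΛ (rho_nonneg _ _ _)
      nlinarith [abs_nonneg (w z - w z')])
  exact this.mono (le_of_eq (by ring))

/-- Solvability at parameter `s` of the method of continuity. -/
def SolvAt (α lam N : ℝ) (a : Es d → Fin d → Fin d → ℝ) (b : Es d → Fin d → ℝ) (s : ℝ) : Prop :=
  ∀ A, 0 ≤ A → ∀ f : ℝ × Es d → ℝ, XH α A univ f → ∃ w g H p, Reg α (N * A) univ w g H p ∧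
    ∀ z, p z = trc (idc d) (H z) - w z + s * mop a b lam w g H z + f z

lemma SolvAt.step {θ Λ α lam N s s' : ℝ} {a : Es d → Fin d → Fin d → ℝ} {b : Es d → Fin d → ℝ}
    (hΛ : 0 ≤ Λ) (hα : 0 < α) (hlam : 1 ≤ lam) (hlamΛ : lam ≤ Λ) (hN : 0 ≤ N)
    (hc : Coef α θ Λ a b) (hs : SolvAt α lam N a b s)
    (hss : |s' - s| * ((2 * d ^ 2 * Λ + d ^ 2 + 2 * d * Λ + Λ) * N) ≤ 1 / 2) :
    SolvAt α lam (2 * N) a b s' := by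
  intro A hA f hf
  have hn : ∀ n : ℕ, ∃ W G H P e, Reg α (2 * N * A * (1 - (1 / 2) ^ n)) univ W G H P ∧
      XH α (A * (1 / 2) ^ n) univ e ∧
      ∀ z, P z = trc (idc d) (H z) - W z + s' * mop a b lam W G H z + f z - e z := by
    intro n
    induction n with
    | zero =>
      refine ⟨fun _ => 0, fun _ => 0, fun _ => 0, fun _ => 0, f, ?_, by simpa using hf, fun z => ?_⟩
      · have h0 : ∀ {V : Type} [NormedAddCommGroup V],
            XH α (2 * N * A * (1 - (1 / 2) ^ 0)) univ (fun _ : ℝ × Es d => (0:V)) := fun {V} _ => by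
          simpa using Hol.const (ϱ := rho α) (S := univ) (0:V)
        exact ⟨fun z _ => hasFDerivAt_const _ _, fun z _ => hasFDerivAt_const _ _,
          fun z _ => hasDerivAt_const _ _, h0, h0, h0, h0⟩
      · simp [mop, trc, drf]
    | succ n ih =>
      obtain ⟨W, G, H, P, e, h1, h2, h3⟩ := ih
      have hAn : 0 ≤ A * (1 / 2) ^ n := by positivity
      obtain ⟨w, g, h, p, h4, h5⟩ := hs _ hAn e h2
      refine ⟨_, _, _, _, fun z => (s' - s) * mop a b lam w g h z, (h1.add h4).mono ?_, ?_, ?_⟩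
      · rw [pow_succ]
        nlinarith
      · have hm := mop_xh hΛ hlam hlamΛ (by positivity) hc h4
        have h6 := (Hol.const (ϱ := rho α) (S := (univ : Set (ℝ × Es d))) (s' - s)).mul hm
        have h7 : ‖s' - s‖ * ((2 * d ^ 2 * Λ + d ^ 2 + 2 * d * Λ + Λ) * (N * (A * (1 / 2) ^ n)))
            ≤ A * (1 / 2) ^ (n + 1) := by
          rw [Real.norm_eq_abs, pow_succ]
          calc _ = |s' - s| * ((2 * d ^ 2 * Λ + d ^ 2 + 2 * d * Λ + Λ) * N)
                * (A * (1 / 2) ^ n) := by ring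
            _ ≤ (1 / 2) * (A * (1 / 2) ^ n) := by gcongr
            _ = _ := by ring
        exact h6.mono (rho_nonneg α) h7 (by linarith)
      · intro z
        simp only [h3, h5, mop, trc_add_right, drf_add_right]
        ring
  choose W G H P e h1 h2 h3 using hn
  have hpow : ∀ n : ℕ, (0:ℝ) ≤ (1 / 2) ^ n := fun n => by positivity
  have hNA : 0 ≤ 2 * N * A := by positivity
  let U : Ultrafilter ℕ := hyperfilter ℕ
  obtain ⟨w, g, h, p, hr, hl⟩ := Reg.closure (U := U) (A := 2 * N * A) hα isOpen_univ
    (Eventually.of_forall fun n => (h1 n).mono (by nlinarith [hpow n]))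
  refine ⟨w, g, h, p, hr, fun z => ?_⟩
  obtain ⟨l1, l2, l3, l4⟩ := hl z (mem_univ _)
  have hU : (U : Filter ℕ) ≤ atTop := Nat.hyperfilter_le_atTop
  have he : Tendsto (fun n => e n z) U (𝓝 0) := by
    have h5 : Tendsto (fun n : ℕ => A * (1 / 2 : ℝ) ^ n) atTop (𝓝 0) := by
      simpa using (tendsto_pow_atTop_nhds_zero_of_lt_one (r := (1/2 : ℝ)) (by norm_num)
        (by norm_num)).const_mul A
    exact squeeze_zero_norm (fun n => (h2 n).bd z (mem_univ _)) (h5.mono_left hU)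
  have ct : ∀ m : Fin d → Fin d → ℝ, Tendsto (fun n => trc m (H n z)) U (𝓝 (trc m (h z))) :=
    fun m => by
      have : Continuous fun T : BL (Es d) (BL (Es d) ℝ) => trc m T := by unfold trc; fun_prop
      exact (this.tendsto _).comp l3
  have cd : ∀ m : Fin d → ℝ, Tendsto (fun n => drf m (G n z)) U (𝓝 (drf m (g z))) := fun m => by
    have : Continuous fun T : BL (Es d) ℝ => drf m T := by unfold drf; fun_prop
    exact (this.tendsto _).comp l2
  have hmop : Tendsto (fun n => mop a b lam (W n) (G n) (H n) z) U (𝓝 (mop a b lam w g h z)) :=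
    (((ct _).sub (ct _)).add (cd _)).sub (l1.const_mul _)
  have hR := (((((ct (idc d)).sub l1).add (hmop.const_mul s')).add_const (f z)).sub he)
  rw [sub_zero] at hR
  exact tendsto_nhds_unique (l4.congr fun n => h3 n z) hR

lemma SolvAt.upgrade {α lam N K s : ℝ} {a : Es d → Fin d → Fin d → ℝ} {b : Es d → Fin d → ℝ}
    (hK : 0 ≤ K)
    (h : ∀ {w : ℝ × Es d → ℝ} {g : ℝ × Es d → BL (Es d) ℝ} {H : ℝ × Es d → BL (Es d) (BL (Es d) ℝ)}
      {p f : ℝ × Es d → ℝ} {A1 A : ℝ}, 0 ≤ A1 → 0 ≤ A →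
      Reg α A1 univ w g H p → XH α A univ f →
      (∀ z, p z = trc (idc d) (H z) - w z + s * mop a b lam w g H z + f z) →
      Reg α (N * A) univ w g H p) (hs : SolvAt α lam K a b s) : SolvAt α lam N a b s := by
  intro A hA f hf
  obtain ⟨w, g, H, p, h1, h2⟩ := hs A hA f hf
  exact ⟨w, g, H, p, h (by positivity) hA h1 hf h2, h2⟩

/-- Solvability of `∂w/∂t = L w - lam w + f`, with a Schauder bound. -/
lemma linear_solve {θ Λ α lam : ℝ} (hθ : 0 < θ) (hΛ : 0 ≤ Λ) (hα : 0 < α) (hα1 : α < 1)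
    (hlam : 1 ≤ lam) (hlamΛ : lam ≤ Λ) {a : Es d → Fin d → Fin d → ℝ} {b : Es d → Fin d → ℝ}
    (hc : Coef α θ Λ a b) :
    ∃ N, 0 ≤ N ∧ ∀ A, 0 ≤ A → ∀ f : ℝ × Es d → ℝ, XH α A univ f → ∃ w g H p,
      Reg α (N * A) univ w g H p ∧
      ∀ z, p z = trc (a z.2) (H z) + drf (b z.2) (g z) - lam * w z + f z := by
  obtain ⟨N, hN, hap⟩ := continuity_apriori (d := d) hθ hΛ hα hα1 hlam hlamΛ
  set D := (2 * d ^ 2 * Λ + d ^ 2 + 2 * d * Λ + Λ) * N with hD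
  have hD0 : 0 ≤ D := by positivity
  obtain ⟨n, hn⟩ := exists_nat_gt (2 * D)
  have hn0 : 0 < (n:ℝ) := by linarith
  have hmem : ∀ k : ℕ, k ≤ n → (k:ℝ) / n ∈ Icc (0:ℝ) 1 := fun k hk =>
    ⟨by positivity, (div_le_one hn0).2 (by exact_mod_cast hk)⟩
  have hk : ∀ k : ℕ, k ≤ n → SolvAt α lam N a b (k / n) := by
    intro k
    induction k with
    | zero =>
      intro h0 A hA f hf
      obtain ⟨K, w, g, H, p, hK, h1, h2⟩ := heat_solve hα hα1 hA hf
      have h3 : ∀ z, p z = trc (idc d) (H z) - w z + ((0:ℕ) / n : ℝ) * mop a b lam w g H z + f z :=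
        fun z => by rw [h2]; simp
      exact ⟨w, g, H, p, hap hc (hmem 0 h0) hK hA h1 hf h3, h3⟩
    | succ k ih =>
      intro hk
      refine SolvAt.upgrade (K := 2 * N) (by positivity)
        (fun hA1 hA h1 h2 h3 => hap hc (hmem (k + 1) hk) hA1 hA h1 h2 h3)
        (SolvAt.step hΛ hα hlam hlamΛ hN hc (ih (by omega)) ?_)
      rw [← hD]
      have : ((k + 1 : ℕ) : ℝ) / n - k / n = 1 / n := by push_cast; ring
      rw [this, abs_of_nonneg (by positivity), one_div_mul_eq_div, div_le_iff₀ hn0]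
      linarith
  have h1 := hk n le_rfl
  rw [div_self hn0.ne'] at h1
  refine ⟨N, hN, fun A hA f hf => ?_⟩
  obtain ⟨w, g, H, p, h2, h3⟩ := h1 A hA f hf
  exact ⟨w, g, H, p, h2, fun z => by rw [h3, mop]; ring⟩

end Continuity

section Nonlinear
variable {d : ℕ}

lemma Reg.lip {α D : ℝ} {w : ℝ × Es d → ℝ} {g : ℝ × Es d → BL (Es d) ℝ}
    {H : ℝ × Es d → BL (Es d) (BL (Es d) ℝ)} {p : ℝ × Es d → ℝ} (h : Reg α D univ w g H p)
    (z z' : ℝ × Es d) : |w z - w z'| ≤ D * (‖z.2 - z'.2‖ + |z.1 - z'.1|) := by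
  have h1 : |w (z.1, z.2) - w (z.1, z'.2)| ≤ D * ‖z.2 - z'.2‖ :=
    convex_univ.norm_image_sub_le_of_norm_hasFDerivWithin_le
      (f := fun x => w (z.1, x)) (f' := fun x => g (z.1, x))
      (fun x _ => (h.dw (z.1, x) (mem_univ _)).hasFDerivWithinAt)
      (fun x _ => h.xg.bd _ (mem_univ _)) (mem_univ _) (mem_univ _)
  have h2 : |w (z.1, z'.2) - w (z'.1, z'.2)| ≤ D * |z.1 - z'.1| :=
    convex_univ.norm_image_sub_le_of_norm_hasDerivWithin_le
      (f := fun t => w (t, z'.2)) (f' := fun t => p (t, z'.2))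
      (fun t _ => (h.dt (t, z'.2) (mem_univ _)).hasDerivWithinAt)
      (fun x _ => h.xp.bd _ (mem_univ _)) (mem_univ _) (mem_univ _)
  have := abs_sub_le (w z) (w (z.1, z'.2)) (w z')
  rw [mul_add]
  exact this.trans (add_le_add h1 h2)

lemma le_pow_mul_rpow {r η γ : ℝ} (hr : 0 ≤ r) (hrη : r ≤ η) (hγ1 : γ ≤ 1) :
    r ≤ η ^ (1 - γ) * r ^ γ := by
  rcases hr.eq_or_lt with rfl | h
  · positivity
  · calc r = r ^ (1 - γ) * r ^ γ := by rw [← Real.rpow_add h]; simp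
      _ ≤ _ := by gcongr

lemma Reg.interp {α D S η : ℝ} (hα : 0 < α) (hα1 : α < 1) (hD : 0 ≤ D) (hS : 0 ≤ S)
    (hη : 0 < η) (hη1 : η ≤ 1)
    {w : ℝ × Es d → ℝ} {g : ℝ × Es d → BL (Es d) ℝ}
    {H : ℝ × Es d → BL (Es d) (BL (Es d) ℝ)} {p : ℝ × Es d → ℝ} (h : Reg α D univ w g H p)
    (hwS : ∀ z, w z ∈ Icc 0 S) (z z' : ℝ × Es d) :
    |w z - w z'| ≤ (D * η ^ (1 - α) + S / η) * rho α z z' := by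
  have hr := rho_nonneg α z z'
  rw [add_mul]
  rcases lt_or_ge (dist z z') η with hlt | hge
  · rw [Prod.dist_eq, max_lt_iff, Real.dist_eq, dist_eq_norm] at hlt
    have h1 := le_pow_mul_rpow (norm_nonneg (z.2 - z'.2)) hlt.2.le hα1.le
    have h2 := le_pow_mul_rpow (γ := α / 3) (abs_nonneg (z.1 - z'.1)) hlt.1.le (by linarith)
    have h3 : η ^ (1 - α / 3) ≤ η ^ (1 - α) :=
      Real.rpow_le_rpow_of_exponent_ge hη hη1 (by linarith)
    have h4 : |z.1 - z'.1| ≤ η ^ (1 - α) * |z.1 - z'.1| ^ (α / 3) :=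
      h2.trans (mul_le_mul_of_nonneg_right h3 (by positivity))
    have h5 : ‖z.2 - z'.2‖ + |z.1 - z'.1| ≤ η ^ (1 - α) * rho α z z' := by
      rw [rho, mul_add]; linarith
    have h6 := (h.lip z z').trans (mul_le_mul_of_nonneg_left h5 hD)
    have : 0 ≤ S / η * rho α z z' := by positivity
    linarith
  · have h1 := le_rho_of_le_dist hα hα1 hη hη1 hge
    have h2 : |w z - w z'| ≤ S := abs_le.2 ⟨by linarith [(hwS z).1, (hwS z').2],
      by linarith [(hwS z).2, (hwS z').1]⟩
    have h3 : S ≤ S / η * rho α z z' := by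
      calc S = S / η * η := by field_simp
        _ ≤ _ := by gcongr
    have : 0 ≤ D * η ^ (1 - α) * rho α z z' := by positivity
    linarith

lemma rho_self {α : ℝ} (hα : 0 < α) (z : ℝ × Es d) : rho α z z = 0 := by
  have : α / 3 ≠ 0 := by positivity
  simp [rho, Real.zero_rpow this, Real.zero_rpow hα.ne']

/-- A nonlinearity which is Lipschitz on `[0, S]`, Hölder in space-time, and for which `0` and `S`
are a sub- and a supersolution. -/
structure NL (α Λ S : ℝ) (F : ℝ × Es d → ℝ → ℝ) : Prop where
  lip : ∀ z z', ∀ s ∈ Icc 0 S, ∀ s' ∈ Icc 0 S, |F z s - F z' s'| ≤ Λ * (rho α z z' + |s - s'|)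
  bd : ∀ z, ∀ s ∈ Icc 0 S, |F z s| ≤ Λ
  zero : ∀ z, 0 ≤ F z 0
  top : ∀ z, F z S ≤ 0
  init : ∀ z : ℝ × Es d, z.1 ≤ 0 → F z 0 = 0

/-- The invariant of the monotone iteration. -/
structure Iter (α Λ S κ K : ℝ) (a : Es d → Fin d → Fin d → ℝ) (b : Es d → Fin d → ℝ)
    (F : ℝ × Es d → ℝ → ℝ) (w : ℝ × Es d → ℝ) (g : ℝ × Es d → BL (Es d) ℝ)
    (H : ℝ × Es d → BL (Es d) (BL (Es d) ℝ)) (p : ℝ × Es d → ℝ) : Prop where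
  reg : Reg α K univ w g H p
  mem : ∀ z, w z ∈ Icc 0 S
  osc : ∀ z z', |w z - w z'| ≤ κ * rho α z z'
  sub : ∀ z, p z ≤ trc (a z.2) (H z) + drf (b z.2) (g z) + F z (w z)
  init : ∀ z : ℝ × Es d, z.1 ≤ 0 → w z = 0

lemma Iter.step {α θ Λ S κ K N : ℝ} (hθ : 0 < θ) (hΛ : 1 ≤ Λ) (hα : 0 < α) (hS : 0 ≤ S)
    (hκ : 0 ≤ κ)
    {a : Es d → Fin d → Fin d → ℝ} {b : Es d → Fin d → ℝ} (hc : Coef α θ Λ a b)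
    {F : ℝ × Es d → ℝ → ℝ} (hF : NL α Λ S F)
    (hN : ∀ A, 0 ≤ A → ∀ f : ℝ × Es d → ℝ, XH α A univ f → ∃ w g H p,
      Reg α (N * A) univ w g H p ∧
      ∀ z, p z = trc (a z.2) (H z) + drf (b z.2) (g z) - Λ * w z + f z)
    (hNK : N * (Λ * (1 + S + 2 * κ)) ≤ K)
    (hint : ∀ {w : ℝ × Es d → ℝ} {g : ℝ × Es d → BL (Es d) ℝ}
      {H : ℝ × Es d → BL (Es d) (BL (Es d) ℝ)} {p : ℝ × Es d → ℝ}, Reg α K univ w g H p →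
      (∀ z, w z ∈ Icc 0 S) → ∀ z z', |w z - w z'| ≤ κ * rho α z z')
    {w : ℝ × Es d → ℝ} {g : ℝ × Es d → BL (Es d) ℝ}
    {H : ℝ × Es d → BL (Es d) (BL (Es d) ℝ)} {p : ℝ × Es d → ℝ}
    (h : Iter α Λ S κ K a b F w g H p) :
    ∃ w' g' H' p', Iter α Λ S κ K a b F w' g' H' p' ∧ (∀ z, w z ≤ w' z) ∧
      ∀ z, p' z = trc (a z.2) (H' z) + drf (b z.2) (g' z) - Λ * w' z
        + (F z (w z) + Λ * w z) := by
  have hf : XH α (Λ * (1 + S + 2 * κ)) univ fun z => F z (w z) + Λ * w z := by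
    refine ⟨fun z _ => ?_, fun z _ z' _ => ?_⟩
    · have h1 := hF.bd z _ (h.mem z)
      have h2 : |Λ * w z| ≤ Λ * S := by
        rw [abs_mul, abs_of_nonneg (by linarith : 0 ≤ Λ), abs_of_nonneg (h.mem z).1]
        exact mul_le_mul_of_nonneg_left (h.mem z).2 (by linarith)
      refine (abs_add_le _ _).trans ?_
      have : 0 ≤ Λ * κ := by positivity
      linarith
    · have h1 := hF.lip z z' _ (h.mem z) _ (h.mem z')
      have h2 := h.osc z z'
      have hr := rho_nonneg α z z'
      have e : F z (w z) + Λ * w z - (F z' (w z') + Λ * w z')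
          = (F z (w z) - F z' (w z')) + Λ * (w z - w z') := by ring
      rw [Real.norm_eq_abs, e]
      refine (abs_add_le _ _).trans ?_
      rw [abs_mul, abs_of_nonneg (by linarith : 0 ≤ Λ)]
      have h3 := mul_le_mul_of_nonneg_left h2 (by linarith : 0 ≤ Λ)
      have : 0 ≤ Λ * S * rho α z z' := by positivity
      linarith
  obtain ⟨w', g', H', p', hr, he⟩ := hN _ (by positivity) _ hf
  replace hr := hr.mono hNK
  have hcw := h.reg.xw.continuous hα
  have hcw' := hr.xw.continuous hα
  have hbd' : ∀ z, |w' z| ≤ K := fun z => hr.xw.bd z (mem_univ _)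
  have hup : ∀ z, w' z - S ≤ 0 := by
    refine mp_univ (K := K) (Λ := Λ) (G := g') (H := H') (p := p')
      (m := fun z => a z.2) (b := fun z => b z.2)
      (hcw'.sub continuous_const) (fun z => by linarith [(abs_le.1 (hbd' z)).2])
      (fun z => (hr.dw z (mem_univ _)).sub_const S)
      (fun z => hr.dg z (mem_univ _)) (fun z => (hr.dt z (mem_univ _)).sub_const S)
      (fun z => (hc.ell z.2).posSemidef hθ.le) (fun z => hc.ha.bd _ (mem_univ _))
      (fun z => hc.hb.bd _ (mem_univ _)) (fun z hz => ?_)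
    rw [he z]
    have h1 := hF.lip z z _ (h.mem z) S ⟨hS, le_rfl⟩
    rw [rho_self hα, abs_of_nonpos (sub_nonpos.2 (h.mem z).2)] at h1
    have h2 := (abs_le.1 h1).2
    have h3 := hF.top z
    nlinarith
  have hmono : ∀ z, w z - w' z ≤ 0 := by
    refine mp_univ (K := S + K) (Λ := Λ) (G := fun z => g z - g' z) (H := fun z => H z - H' z)
      (p := fun z => p z - p' z) (m := fun z => a z.2) (b := fun z => b z.2)
      (hcw.sub hcw') (fun z => by linarith [(abs_le.1 (hbd' z)).1, (h.mem z).2])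
      (fun z => (h.reg.dw z (mem_univ _)).sub (hr.dw z (mem_univ _)))
      (fun z => (h.reg.dg z (mem_univ _)).sub (hr.dg z (mem_univ _)))
      (fun z => (h.reg.dt z (mem_univ _)).sub (hr.dt z (mem_univ _)))
      (fun z => (hc.ell z.2).posSemidef hθ.le) (fun z => hc.ha.bd _ (mem_univ _))
      (fun z => hc.hb.bd _ (mem_univ _)) (fun z hz => ?_)
    rw [he z, ← trc_sub_right, ← drf_sub_right]
    have h1 := h.sub z
    nlinarith
  have hmem : ∀ z, w' z ∈ Icc 0 S := fun z =>
    ⟨(h.mem z).1.trans (by linarith [hmono z]), by linarith [hup z]⟩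
  refine ⟨w', g', H', p', ⟨hr, hmem, hint hr hmem, fun z => ?_, ?_⟩,
    fun z => by linarith [hmono z], he⟩
  · have h1 := hF.lip z z _ (h.mem z) _ (hmem z)
    rw [rho_self hα, abs_of_nonpos (hmono z)] at h1
    have h2 := (abs_le.1 h1).2
    rw [he z]
    linarith
  · have h0 : ∀ z ∈ {z : ℝ × Es d | z.1 ≤ 0}, w' z ≤ 0 := by
      refine max_principle (K := K) (Λ := Λ) (isClosed_le continuous_fst continuous_const)
        hcw'.continuousOn (fun z _ => (abs_le.1 (hbd' z)).2) (fun z hz hpos => ⟨?_, ?_, p' z,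
          fun y => g' (z.1, y), H' z, a z.2, b z.2, hr.dt z (mem_univ _),
          Eventually.of_forall fun y => hr.dw (z.1, y) (mem_univ _), hr.dg z (mem_univ _),
          (hc.ell z.2).posSemidef hθ.le, hc.ha.bd _ (mem_univ _), hc.hb.bd _ (mem_univ _), ?_⟩)
      · exact Eventually.of_forall fun y => hz
      · filter_upwards [self_mem_nhdsWithin] with s hs
        exact le_trans hs hz
      · rw [he z, h.init z hz, hF.init z hz]
        simp only [Prod.mk.eta]
        nlinarith
    exact fun z hz => le_antisymm (h0 z hz) (hmem z).1

/-- Solvability of the semilinear equation between the ordered barriers `0` and `S`. -/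
lemma nonlinear_solve {α θ Λ S : ℝ} (hθ : 0 < θ) (hΛ : 1 ≤ Λ) (hα : 0 < α) (hα1 : α < 1)
    (hS : 0 ≤ S) {a : Es d → Fin d → Fin d → ℝ} {b : Es d → Fin d → ℝ} (hc : Coef α θ Λ a b)
    {F : ℝ × Es d → ℝ → ℝ} (hF : NL α Λ S F) :
    ∃ K w g H p, Reg α K univ w g H p ∧ (∀ z, w z ∈ Icc 0 S) ∧
      (∀ z : ℝ × Es d, z.1 ≤ 0 → w z = 0) ∧
      ∀ z, p z = trc (a z.2) (H z) + drf (b z.2) (g z) + F z (w z) := by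
  obtain ⟨N, hN0, hN⟩ := linear_solve hθ (by linarith) hα hα1 hΛ le_rfl hc
  obtain ⟨η, hη, hη1, hηN⟩ : ∃ η : ℝ, 0 < η ∧ η ≤ 1 ∧ N * (Λ * 2) * η ^ (1 - α) ≤ 1 / 2 := by
    have hγ : 0 < 1 - α := by linarith
    have h1 : Tendsto (fun η : ℝ => N * (Λ * 2) * η ^ (1 - α)) (𝓝[>] 0) (𝓝 0) := by
      have h2 : ContinuousAt (fun η : ℝ => N * (Λ * 2) * η ^ (1 - α)) 0 :=
        (Real.continuousAt_rpow_const _ _ (Or.inr hγ.le)).const_mul _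
      have h3 := h2.tendsto
      rw [Real.zero_rpow hγ.ne', mul_zero] at h3
      exact h3.mono_left nhdsWithin_le_nhds
    have h2 := (h1.eventually (eventually_le_nhds (by norm_num : (0:ℝ) < 1 / 2))).and
      (Ioc_mem_nhdsGT (zero_lt_one' ℝ))
    obtain ⟨η, h3, h4⟩ := h2.exists
    exact ⟨η, h4.1, h4.2, h3⟩
  have hηp : 0 ≤ η ^ (1 - α) := by positivity
  set κ := 2 * (N * (Λ * (1 + S)) * η ^ (1 - α) + S / η) with hκ
  have hκ0 : 0 ≤ κ := by positivity
  set K := N * (Λ * (1 + S + 2 * κ)) with hK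
  have hK0 : 0 ≤ K := by positivity
  have hint : ∀ {w : ℝ × Es d → ℝ} {g : ℝ × Es d → BL (Es d) ℝ}
      {H : ℝ × Es d → BL (Es d) (BL (Es d) ℝ)} {p : ℝ × Es d → ℝ}, Reg α K univ w g H p →
      (∀ z, w z ∈ Icc 0 S) → ∀ z z', |w z - w z'| ≤ κ * rho α z z' := by
    intro w g H p h1 h2 z z'
    refine (h1.interp hα hα1 hK0 hS hη hη1 h2 z z').trans
      (mul_le_mul_of_nonneg_right ?_ (rho_nonneg _ _ _))
    have e : K * η ^ (1 - α) + S / η = κ / 2 + N * (Λ * 2) * η ^ (1 - α) * κ := by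
      rw [hK, hκ]; ring
    rw [e]
    nlinarith
  let T := (ℝ × Es d → ℝ) × (ℝ × Es d → BL (Es d) ℝ) ×
    (ℝ × Es d → BL (Es d) (BL (Es d) ℝ)) × (ℝ × Es d → ℝ)
  have hstep : ∀ x : T, Iter α Λ S κ K a b F x.1 x.2.1 x.2.2.1 x.2.2.2 →
      ∃ y : T, Iter α Λ S κ K a b F y.1 y.2.1 y.2.2.1 y.2.2.2 ∧ (∀ z, x.1 z ≤ y.1 z) ∧
      ∀ z, y.2.2.2 z = trc (a z.2) (y.2.2.1 z) + drf (b z.2) (y.2.1 z) - Λ * y.1 z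
        + (F z (x.1 z) + Λ * x.1 z) := by
    intro x hx
    obtain ⟨w', g', H', p', h1, h2, h3⟩ := hx.step hθ hΛ hα hS hκ0 hc hF hN le_rfl hint
    exact ⟨(w', g', H', p'), h1, h2, h3⟩
  have h0 : Iter α Λ S κ K a b F (fun _ => 0) (fun _ => 0) (fun _ => 0) (fun _ => 0) := by
    have h0 : ∀ {V : Type} [NormedAddCommGroup V], XH α K univ (fun _ : ℝ × Es d => (0:V)) :=
      fun {V} _ => (Hol.const (ϱ := rho α) (S := univ) (0:V)).mono (rho_nonneg α)
        (by simpa using hK0) hK0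
    refine ⟨⟨fun z _ => hasFDerivAt_const _ _, fun z _ => hasFDerivAt_const _ _,
          fun z _ => hasDerivAt_const _ _, h0, h0, h0, h0⟩, fun z => ⟨le_rfl, hS⟩,
          fun z z' => ?_, fun z => ?_, fun z _ => rfl⟩
    · have := rho_nonneg α z z'
      simpa using (by positivity : 0 ≤ κ * rho α z z')
    · simpa [trc, drf] using hF.zero z
  choose! nx hx1 hx2 hx3 using hstep
  let s : ℕ → T := fun n => nx^[n] (fun _ => 0, fun _ => 0, fun _ => 0, fun _ => 0)
  have hs : ∀ n, s (n + 1) = nx (s n) := fun n => Function.iterate_succ_apply' _ _ _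
  have hI : ∀ n, Iter α Λ S κ K a b F (s n).1 (s n).2.1 (s n).2.2.1 (s n).2.2.2 := by
    intro n
    induction n with
    | zero => exact h0
    | succ n ih => rw [hs]; exact hx1 _ ih
  let U : Ultrafilter ℕ := hyperfilter ℕ
  have hU : (U : Filter ℕ) ≤ atTop := Nat.hyperfilter_le_atTop
  obtain ⟨w, g, H, p, hr, hl⟩ := Reg.closure (U := U) (A := K) hα isOpen_univ
    (Eventually.of_forall fun n => (hI (n + 1)).reg)
  have hlim : ∀ z, Tendsto (fun n => (s n).1 z) atTop (𝓝 (w z)) := by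
    intro z
    have hm : Monotone fun n => (s n).1 z := monotone_nat_of_le_succ fun n => by
      rw [hs]; exact hx2 _ (hI n) z
    have h1 := tendsto_atTop_ciSup hm ⟨S, by rintro _ ⟨n, rfl⟩; exact ((hI n).mem z).2⟩
    have h2 := (h1.comp (tendsto_add_atTop_nat 1)).mono_left hU
    rw [tendsto_nhds_unique (hl z (mem_univ _)).1 h2]
    exact h1
  have hmem : ∀ z, w z ∈ Icc 0 S := fun z =>
    isClosed_Icc.mem_of_tendsto (hlim z) (Eventually.of_forall fun n => (hI n).mem z)
  refine ⟨K, w, g, H, p, hr, hmem, fun z hz => ?_, fun z => ?_⟩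
  · refine tendsto_nhds_unique (hlim z) (tendsto_const_nhds.congr fun n => ?_)
    exact ((hI n).init z hz).symm
  · obtain ⟨l1, l2, l3, l4⟩ := hl z (mem_univ _)
    have l0 := (hlim z).mono_left hU
    have ct : Tendsto (fun n => trc (a z.2) ((s (n + 1)).2.2.1 z)) U (𝓝 (trc (a z.2) (H z))) := by
      have : Continuous fun T : BL (Es d) (BL (Es d) ℝ) => trc (a z.2) T := by
        unfold trc; fun_prop
      exact (this.tendsto _).comp l3
    have cd : Tendsto (fun n => drf (b z.2) ((s (n + 1)).2.1 z)) U (𝓝 (drf (b z.2) (g z))) := by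
      have : Continuous fun T : BL (Es d) ℝ => drf (b z.2) T := by unfold drf; fun_prop
      exact (this.tendsto _).comp l2
    have cF : Tendsto (fun n => F z ((s n).1 z)) U (𝓝 (F z (w z))) := by
      rw [tendsto_iff_norm_sub_tendsto_zero]
      have h1 : Tendsto (fun n => Λ * |(s n).1 z - w z|) U (𝓝 0) := by
        simpa using ((l0.sub_const (w z)).abs.const_mul Λ)
      refine squeeze_zero (fun _ => norm_nonneg _) (fun n => ?_) h1
      have := hF.lip z z _ ((hI n).mem z) _ (hmem z)
      rwa [rho_self hα, zero_add] at this
    have hR := ((ct.add cd).sub (l1.const_mul Λ)).add (cF.add (l0.const_mul Λ))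
    have hEq : ∀ n, (s (n + 1)).2.2.2 z = trc (a z.2) ((s (n + 1)).2.2.1 z)
        + drf (b z.2) ((s (n + 1)).2.1 z) - Λ * (s (n + 1)).1 z
        + (F z ((s n).1 z) + Λ * (s n).1 z) := fun n => by
      have := hx3 _ (hI n) z
      rwa [← hs] at this
    rw [tendsto_nhds_unique (l4.congr hEq) hR]
    ring

end Nonlinear

section Upgrade
variable {d : ℕ}

/-- Bounded and Hölder continuous on the whole space-time. -/
def BH {V : Type*} [NormedAddCommGroup V] (α : ℝ) (f : ℝ × Es d → V) : Prop :=
  ∃ A, 0 ≤ A ∧ XH α A univ f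

lemma Hol.bh {V : Type*} [NormedAddCommGroup V] {α A B : ℝ} {f : ℝ × Es d → V}
    (h : Hol (rho α) A B univ f) : BH α f :=
  ⟨max 0 (max A B), le_max_left _ _, h.mono (rho_nonneg α)
    ((le_max_left A B).trans (le_max_right _ _)) ((le_max_right A B).trans (le_max_right _ _))⟩

namespace BH
variable {V : Type*} [NormedAddCommGroup V] {α : ℝ}

lemma add {f f' : ℝ × Es d → V} (h : BH α f) (h' : BH α f') : BH α fun z => f z + f' z :=
  (h.choose_spec.2.add h'.choose_spec.2).bh

lemma sub {f f' : ℝ × Es d → V} (h : BH α f) (h' : BH α f') : BH α fun z => f z - f' z :=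
  (h.choose_spec.2.sub h'.choose_spec.2).bh

lemma mul {f f' : ℝ × Es d → ℝ} (h : BH α f) (h' : BH α f') : BH α fun z => f z * f' z :=
  (h.choose_spec.2.mul h'.choose_spec.2).bh

lemma trc {a : ℝ × Es d → Fin d → Fin d → ℝ} {H : ℝ × Es d → BL (Es d) (BL (Es d) ℝ)}
    (h : BH α a) (h' : BH α H) : BH α fun z => trc (a z) (H z) :=
  (h.choose_spec.2.trc h'.choose_spec.2).bh

lemma drf {b : ℝ × Es d → Fin d → ℝ} {g : ℝ × Es d → BL (Es d) ℝ}
    (h : BH α b) (h' : BH α g) : BH α fun z => drf (b z) (g z) :=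
  (h.choose_spec.2.drf h'.choose_spec.2).bh

lemma tens {f f' : ℝ × Es d → BL (Es d) ℝ} (h : BH α f) (h' : BH α f') :
    BH α fun z => tens (f z) (f' z) :=
  (h.choose_spec.2.tens h'.choose_spec.2).bh

end BH

lemma Reg.bh_fun {α α' K : ℝ} (hα : 0 < α) (hα1 : α < 1) (hK : 0 ≤ K) {w : ℝ × Es d → ℝ}
    {g : ℝ × Es d → BL (Es d) ℝ} {H : ℝ × Es d → BL (Es d) (BL (Es d) ℝ)} {p : ℝ × Es d → ℝ}
    (h : Reg α' K univ w g H p) : BH α w := by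
  have hb : ∀ z, ‖w z‖ ≤ K := fun z => h.xw.bd z (mem_univ _)
  refine Hol.bh (A := K) (B := 2 * K) ⟨fun z _ => hb z, fun z _ z' _ => ?_⟩
  refine le_rho_of_lip hα hα1 (by positivity) ((h.lip z z').trans ?_) ?_
  · rw [Prod.dist_eq, Real.dist_eq, dist_eq_norm]
    have := le_max_left |z.1 - z'.1| ‖z.2 - z'.2‖
    have := le_max_right |z.1 - z'.1| ‖z.2 - z'.2‖
    nlinarith
  · exact (norm_sub_le _ _).trans (by linarith [hb z, hb z'])

lemma Reg.bh_grad {α α' K : ℝ} (hα : 0 < α) (hα1 : α < 1) (hK : 0 ≤ K) {w : ℝ × Es d → ℝ}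
    {g : ℝ × Es d → BL (Es d) ℝ} {H : ℝ × Es d → BL (Es d) (BL (Es d) ℝ)} {p : ℝ × Es d → ℝ}
    (h : Reg α' K univ w g H p) : BH α g := by
  have hb : ∀ z, ‖g z‖ ≤ K := fun z => h.xg.bd z (mem_univ _)
  refine Hol.bh (A := K) (B := 5 * K) ⟨fun z _ => hb z, fun z _ z' _ => ?_⟩
  have hr := rho_nonneg α z z'
  rcases le_or_gt 1 (dist z z') with hd | hd
  · have := le_rho_of_le_dist hα hα1 one_pos le_rfl hd
    exact (norm_sub_le _ _).trans (by nlinarith [hb z, hb z'])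
  rw [Prod.dist_eq, max_lt_iff, Real.dist_eq, dist_eq_norm] at hd
  have hx : ‖g (z.1, z.2) - g (z.1, z'.2)‖ ≤ K * ‖z.2 - z'.2‖ :=
    convex_univ.norm_image_sub_le_of_norm_hasFDerivWithin_le
      (f := fun x => g (z.1, x)) (f' := fun x => H (z.1, x))
      (fun x _ => (h.dg (z.1, x) (mem_univ _)).hasFDerivWithinAt)
      (fun x _ => h.xH.bd _ (mem_univ _)) (mem_univ _) (mem_univ _)
  have hx' : ‖z.2 - z'.2‖ ≤ ‖z.2 - z'.2‖ ^ α :=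
    le_rpow_of_le_one (norm_nonneg _) hd.2.le hα1.le
  have ht : ‖g (z.1, z'.2) - g (z'.1, z'.2)‖ ≤ 5 * K * |z.1 - z'.1| ^ (α / 3) := by
    rcases (abs_nonneg (z.1 - z'.1)).eq_or_lt with h0 | h0
    · rw [sub_eq_zero.1 (abs_eq_zero.1 h0.symm), sub_self, norm_zero]
      positivity
    set τ := |z.1 - z'.1| with hτ
    have hs0 : 0 < √τ := Real.sqrt_pos.2 h0
    have h1 := (interp_ball (x := z'.2) (w := fun x => w (z.1, x) - w (z'.1, x))
      (g := fun x => g (z.1, x) - g (z'.1, x)) (H := fun x => H (z.1, x) - H (z'.1, x))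
      (A := K * τ) (K := 4 * K) hs0
      (fun y _ => (h.dw (z.1, y) (mem_univ _)).sub (h.dw (z'.1, y) (mem_univ _)))
      (fun y _ => (h.dg (z.1, y) (mem_univ _)).sub (h.dg (z'.1, y) (mem_univ _)))
      (fun y _ => by simpa using h.lip (z.1, y) (z'.1, y)) (fun y _ => by
        have := fun z => h.xH.bd z (mem_univ _)
        refine (norm_sub_le _ _).trans ?_
        have := norm_sub_le (H (z.1, y)) (H (z'.1, y))
        have := norm_sub_le (H (z.1, z'.2)) (H (z'.1, z'.2))
        linarith [h.xH.bd (z.1, y) (mem_univ _), h.xH.bd (z'.1, y) (mem_univ _),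
          h.xH.bd (z.1, z'.2) (mem_univ _), h.xH.bd (z'.1, z'.2) (mem_univ _)])).1
    have h2 : K * τ / √τ = K * √τ := by
      rw [mul_div_assoc, Real.div_sqrt]
    have h3 : √τ ≤ τ ^ (α / 3) := by
      rw [Real.sqrt_eq_rpow]
      exact Real.rpow_le_rpow_of_exponent_ge h0 hd.1.le (by linarith)
    rw [h2] at h1
    refine h1.trans ?_
    nlinarith
  have hpos : 0 ≤ ‖z.2 - z'.2‖ ^ α := by positivity
  calc ‖g z - g z'‖ ≤ ‖g (z.1, z.2) - g (z.1, z'.2)‖ + ‖g (z.1, z'.2) - g (z'.1, z'.2)‖ :=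
        norm_sub_le_norm_sub_add_norm_sub _ _ _
    _ ≤ _ := by rw [rho, mul_add]; nlinarith

lemma Coef.mono {α θ Λ Λ' : ℝ} {a : Es d → Fin d → Fin d → ℝ} {b : Es d → Fin d → ℝ}
    (hc : Coef α θ Λ a b) (h : Λ ≤ Λ') : Coef α θ Λ' a b :=
  ⟨hc.ell, hc.ha.mono (sho_nonneg α) h h, hc.hb.mono (sho_nonneg α) h h⟩

/-- A solution with some Hölder regularity acquires, after a cutoff, the regularity
of the coefficients. -/
lemma cut_upgrade {α α' θ Λ K R : ℝ} (hθ : 0 < θ) (hΛ : 0 ≤ Λ) (hα : 0 < α) (hα1 : α < 1)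
    (hα' : 0 < α') (hK : 0 ≤ K) (hR : 0 < R) (hR1 : R ≤ 1)
    {a : Es d → Fin d → Fin d → ℝ} {b : Es d → Fin d → ℝ} (hc : Coef α θ Λ a b)
    {w : ℝ × Es d → ℝ} {g : ℝ × Es d → BL (Es d) ℝ} {H : ℝ × Es d → BL (Es d) (BL (Es d) ℝ)}
    {p f : ℝ × Es d → ℝ} {z0 : ℝ × Es d} (h : Reg α' K univ w g H p) (hf : BH α f)
    (heq : ∀ z ∈ Metric.ball z0 (3 * R), p z = trc (a z.2) (H z) + drf (b z.2) (g z) + f z) :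
    ∃ K' w' g' H' p', 0 ≤ K' ∧ Reg α K' univ w' g' H' p' ∧
      ∀ z ∈ Metric.ball z0 (2 * R), w' z = w z ∧
        p' z = trc (a z.2) (H' z) + drf (b z.2) (g' z) + f z := by
  obtain ⟨Kb, hKb, hbump⟩ := exists_bump (Es d) hα hα1
  obtain ⟨ξ, gξ, Hξ, pξ, hξ, -, hone, hzero⟩ := hbump z0 R hR hR1
  have hpξ : ∀ z ∈ Metric.ball z0 (2 * R), pξ z = 0 := by
    intro z hz
    refine (hξ.dt z (mem_univ _)).unique ((hasDerivAt_const z.1 (1:ℝ)).congr_of_eventuallyEq ?_)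
    have : ContinuousAt (fun t : ℝ => (t, z.2)) z.1 := by fun_prop
    filter_upwards [this.preimage_mem_nhds (Metric.isOpen_ball.mem_nhds hz)] with t ht
    exact (hone _ ht).1
  set F : ℝ × Es d → ℝ := fun z => ξ z * f z
    + w z * (pξ z - trc (a z.2) (Hξ z) - drf (b z.2) (gξ z))
    - trc (a z.2) (tens (g z) (gξ z) + tens (gξ z) (g z)) + w z * ξ z with hF
  have hw : BH α w := h.bh_fun hα hα1 hK
  have hg : BH α g := h.bh_grad hα hα1 hK
  have ha : BH α fun z : ℝ × Es d => a z.2 := (hc.xa hΛ).bh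
  have hb : BH α fun z : ℝ × Es d => b z.2 := (hc.xb hΛ).bh
  have bg : BH α gξ := hξ.xg.bh
  have hFB : BH α F :=
    (((hξ.xw.bh.mul hf).add (hw.mul ((hξ.xp.bh.sub (ha.trc hξ.xH.bh)).sub (hb.drf bg)))).sub
      (ha.trc ((hg.tens bg).add (bg.tens hg)))).add (hw.mul hξ.xw.bh)
  obtain ⟨A, hA, hFA⟩ := hFB
  obtain ⟨N, hN, hsol⟩ := linear_solve (Λ := Λ + 1) hθ (by linarith) hα hα1 le_rfl (by linarith)
    (hc.mono (by linarith))
  obtain ⟨w', g', H', p', hr, he⟩ := hsol A hA F hFA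
  set G : ℝ × Es d → BL (Es d) ℝ := fun z => w z • gξ z + ξ z • g z with hG
  set Q : ℝ × Es d → BL (Es d) (BL (Es d) ℝ) := fun z =>
    (w z • Hξ z + tens (g z) (gξ z)) + (ξ z • H z + tens (gξ z) (g z)) with hQ
  set P : ℝ × Es d → ℝ := fun z => p z * ξ z + w z * pξ z with hP
  have dW : ∀ z : ℝ × Es d, HasFDerivAt (fun x => w (z.1, x) * ξ (z.1, x)) (G z) z.2 := fun z =>
    (h.dw z (mem_univ _)).mul (hξ.dw z (mem_univ _))
  have dG : ∀ z : ℝ × Es d, HasFDerivAt (fun x => G (z.1, x)) (Q z) z.2 := fun z =>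
    ((h.dw z (mem_univ _)).smul (hξ.dg z (mem_univ _))).add
      ((hξ.dw z (mem_univ _)).smul (h.dg z (mem_univ _)))
  have dP : ∀ z : ℝ × Es d, HasDerivAt (fun t => w (t, z.2) * ξ (t, z.2)) (P z) z.1 := fun z =>
    (h.dt z (mem_univ _)).mul (hξ.dt z (mem_univ _))
  have hPeq : ∀ z, P z = trc (a z.2) (Q z) + drf (b z.2) (G z) - w z * ξ z + F z := by
    intro z
    have e1 : ξ z * p z = ξ z * (trc (a z.2) (H z) + drf (b z.2) (g z) + f z) := by
      by_cases hz : z ∈ Metric.ball z0 (3 * R)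
      · rw [heq z hz]
      · rw [(hzero z hz).1, zero_mul, zero_mul]
    simp only [hP, hQ, hG, hF, trc_add_right, drf_add_right, trc_smul_right, drf_smul_right]
    linear_combination e1
  have hcW : Continuous fun z => w z * ξ z := (h.xw.continuous hα').mul (hξ.xw.continuous hα)
  have hcw' := hr.xw.continuous hα
  have hWb : ∀ z, |w z * ξ z| ≤ K * (Kb * R⁻¹ ^ 3) := fun z => by
    rw [abs_mul]
    exact mul_le_mul (h.xw.bd z (mem_univ _)) (hξ.xw.bd z (mem_univ _)) (abs_nonneg _) hK
  have hw'b : ∀ z, |w' z| ≤ N * A := fun z => hr.xw.bd z (mem_univ _)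
  have h1 : ∀ z, w z * ξ z - w' z ≤ 0 := by
    refine mp_univ (K := K * (Kb * R⁻¹ ^ 3) + N * A) (Λ := Λ) (G := fun z => G z - g' z)
      (H := fun z => Q z - H' z)
      (p := fun z => P z - p' z) (m := fun z => a z.2) (b := fun z => b z.2)
      (hcW.sub hcw') (fun z => by linarith [(abs_le.1 (hWb z)).2, (abs_le.1 (hw'b z)).1])
      (fun z => (dW z).sub (hr.dw z (mem_univ _)))
      (fun z => (dG z).sub (hr.dg z (mem_univ _)))
      (fun z => (dP z).sub (hr.dt z (mem_univ _)))
      (fun z => (hc.ell z.2).posSemidef hθ.le) (fun z => hc.ha.bd _ (mem_univ _))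
      (fun z => hc.hb.bd _ (mem_univ _)) (fun z hz => ?_)
    rw [he z, hPeq z, ← trc_sub_right, ← drf_sub_right]
    linarith
  have h2 : ∀ z, w' z - w z * ξ z ≤ 0 := by
    refine mp_univ (K := K * (Kb * R⁻¹ ^ 3) + N * A) (Λ := Λ) (G := fun z => g' z - G z)
      (H := fun z => H' z - Q z)
      (p := fun z => p' z - P z) (m := fun z => a z.2) (b := fun z => b z.2)
      (hcw'.sub hcW) (fun z => by linarith [(abs_le.1 (hWb z)).1, (abs_le.1 (hw'b z)).2])
      (fun z => (hr.dw z (mem_univ _)).sub (dW z))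
      (fun z => (hr.dg z (mem_univ _)).sub (dG z))
      (fun z => (hr.dt z (mem_univ _)).sub (dP z))
      (fun z => (hc.ell z.2).posSemidef hθ.le) (fun z => hc.ha.bd _ (mem_univ _))
      (fun z => hc.hb.bd _ (mem_univ _)) (fun z hz => ?_)
    rw [he z, hPeq z, ← trc_sub_right, ← drf_sub_right]
    linarith
  refine ⟨N * A, w', g', H', p', by positivity, hr, fun z hz => ?_⟩
  obtain ⟨e1, e2, e3⟩ := hone z hz
  have e4 : w' z = w z := by
    have := h1 z
    have := h2 z
    rw [e1, mul_one] at *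
    linarith
  refine ⟨e4, ?_⟩
  have e5 : F z = f z + w z := by
    have t0 : ∀ m : Fin d → Fin d → ℝ, trc m (0 : BL (Es d) (BL (Es d) ℝ)) = 0 := fun m => by
      simp [trc]
    have d0 : ∀ m : Fin d → ℝ, drf m (0 : BL (Es d) ℝ) = 0 := fun m => by simp [drf]
    have q1 : tens (g z) (0 : BL (Es d) ℝ) + tens 0 (g z) = 0 := by
      ext x y; simp [tens]
    simp only [hF, e1, e2, e3, q1, hpξ z hz, t0, d0]
    ring
  rw [he, e5, e4]
  ring

/-- Interior Schauder estimate for a solution with an unspecified global Hölder exponent. -/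
lemma interior_reg_of_coef {θ Λ α R : ℝ} (hθ : 0 < θ) (hΛ : 0 ≤ Λ) (hα : 0 < α) (hα1 : α < 1)
    (hR : 0 < R) (hR1 : R ≤ 1) :
    ∃ r C, 0 < r ∧ 0 ≤ C ∧ ∀ {a : Es d → Fin d → Fin d → ℝ} {b : Es d → Fin d → ℝ}
      {w : ℝ × Es d → ℝ} {g : ℝ × Es d → BL (Es d) ℝ} {H : ℝ × Es d → BL (Es d) (BL (Es d) ℝ)}
      {p f : ℝ × Es d → ℝ} {α' K A : ℝ} {z0 : ℝ × Es d}, 0 < α' → 0 ≤ K → 0 ≤ A →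
      Coef α θ Λ a b → Reg α' K univ w g H p → BH α f →
      (∀ z ∈ Metric.ball z0 R, p z = trc (a z.2) (H z) + drf (b z.2) (g z) + f z) →
      (∀ z ∈ Metric.ball z0 R, |w z| ≤ A) → (∀ z ∈ Metric.ball z0 R, |f z| ≤ A) →
      (∀ z ∈ Metric.ball z0 R, ∀ z' ∈ Metric.ball z0 R,
        |f z - f z'| ≤ A * rho α z z' + Λ * |w z - w z'|) →
      ∃ g' H' p', Reg α (C * A) (Metric.ball z0 r) w g' H' p' ∧
        ∀ z ∈ Metric.ball z0 r, p' z = trc (a z.2) (H' z) + drf (b z.2) (g' z) + f z := by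
  obtain ⟨r, C, hr, hrR, hC, hreg⟩ := interior_reg (d := d) hθ hΛ hα hα1 (R := 2 * (R / 3))
    (by positivity) (by linarith)
  refine ⟨r, C, hr, hC, ?_⟩
  intro a b w g H p f α' K A z0 hα' hK hA hc h hf heq hw hfA hfh
  obtain ⟨K', w', g', H', p', hK', h', hE⟩ := cut_upgrade hθ hΛ hα hα1 hα' hK
    (by positivity : 0 < R / 3) (by linarith) hc h hf (z0 := z0)
    (by rwa [show 3 * (R / 3) = R by ring])
  have hsub : Metric.ball z0 (2 * (R / 3)) ⊆ Metric.ball z0 R :=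
    Metric.ball_subset_ball (by linarith)
  have hsub' : Metric.ball z0 r ⊆ Metric.ball z0 (2 * (R / 3)) := Metric.ball_subset_ball hrR
  have key := hreg hK' hA h' (z0 := z0) (f := f) (a := a) (b := b) ⟨fun x _ => hc.ell x,
    hc.ha.subset (subset_univ _), hc.hb.subset (subset_univ _), fun z hz => (hE z hz).2,
    fun z hz => by rw [(hE z hz).1]; exact hw z (hsub hz), fun z hz => hfA z (hsub hz),
    fun z hz z' hz' => by
      rw [(hE z hz).1, (hE z' hz').1]; exact hfh z (hsub hz) z' (hsub hz')⟩
  refine ⟨g', H', p', ⟨fun z hz => ?_, key.dg, fun z hz => ?_, key.xw.congr ?_, key.xg, key.xH,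
    key.xp⟩, fun z hz => (hE z (hsub' hz)).2⟩
  · refine (key.dw z hz).congr_of_eventuallyEq ?_
    have : ContinuousAt (fun x : Es d => (z.1, x)) z.2 := by fun_prop
    filter_upwards [this.preimage_mem_nhds (Metric.isOpen_ball.mem_nhds hz)] with x hx
    exact ((hE _ (hsub' hx)).1).symm
  · refine (key.dt z hz).congr_of_eventuallyEq ?_
    have : ContinuousAt (fun t : ℝ => (t, z.2)) z.1 := by fun_prop
    filter_upwards [this.preimage_mem_nhds (Metric.isOpen_ball.mem_nhds hz)] with t ht
    exact ((hE _ (hsub' ht)).1).symm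
  · intro z hz
    exact (hE z (hsub' hz)).1

end Upgrade

section Localize
variable {d : ℕ}

/-- Bounded and Hölder continuous on the whole space, with every small exponent. -/
def HE {V : Type*} [NormedAddCommGroup V] (f : Es d → V) : Prop :=
  ∀ᶠ α in 𝓝[>] (0:ℝ), ∃ A, 0 ≤ A ∧ Hol (sho α) A A univ f

lemma Hol.sho_max {V : Type*} [NormedAddCommGroup V] {α A B : ℝ} {f : Es d → V}
    (h : Hol (sho α) A B univ f) : ∃ A, 0 ≤ A ∧ Hol (sho α) A A univ f :=
  ⟨max 0 (max A B), le_max_left _ _, h.mono (sho_nonneg α)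
    ((le_max_left A B).trans (le_max_right _ _)) ((le_max_right A B).trans (le_max_right _ _))⟩

namespace HE

lemma const {V : Type*} [NormedAddCommGroup V] (c : V) : HE (d := d) fun _ => c :=
  Eventually.of_forall fun _ => (Hol.const c).sho_max

lemma add {V : Type*} [NormedAddCommGroup V] {f f' : Es d → V} (h : HE f) (h' : HE f') :
    HE fun x => f x + f' x := by
  filter_upwards [h, h'] with α h1 h2
  exact (h1.choose_spec.2.add h2.choose_spec.2).sho_max

lemma sub {V : Type*} [NormedAddCommGroup V] {f f' : Es d → V} (h : HE f) (h' : HE f') :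
    HE fun x => f x - f' x := by
  filter_upwards [h, h'] with α h1 h2
  exact (h1.choose_spec.2.sub h2.choose_spec.2).sho_max

lemma mul {f f' : Es d → ℝ} (h : HE f) (h' : HE f') : HE fun x => f x * f' x := by
  filter_upwards [h, h'] with α h1 h2
  exact (h1.choose_spec.2.mul h2.choose_spec.2).sho_max

lemma pi {V : Type*} [NormedAddCommGroup V] {ι : Type*} [Fintype ι] {f : Es d → ι → V}
    (h : ∀ i, HE fun x => f x i) : HE f := by
  filter_upwards [eventually_all.2 h] with α h1
  choose A hA hf using h1
  have hle : ∀ i, A i ≤ ∑ j, A j := fun i =>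
    Finset.single_le_sum (fun j _ => hA j) (Finset.mem_univ i)
  have hS : 0 ≤ ∑ j, A j := Finset.sum_nonneg fun j _ => hA j
  refine ⟨∑ j, A j, hS, ⟨fun x hx => ?_, fun x hx y hy => ?_⟩⟩
  · exact (pi_norm_le_iff_of_nonneg hS).2 fun i => ((hf i).bd x hx).trans (hle i)
  · have := sho_nonneg α x y
    refine (pi_norm_le_iff_of_nonneg (by positivity)).2 fun i => ((hf i).ho x hx y hy).trans ?_
    gcongr
    exact hle i

end HE

/-- Smooth cutoff functions for centered balls. -/
lemma exists_cut (d : ℕ) {r : ℝ} (hr : 0 < r) : ∃ ψ : Es d → ℝ, ContDiff ℝ 3 ψ ∧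
    HasCompactSupport ψ ∧ (∀ x, 0 ≤ ψ x) ∧ (∀ x, ψ x ≤ 1) ∧ (∀ x, ‖x‖ ≤ r → ψ x = 1) ∧
    ∀ x, r + 1 ≤ ‖x‖ → ψ x = 0 := by
  let ψ : ContDiffBump (0 : Es d) := ⟨r, r + 1, hr, by linarith⟩
  refine ⟨ψ, ψ.contDiff, ψ.hasCompactSupport, fun x => ψ.nonneg, fun x => ψ.le_one,
    fun x hx => ψ.one_of_mem_closedBall (by simpa using hx), fun x hx => ?_⟩
  exact ψ.zero_of_le_dist (by simpa using hx)

lemma HE.of_contDiff {ψ : Es d → ℝ} (hψ : ContDiff ℝ 3 ψ) (hc : HasCompactSupport ψ) : HE ψ := by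
  obtain ⟨C, hC⟩ := (hψ.of_le (by norm_num) : ContDiff ℝ 1 ψ).lipschitzWith_of_hasCompactSupport
    hc (by simp)
  obtain ⟨M, hM⟩ := hψ.continuous.bounded_above_of_compact_support hc
  have hM0 : 0 ≤ M := (norm_nonneg _).trans (hM 0)
  have hC0 : (0:ℝ) ≤ C := C.2
  have h1 : ∀ᶠ α in 𝓝[>] (0:ℝ), α ∈ Ioo (0:ℝ) 1 := Ioo_mem_nhdsGT one_pos
  filter_upwards [h1] with α hα
  refine Hol.sho_max (A := M) (B := C + 2 * M) ⟨fun x _ => hM x, fun x _ y _ => ?_⟩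
  unfold sho
  rcases le_or_gt 1 ‖x - y‖ with h | h
  · have := Real.one_le_rpow h hα.1.le
    refine (norm_sub_le _ _).trans ?_
    nlinarith [hM x, hM y]
  · have h2 := le_rpow_of_le_one (norm_nonneg (x - y)) h.le hα.2.le
    have h3 := hC.dist_le_mul x y
    rw [dist_eq_norm, dist_eq_norm] at h3
    have : 0 ≤ ‖x - y‖ ^ α := by positivity
    nlinarith

lemma HE.cut_mul {f ψ : Es d → ℝ} {r : ℝ} (hf : LocHolder f) (hψ : HE ψ)
    (hr : 0 ≤ r) (h0 : ∀ x, r + 1 ≤ ‖x‖ → ψ x = 0) : HE fun x => ψ x * f x := by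
  obtain ⟨κ, C, hκ, hκ1, hC, hfC⟩ := hf _ (isCompact_closedBall (0 : Es d) (r + 2))
  set B := |f 0| + C * (r + 2) ^ κ with hB
  have hB0 : 0 ≤ B := by positivity
  have hfB : ∀ x : Es d, ‖x‖ ≤ r + 2 → |f x| ≤ B := by
    intro x hx
    have h1 := hfC x (by simpa using hx) 0 (by simp; linarith)
    rw [sub_zero] at h1
    have h2 : ‖x‖ ^ κ ≤ (r + 2) ^ κ := Real.rpow_le_rpow (norm_nonneg _) hx hκ.le
    have h3 := abs_sub_abs_le_abs_sub (f x) (f 0)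
    nlinarith
  have h1 : ∀ᶠ α in 𝓝[>] (0:ℝ), α ∈ Ioc (0:ℝ) κ := Ioc_mem_nhdsGT hκ
  filter_upwards [h1, hψ] with α hα ⟨A, hA, hψA⟩
  have hbd : ∀ x, |ψ x * f x| ≤ A * B := by
    intro x
    rcases le_or_gt (r + 1) ‖x‖ with hx | hx
    · rw [h0 x hx, zero_mul, abs_zero]
      positivity
    · rw [abs_mul]
      exact mul_le_mul (hψA.bd x (mem_univ _)) (hfB x (by linarith)) (abs_nonneg _) hA
  refine Hol.sho_max (A := A * B) (B := A * C + 2 * (A * B)) ⟨fun x _ => hbd x, fun x _ y _ => ?_⟩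
  unfold sho
  have hn : 0 ≤ ‖x - y‖ ^ α := by positivity
  rcases le_or_gt 1 ‖x - y‖ with h | h
  · have := Real.one_le_rpow h hα.1.le
    refine (norm_sub_le _ _).trans ?_
    have h2 := hbd x
    have h3 := hbd y
    rw [← Real.norm_eq_abs] at h2 h3
    have : 0 ≤ A * C := by positivity
    have : 0 ≤ A * B := by positivity
    nlinarith
  have key : ∀ x y : Es d, ‖x‖ ≤ r + 2 → ‖y‖ ≤ r + 2 → ‖x - y‖ < 1 →
      ‖ψ x * f x - ψ y * f y‖ ≤ (A * C + 2 * (A * B)) * ‖x - y‖ ^ α := by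
    intro x y hx hy h
    have hn : 0 ≤ ‖x - y‖ ^ α := by positivity
    have h2 : ‖x - y‖ ^ κ ≤ ‖x - y‖ ^ α := by
      rcases (norm_nonneg (x - y)).eq_or_lt with h3 | h3
      · rw [← h3, Real.zero_rpow hκ.ne', Real.zero_rpow hα.1.ne']
      · exact Real.rpow_le_rpow_of_exponent_ge h3 h.le hα.2
    have h3 : ψ x * f x - ψ y * f y = ψ x * (f x - f y) + (ψ x - ψ y) * f y := by ring
    have e1 : ‖ψ x * (f x - f y)‖ ≤ A * (C * ‖x - y‖ ^ α) := by
      rw [norm_mul]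
      refine mul_le_mul (hψA.bd x (mem_univ _)) ((hfC x (by simpa using hx) y
        (by simpa using hy)).trans ?_) (norm_nonneg _) hA
      gcongr
    have e2 : ‖(ψ x - ψ y) * f y‖ ≤ A * ‖x - y‖ ^ α * B := by
      rw [norm_mul]
      exact mul_le_mul (hψA.ho x (mem_univ _) y (mem_univ _)) (hfB y hy) (norm_nonneg _)
        (by positivity)
    rw [h3]
    refine (norm_add_le _ _).trans ((add_le_add e1 e2).trans ?_)
    have : 0 ≤ A * B * ‖x - y‖ ^ α := by positivity
    nlinarith
  have hxy := norm_le_norm_add_norm_sub' x y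
  have hyx := norm_le_norm_add_norm_sub x y
  by_cases hx : ‖x‖ ≤ r + 2
  · by_cases hy : ‖y‖ ≤ r + 2
    · exact key x y hx hy h
    · rw [h0 x (by linarith), h0 y (by linarith), zero_mul, zero_mul, sub_zero, norm_zero]
      positivity
  · rw [h0 x (by linarith), h0 y (by linarith), zero_mul, zero_mul, sub_zero, norm_zero]
    positivity

/-- Uniform ellipticity on compact sets. -/
lemma exists_ell_of_isCompact {a : Fin d → Fin d → Es d → ℝ} (hc : ∀ i j, Continuous (a i j))
    (hs : ∀ i j x, a i j x = a j i x)
    (he : ∀ x ν : Es d, ν ≠ 0 → 0 < ∑ i, ∑ j, a i j x * ν i * ν j) {K : Set (Es d)}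
    (hK : IsCompact K) : ∃ θ, 0 < θ ∧ ∀ x ∈ K, Ell θ fun i j => a i j x := by
  have hS : IsCompact (K ×ˢ Metric.sphere (0 : Es d) 1) := hK.prod (isCompact_sphere _ _)
  obtain ⟨θ, hθ, hmin⟩ := hS.exists_forall_le' (a := (0:ℝ))
    (f := fun q : Es d × Es d => ∑ i, ∑ j, a i j q.1 * q.2 i * q.2 j)
    (Continuous.continuousOn (by fun_prop)) (fun q hq => he q.1 q.2 (by
      rintro h0
      have := hq.2
      rw [h0] at this
      simp at this))
  refine ⟨θ, hθ, fun x hx => ⟨fun i j => hs i j x, fun ν => ?_⟩⟩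
  rcases eq_or_ne ν 0 with h0 | h0
  · simp [h0]
  have hn : 0 < ‖ν‖ := norm_pos_iff.2 h0
  have h1 := hmin (x, ‖ν‖⁻¹ • ν) ⟨hx, by simp [norm_smul, hn.ne']⟩
  have h2 : ∑ i, ∑ j, a i j x * (‖ν‖⁻¹ • ν) i * (‖ν‖⁻¹ • ν) j
      = (‖ν‖ ^ 2)⁻¹ * ∑ i, ∑ j, a i j x * ν i * ν j := by
    simp only [Finset.mul_sum]
    refine Finset.sum_congr rfl fun i _ => Finset.sum_congr rfl fun j _ => ?_
    simp only [PiLp.smul_apply, smul_eq_mul]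
    ring
  simp only [h2] at h1
  rwa [inv_mul_eq_div, le_div_iff₀ (by positivity)] at h1

lemma LocHolder.continuous {f : Es d → ℝ} (hf : LocHolder f) : Continuous f := by
  refine continuous_iff_continuousAt.2 fun x => ?_
  obtain ⟨κ, C, hκ, -, hC, hfC⟩ := hf _ (isCompact_closedBall x 1)
  rw [ContinuousAt, tendsto_iff_norm_sub_tendsto_zero]
  have h1 : Tendsto (fun y => C * ‖y - x‖ ^ κ) (𝓝 x) (𝓝 0) := by
    have : Continuous fun y => C * ‖y - x‖ ^ κ :=
      continuous_const.mul ((continuous_id.sub continuous_const).norm.rpow_const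
        fun _ => Or.inr hκ.le)
    simpa [Real.zero_rpow hκ.ne'] using this.tendsto x
  refine squeeze_zero' (Eventually.of_forall fun _ => norm_nonneg _) ?_ h1
  filter_upwards [Metric.closedBall_mem_nhds x one_pos] with y hy
  exact hfC y hy x (by simp)

/-- Coefficients agreeing with given locally Hölder ones on a ball and globally well behaved. -/
lemma exists_local_coef {a : Fin d → Fin d → Es d → ℝ} {b : Fin d → Es d → ℝ} {α β : Es d → ℝ}
    (ha : ∀ i j, LocHolder (a i j)) (hb : ∀ i, LocHolder (b i))
    (hs : ∀ i j x, a i j x = a j i x)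
    (he : ∀ x ν : Es d, ν ≠ 0 → 0 < ∑ i, ∑ j, a i j x * ν i * ν j)
    (hα : LocHolder α) (hβ : LocHolder β) {r : ℝ} (hr : 0 < r) :
    ∃ (a' : Es d → Fin d → Fin d → ℝ) (b' : Es d → Fin d → ℝ) (ψ : Es d → ℝ) (θ : ℝ),
      0 < θ ∧ (∀ x, 0 ≤ ψ x) ∧ (∀ x, ψ x ≤ 1) ∧ (∀ x, r + 1 ≤ ‖x‖ → ψ x = 0) ∧
      (∀ x, ‖x‖ ≤ r → ψ x = 1 ∧ a' x = (fun i j => a i j x) ∧ b' x = fun i => b i x) ∧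
      ∀ᶠ κ in 𝓝[>] (0:ℝ), ∃ Λ, 1 ≤ Λ ∧ Coef κ θ Λ a' b' ∧
        Hol (sho κ) Λ Λ univ (fun x => ψ x * α x) ∧ Hol (sho κ) Λ Λ univ fun x => ψ x * β x := by
  obtain ⟨ψ, hψ, hψc, hψ0, hψ1, hone, hzero⟩ := exists_cut d hr
  have hψE := HE.of_contDiff hψ hψc
  obtain ⟨θ, hθ, hell⟩ := exists_ell_of_isCompact (fun i j => (ha i j).continuous) hs he
    (isCompact_closedBall (0 : Es d) (r + 1))
  set a' : Es d → Fin d → Fin d → ℝ := fun x i j => ψ x * a i j x + (1 - ψ x) * idc d i j with ha'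
  set b' : Es d → Fin d → ℝ := fun x i => ψ x * b i x with hb'
  have hEa : HE a' := HE.pi fun i => HE.pi fun j => (HE.cut_mul (ha i j) hψE hr.le hzero).add
    (((HE.const 1).sub hψE).mul (HE.const _))
  have hEb : HE b' := HE.pi fun i => HE.cut_mul (hb i) hψE hr.le hzero
  have hEα := HE.cut_mul hα hψE hr.le hzero
  have hEβ := HE.cut_mul hβ hψE hr.le hzero
  have hEll : ∀ x, Ell (min θ 1) (a' x) := by
    intro x
    refine ⟨fun i j => ?_, fun ν => ?_⟩
    · simp only [ha']
      rw [hs i j x, ell_idc.symm i j]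
    have e : ∑ i, ∑ j, a' x i j * ν i * ν j = ψ x * ∑ i, ∑ j, a i j x * ν i * ν j
        + (1 - ψ x) * ∑ i, ∑ j, idc d i j * ν i * ν j := by
      simp only [ha', Finset.mul_sum, ← Finset.sum_add_distrib]
      refine Finset.sum_congr rfl fun i _ => Finset.sum_congr rfl fun j _ => ?_
      ring
    have hn : 0 ≤ ‖ν‖ ^ 2 := by positivity
    have h1 : 0 ≤ 1 - ψ x := by linarith [hψ1 x]
    have e2 : ψ x * (θ * ‖ν‖ ^ 2) ≤ ψ x * ∑ i, ∑ j, a i j x * ν i * ν j := by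
      rcases le_or_gt ‖x‖ (r + 1) with hx | hx
      · exact mul_le_mul_of_nonneg_left ((hell x (by simpa using hx)).ell ν) (hψ0 x)
      · rw [hzero x hx.le, zero_mul, zero_mul]
    have e1 := mul_le_mul_of_nonneg_left (ell_idc.ell ν) h1
    have e3 : min θ 1 * ‖ν‖ ^ 2 ≤ θ * ‖ν‖ ^ 2 := by gcongr; exact min_le_left _ _
    have e4 : min θ 1 * ‖ν‖ ^ 2 ≤ 1 * ‖ν‖ ^ 2 := by gcongr; exact min_le_right _ _
    rw [e]
    nlinarith [mul_le_mul_of_nonneg_left e3 (hψ0 x), mul_le_mul_of_nonneg_left e4 h1]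
  refine ⟨a', b', ψ, min θ 1, by positivity, hψ0, hψ1, hzero, fun x hx => ⟨hone x hx, ?_, ?_⟩, ?_⟩
  · funext i j
    simp [ha', hone x hx]
  · funext i
    simp [hb', hone x hx]
  filter_upwards [hEa, hEb, hEα, hEβ] with κ ⟨A1, h1, k1⟩ ⟨A2, h2, k2⟩ ⟨A3, h3, k3⟩ ⟨A4, h4, k4⟩
  have l1 : A1 ≤ 1 + A1 + A2 + A3 + A4 := by linarith
  have l2 : A2 ≤ 1 + A1 + A2 + A3 + A4 := by linarith
  have l3 : A3 ≤ 1 + A1 + A2 + A3 + A4 := by linarith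
  have l4 : A4 ≤ 1 + A1 + A2 + A3 + A4 := by linarith
  exact ⟨1 + A1 + A2 + A3 + A4, by linarith, ⟨hEll, k1.mono (sho_nonneg _) l1 l1,
    k2.mono (sho_nonneg _) l2 l2⟩, k3.mono (sho_nonneg _) l3 l3, k4.mono (sho_nonneg _) l4 l4⟩

end Localize

section Nonlin
variable {d : ℕ}

/-- Bounded and Lipschitz on `[0, S]` in the last variable, Hölder in space-time. -/
def JL (α S : ℝ) (F : ℝ × Es d → ℝ → ℝ) : Prop :=
  ∃ K, 0 ≤ K ∧ (∀ z, ∀ s ∈ Icc 0 S, |F z s| ≤ K) ∧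
    ∀ z z', ∀ s ∈ Icc 0 S, ∀ s' ∈ Icc 0 S, |F z s - F z' s'| ≤ K * (rho α z z' + |s - s'|)

namespace JL
variable {α S : ℝ} {F F' : ℝ × Es d → ℝ → ℝ}

lemma sub (h : JL α S F) (h' : JL α S F') : JL α S fun z s => F z s - F' z s := by
  obtain ⟨K, hK, hb, hl⟩ := h
  obtain ⟨K', hK', hb', hl'⟩ := h'
  refine ⟨K + K', by positivity, fun z s hs => ?_, fun z z' s hs s' hs' => ?_⟩
  · exact (abs_sub _ _).trans (add_le_add (hb z s hs) (hb' z s hs))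
  · have e : F z s - F' z s - (F z' s' - F' z' s') = F z s - F z' s' - (F' z s - F' z' s') := by
      ring
    rw [e, add_mul]
    exact (abs_sub _ _).trans (add_le_add (hl z z' s hs s' hs') (hl' z z' s hs s' hs'))

lemma mul (h : JL α S F) (h' : JL α S F') : JL α S fun z s => F z s * F' z s := by
  obtain ⟨K, hK, hb, hl⟩ := h
  obtain ⟨K', hK', hb', hl'⟩ := h'
  refine ⟨2 * (K * K'), by positivity, fun z s hs => ?_, fun z z' s hs s' hs' => ?_⟩
  · rw [abs_mul]
    have := mul_le_mul (hb z s hs) (hb' z s hs) (abs_nonneg _) hK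
    have := mul_nonneg hK hK'
    linarith
  · have e : F z s * F' z s - F z' s' * F' z' s'
        = F z s * (F' z s - F' z' s') + (F z s - F z' s') * F' z' s' := by ring
    rw [e]
    refine (abs_add_le _ _).trans ?_
    rw [abs_mul, abs_mul]
    have h1 := mul_le_mul (hb z s hs) (hl' z z' s hs s' hs') (abs_nonneg _) hK
    have h2 := mul_le_mul (hl z z' s hs s' hs') (hb' z' s' hs') (abs_nonneg _)
      ((abs_nonneg _).trans (hl z z' s hs s' hs'))
    linarith

lemma of_bh {f : ℝ × Es d → ℝ} (h : BH α f) : JL α S fun z _ => f z := by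
  obtain ⟨A, hA, hf⟩ := h
  refine ⟨A, hA, fun z s _ => hf.bd z (mem_univ _), fun z z' s hs s' hs' => ?_⟩
  refine (hf.ho z (mem_univ _) z' (mem_univ _)).trans ?_
  gcongr
  linarith [abs_nonneg (s - s')]

lemma id : JL (d := d) α S fun _ s => s := by
  refine ⟨max S 1, by positivity, fun z s hs => ?_, fun z z' s hs s' hs' => ?_⟩
  · rw [abs_of_nonneg hs.1]
    exact hs.2.trans (le_max_left _ _)
  · have := rho_nonneg α z z'
    have := abs_nonneg (s - s')
    have := le_max_right S 1
    nlinarith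

lemma abs_rpow_sub_rpow_le {p : ℝ} (hp : 1 ≤ p) {s s' : ℝ} (hs : s ∈ Icc 0 S)
    (hs' : s' ∈ Icc 0 S) : |s ^ p - s' ^ p| ≤ p * S ^ (p - 1) * |s - s'| := by
  have hS : 0 ≤ S := hs.1.trans hs.2
  refine (convex_Icc 0 S).norm_image_sub_le_of_norm_hasDerivWithin_le
    (f := fun x : ℝ => x ^ p) (f' := fun x => p * x ^ (p - 1))
    (fun x _ => (Real.hasDerivAt_rpow_const (Or.inr hp)).hasDerivWithinAt) (fun x hx => ?_) hs' hs
  rw [Real.norm_of_nonneg (mul_nonneg (by linarith) (Real.rpow_nonneg hx.1 _))]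
  gcongr
  · exact hx.1
  · exact hx.2

lemma rpow {p : ℝ} (hp : 1 ≤ p) (hS : 0 ≤ S) : JL (d := d) α S fun _ s => s ^ p := by
  refine ⟨p * S ^ (p - 1) + S ^ p, by positivity, fun z s hs => ?_, fun z z' s hs s' hs' => ?_⟩
  · rw [abs_of_nonneg (Real.rpow_nonneg hs.1 _)]
    have h1 : s ^ p ≤ S ^ p := Real.rpow_le_rpow hs.1 hs.2 (by linarith)
    have h2 : 0 ≤ p * S ^ (p - 1) := by positivity
    linarith
  · have h1 := abs_rpow_sub_rpow_le hp hs hs'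
    have h2 : 0 ≤ S ^ p := by positivity
    have h3 : 0 ≤ p * S ^ (p - 1) := by positivity
    have := rho_nonneg α z z'
    have := abs_nonneg (s - s')
    nlinarith [mul_nonneg h2 this, mul_nonneg (add_nonneg h3 h2) (rho_nonneg α z z')]

end JL

/-- The penalized logistic nonlinearity is admissible. -/
lemma exists_nl {κ S p k : ℝ} (hS : 0 ≤ S) (hp : 1 ≤ p) (hk : 0 ≤ k)
    {A B ρ : Es d → ℝ} {φ : ℝ × Es d → ℝ} (hA : BH κ fun z : ℝ × Es d => A z.2)
    (hB : BH κ fun z : ℝ × Es d => B z.2) (hρ : BH κ fun z : ℝ × Es d => ρ z.2) (hφ : BH κ φ)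
    (hρ0 : ∀ x, 0 ≤ ρ x) (hφ0 : ∀ z, φ z ∈ Icc 0 S) (hφi : ∀ z : ℝ × Es d, z.1 ≤ 0 → φ z = 0)
    (hAB : ∀ x, B x * S ≤ A x * S ^ p) :
    ∃ Λ0, ∀ Λ ≥ Λ0, NL κ Λ S fun z s => B z.2 * s - A z.2 * s ^ p - k * ρ z.2 * (s - φ z) := by
  have hkρ : BH κ fun z : ℝ × Es d => k * ρ z.2 :=
    BH.mul (f := fun _ => k) (Hol.const k).bh hρ
  obtain ⟨K, hK, hb, hl⟩ := (((JL.of_bh hB).mul (JL.id)).sub ((JL.of_bh hA).mul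
    (JL.rpow hp hS))).sub ((JL.of_bh hkρ).mul ((JL.id).sub (JL.of_bh (S := S) hφ)))
  have hp0 : (0:ℝ) ^ p = 0 := Real.zero_rpow (by linarith)
  refine ⟨K, fun Λ hΛ => ⟨fun z z' s hs s' hs' => ?_, fun z s hs => (hb z s hs).trans hΛ,
    fun z => ?_, fun z => ?_, fun z hz => ?_⟩⟩
  · have := rho_nonneg κ z z'
    exact (hl z z' s hs s' hs').trans (by gcongr)
  · have := mul_nonneg (mul_nonneg hk (hρ0 z.2)) (hφ0 z).1
    simp only [hp0]
    linarith
  · have := mul_nonneg (mul_nonneg hk (hρ0 z.2)) (sub_nonneg.2 (hφ0 z).2)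
    have := hAB z.2
    linarith
  · simp only [hp0, hφi z hz]
    ring

end Nonlin

open scoped Manifold ContDiff in
/-- Smooth approximation on compact sets of a nonnegative bounded continuous function vanishing
for nonpositive times. -/
lemma exists_smooth_approx {d : ℕ} {W : ℝ × Es d → ℝ} {S δ R : ℝ} (hW : Continuous W)
    (hWS : ∀ z, W z ∈ Icc 0 S) (hW0 : ∀ z : ℝ × Es d, z.1 ≤ 0 → W z = 0) (hδ : 0 < δ) :
    ∃ φ : ℝ × Es d → ℝ, ContDiff ℝ 3 φ ∧ HasCompactSupport φ ∧ (∀ z, φ z ∈ Icc 0 S) ∧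
      (∀ z : ℝ × Es d, z.1 ≤ 0 → φ z = 0) ∧ ∀ z, ‖z‖ ≤ R → |φ z - W z| ≤ δ := by
  have hS : 0 ≤ S := (hWS 0).1.trans (hWS 0).2
  set χ : ℝ × Es d → ℝ := fun z => max 0 (min 1 (R + 1 - ‖z‖)) with hχ
  have hχc : Continuous χ := by fun_prop
  have hχ0 : ∀ z, 0 ≤ χ z := fun z => le_max_left _ _
  have hχ1 : ∀ z, χ z ≤ 1 := fun z => max_le zero_le_one (min_le_left _ _)
  set X : ℝ × Es d → ℝ := fun z => χ z * W z with hX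
  have hXc : Continuous X := hχc.mul hW
  set t : ℝ × Es d → Set ℝ := fun z =>
    {s | s ∈ Icc 0 S ∧ s ∈ Icc (X z - δ) (X z + δ) ∧ (z.1 ≤ 0 ∨ R + 1 ≤ ‖z‖ → s ∈ ({0} : Set ℝ))}
    with ht
  have hconv : ∀ z, Convex ℝ (t z) := by
    intro z
    by_cases h : z.1 ≤ 0 ∨ R + 1 ≤ ‖z‖
    · have : t z = Icc 0 S ∩ (Icc (X z - δ) (X z + δ) ∩ {0}) := by
        ext s; simp [ht, h]
      rw [this]
      exact (convex_Icc _ _).inter ((convex_Icc _ _).inter (convex_singleton _))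
    · have : t z = Icc 0 S ∩ Icc (X z - δ) (X z + δ) := by
        ext s; simp [ht, h]
      rw [this]
      exact (convex_Icc _ _).inter (convex_Icc _ _)
  have hnear : ∀ z, ∀ᶠ y in 𝓝 z, X z ∈ Icc (X y - δ) (X y + δ) := by
    intro z
    filter_upwards [Metric.tendsto_nhds.1 (hXc.tendsto z) δ hδ] with y hy
    rw [Real.dist_eq, abs_lt] at hy
    constructor <;> linarith [hy.1, hy.2]
  obtain ⟨φ, hφ⟩ := exists_contMDiffMap_forall_mem_convex_of_local_const
    (n := (3 : ℕ∞)) 𝓘(ℝ, ℝ × Es d) hconv (fun z => by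
    by_cases h : z.1 ≤ 0 ∨ R + 1 ≤ ‖z‖
    · have hz : X z = 0 := by
        rcases h with h | h
        · simp [hX, hW0 z h]
        · have : χ z = 0 := max_eq_left ((min_le_right _ _).trans (by linarith))
          simp [hX, this]
      refine ⟨0, ?_⟩
      filter_upwards [hnear z] with y hy
      rw [hz] at hy
      exact ⟨⟨le_rfl, hS⟩, hy, fun _ => rfl⟩
    · push Not at h
      refine ⟨X z, ?_⟩
      have h1 : ∀ᶠ y : ℝ × Es d in 𝓝 z, 0 < y.1 := continuousAt_fst.eventually_const_lt h.1
      have h2 : ∀ᶠ y : ℝ × Es d in 𝓝 z, ‖y‖ < R + 1 :=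
        continuous_norm.continuousAt.eventually_lt_const h.2
      filter_upwards [hnear z, h1, h2] with y hy hy1 hy2
      refine ⟨⟨mul_nonneg (hχ0 z) (hWS z).1, ?_⟩, hy, fun h' => ?_⟩
      · have := mul_le_mul (hχ1 z) (hWS z).2 (hWS z).1 zero_le_one
        simpa using this
      · rcases h' with h' | h' <;> linarith)
  refine ⟨φ, φ.contMDiff.contDiff, ?_, fun z => (hφ z).1, fun z hz => (hφ z).2.2 (Or.inl hz),
    fun z hz => ?_⟩
  · refine HasCompactSupport.intro (isCompact_closedBall (0 : ℝ × Es d) (R + 1)) fun z hz => ?_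
    rw [mem_closedBall_zero_iff, not_le] at hz
    exact (hφ z).2.2 (Or.inr hz.le)
  · have h1 : χ z = 1 := by
      rw [hχ]
      simp only
      rw [min_eq_left (by linarith), max_eq_right zero_le_one]
    have h2 := (hφ z).2.1
    simp only [hX, h1, one_mul] at h2
    rw [abs_le]
    constructor <;> linarith [h2.1, h2.2]

section Penalty
variable {d : ℕ}

lemma fderiv_eq_zero_of_const {V : Type*} [NormedAddCommGroup V] [NormedSpace ℝ V] {η : Es d → V}
    {U : Set (Es d)} (hU : IsOpen U) {c : V} (h : ∀ x ∈ U, η x = c) {x : Es d} (hx : x ∈ U) :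
    fderiv ℝ η x = 0 := by
  have : η =ᶠ[𝓝 x] fun _ => c := by
    filter_upwards [hU.mem_nhds hx] with y hy using h y hy
  rw [this.fderiv_eq, fderiv_const_apply]

lemma exists_operator_bound {η : Es d → ℝ} (hη : ContDiff ℝ 3 η) (hc : HasCompactSupport η)
    (Λ : ℝ) : ∃ (G : Es d → BL (Es d) ℝ) (H : Es d → BL (Es d) (BL (Es d) ℝ)) (N : ℝ), 0 ≤ N ∧
      (∀ x, HasFDerivAt η (G x) x) ∧ (∀ x, HasFDerivAt G (H x) x) ∧
      (∀ (m : Fin d → Fin d → ℝ) (b : Fin d → ℝ), ‖m‖ ≤ Λ → ‖b‖ ≤ Λ → ∀ x,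
        |trc m (H x) + drf b (G x)| ≤ N) ∧
      ∀ U : Set (Es d), IsOpen U → ∀ c : ℝ, (∀ x ∈ U, η x = c) → ∀ x ∈ U, G x = 0 ∧ H x = 0 := by
  obtain ⟨G, hGd, hG, hGc, hG0⟩ : ∃ G : Es d → BL (Es d) ℝ, (∀ x, HasFDerivAt η (G x) x) ∧
      ContDiff ℝ 2 G ∧ HasCompactSupport G ∧
      ∀ U : Set (Es d), IsOpen U → ∀ c : ℝ, (∀ x ∈ U, η x = c) → ∀ x ∈ U, G x = 0 :=
    ⟨fderiv ℝ η, fun x => (hη.differentiable (by norm_num) x).hasFDerivAt,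
      hη.fderiv_right (by norm_num), hc.fderiv ℝ,
      fun U hU c h x hx => fderiv_eq_zero_of_const hU h hx⟩
  obtain ⟨H, hHd, hH, hHc, hH0⟩ : ∃ H : Es d → BL (Es d) (BL (Es d) ℝ),
      (∀ x, HasFDerivAt G (H x) x) ∧ Continuous H ∧ HasCompactSupport H ∧
      ∀ U : Set (Es d), IsOpen U → (∀ x ∈ U, G x = 0) → ∀ x ∈ U, H x = 0 :=
    ⟨fderiv ℝ G, fun x => (hG.differentiable (by norm_num) x).hasFDerivAt,
      hG.continuous_fderiv (by norm_num), hGc.fderiv ℝ,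
      fun U hU h x hx => fderiv_eq_zero_of_const hU h hx⟩
  obtain ⟨M1, h1⟩ := hG.continuous.bounded_above_of_compact_support hGc
  obtain ⟨M2, h2⟩ := hH.bounded_above_of_compact_support hHc
  have hM1 : 0 ≤ M1 := (norm_nonneg _).trans (h1 0)
  have hM2 : 0 ≤ M2 := (norm_nonneg _).trans (h2 0)
  refine ⟨G, H, (d:ℝ) ^ 2 * |Λ| * M2 + d * |Λ| * M1, by positivity, hGd, hHd,
    fun m b hm hb x => ?_, fun U hU c h x hx => ⟨hG0 U hU c h x hx, hH0 U hU (hG0 U hU c h) x hx⟩⟩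
  refine (abs_add_le _ _).trans (add_le_add ((norm_trc_le _ _).trans ?_)
    ((norm_drf_le _ _).trans ?_))
  · have := hm.trans (le_abs_self _)
    have := h2 x
    gcongr
  · have := hb.trans (le_abs_self _)
    have := h1 x
    gcongr

set_option maxHeartbeats 2000000 in
/-- A penalized global problem whose solution is close to a prescribed function outside a ball. -/
lemma penalized_solve {κ θ Λ S R δ p : ℝ} (hθ : 0 < θ) (hΛ : 1 ≤ Λ) (hκ : 0 < κ) (hκ1 : κ < 1)
    (hS : 0 ≤ S) (hR : 2 < R) (hδ : 0 < δ) (hp : 1 ≤ p)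
    {a : Es d → Fin d → Fin d → ℝ} {b : Es d → Fin d → ℝ} (hc : Coef κ θ Λ a b) {A B : Es d → ℝ}
    (hA : Hol (sho κ) Λ Λ univ A) (hB : Hol (sho κ) Λ Λ univ B)
    (hAB : ∀ x, B x * S ≤ A x * S ^ p) {φ : ℝ × Es d → ℝ} (hφ : ContDiff ℝ 3 φ)
    (hφc : HasCompactSupport φ) (hφ0 : ∀ z, φ z ∈ Icc 0 S)
    (hφi : ∀ z : ℝ × Es d, z.1 ≤ 0 → φ z = 0) :
    ∃ K u g H q k, ∃ ρ : Es d → ℝ, Reg κ K univ u g H q ∧ (∀ z, u z ∈ Icc 0 S) ∧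
      (∀ z : ℝ × Es d, z.1 ≤ 0 → u z = 0) ∧ 0 ≤ k ∧ (∀ x, 0 ≤ ρ x) ∧
      (∀ x, ‖x‖ ≤ R - 2 → ρ x = 0) ∧
      (∀ z, q z = trc (a z.2) (H z) + drf (b z.2) (g z)
        + (B z.2 * u z - A z.2 * u z ^ p - k * ρ z.2 * (u z - φ z))) ∧
      ∀ z : ℝ × Es d, z.1 ∈ Icc 0 R → R ≤ ‖z.2‖ → |u z - φ z| ≤ δ := by
  have hΛ0 : 0 ≤ Λ := by linarith
  obtain ⟨Kφ, gφ, Hφ, pφ, hKφ, rφ, -⟩ := exists_reg_of_contDiff hκ hκ1 hφ hφc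
  obtain ⟨η, hη, hηc, hη0, hη1, hηone, hηzero⟩ := exists_cut d (r := R - 1) (by linarith)
  obtain ⟨ζ, hζ, hζc, hζ0, hζ1, hζone, hζzero⟩ := exists_cut d (r := R - 2) (by linarith)
  obtain ⟨Gη, Hη, N, hN, dη, dG, hNb, hNU⟩ := exists_operator_bound hη hηc Λ
  have hAb : ∀ x, |A x| ≤ Λ := fun x => hA.bd x (mem_univ _)
  have hBb : ∀ x, |B x| ≤ Λ := fun x => hB.bd x (mem_univ _)
  have hSp : 0 ≤ S ^ p := by positivity
  set C0 := (d:ℝ) ^ 2 * Λ * Kφ + d * Λ * Kφ + Kφ + Λ * S + Λ * S ^ p with hC0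
  have hC00 : 0 ≤ C0 := by positivity
  set C := C0 + S with hC
  set C' := C0 + C * R * N + S + 1 with hC'
  have hCnn : 0 ≤ C := by positivity
  have hC'0 : 0 < C' := by
    have : 0 ≤ C * R * N := mul_nonneg (mul_nonneg hCnn (by linarith)) hN
    rw [hC']; linarith
  set k := C' / δ with hk
  have hk0 : 0 ≤ k := by positivity
  have hkδ : k * δ = C' := div_mul_cancel₀ _ hδ.ne'
  set ρ : Es d → ℝ := fun x => 1 - ζ x with hρ
  have hρ0 : ∀ x, 0 ≤ ρ x := fun x => by simp only [hρ]; linarith [hζ1 x]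
  obtain ⟨Aζ, hAζ, hζH⟩ : ∃ A, 0 ≤ A ∧ Hol (sho κ) A A univ ρ := by
    obtain ⟨L, hL⟩ := (hζ.of_le (by norm_num) : ContDiff ℝ 1 ζ).lipschitzWith_of_hasCompactSupport
      hζc (by simp)
    refine Hol.sho_max (A := 1) (B := L + 2) ⟨fun x _ => ?_, fun x _ y _ => ?_⟩
    · rw [Real.norm_of_nonneg (hρ0 x)]
      simp only [hρ]
      linarith [hζ0 x]
    · have hL0 : (0:ℝ) ≤ L := L.2
      have h1 := le_rho_of_lip (z := ((0:ℝ), x)) (z' := ((0:ℝ), y)) (D := L + 2) hκ hκ1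
        (c := ‖ρ x - ρ y‖) (by linarith) ?_ ?_
      · rwa [rho_space hκ] at h1
      · have := hL.dist_le_mul x y
        rw [Real.dist_eq] at this
        rw [Prod.dist_eq, dist_self, max_eq_right dist_nonneg]
        have e : ρ x - ρ y = -(ζ x - ζ y) := by simp only [hρ]; ring
        rw [e, norm_neg, Real.norm_eq_abs]
        nlinarith [dist_nonneg (x := x) (y := y)]
      · rw [Real.norm_eq_abs, abs_le]
        simp only [hρ]
        constructor <;> linarith [hζ0 x, hζ0 y, hζ1 x, hζ1 y]
  have toBH : ∀ {f : Es d → ℝ} {A : ℝ}, 0 ≤ A → Hol (sho κ) A A univ f →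
      BH κ fun z : ℝ × Es d => f z.2 := fun hA hf =>
    ⟨_, hA, (hf.comp_snd hA).subset fun _ _ => mem_univ _⟩
  obtain ⟨Λ0, hNL⟩ := exists_nl (κ := κ) hS hp hk0 (toBH hΛ0 hA) (toBH hΛ0 hB) (toBH hAζ hζH)
    rφ.xw.bh hρ0 hφ0 hφi hAB
  obtain ⟨K, u, g, H, q, ru, hu0, hui, hq⟩ := nonlinear_solve hθ (hΛ.trans (le_max_left Λ Λ0))
    hκ hκ1 hS (hc.mono (le_max_left Λ Λ0)) (hNL _ (le_max_right Λ Λ0))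
  refine ⟨K, u, g, H, q, k, ρ, ru, hu0, hui, hk0, hρ0,
    fun x hx => by simp only [hρ, hζone x hx, sub_self], hq, ?_⟩
  have main : ∀ σ : ℝ, |σ| = 1 → ∀ z ∈ {z : ℝ × Es d | z.1 ∈ Icc 0 R},
      σ * (u z - φ z) - (δ + C * z.1 * η z.2) ≤ 0 := by
    intro σ hσ
    have hdiff : ∀ z, |u z - φ z| ≤ S := fun z => by
      rw [abs_le]
      constructor <;> linarith [(hu0 z).1, (hu0 z).2, (hφ0 z).1, (hφ0 z).2]
    have hσd : ∀ z, σ * (u z - φ z) ≤ S := fun z =>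
      (le_abs_self _).trans (by rw [abs_mul, hσ, one_mul]; exact hdiff z)
    have hnn : ∀ z : ℝ × Es d, z.1 ∈ Icc 0 R → 0 ≤ C * z.1 * η z.2 := fun z hz =>
      mul_nonneg (mul_nonneg hCnn hz.1) (hη0 _)
    refine max_principle (K := S) (Λ := Λ) (isClosed_Icc.preimage continuous_fst) ?_ ?_ ?_
    · have h1 := ru.xw.continuous hκ
      have h2 := hφ.continuous
      have h3 := hη.continuous
      exact Continuous.continuousOn (by fun_prop)
    · intro z hz
      linarith [hσd z, hnn z hz]
    intro z hz hpos
    have hz1 : 0 < z.1 := by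
      rcases hz.1.eq_or_lt with h | h
      · rw [hui z h.ge, hφi z h.ge, ← h] at hpos
        simp at hpos
        linarith
      · exact h
    refine ⟨Eventually.of_forall fun y => hz, ?_, σ * (q z - pφ z) - C * η z.2,
      fun y => σ • (g (z.1, y) - gφ (z.1, y)) - (C * z.1) • Gη y,
      σ • (H z - Hφ z) - (C * z.1) • Hη z.2, a z.2, b z.2, ?_, ?_, ?_,
      (hc.ell z.2).posSemidef hθ.le, hc.ha.bd _ (mem_univ _), hc.hb.bd _ (mem_univ _), ?_⟩
    · filter_upwards [self_mem_nhdsWithin, mem_nhdsWithin_of_mem_nhds (Ioi_mem_nhds hz1)]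
        with s hs hs'
      exact ⟨le_of_lt hs', le_trans hs hz.2⟩
    · have h1 := ((ru.dt z (mem_univ _)).sub (rφ.dt z (mem_univ _))).const_mul σ
      have h2 := (((hasDerivAt_id z.1).const_mul C).mul_const (η z.2)).const_add δ
      rw [mul_one] at h2
      exact h1.sub h2
    · refine Eventually.of_forall fun y => ?_
      have h1 := ((ru.dw (z.1, y) (mem_univ _)).sub (rφ.dw (z.1, y) (mem_univ _))).const_mul σ
      have h2 := ((dη y).const_mul (C * z.1)).const_add δ
      exact h1.sub h2
    · have h1 := ((ru.dg z (mem_univ _)).sub (rφ.dg z (mem_univ _))).const_smul σ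
      have h2 := (dG z.2).const_smul (C * z.1)
      exact h1.sub h2
    rw [hq z]
    simp only [← trc_sub_right, ← drf_sub_right, trc_smul_right, drf_smul_right, Prod.mk.eta]
    set T := trc (a z.2) (Hφ z) + drf (b z.2) (gφ z) - pφ z + B z.2 * u z - A z.2 * u z ^ p with hT
    have hTb : |T| ≤ C0 := by
      have e1 := norm_trc_le (a z.2) (Hφ z)
      have e2 := norm_drf_le (b z.2) (gφ z)
      have e3 := rφ.xp.bd z (mem_univ _)
      have e4 : |B z.2 * u z| ≤ Λ * S := by
        rw [abs_mul, abs_of_nonneg (hu0 z).1]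
        exact mul_le_mul (hBb _) (hu0 z).2 (hu0 z).1 hΛ0
      have e5 : |A z.2 * u z ^ p| ≤ Λ * S ^ p := by
        have := Real.rpow_nonneg (hu0 z).1 p
        rw [abs_mul, abs_of_nonneg this]
        exact mul_le_mul (hAb _) (Real.rpow_le_rpow (hu0 z).1 (hu0 z).2 (by linarith)) this hΛ0
      have e6 : (d:ℝ) ^ 2 * ‖a z.2‖ * ‖Hφ z‖ ≤ (d:ℝ) ^ 2 * Λ * Kφ := by
        have := hc.ha.bd z.2 (mem_univ _)
        have := rφ.xH.bd z (mem_univ _)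
        gcongr
      have e7 : (d:ℝ) * ‖b z.2‖ * ‖gφ z‖ ≤ d * Λ * Kφ := by
        have := hc.hb.bd z.2 (mem_univ _)
        have := rφ.xg.bd z (mem_univ _)
        gcongr
      rw [Real.norm_eq_abs] at e1 e2 e3
      rw [abs_le] at *
      constructor <;> linarith [e1.1, e1.2, e2.1, e2.2, e3.1, e3.2, e4.1, e4.2, e5.1, e5.2]
    have hσT : σ * T ≤ C0 := (le_abs_self _).trans (by rw [abs_mul, hσ, one_mul]; exact hTb)
    have hpen : k * ρ z.2 * δ ≤ k * ρ z.2 * (σ * (u z - φ z)) := by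
      refine mul_le_mul_of_nonneg_left ?_ (mul_nonneg hk0 (hρ0 _))
      linarith [hnn z hz]
    have hpen' : k * ρ z.2 * δ = C' * ρ z.2 := by rw [← hkδ]; ring
    have hLη := hNb (a z.2) (b z.2) (hc.ha.bd _ (mem_univ _)) (hc.hb.bd _ (mem_univ _)) z.2
    have h4 := hσd z
    have h5 := hnn z hz
    suffices h : C0 - C' * ρ z.2 - C * η z.2
        + C * z.1 * (trc (a z.2) (Hη z.2) + drf (b z.2) (Gη z.2)) + S ≤ 0 by
      rw [hT] at hσT
      nlinarith
    rcases lt_or_ge ‖z.2‖ (R - 1) with hx | hx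
    · obtain ⟨g0, H0⟩ := hNU (Metric.ball 0 (R - 1)) Metric.isOpen_ball 1 (fun x hx =>
        hηone x (le_of_lt (by simpa using hx))) z.2 (by simpa using hx)
      have t0 : trc (a z.2) (Hη z.2) + drf (b z.2) (Gη z.2) = 0 := by
        rw [g0, H0]; simp [trc, drf]
      rw [t0, hηone z.2 hx.le]
      nlinarith [hρ0 z.2]
    · have hρ1 : ρ z.2 = 1 := by
        simp only [hρ]
        rw [hζzero z.2 (by linarith), sub_zero]
      have h6 : C * z.1 * (trc (a z.2) (Hη z.2) + drf (b z.2) (Gη z.2)) ≤ C * R * N :=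
        (mul_le_mul_of_nonneg_left ((le_abs_self _).trans hLη) (mul_nonneg hCnn hz.1)).trans
          (mul_le_mul_of_nonneg_right (mul_le_mul_of_nonneg_left hz.2 hCnn) hN)
      rw [hρ1]
      have := mul_nonneg hCnn (hη0 z.2)
      linarith
  intro z hz hx
  have h1 := main 1 (by simp) z hz
  have h2 := main (-1) (by simp) z hz
  rw [hηzero z.2 (by linarith)] at h1 h2
  rw [abs_le]
  constructor <;> linarith

end Penalty

section Comparison
variable {d : ℕ}

/-- A bounded nonnegative solution of the linear Cauchy problem with zero data, extended by zero
to negative times. -/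
structure LinSol (S : ℝ) (a : Es d → Fin d → Fin d → ℝ) (b : Es d → Fin d → ℝ) (V : ℝ × Es d → ℝ)
    (G : ℝ × Es d → BL (Es d) ℝ) (H : ℝ × Es d → BL (Es d) (BL (Es d) ℝ)) : Prop where
  cont : Continuous V
  mem : ∀ z, V z ∈ Icc 0 S
  init : ∀ z : ℝ × Es d, z.1 ≤ 0 → V z = 0
  dw : ∀ z : ℝ × Es d, 0 < z.1 → HasFDerivAt (fun x => V (z.1, x)) (G z) z.2
  dg : ∀ z : ℝ × Es d, 0 < z.1 → HasFDerivAt (fun x => G (z.1, x)) (H z) z.2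
  dt : ∀ z : ℝ × Es d, 0 < z.1 →
    HasDerivAt (fun t => V (t, z.2)) (trc (a z.2) (H z) + drf (b z.2) (G z)) z.1

lemma cylinder_aux {R : ℝ} {z : ℝ × Es d} (h0 : 0 < z.1) (h1 : z.1 ≤ R) (h2 : ‖z.2‖ < R) :
    (∀ᶠ y in 𝓝 z.2, (z.1, y) ∈ {z : ℝ × Es d | z.1 ∈ Icc 0 R ∧ ‖z.2‖ ≤ R}) ∧
    ∀ᶠ s in 𝓝[≤] z.1, (s, z.2) ∈ {z : ℝ × Es d | z.1 ∈ Icc 0 R ∧ ‖z.2‖ ≤ R} := by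
  constructor
  · filter_upwards [continuous_norm.continuousAt.eventually_lt_const h2] with y hy
    exact ⟨⟨h0.le, h1⟩, hy.le⟩
  · filter_upwards [self_mem_nhdsWithin, mem_nhdsWithin_of_mem_nhds (Ioi_mem_nhds h0)]
      with s hs hs'
    exact ⟨⟨le_of_lt hs', le_trans hs h1⟩, h2.le⟩

lemma isClosed_cylinder (R : ℝ) : IsClosed {z : ℝ × Es d | z.1 ∈ Icc 0 R ∧ ‖z.2‖ ≤ R} :=
  (isClosed_Icc.preimage continuous_fst).inter
    (isClosed_le (continuous_norm.comp continuous_snd) continuous_const)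

variable {κ θ Λ S S' R δ p k K M : ℝ} {a a0 : Es d → Fin d → Fin d → ℝ}
    {b b0 : Es d → Fin d → ℝ} {A B ρ : Es d → ℝ} {φ u q V : ℝ × Es d → ℝ}
    {g GV : ℝ × Es d → BL (Es d) ℝ} {H HV : ℝ × Es d → BL (Es d) (BL (Es d) ℝ)}

set_option maxHeartbeats 1000000 in
lemma lower_comparison (hθ : 0 < θ) (hκ : 0 < κ) (hδ : 0 < δ) (hc : Coef κ θ Λ a b)
    (ha : ∀ x, ‖x‖ ≤ R → a x = a0 x ∧ b x = b0 x)
    (hAB : ∀ x, ∀ s ∈ Icc 0 S', A x * s ^ p ≤ B x * s) (ru : Reg κ K univ u g H q)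
    (hu0 : ∀ z, 0 ≤ u z) (hk : 0 ≤ k) (hρ : ∀ x, 0 ≤ ρ x)
    (hq : ∀ z, q z = trc (a z.2) (H z) + drf (b z.2) (g z)
        + (B z.2 * u z - A z.2 * u z ^ p - k * ρ z.2 * (u z - φ z)))
    (hbd : ∀ z : ℝ × Es d, z.1 ∈ Icc 0 R → R ≤ ‖z.2‖ → |u z - φ z| ≤ δ)
    (hφV : ∀ z, ‖z‖ ≤ R → |φ z - V z| ≤ δ) (hV : LinSol S' a0 b0 V GV HV) {z : ℝ × Es d}
    (hz : z.1 ∈ Icc 0 R) (hzx : ‖z.2‖ ≤ R) : V z - 2 * δ ≤ u z := by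
  have hnorm : ∀ z : ℝ × Es d, z.1 ∈ Icc 0 R → ‖z.2‖ ≤ R → ‖z‖ ≤ R := fun z h1 h2 => by
    rw [Prod.norm_def, Real.norm_of_nonneg h1.1]
    exact max_le h1.2 h2
  have main : ∀ z ∈ {z : ℝ × Es d | z.1 ∈ Icc 0 R ∧ ‖z.2‖ ≤ R},
      Real.exp (-z.1) * (V z - 2 * δ - u z) ≤ 0 := by
    refine max_principle (K := S') (Λ := Λ) (isClosed_cylinder R) ?_ ?_ ?_
    · have h1 := ru.xw.continuous hκ
      have h2 := hV.cont
      exact Continuous.continuousOn (by fun_prop)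
    · intro z hz
      have h1 : V z - 2 * δ - u z ≤ S' := by linarith [(hV.mem z).2, hu0 z]
      have h2 : Real.exp (-z.1) ≤ 1 := Real.exp_le_one_iff.2 (by linarith [hz.1.1])
      have h3 := Real.exp_pos (-z.1)
      have h4 := (hV.mem z).1.trans (hV.mem z).2
      nlinarith
    intro z hz hpos
    have hE := Real.exp_pos (-z.1)
    have hlt : 0 < V z - 2 * δ - u z := (pos_iff_pos_of_mul_pos hpos).1 hE
    have hz1 : 0 < z.1 := by
      by_contra! h
      linarith [hV.init z h, hu0 z]
    have hφ := abs_le.1 (hφV z (hnorm z hz.1 hz.2))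
    have hz2 : ‖z.2‖ < R := by
      by_contra! h
      linarith [(abs_le.1 (hbd z hz.1 h)).1]
    obtain ⟨hD1, hD2⟩ := cylinder_aux hz1 hz.1.2 hz2
    refine ⟨hD1, hD2, -Real.exp (-z.1) * (V z - 2 * δ - u z) + Real.exp (-z.1) *
      (trc (a0 z.2) (HV z) + drf (b0 z.2) (GV z) - q z),
      fun y => Real.exp (-z.1) • (GV (z.1, y) - g (z.1, y)),
      Real.exp (-z.1) • (HV z - H z), a z.2, b z.2, ?_, ?_, ?_,
      (hc.ell z.2).posSemidef hθ.le, hc.ha.bd _ (mem_univ _), hc.hb.bd _ (mem_univ _), ?_⟩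
    · have h1 : HasDerivAt (fun s : ℝ => Real.exp (-s)) (-Real.exp (-z.1)) z.1 := by
        simpa using (hasDerivAt_neg z.1).exp
      have h2 := ((hV.dt z hz1).sub_const (2 * δ)).sub (ru.dt z (mem_univ _))
      exact h1.mul h2
    · refine Eventually.of_forall fun y => ?_
      have h2 := ((hV.dw (z.1, y) hz1).sub_const (2 * δ)).sub (ru.dw (z.1, y) (mem_univ _))
      exact h2.const_mul (Real.exp (-z.1))
    · exact ((hV.dg z hz1).sub (ru.dg z (mem_univ _))).const_smul (Real.exp (-z.1))
    rw [hq z, (ha z.2 hz2.le).1, (ha z.2 hz2.le).2]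
    simp only [← trc_sub_right, ← drf_sub_right, trc_smul_right, drf_smul_right, Prod.mk.eta]
    have hN := hAB z.2 (u z) ⟨hu0 z, by linarith [(hV.mem z).2]⟩
    have hpen : k * ρ z.2 * (u z - φ z) ≤ 0 :=
      mul_nonpos_of_nonneg_of_nonpos (mul_nonneg hk (hρ _)) (by linarith)
    have := mul_nonneg hE.le (by linarith :
      0 ≤ B z.2 * u z - A z.2 * u z ^ p - k * ρ z.2 * (u z - φ z))
    linarith
  have h1 := main z ⟨hz, hzx⟩
  have h2 := Real.exp_pos (-z.1)
  by_contra! h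
  have := mul_pos h2 (by linarith : 0 < V z - 2 * δ - u z)
  linarith

set_option maxHeartbeats 1000000 in
lemma upper_comparison (hθ : 0 < θ) (hκ : 0 < κ) (hδ : 0 < δ) (hc : Coef κ θ Λ a b)
    (ha : ∀ x, ‖x‖ ≤ R → a x = a0 x ∧ b x = b0 x) (hA : ∀ x, 0 ≤ A x) (hB : ∀ x, B x ≤ M)
    (hM : 0 ≤ M) (ru : Reg κ K univ u g H q)
    (hu0 : ∀ z, u z ∈ Icc 0 S) (hui : ∀ z : ℝ × Es d, z.1 ≤ 0 → u z = 0)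
    (hk : 0 ≤ k) (hρ : ∀ x, 0 ≤ ρ x)
    (hq : ∀ z, q z = trc (a z.2) (H z) + drf (b z.2) (g z)
        + (B z.2 * u z - A z.2 * u z ^ p - k * ρ z.2 * (u z - φ z)))
    (hbd : ∀ z : ℝ × Es d, z.1 ∈ Icc 0 R → R ≤ ‖z.2‖ → |u z - φ z| ≤ δ)
    (hφV : ∀ z, ‖z‖ ≤ R → |φ z - V z| ≤ δ) (hV : LinSol S' a0 b0 V GV HV) {z : ℝ × Es d}
    (hz : z.1 ∈ Icc 0 R) (hzx : ‖z.2‖ ≤ R) : u z ≤ Real.exp (M * z.1) * (V z + 2 * δ) := by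
  have hnorm : ∀ z : ℝ × Es d, z.1 ∈ Icc 0 R → ‖z.2‖ ≤ R → ‖z‖ ≤ R := fun z h1 h2 => by
    rw [Prod.norm_def, Real.norm_of_nonneg h1.1]
    exact max_le h1.2 h2
  have hsplit : ∀ t : ℝ, Real.exp (-t) = Real.exp (-(M + 1) * t) * Real.exp (M * t) := fun t => by
    rw [← Real.exp_add]; ring_nf
  have main : ∀ z ∈ {z : ℝ × Es d | z.1 ∈ Icc 0 R ∧ ‖z.2‖ ≤ R},
      Real.exp (-(M + 1) * z.1) * u z - Real.exp (-z.1) * (V z + 2 * δ) ≤ 0 := by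
    refine max_principle (K := S) (Λ := Λ) (isClosed_cylinder R) ?_ ?_ ?_
    · have h1 := ru.xw.continuous hκ
      have h2 := hV.cont
      exact Continuous.continuousOn (by fun_prop)
    · intro z hz
      have h2 : Real.exp (-(M + 1) * z.1) ≤ 1 :=
        Real.exp_le_one_iff.2 (by nlinarith [hz.1.1])
      have h3 := Real.exp_pos (-z.1)
      have h4 := (hV.mem z).1
      have h5 := mul_nonneg h3.le (by linarith : 0 ≤ V z + 2 * δ)
      have h6 := mul_le_mul h2 (hu0 z).2 (hu0 z).1 zero_le_one
      linarith
    intro z hz hpos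
    have hE := Real.exp_pos (-(M + 1) * z.1)
    have hE' : 1 ≤ Real.exp (M * z.1) := Real.one_le_exp (mul_nonneg hM hz.1.1)
    have hV0 := (hV.mem z).1
    have hlt : V z + 2 * δ < u z := by
      rw [hsplit z.1, mul_assoc, ← mul_sub] at hpos
      have := (pos_iff_pos_of_mul_pos hpos).1 hE
      nlinarith
    have hz1 : 0 < z.1 := by
      by_contra! h
      linarith [hui z h]
    have hφ := abs_le.1 (hφV z (hnorm z hz.1 hz.2))
    have hz2 : ‖z.2‖ < R := by
      by_contra! h
      linarith [(abs_le.1 (hbd z hz.1 h)).2]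
    obtain ⟨hD1, hD2⟩ := cylinder_aux hz1 hz.1.2 hz2
    refine ⟨hD1, hD2, (Real.exp (-(M + 1) * z.1) * -(M + 1)) * u z
      + Real.exp (-(M + 1) * z.1) * q z - (-Real.exp (-z.1) * (V z + 2 * δ) + Real.exp (-z.1) *
      (trc (a0 z.2) (HV z) + drf (b0 z.2) (GV z))),
      fun y => Real.exp (-(M + 1) * z.1) • g (z.1, y) - Real.exp (-z.1) • GV (z.1, y),
      Real.exp (-(M + 1) * z.1) • H z - Real.exp (-z.1) • HV z, a z.2, b z.2, ?_, ?_, ?_,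
      (hc.ell z.2).posSemidef hθ.le, hc.ha.bd _ (mem_univ _), hc.hb.bd _ (mem_univ _), ?_⟩
    · have h1 : HasDerivAt (fun s : ℝ => Real.exp (-s)) (-Real.exp (-z.1)) z.1 := by
        simpa using (hasDerivAt_neg z.1).exp
      have h3 : HasDerivAt (fun s : ℝ => Real.exp (-(M + 1) * s))
          (Real.exp (-(M + 1) * z.1) * -(M + 1)) z.1 := by
        simpa using ((hasDerivAt_id z.1).const_mul (-(M + 1))).exp
      exact (h3.mul (ru.dt z (mem_univ _))).sub (h1.mul ((hV.dt z hz1).add_const (2 * δ)))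
    · refine Eventually.of_forall fun y => ?_
      exact ((ru.dw (z.1, y) (mem_univ _)).const_mul (Real.exp (-(M + 1) * z.1))).sub
        (((hV.dw (z.1, y) hz1).add_const (2 * δ)).const_mul (Real.exp (-z.1)))
    · exact ((ru.dg z (mem_univ _)).const_smul (Real.exp (-(M + 1) * z.1))).sub
        ((hV.dg z hz1).const_smul (Real.exp (-z.1)))
    rw [hq z, (ha z.2 hz2.le).1, (ha z.2 hz2.le).2]
    simp only [← trc_sub_right, ← drf_sub_right, trc_smul_right, drf_smul_right, Prod.mk.eta]
    have hpen : 0 ≤ k * ρ z.2 * (u z - φ z) :=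
      mul_nonneg (mul_nonneg hk (hρ _)) (by linarith)
    have hBu : B z.2 * u z ≤ M * u z := mul_le_mul_of_nonneg_right (hB _) (hu0 z).1
    have hAu : 0 ≤ A z.2 * u z ^ p := mul_nonneg (hA _) (Real.rpow_nonneg (hu0 z).1 _)
    have := mul_nonneg hE.le (by linarith :
      0 ≤ M * u z - (B z.2 * u z - A z.2 * u z ^ p - k * ρ z.2 * (u z - φ z)))
    linarith
  have h1 := main z ⟨hz, hzx⟩
  rw [hsplit z.1, mul_assoc, ← mul_sub] at h1
  by_contra! h
  have := mul_pos (Real.exp_pos (-(M + 1) * z.1))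
    (by linarith : 0 < u z - Real.exp (M * z.1) * (V z + 2 * δ))
  linarith

end Comparison

section Approx
variable {d : ℕ}

/-- A function solving the semilinear equation for `‖x‖ ≤ n` and squeezed between multiples of `V`
there. -/
structure ApproxSol (α β : Es d → ℝ) (p M : ℝ) (a : Es d → Fin d → Fin d → ℝ)
    (b : Es d → Fin d → ℝ) (V : ℝ × Es d → ℝ) (n : ℕ) (κ K S : ℝ) (u : ℝ × Es d → ℝ)
    (g : ℝ × Es d → BL (Es d) ℝ) (H : ℝ × Es d → BL (Es d) (BL (Es d) ℝ)) (q : ℝ × Es d → ℝ) :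
    Prop where
  hκ : 0 < κ
  hK : 0 ≤ K
  reg : Reg κ K univ u g H q
  mem : ∀ z, u z ∈ Icc 0 S
  pde : ∀ z : ℝ × Es d, ‖z.2‖ ≤ n → q z = trc (a z.2) (H z) + drf (b z.2) (g z)
    + (β z.2 * u z - α z.2 * u z ^ p)
  lower : ∀ z : ℝ × Es d, z.1 ∈ Icc (0:ℝ) n → ‖z.2‖ ≤ n → V z - 2 * (1 / ((n:ℝ) + 1)) ≤ u z
  upper : ∀ z : ℝ × Es d, z.1 ∈ Icc (0:ℝ) n → ‖z.2‖ ≤ n →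
    u z ≤ Real.exp (M * z.1) * (V z + 2 * (1 / ((n:ℝ) + 1)))

lemma exists_approxSol {a : Fin d → Fin d → Es d → ℝ} {b : Fin d → Es d → ℝ} {α β : Es d → ℝ}
    (ha : ∀ i j, LocHolder (a i j)) (hb : ∀ i, LocHolder (b i))
    (hs : ∀ i j x, a i j x = a j i x)
    (he : ∀ x ν : Es d, ν ≠ 0 → 0 < ∑ i, ∑ j, a i j x * ν i * ν j)
    (hα : LocHolder α) (hβ : LocHolder β) (hα0 : ∀ x, 0 < α x) (hβ0 : ∀ x, 0 ≤ β x) {M : ℝ}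
    (hβM : ∀ x, β x ≤ M) {p : ℝ} (hp : 1 < p) {S' : ℝ} {V : ℝ × Es d → ℝ}
    {G : ℝ × Es d → BL (Es d) ℝ} {HV : ℝ × Es d → BL (Es d) (BL (Es d) ℝ)}
    (hV : LinSol S' (fun x i j => a i j x) (fun x i => b i x) V G HV)
    (hαβ : ∀ x, ∀ s ∈ Icc 0 S', α x * s ^ p ≤ β x * s) (n : ℕ) :
    ∃ κ K S u g H q, ApproxSol α β p M (fun x i j => a i j x) (fun x i => b i x) V n κ K S u g H q := by
  have hR : (2:ℝ) < (n:ℝ) + 3 := by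
    have : (0:ℝ) ≤ n := n.cast_nonneg
    linarith
  obtain ⟨a', b', ψ, θ, hθ, hψ0, hψ1, hψz, hψ, hev⟩ := exists_local_coef ha hb hs he hα hβ
    (show (0:ℝ) < n + 3 by linarith)
  obtain ⟨κ, ⟨Λ, hΛ, hc, hA, hB⟩, hκ, hκ1⟩ := (hev.and (Ioo_mem_nhdsGT one_pos)).exists
  obtain ⟨Q, hQ⟩ := (isCompact_closedBall (0 : Es d) ((n:ℝ) + 3 + 1)).exists_bound_of_continuousOn
    (f := fun x => β x / α x) (hβ.continuous.div hα.continuous fun x => (hα0 x).ne').continuousOn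
  have hQ0 : 0 ≤ Q := (norm_nonneg _).trans (hQ 0 (by simp; linarith))
  set S : ℝ := max (max S' 1) (Q ^ (1 / (p - 1))) with hS
  have hS1 : 1 ≤ S := (le_max_right _ _).trans (le_max_left _ _)
  have hSS : S' ≤ S := (le_max_left _ _).trans (le_max_left _ _)
  have hQS : Q ≤ S ^ (p - 1) := by
    have : Q = (Q ^ (1 / (p - 1))) ^ (p - 1) := by
      rw [← Real.rpow_mul hQ0, one_div_mul_cancel (by linarith), Real.rpow_one]
    rw [this]
    gcongr
    · exact le_max_right _ _
  have hSp : S ^ p = S ^ (p - 1) * S := by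
    rw [Real.rpow_sub_one (by linarith), div_mul_cancel₀ _ (by linarith)]
  have hAB : ∀ x, ψ x * β x * S ≤ ψ x * α x * S ^ p := by
    intro x
    rcases le_or_gt ‖x‖ ((n:ℝ) + 3 + 1) with hx | hx
    · have h1 := (le_abs_self _).trans (hQ x (by simpa using hx))
      rw [div_le_iff₀ (hα0 x)] at h1
      have h2 : β x * S ≤ α x * S ^ p := by
        rw [hSp]
        have h3 := mul_le_mul_of_nonneg_right hQS (hα0 x).le
        have := mul_le_mul_of_nonneg_right (h1.trans h3) (by linarith : 0 ≤ S)
        linarith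
      rw [mul_assoc, mul_assoc]
      exact mul_le_mul_of_nonneg_left h2 (hψ0 x)
    · rw [hψz x hx.le]
      simp
  have hδ : (0:ℝ) < 1 / ((n:ℝ) + 1) := by positivity
  have hVS : ∀ z, V z ∈ Icc 0 S := fun z => ⟨(hV.mem z).1, (hV.mem z).2.trans hSS⟩
  obtain ⟨φ, hφ, hφc, hφ0, hφi, hφV⟩ := exists_smooth_approx (R := (n:ℝ) + 3) hV.cont hVS
    hV.init hδ
  obtain ⟨K, u, g, H, q, k, ρ, ru, hu0, hui, hk, hρ, hρ0, hq, hbd⟩ := penalized_solve hθ hΛ hκ hκ1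
    (by linarith : 0 ≤ S) hR hδ hp.le hc hA hB hAB hφ hφc hφ0 hφi
  have hM : 0 ≤ M := (hβ0 0).trans (hβM 0)
  have hcof : ∀ x, ‖x‖ ≤ (n:ℝ) + 3 → a' x = (fun i j => a i j x) ∧ b' x = fun i => b i x :=
    fun x hx => (hψ x hx).2
  refine ⟨κ, K, S, u, g, H, q, hκ, (norm_nonneg _).trans (ru.xw.bd 0 (mem_univ _)), ru, hu0, ?_,
    ?_, ?_⟩
  · intro z hz
    have h1 := hψ z.2 (by linarith)
    rw [hq z, h1.1, h1.2.1, h1.2.2, hρ0 _ (by linarith)]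
    ring
  · intro z hz hzx
    refine lower_comparison (a0 := fun x i j => a i j x) (b0 := fun x i => b i x)
      (A := fun x => ψ x * α x) (B := fun x => ψ x * β x) (p := p) hθ hκ hδ hc hcof
      (fun x s hs => ?_) ru (fun z => (hu0 z).1) hk hρ hq hbd hφV hV ⟨hz.1, by linarith [hz.2]⟩
      (by linarith)
    rw [mul_assoc, mul_assoc]
    exact mul_le_mul_of_nonneg_left (hαβ x s hs) (hψ0 x)
  · intro z hz hzx
    refine upper_comparison (a0 := fun x i j => a i j x) (b0 := fun x i => b i x)
      (A := fun x => ψ x * α x) (B := fun x => ψ x * β x) (p := p) hθ hκ hδ hc hcof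
      (fun x => mul_nonneg (hψ0 x) (hα0 x).le) (fun x => ?_) hM ru hu0 hui hk hρ hq hbd hφV hV
      ⟨hz.1, by linarith [hz.2]⟩ (by linarith)
    exact (mul_le_of_le_one_left (hβ0 x) (hψ1 x)).trans (hβM x)

end Approx

section Limit
variable {d : ℕ}

lemma JL.comp_bh {κ S : ℝ} {F : ℝ × Es d → ℝ → ℝ} (hF : JL κ S F) {w : ℝ × Es d → ℝ}
    (hw : BH κ w) (hwS : ∀ z, w z ∈ Icc 0 S) : BH κ fun z => F z (w z) := by
  obtain ⟨K, hK, hb, hl⟩ := hF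
  obtain ⟨A, hA, hw⟩ := hw
  refine Hol.bh (A := K) (B := K * (1 + A)) ⟨fun z _ => hb z _ (hwS z), fun z _ z' _ => ?_⟩
  refine (hl z z' _ (hwS z) _ (hwS z')).trans ?_
  have := hw.ho z (mem_univ _) z' (mem_univ _)
  rw [Real.norm_eq_abs] at this
  rw [mul_assoc, add_mul, one_mul]
  gcongr

lemma Reg.congr {κ A : ℝ} {S : Set (ℝ × Es d)} (hS : IsOpen S) {w w' : ℝ × Es d → ℝ}
    {g : ℝ × Es d → BL (Es d) ℝ} {H : ℝ × Es d → BL (Es d) (BL (Es d) ℝ)} {p : ℝ × Es d → ℝ}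
    (h : Reg κ A S w g H p) (hw : ∀ z ∈ S, w' z = w z) : Reg κ A S w' g H p := by
  refine ⟨fun z hz => (h.dw z hz).congr_of_eventuallyEq ?_, h.dg,
    fun z hz => (h.dt z hz).congr_of_eventuallyEq ?_, ⟨fun z hz => ?_, fun z hz z' hz' => ?_⟩,
    h.xg, h.xH, h.xp⟩
  · have : Continuous fun y : Es d => ((z.1, y) : ℝ × Es d) := by fun_prop
    filter_upwards [this.continuousAt.preimage_mem_nhds (hS.mem_nhds hz)] with y hy
    exact hw _ hy
  · have : Continuous fun t : ℝ => ((t, z.2) : ℝ × Es d) := by fun_prop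
    filter_upwards [this.continuousAt.preimage_mem_nhds (hS.mem_nhds hz)] with y hy
    exact hw _ hy
  · rw [hw z hz]
    exact h.xw.bd z hz
  · rw [hw z hz, hw z' hz']
    exact h.xw.ho z hz z' hz'

lemma continuous_trc (m : Fin d → Fin d → ℝ) : Continuous (trc m) := by
  unfold trc
  fun_prop

lemma continuous_drf (m : Fin d → ℝ) : Continuous (drf m) := by
  unfold drf
  fun_prop

set_option maxHeartbeats 1000000 in
/-- A pointwise limit of approximate solutions is locally a classical solution. -/
lemma exists_local_limit {a : Fin d → Fin d → Es d → ℝ} {b : Fin d → Es d → ℝ} {α β : Es d → ℝ}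
    (ha : ∀ i j, LocHolder (a i j)) (hb : ∀ i, LocHolder (b i))
    (hs : ∀ i j x, a i j x = a j i x)
    (he : ∀ x ν : Es d, ν ≠ 0 → 0 < ∑ i, ∑ j, a i j x * ν i * ν j)
    (hα : LocHolder α) (hβ : LocHolder β) {M : ℝ} (hM : 0 ≤ M) {p : ℝ} (hp : 1 ≤ p)
    {V : ℝ × Es d → ℝ} {S' : ℝ} (hVS : ∀ z, V z ∈ Icc 0 S') {κ' K S : ℕ → ℝ}
    {u : ℕ → ℝ × Es d → ℝ} {g : ℕ → ℝ × Es d → BL (Es d) ℝ}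
    {H : ℕ → ℝ × Es d → BL (Es d) (BL (Es d) ℝ)} {q : ℕ → ℝ × Es d → ℝ}
    (hu : ∀ n, ApproxSol α β p M (fun x i j => a i j x) (fun x i => b i x) V n (κ' n) (K n) (S n)
      (u n) (g n) (H n) (q n)) {w : ℝ × Es d → ℝ}
    (hw : ∀ z : ℝ × Es d, 0 < z.1 → Tendsto (fun n => u n z) (hyperfilter ℕ : Filter ℕ) (𝓝 (w z)))
    {z0 : ℝ × Es d} (hz0 : 0 < z0.1) :
    ∃ r κ C g' H' p', 0 < r ∧ 0 < κ ∧ Reg κ C (Metric.ball z0 r) w g' H' p' ∧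
      ∀ z ∈ Metric.ball z0 r, p' z = trc (fun i j => a i j z.2) (H' z)
        + drf (fun i => b i z.2) (g' z) + (β z.2 * w z - α z.2 * w z ^ p) := by
  obtain ⟨a', b', ψ, θ, hθ, -, -, -, hψ, hev⟩ := exists_local_coef ha hb hs he hα hβ
    (show (0:ℝ) < ‖z0.2‖ + 2 by positivity)
  obtain ⟨κ, ⟨Λ, hΛ, hc, hA, hB⟩, hκ, hκ1⟩ := (hev.and (Ioo_mem_nhdsGT one_pos)).exists
  set R : ℝ := min 1 (z0.1 / 2) with hRdef
  have hR : 0 < R := by positivity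
  have hR1 : R ≤ 1 := min_le_left _ _
  have hS'0 : 0 ≤ S' := (hVS 0).1.trans (hVS 0).2
  set T : ℝ := z0.1 + 1 with hT
  have hball : ∀ z ∈ Metric.ball z0 R, 0 < z.1 ∧ z.1 ≤ T ∧ ‖z.2‖ ≤ ‖z0.2‖ + 1 := by
    intro z hz
    rw [Metric.mem_ball, Prod.dist_eq, max_lt_iff, Real.dist_eq, dist_eq_norm, abs_lt] at hz
    have h1 : R ≤ z0.1 / 2 := min_le_right _ _
    have h2 := norm_le_norm_add_norm_sub' z.2 z0.2
    refine ⟨by linarith [hz.1.1], by linarith [hz.1.2], by linarith [hz.2]⟩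
  have hAz : BH κ fun z : ℝ × Es d => ψ z.2 * α z.2 := ((hA.comp_snd (by linarith)).subset fun _ _ => mem_univ _).bh
  have hBz : BH κ fun z : ℝ × Es d => ψ z.2 * β z.2 := ((hB.comp_snd (by linarith)).subset fun _ _ => mem_univ _).bh
  have hF : ∀ s, 0 ≤ s → JL κ s fun (z : ℝ × Es d) s =>
      ψ z.2 * β z.2 * s - ψ z.2 * α z.2 * s ^ p := fun s h =>
    ((JL.of_bh hBz).mul JL.id).sub ((JL.of_bh hAz).mul (JL.rpow hp h))
  set Sb : ℝ := Real.exp (M * T) * (S' + 2) with hSb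
  have hSb0 : 0 ≤ Sb := by positivity
  obtain ⟨K1, hK1, hFb, hFl⟩ := hF Sb hSb0
  obtain ⟨r, C, hr, hC, hreg⟩ := interior_reg_of_coef (d := d) (Λ := max Λ K1) hθ (by positivity)
    hκ hκ1 hR hR1
  obtain ⟨N, hN⟩ := exists_nat_ge (T + ‖z0.2‖ + 1)
  have hmem : ∀ n, N ≤ n → ∀ z ∈ Metric.ball z0 R, u n z ∈ Icc 0 Sb ∧ ‖z.2‖ ≤ n := by
    intro n hn z hz
    obtain ⟨h1, h2, h3⟩ := hball z hz
    have hn' : (N:ℝ) ≤ n := by exact_mod_cast hn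
    have h4 : ‖z.2‖ ≤ n := by linarith
    have h5 : z.1 ≤ n := by linarith [norm_nonneg z0.2]
    refine ⟨⟨((hu n).mem z).1, ((hu n).upper z ⟨h1.le, h5⟩ h4).trans ?_⟩, h4⟩
    have h6 : 1 / ((n:ℝ) + 1) ≤ 1 := by
      rw [div_le_one (by positivity)]
      linarith [n.cast_nonneg (α := ℝ)]
    have h7 := (hVS z).2
    have h8 := (hVS z).1
    have h9 : (0:ℝ) ≤ 1 / ((n:ℝ) + 1) := by positivity
    rw [hSb]
    gcongr
    linarith
  have hsub : Metric.ball z0 (min r R) ⊆ Metric.ball z0 R := Metric.ball_subset_ball (min_le_right _ _)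
  have hloc : ∀ n, ∃ g' H' p', N ≤ n → Reg κ (C * max K1 Sb) (Metric.ball z0 (min r R)) (u n) g' H' p' ∧
      ∀ z ∈ Metric.ball z0 (min r R), p' z = trc (fun i j => a i j z.2) (H' z)
        + drf (fun i => b i z.2) (g' z) + (β z.2 * u n z - α z.2 * u n z ^ p) := by
    intro n
    by_cases hn : N ≤ n
    swap
    · exact ⟨0, 0, 0, fun h => absurd h hn⟩
    have hm := hmem n hn
    have hcof : ∀ z ∈ Metric.ball z0 R, ψ z.2 = 1 ∧ a' z.2 = (fun i j => a i j z.2) ∧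
        b' z.2 = fun i => b i z.2 := fun z hz => hψ z.2 (by linarith [(hball z hz).2.2])
    have hf : BH κ fun z => ψ z.2 * β z.2 * u n z - ψ z.2 * α z.2 * u n z ^ p :=
      (hF (S n) (((hu n).mem 0).1.trans ((hu n).mem 0).2)).comp_bh
        ((hu n).reg.bh_fun hκ hκ1 (hu n).hK) (hu n).mem
    obtain ⟨g', H', p', hreg', hp'⟩ := hreg (A := max K1 Sb) (z0 := z0) (hu n).hκ (hu n).hK
      (by positivity) (Coef.mono hc (le_max_left _ _)) (hu n).reg hf
      (fun z hz => by
        obtain ⟨h1, h2, h3⟩ := hcof z hz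
        rw [(hu n).pde z (hm z hz).2, h1, h2, h3, one_mul, one_mul])
      (fun z hz => by
        rw [abs_of_nonneg (hm z hz).1.1]
        exact (hm z hz).1.2.trans (le_max_right _ _))
      (fun z hz => (hFb z _ (hm z hz).1).trans (le_max_left _ _))
      (fun z hz z' hz' => by
        refine (hFl z z' _ (hm z hz).1 _ (hm z' hz').1).trans ?_
        rw [mul_add]
        have := rho_nonneg κ z z'
        gcongr
        · exact le_max_left _ _
        · exact le_max_right _ _)
    refine ⟨g', H', p', fun _ => ⟨hreg'.subset (Metric.ball_subset_ball (min_le_left _ _)),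
      fun z hz => ?_⟩⟩
    obtain ⟨h1, h2, h3⟩ := hcof z (hsub hz)
    rw [hp' z (Metric.ball_subset_ball (min_le_left _ _) hz), h1, h2, h3, one_mul, one_mul]
  choose g' H' p' hgH using hloc
  have hge : ∀ᶠ n in (hyperfilter ℕ : Filter ℕ), N ≤ n :=
    Nat.hyperfilter_le_atTop (eventually_ge_atTop N)
  obtain ⟨w1, g1, H1, p1, hr1, hlim⟩ := Reg.closure (U := hyperfilter ℕ) hκ Metric.isOpen_ball
    (hge.mono fun n hn => (hgH n hn).1)
  have hww : ∀ z ∈ Metric.ball z0 (min r R), w z = w1 z := fun z hz =>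
    tendsto_nhds_unique (hw z (hball z (hsub hz)).1) (hlim z hz).1
  refine ⟨min r R, κ, C * max K1 Sb, g1, H1, p1, by positivity, hκ,
    hr1.congr Metric.isOpen_ball hww, fun z hz => ?_⟩
  obtain ⟨-, l2, l3, l4⟩ := hlim z hz
  have l1 := hw z (hball z (hsub hz)).1
  refine tendsto_nhds_unique_of_eventuallyEq l4
    (((((continuous_trc _).tendsto _).comp l3).add (((continuous_drf _).tendsto _).comp l2)).add
      ((l1.const_mul (β z.2)).sub ((l1.rpow_const (Or.inr (by linarith))).const_mul (α z.2)))) ?_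
  filter_upwards [hge] with n hn
  exact (hgH n hn).2 z hz

end Limit

section Final
variable {d : ℕ}

lemma pd_eq {f : Es d → ℝ} {g : BL (Es d) ℝ} {x : Es d} (h : HasFDerivAt f g x) (i : Fin d) :
    pd i f x = g (eb i) := by
  rw [pd, h.fderiv]

lemma pd_pd_eq {f : Es d → ℝ} {g : Es d → BL (Es d) ℝ} {H : BL (Es d) (BL (Es d) ℝ)} {x : Es d}
    (hf : ∀ᶠ y in 𝓝 x, HasFDerivAt f (g y) y) (hg : HasFDerivAt g H x) (i j : Fin d) :
    pd i (pd j f) x = H (eb i) (eb j) := by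
  have h1 : HasFDerivAt (fun y => g y (eb j)) _ x := hg.clm_apply (hasFDerivAt_const (eb j) x)
  have h2 : HasFDerivAt (pd j f) _ x :=
    h1.congr_of_eventuallyEq (hf.mono fun y hy => pd_eq hy j)
  rw [pd_eq h2 i]
  simp

lemma trc_eq_pd {f : Es d → ℝ} {g : Es d → BL (Es d) ℝ} {H : BL (Es d) (BL (Es d) ℝ)} {x : Es d}
    (hf : ∀ᶠ y in 𝓝 x, HasFDerivAt f (g y) y) (hg : HasFDerivAt g H x) (m : Fin d → Fin d → ℝ) :
    trc m H = (1 / 2) * ∑ i, ∑ j, m i j * pd i (pd j f) x := by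
  simp only [trc, pd_pd_eq hf hg]

lemma drf_eq_pd {f : Es d → ℝ} {g : BL (Es d) ℝ} {x : Es d} (hf : HasFDerivAt f g x)
    (m : Fin d → ℝ) : drf m g = ∑ i, m i * pd i f x := by
  simp only [drf, pd_eq hf]

namespace Reg
variable {κ A : ℝ} {S : Set (ℝ × Es d)} {w : ℝ × Es d → ℝ} {g : ℝ × Es d → BL (Es d) ℝ}
    {H : ℝ × Es d → BL (Es d) (BL (Es d) ℝ)} {p : ℝ × Es d → ℝ}

lemma eventually_space (hS : IsOpen S) {z : ℝ × Es d} (hz : z ∈ S) :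
    ∀ᶠ y in 𝓝 z.2, (z.1, y) ∈ S := by
  have : Continuous fun y : Es d => ((z.1, y) : ℝ × Es d) := by fun_prop
  exact this.continuousAt.preimage_mem_nhds (hS.mem_nhds hz)

lemma eventually_time (hS : IsOpen S) {z : ℝ × Es d} (hz : z ∈ S) :
    ∀ᶠ t in 𝓝 z.1, (t, z.2) ∈ S := by
  have : Continuous fun t : ℝ => ((t, z.2) : ℝ × Es d) := by fun_prop
  exact this.continuousAt.preimage_mem_nhds (hS.mem_nhds hz)

lemma contDiffAt_space (hκ : 0 < κ) (hS : IsOpen S) (h : Reg κ A S w g H p) {z : ℝ × Es d}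
    (hz : z ∈ S) : ContDiffAt ℝ 2 (fun y => w (z.1, y)) z.2 := by
  have hev := eventually_space hS hz
  have h0 : ContDiffAt ℝ ((0 : ℕ) : WithTop ℕ∞) (fun y => H (z.1, y)) z.2 := by
    rw [Nat.cast_zero, contDiffAt_zero]
    refine ⟨_, hev, (h.xH.continuousOn hκ).comp (by fun_prop) fun y hy => hy⟩
  have h1 : ContDiffAt ℝ ((1 : ℕ) : WithTop ℕ∞) (fun y => g (z.1, y)) z.2 := by
    have := (contDiffAt_succ_iff_hasFDerivAt (f := fun y => g (z.1, y))).2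
      ⟨fun y => H (z.1, y), ⟨_, hev, fun y hy => h.dg (z.1, y) hy⟩, h0⟩
    simpa using this
  have := (contDiffAt_succ_iff_hasFDerivAt (f := fun y => w (z.1, y))).2
    ⟨fun y => g (z.1, y), ⟨_, hev, fun y hy => h.dw (z.1, y) hy⟩, h1⟩
  simpa [one_add_one_eq_two] using this

lemma contDiffAt_time (hκ : 0 < κ) (hS : IsOpen S) (h : Reg κ A S w g H p) {z : ℝ × Es d}
    (hz : z ∈ S) : ContDiffAt ℝ 1 (fun t => w (t, z.2)) z.1 := by
  have hev := eventually_time hS hz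
  have h0 : ContDiffAt ℝ ((0 : ℕ) : WithTop ℕ∞)
      (fun t => ContinuousLinearMap.toSpanSingleton ℝ (p (t, z.2))) z.1 := by
    rw [Nat.cast_zero, contDiffAt_zero]
    refine ⟨_, hev, ?_⟩
    have h1 : ContinuousOn (fun t => p (t, z.2)) {t | (t, z.2) ∈ S} :=
      (h.xp.continuousOn hκ).comp (by fun_prop) fun y hy => hy
    exact (ContinuousLinearMap.toSpanSingletonCLE (𝕜 := ℝ) (E := ℝ)).continuous.comp_continuousOn h1
  have := (contDiffAt_succ_iff_hasFDerivAt (f := fun t => w (t, z.2))).2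
    ⟨fun t => ContinuousLinearMap.toSpanSingleton ℝ (p (t, z.2)),
      ⟨_, hev, fun y hy => (h.dt (y, z.2) hy).hasFDerivAt⟩, h0⟩
  simpa using this

end Reg

/-- The extension by zero of a multiple of a classical solution. -/
lemma LinSol.of_classical {a : Fin d → Fin d → Es d → ℝ} {b : Fin d → Es d → ℝ} {v : Es d → ℝ → ℝ}
    {m c : ℝ} (hc : 0 ≤ c) (hm : ∀ x t, 0 ≤ t → |v x t| ≤ m)
    (hv_cont : ContinuousOn (fun q : Es d × ℝ => v q.1 q.2) (univ ×ˢ Ici (0 : ℝ)))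
    (hv_nonneg : ∀ x t, 0 ≤ t → 0 ≤ v x t)
    (hv_x : ∀ t : ℝ, 0 < t → ContDiff ℝ 2 (fun x => v x t))
    (hv_t : ∀ x, ContDiffOn ℝ 1 (fun s => v x s) (Ioi (0 : ℝ)))
    (hv_pde : ∀ x t, 0 < t →
      deriv (fun s => v x s) t =
        (1 / 2) * ∑ i, ∑ j, a i j x * pd i (pd j (fun y => v y t)) x
          + ∑ i, b i x * pd i (fun y => v y t) x)
    (hv_init : ∀ x, v x 0 = 0) :
    LinSol (c * m) (fun x i j => a i j x) (fun x i => b i x) (fun z => c * v z.2 (max z.1 0))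
      (fun z => c • fderiv ℝ (fun x => v x z.1) z.2)
      (fun z => c • fderiv ℝ (fderiv ℝ fun x => v x z.1) z.2) := by
  have hd1 : ∀ t, 0 < t → ∀ x, HasFDerivAt (fun x => v x t) (fderiv ℝ (fun x => v x t) x) x :=
    fun t ht x => ((hv_x t ht).differentiable two_ne_zero x).hasFDerivAt
  have hd2 : ∀ t, 0 < t → ∀ x, HasFDerivAt (fderiv ℝ fun x => v x t)
      (fderiv ℝ (fderiv ℝ fun x => v x t) x) x := fun t ht x =>
    (((hv_x t ht).fderiv_right (m := 1) (by norm_num [one_add_one_eq_two])).differentiable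
      one_ne_zero x).hasFDerivAt
  refine ⟨?_, fun z => ⟨?_, ?_⟩, fun z hz => ?_, fun z hz => ?_, fun z hz => ?_, fun z hz => ?_⟩
  · refine continuous_const.mul (hv_cont.comp_continuous
      (f := fun z : ℝ × Es d => (z.2, max z.1 0)) (by fun_prop) fun z => ?_)
    simp
  · exact mul_nonneg hc (hv_nonneg _ _ (le_max_right _ _))
  · exact mul_le_mul_of_nonneg_left ((le_abs_self _).trans (hm _ _ (le_max_right _ _))) hc
  · simp [max_eq_right hz, hv_init]
  · have h1 : max z.1 0 = z.1 := max_eq_left hz.le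
    simp only [h1]
    exact (hd1 z.1 hz z.2).const_mul c
  · exact (hd2 z.1 hz z.2).const_smul c
  · have h2 : HasDerivAt (fun s => v z.2 s) (deriv (fun s => v z.2 s) z.1) z.1 :=
      (((hv_t z.2).contDiffAt (Ioi_mem_nhds hz)).differentiableAt one_ne_zero).hasDerivAt
    rw [hv_pde z.2 z.1 hz, ← trc_eq_pd (Eventually.of_forall (hd1 z.1 hz)) (hd2 z.1 hz z.2)
      (fun i j => a i j z.2), ← drf_eq_pd (hd1 z.1 hz z.2) (fun i => b i z.2)] at h2
    have h3 := h2.const_mul c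
    rw [mul_add, ← trc_smul_right, ← drf_smul_right] at h3
    refine h3.congr_of_eventuallyEq ?_
    filter_upwards [Ioi_mem_nhds hz] with s hs
    have h4 : max s 0 = s := max_eq_left (mem_Ioi.1 hs).le
    simp only [h4]

end Final

section Squeeze
variable {d : ℕ}

lemma exists_squeezed_limit {a : Es d → Fin d → Fin d → ℝ} {b : Es d → Fin d → ℝ} {α β : Es d → ℝ}
    {M p : ℝ} {V : ℝ × Es d → ℝ} {κ K S : ℕ → ℝ} {u : ℕ → ℝ × Es d → ℝ}
    {g : ℕ → ℝ × Es d → BL (Es d) ℝ} {H : ℕ → ℝ × Es d → BL (Es d) (BL (Es d) ℝ)}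
    {q : ℕ → ℝ × Es d → ℝ}
    (hu : ∀ n, ApproxSol α β p M a b V n (κ n) (K n) (S n) (u n) (g n) (H n) (q n)) :
    ∃ w : ℝ × Es d → ℝ, ∀ z : ℝ × Es d, 0 ≤ z.1 →
      Tendsto (fun n => u n z) (hyperfilter ℕ : Filter ℕ) (𝓝 (w z)) ∧
      V z ≤ w z ∧ w z ≤ Real.exp (M * z.1) * V z := by
  have hδ : Tendsto (fun n : ℕ => 2 * (1 / ((n:ℝ) + 1))) (hyperfilter ℕ : Filter ℕ) (𝓝 0) := by
    have := (tendsto_one_div_add_atTop_nhds_zero_nat (𝕜 := ℝ)).const_mul 2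
    rw [mul_zero] at this
    exact this.mono_left Nat.hyperfilter_le_atTop
  have hlo : ∀ z, Tendsto (fun n : ℕ => V z - 2 * (1 / ((n:ℝ) + 1))) (hyperfilter ℕ : Filter ℕ)
      (𝓝 (V z)) := fun z => by simpa using hδ.const_sub (V z)
  have hup : ∀ z, Tendsto (fun n : ℕ => Real.exp (M * z.1) * (V z + 2 * (1 / ((n:ℝ) + 1))))
      (hyperfilter ℕ : Filter ℕ) (𝓝 (Real.exp (M * z.1) * V z)) := fun z => by
    simpa using (hδ.const_add (V z)).const_mul (Real.exp (M * z.1))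
  have hev : ∀ z : ℝ × Es d, 0 ≤ z.1 → ∀ᶠ n : ℕ in (hyperfilter ℕ : Filter ℕ),
      V z - 2 * (1 / ((n:ℝ) + 1)) ≤ u n z ∧
        u n z ≤ Real.exp (M * z.1) * (V z + 2 * (1 / ((n:ℝ) + 1))) := by
    intro z hz
    obtain ⟨N, hN⟩ := exists_nat_ge (z.1 + ‖z.2‖)
    filter_upwards [Nat.hyperfilter_le_atTop (eventually_ge_atTop N)] with n hn
    have hn' : (N:ℝ) ≤ n := by exact_mod_cast hn
    have h1 : z.1 ≤ n := by linarith [norm_nonneg z.2]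
    have h2 : ‖z.2‖ ≤ n := by linarith
    exact ⟨(hu n).lower z ⟨hz, h1⟩ h2, (hu n).upper z ⟨hz, h1⟩ h2⟩
  have hex : ∀ z : ℝ × Es d, ∃ l, 0 ≤ z.1 →
      Tendsto (fun n => u n z) (hyperfilter ℕ : Filter ℕ) (𝓝 l) := by
    intro z
    by_cases hz : 0 ≤ z.1
    swap
    · exact ⟨0, fun h => absurd h hz⟩
    obtain ⟨l, hl⟩ := exists_tendsto_of_bounded (U := hyperfilter ℕ) (f := fun n => u n z)
      (A := |V z - 1| + |Real.exp (M * z.1) * V z + 1|) (by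
        filter_upwards [hev z hz, (hlo z).eventually_const_lt (sub_one_lt (V z)),
          (hup z).eventually_lt_const (lt_add_one _)] with n h1 h2 h3
        rw [Real.norm_eq_abs, abs_le]
        have := neg_abs_le (V z - 1)
        have := le_abs_self (Real.exp (M * z.1) * V z + 1)
        have := abs_nonneg (V z - 1)
        have := abs_nonneg (Real.exp (M * z.1) * V z + 1)
        constructor <;> linarith)
    exact ⟨l, fun _ => hl⟩
  choose w hw using hex
  exact ⟨w, fun z hz => ⟨hw z hz, le_of_tendsto_of_tendsto (hlo z) (hw z hz)
    ((hev z hz).mono fun _ h => h.1), le_of_tendsto_of_tendsto (hw z hz) (hup z)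
    ((hev z hz).mono fun _ h => h.2)⟩⟩

end Squeeze

/-- Theorem EP4: if the diffusion corresponding to `L` explodes
(i.e. there is a nontrivial bounded nonnegative classical solution of `v_t = Lv`
with zero initial data) and `inf β/α > 0`, then there is a nontrivial nonnegative
classical solution of `u_t = Lu + βu − αu^p` with zero initial data. -/
theorem stmt_8 {d : ℕ} (hd : 1 ≤ d) (p : ℝ) (hp1 : 1 < p) (hp2 : p ≤ 2)
    (a : Fin d → Fin d → EuclideanSpace ℝ (Fin d) → ℝ)
    (b : Fin d → EuclideanSpace ℝ (Fin d) → ℝ)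
    (ha_holder : ∀ i j, LocHolder (a i j))
    (hb_holder : ∀ i, LocHolder (b i))
    (ha_symm : ∀ i j x, a i j x = a j i x)
    (ha_ell : ∀ (x ν : EuclideanSpace ℝ (Fin d)), ν ≠ 0 →
      0 < ∑ i, ∑ j, a i j x * ν i * ν j)
    (α β : EuclideanSpace ℝ (Fin d) → ℝ)
    (hα_holder : LocHolder α) (hβ_holder : LocHolder β)
    (hα_pos : ∀ x, 0 < α x)
    (hβ_bdd : ∃ M : ℝ, ∀ x, β x ≤ M)
    (hratio : ∃ ε : ℝ, 0 < ε ∧ ∀ x, ε ≤ β x / α x)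
    (v : EuclideanSpace ℝ (Fin d) → ℝ → ℝ)
    (hv_bdd : ∃ M : ℝ, ∀ x t, 0 ≤ t → |v x t| ≤ M)
    (hv_cont : ContinuousOn (fun q : EuclideanSpace ℝ (Fin d) × ℝ => v q.1 q.2)
      (univ ×ˢ Ici (0 : ℝ)))
    (hv_nonneg : ∀ x t, 0 ≤ t → 0 ≤ v x t)
    (hv_x : ∀ t : ℝ, 0 < t → ContDiff ℝ 2 (fun x => v x t))
    (hv_t : ∀ x, ContDiffOn ℝ 1 (fun s => v x s) (Ioi (0 : ℝ)))
    (hv_pde : ∀ x t, 0 < t →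
      deriv (fun s => v x s) t =
        (1 / 2) * ∑ i, ∑ j, a i j x * pd i (pd j (fun y => v y t)) x
          + ∑ i, b i x * pd i (fun y => v y t) x)
    (hv_init : ∀ x, v x 0 = 0)
    (hv_nontriv : ∃ x t, 0 ≤ t ∧ v x t ≠ 0) :
    ∃ u : EuclideanSpace ℝ (Fin d) → ℝ → ℝ,
      ContinuousOn (fun q : EuclideanSpace ℝ (Fin d) × ℝ => u q.1 q.2)
        (univ ×ˢ Ici (0 : ℝ)) ∧
      (∀ x t, 0 ≤ t → 0 ≤ u x t) ∧
      (∀ t : ℝ, 0 < t → ContDiff ℝ 2 (fun x => u x t)) ∧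
      (∀ x, ContDiffOn ℝ 1 (fun s => u x s) (Ioi (0 : ℝ))) ∧
      (∀ x t, 0 < t →
        deriv (fun s => u x s) t =
          (1 / 2) * ∑ i, ∑ j, a i j x * pd i (pd j (fun y => u y t)) x
            + ∑ i, b i x * pd i (fun y => u y t) x
            + β x * u x t - α x * u x t ^ p) ∧
      (∀ x, u x 0 = 0) ∧
      (∃ x t, 0 ≤ t ∧ u x t ≠ 0) := by
  obtain ⟨M, hM⟩ := hβ_bdd
  obtain ⟨ε, hε, hεβ⟩ := hratio
  obtain ⟨m, hm⟩ := hv_bdd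
  have hεαβ : ∀ x, ε * α x ≤ β x := fun x => (le_div_iff₀ (hα_pos x)).1 (hεβ x)
  have hβ0 : ∀ x, 0 ≤ β x := fun x => (mul_pos hε (hα_pos x)).le.trans (hεαβ x)
  have hM0 : 0 ≤ M := (hβ0 0).trans (hM 0)
  have hm0 : 0 ≤ m := (abs_nonneg _).trans (hm 0 0 le_rfl)
  set S : ℝ := ε ^ (1 / (p - 1)) with hS
  have hS0 : 0 < S := Real.rpow_pos_of_pos hε _
  have hSε : S ^ (p - 1) = ε := by
    rw [hS, ← Real.rpow_mul hε.le, one_div_mul_cancel (by linarith), Real.rpow_one]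
  set c : ℝ := S / (m + 1) with hcdef
  have hc : 0 < c := by positivity
  have hcm : c * (m + 1) = S := div_mul_cancel₀ _ (by positivity)
  have hαβ : ∀ x, ∀ s ∈ Icc 0 (c * (m + 1)), α x * s ^ p ≤ β x * s := by
    intro x s hs
    rcases hs.1.eq_or_lt with h0 | h0
    · rw [← h0, Real.zero_rpow (by linarith)]
      simp
    have h1 : s ^ p = s ^ (p - 1) * s := by
      rw [Real.rpow_sub_one h0.ne', div_mul_cancel₀ _ h0.ne']
    have h2 : s ^ (p - 1) ≤ ε := by
      rw [← hSε, ← hcm]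
      exact Real.rpow_le_rpow hs.1 hs.2 (by linarith)
    rw [h1, ← mul_assoc]
    refine mul_le_mul_of_nonneg_right (le_trans ?_ (hεαβ x)) hs.1
    rw [mul_comm ε]
    exact mul_le_mul_of_nonneg_left h2 (hα_pos x).le
  have hV := LinSol.of_classical hc.le (fun x t ht => (hm x t ht).trans (by linarith : m ≤ m + 1))
    hv_cont hv_nonneg hv_x hv_t hv_pde hv_init
  set V : ℝ × Es d → ℝ := fun z => c * v z.2 (max z.1 0) with hVdef
  choose κ K S' u g H q hu using exists_approxSol ha_holder hb_holder ha_symm ha_ell hα_holder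
    hβ_holder hα_pos hβ0 hM hp1 hV hαβ
  obtain ⟨w, hw⟩ := exists_squeezed_limit hu
  have hloc := fun (x : Es d) (t : ℝ) (ht : 0 < t) =>
    exists_local_limit ha_holder hb_holder ha_symm ha_ell hα_holder hβ_holder hM0 hp1.le hV.mem hu
      (fun z hz => (hw z hz.le).1) (z0 := (t, x)) ht
  have hw0 : ∀ z : ℝ × Es d, 0 ≤ z.1 → 0 ≤ w z := fun z hz => (hV.mem z).1.trans (hw z hz).2.1
  have hwi : ∀ x, w (0, x) = 0 := fun x => by
    have h1 := (hw (0, x) le_rfl).2.2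
    rw [hV.init (0, x) le_rfl, mul_zero] at h1
    exact le_antisymm h1 (hw0 (0, x) le_rfl)
  refine ⟨fun x t => w (t, x), ?_, fun x t ht => hw0 (t, x) ht, fun t ht => ?_, fun x t ht => ?_,
    fun x t ht => ?_, hwi, ?_⟩
  · rintro ⟨x, t⟩ ⟨-, ht⟩
    rcases (mem_Ici.1 ht).eq_or_lt with h0 | h0
    · dsimp only at h0
      subst h0
      have h1 : Tendsto (fun y : Es d × ℝ => Real.exp (M * y.2) * V (y.2, y.1)) (𝓝 (x, 0)) (𝓝 0) := by
        have h2 := hV.cont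
        have : Continuous fun y : Es d × ℝ => Real.exp (M * y.2) * V (y.2, y.1) := by fun_prop
        have := this.tendsto (x, 0)
        rwa [hV.init _ le_rfl, mul_zero] at this
      rw [ContinuousWithinAt]
      dsimp only
      rw [hwi x]
      refine squeeze_zero' ?_ ?_ (h1.mono_left nhdsWithin_le_nhds)
      · filter_upwards [self_mem_nhdsWithin] with y hy
        exact hw0 _ hy.2
      · filter_upwards [self_mem_nhdsWithin] with y hy
        exact (hw (y.2, y.1) hy.2).2.2
    · obtain ⟨r, κ0, C, g', H', p', hr, hκ0, hreg, -⟩ := hloc x t h0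
      have h1 : ContinuousAt w (t, x) := (hreg.xw.continuousOn hκ0).continuousAt
        (Metric.ball_mem_nhds _ hr)
      have h2 : ContinuousAt (fun q : Es d × ℝ => w (q.2, q.1)) (x, t) :=
        ContinuousAt.comp (f := fun q : Es d × ℝ => (q.2, q.1)) h1 (by fun_prop)
      exact h2.continuousWithinAt
  · refine contDiff_iff_contDiffAt.2 fun x => ?_
    obtain ⟨r, κ0, C, g', H', p', hr, hκ0, hreg, -⟩ := hloc x t ht
    exact hreg.contDiffAt_space hκ0 Metric.isOpen_ball (Metric.mem_ball_self hr)
  · obtain ⟨r, κ0, C, g', H', p', hr, hκ0, hreg, -⟩ := hloc x t ht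
    exact (hreg.contDiffAt_time hκ0 Metric.isOpen_ball
      (Metric.mem_ball_self hr)).contDiffWithinAt
  · obtain ⟨r, κ0, C, g', H', p', hr, hκ0, hreg, hp'⟩ := hloc x t ht
    have hz := Metric.mem_ball_self (x := ((t, x) : ℝ × Es d)) hr
    have h1 : ∀ᶠ y in 𝓝 x, HasFDerivAt (fun y => w (t, y)) (g' (t, y)) y :=
      (Reg.eventually_space Metric.isOpen_ball hz).mono fun y hy => hreg.dw (t, y) hy
    have h2 := trc_eq_pd h1 (hreg.dg (t, x) hz) (fun i j => a i j x)
    have h3 := drf_eq_pd h1.self_of_nhds (fun i => b i x)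
    rw [(hreg.dt (t, x) hz).deriv, hp' (t, x) hz, h2, h3]
    ring
  · obtain ⟨x, t, ht, hvt⟩ := hv_nontriv
    refine ⟨x, t, ht, fun h => hvt ?_⟩
    have h1 := (hw (t, x) ht).2.1
    have h2 : V (t, x) = c * v x t := by simp only [hVdef, max_eq_left ht]
    simp only at h
    rw [h, h2] at h1
    have h3 := nonneg_of_mul_nonneg_right (b := -v x t) (by linarith) hc
    exact le_antisymm (by linarith) (hv_nonneg x t ht)
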